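/- For each prime p ≥ 5 there exist real constants c_p(C_{2p}) > 0, c_{2p−2}(C_{2p}), c_{2p−1}(C_{2p}) such that #F_ℚ(C_{2p}; X) = c_p(C_{2p}) X^{1/p} + c_{2p−2}(C_{2p}) X^{1/(2p−2)} + c_{2p−1}(C_{2p}) X^{1/(2p−1)} + O_p(X^{1/(2p)} (log X)^3) as X → ∞, where the implied constant may depend on p. -/

import Mathlib

open scoped Classical

/-- The absolute value of the discriminant of a finite intermediate field of
`AlgebraicClosure ℚ / ℚ` (junk value `0` if the field is not finite over `ℚ`). -/
noncomputable def absDisc (L : IntermediateField ℚ (AlgebraicClosure ℚ)) : ℕ :=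
  if h : FiniteDimensional ℚ L then
    letI := h
    letI : NumberField L := ⟨⟩
    (NumberField.discr L).natAbs
  else 0

/-- `#F_ℚ(G; X)`: the number of field extensions `L/ℚ` inside a fixed algebraic
closure of `ℚ` that are Galois over `ℚ` with `Gal(L/ℚ) ≅ G` and `|disc(L/ℚ)| ≤ X`. -/
noncomputable def galoisCount (G : Type) [Group G] (X : ℝ) : ℕ :=
  Nat.card {L : IntermediateField ℚ (AlgebraicClosure ℚ) //
    FiniteDimensional ℚ L ∧ IsGalois ℚ L ∧ Nonempty ((L ≃ₐ[ℚ] L) ≃* G) ∧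
      (absDisc L : ℝ) ≤ X}

noncomputable section

namespace CountC2p
open Filter Topology MeasureTheory

section GammaBound
open Real Nat
open Complex

lemma norm_Gamma_le s (hs : 0 < s.re) : ‖Complex.Gamma s‖ ≤ Real.Gamma s.re := by
  rw [Complex.Gamma_eq_integral hs, Real.Gamma_eq_integral hs, GammaIntegral]
  refine (norm_integral_le_integral_norm _).trans (le_of_eq ?_)
  refine setIntegral_congr_fun measurableSet_Ioi fun x hx => ?_
  have hx' := hx
  simp only [norm_mul]
  rw [norm_cpow_eq_rpow_re_of_pos hx', norm_real, norm_of_nonneg (exp_pos _).le]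
  simp

lemma norm_exp_neg_pi_I s : ‖cexp (-π * I * s / 2)‖ = rexp (π * s.im / 2) := by
  rw [norm_exp]; congr 1; simp

lemma norm_sq_Gamma_half (y : ℝ) :
    ‖Complex.Gamma (1/2 + y * I)‖ ^ 2 = π / Real.cosh (π * y) := by
  have h := Complex.Gamma_mul_Gamma_one_sub (1/2 + y * I)
  have h1 : 1 - (1/2 + y*I) = (starRingEnd ℂ) (1/2 + y*I) := by
    apply ext <;> simp; norm_num
  rw [h1, Gamma_conj, mul_conj] at h
  have h2 : Complex.sin (π * (1/2 + y * I)) = Real.cosh (π * y) := by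
    rw [mul_add, show (π:ℂ) * (1/2) = π/2 by ring, add_comm, Complex.sin_add_pi_div_two,
      ← mul_assoc, cos_mul_I]
    push_cast; rfl
  rw [h2, normSq_eq_norm_sq] at h
  exact_mod_cast h

lemma Gamma_line_half (y : ℝ) :
    ‖Complex.Gamma (1/2 + y * I)‖ * rexp (π * y / 2) ≤ 3 := by
  have h := norm_sq_Gamma_half y
  have h2 : rexp (π * y / 2) ^ 2 ≤ 2 * Real.cosh (π * y) := by
    rw [cosh_eq, ← Real.exp_nat_mul]
    have := exp_pos (-(π * y))
    have e : ((2:ℕ):ℝ) * (π * y / 2) = π * y := by ring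
    rw [e]; linarith
  refine abs_le_of_sq_le_sq' ?_ (by norm_num) |>.2
  rw [mul_pow, h]
  calc π / Real.cosh (π * y) * rexp (π * y / 2) ^ 2 
      ≤ π / Real.cosh (π * y) * (2 * Real.cosh (π * y)) := by gcongr
    _ = 2 * π := by field_simp
    _ ≤ 3 ^ 2 := by have := pi_lt_four; linarith

lemma Gamma_line_three_half (y : ℝ) :
    ‖Complex.Gamma (3/2 + y * I)‖ * rexp (π * y / 2) ≤ 3 * (1 + |y|) := by
  have h0 : (1/2 + y * I : ℂ) ≠ 0 := by
    intro h; have := congrArg re h; simp at this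
  have h1 : Complex.Gamma (3/2 + y * I) = (1/2 + y * I) * Complex.Gamma (1/2 + y * I) := by
    rw [← Complex.Gamma_add_one _ h0]; congr 1; ring
  have h2 : ‖(1/2 + y * I : ℂ)‖ ≤ 1 + |y| := by
    refine (norm_add_le _ _).trans ?_
    simp; norm_num
  rw [h1, norm_mul, mul_assoc, mul_comm 3]
  gcongr
  exact Gamma_line_half y

lemma Gamma_strip s (h1 : 1/2 ≤ s.re) (h2 : s.re ≤ 3/2) :
    ‖Complex.Gamma s‖ * rexp (π * s.im / 2) ≤
      90 * rexp 3 * (1 + |s.im|) ^ (s.re - 1/2) := by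
  set y0 := s.im with hy0
  let f : ℂ → ℂ := fun z => Complex.Gamma z * cexp (-π * I * z / 2) * cexp ((z - y0 * I) ^ 2)
  have hn : ∀ z, ‖f z‖ = ‖Complex.Gamma z‖ * rexp (π * z.im / 2) *
      rexp (z.re ^ 2 - (z.im - y0) ^ 2) := by
    intro z
    simp only [f, norm_mul, norm_exp_neg_pi_I]
    congr 1
    rw [norm_exp]; congr 1
    simp [pow_two]
  have hpos : ∀ z : ℂ, z ∈ HadamardThreeLines.verticalClosedStrip (1/2) (3/2) → 0 < z.re := by
    intro z hz
    have := hz.1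
    linarith
  have hdiff : ∀ z : ℂ, 0 < z.re → DifferentiableAt ℂ f z := by
    intro z hz
    have : DifferentiableAt ℂ Complex.Gamma z := by
      apply Complex.differentiableAt_Gamma
      intro m hm
      rw [hm] at hz; simp at hz
      linarith
    fun_prop
  have hd : DiffContOnCl ℂ f (HadamardThreeLines.verticalStrip (1/2) (3/2)) := by
    have hdo : DifferentiableOn ℂ f {z : ℂ | 0 < z.re} :=
      fun z hz => (hdiff z hz).differentiableWithinAt
    refine DifferentiableOn.diffContOnCl (hdo.mono ?_)
    have hsub : HadamardThreeLines.verticalStrip (1/2) (3/2) ⊆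
        HadamardThreeLines.verticalClosedStrip (1/2) (3/2) := fun z hz => ⟨hz.1.le, hz.2.le⟩
    exact (closure_minimal hsub (isClosed_Icc.preimage continuous_re)).trans
      fun z hz => hpos z hz
  have hgauss : ∀ d : ℝ, π * d / 2 - d ^ 2 ≤ 1 := by
    intro d
    have := pi_lt_four
    have := pi_pos
    nlinarith [sq_nonneg (d - π/4)]
  have hB : BddAbove ((norm ∘ f) '' HadamardThreeLines.verticalClosedStrip (1/2) (3/2)) := by
    obtain ⟨M, hM⟩ : ∃ M, ∀ x ∈ Set.Icc (1/2:ℝ) (3/2), ‖Real.Gamma x‖ ≤ M := by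
      refine isCompact_Icc.exists_bound_of_continuousOn fun x hx => ?_
      refine (Real.differentiableAt_Gamma fun m => ?_).continuousAt.continuousWithinAt
      have := hx.1
      linarith
    refine ⟨M * rexp (9/4 + 1 + π * y0 / 2), ?_⟩
    rintro _ ⟨z, hz, rfl⟩
    have hz1 := hz.1
    have hz2 := hz.2
    simp only [Function.comp]
    rw [hn, mul_assoc, ← Real.exp_add]
    have hG := (norm_Gamma_le z (hpos z hz)).trans ((le_norm_self _).trans (hM _ ⟨hz1, hz2⟩))
    have := hgauss (z.im - y0)
    refine mul_le_mul hG (exp_le_exp.2 ?_) (exp_pos _).le ((norm_nonneg _).trans hG)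
    nlinarith
  have h := HadamardThreeLines.norm_le_interp_of_mem_verticalClosedStrip'
    (a := 90 * rexp 3) (b := 90 * rexp 3 * (1 + |y0|)) (by norm_num : (1/2:ℝ) < 3/2) ⟨h1, h2⟩ hd hB ?_ ?_
  · rw [hn] at h
    have e1 : (1:ℝ) ≤ rexp (s.re ^ 2 - (s.im - y0) ^ 2) := by
      rw [← hy0]; simp; positivity
    refine (le_mul_of_one_le_right (by positivity) e1).trans (h.trans (le_of_eq ?_))
    have e2 : (s.re - 1/2) / (3/2 - 1/2) = s.re - 1/2 := by norm_num
    rw [e2, mul_rpow (x := 90 * rexp 3) (y := 1 + |y0|) (by positivity) (by positivity),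
      ← mul_assoc, ← rpow_add (by positivity)]
    norm_num
  · intro z hz
    have hz' : z.re = 1/2 := hz
    rw [hn]
    have : z = 1/2 + z.im * I := by apply ext <;> simp [hz']
    have h3 := Gamma_line_half z.im
    rw [← this] at h3
    rw [hz']
    have h4 : rexp ((1/2) ^ 2 - (z.im - y0) ^ 2) ≤ rexp 3 := by
      apply exp_le_exp.2; nlinarith [sq_nonneg (z.im - y0)]
    calc _ ≤ 3 * rexp 3 := by gcongr
      _ ≤ _ := by have := exp_pos 3; nlinarith
  · intro z hz
    have hz' : z.re = 3/2 := hz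
    rw [hn]
    have : z = 3/2 + z.im * I := by apply ext <;> simp [hz']
    have h3 := Gamma_line_three_half z.im
    rw [← this] at h3
    rw [hz']
    have h5 : 1 + |z.im| ≤ (1 + |y0|) * rexp |z.im - y0| := by
      have : |z.im| ≤ |z.im - y0| + |y0| := by
        simpa using abs_add_le (z.im - y0) y0
      have := add_one_le_exp |z.im - y0|
      nlinarith [abs_nonneg y0, abs_nonneg (z.im - y0)]
    have h4 : rexp |z.im - y0| * rexp ((3/2) ^ 2 - (z.im - y0) ^ 2) ≤ rexp 3 := by
      rw [← Real.exp_add]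
      apply exp_le_exp.2
      rw [← sq_abs (z.im - y0)]
      nlinarith
    calc _ ≤ (3 * ((1 + |y0|) * rexp |z.im - y0|)) * rexp ((3/2) ^ 2 - (z.im - y0) ^ 2) := by
            refine mul_le_mul_of_nonneg_right ?_ (exp_pos _).le
            exact h3.trans (by gcongr)
      _ = 3 * (1 + |y0|) * (rexp |z.im - y0| * rexp ((3/2) ^ 2 - (z.im - y0) ^ 2)) := by ring
      _ ≤ 3 * (1 + |y0|) * rexp 3 := by gcongr
      _ ≤ _ := by have : 0 < rexp 3 * (1 + |y0|) := by positivity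
                  nlinarith

/-- Vertical decay of the Gamma function. -/
lemma Gamma_bound_aux (n : ℕ) : ∃ C : ℝ, 0 < C ∧ ∀ s : ℂ, 1/2 ≤ s.re → s.re ≤ 3/2 + n →
    ‖Complex.Gamma s‖ * rexp (π * s.im / 2) ≤ C * (1 + |s.im|) ^ (s.re - 1/2) := by
  induction n with
  | zero => exact ⟨90 * rexp 3, by positivity, fun s h1 h2 => Gamma_strip s h1 (by simpa using h2)⟩
  | succ n ih =>
    obtain ⟨C, hC, h⟩ := ih
    refine ⟨C * (3/2 + n), by positivity, fun s h1 h2 => ?_⟩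
    by_cases hs : s.re ≤ 3/2 + n
    · refine (h s h1 hs).trans ?_
      gcongr
      nlinarith
    · push Not at hs
      push_cast at h2
      have h3 := h (s - 1) (by simp; linarith) (by simp; linarith)
      have hs0 : s - 1 ≠ 0 := by
        intro h0; have := congrArg re h0; simp at this; linarith
      have h4 := Complex.Gamma_add_one (s - 1) hs0
      rw [sub_add_cancel] at h4
      have h5 : ‖s - 1‖ ≤ (3/2 + n) * (1 + |s.im|) := by
        refine (norm_le_abs_re_add_abs_im _).trans ?_
        simp
        rw [abs_of_nonneg (by linarith)]
        nlinarith [abs_nonneg s.im]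
      simp only [sub_re, one_re, sub_im, one_im, sub_zero] at h3
      rw [h4, norm_mul, mul_assoc]
      calc _ ≤ ((3/2 + n) * (1 + |s.im|)) * (C * (1 + |s.im|) ^ (s.re - 1 - 1/2)) := by gcongr
        _ = C * (3/2+n) * ((1 + |s.im|) ^ (s.re - 1 - 1/2) * (1 + |s.im|)) := by ring
        _ = _ := by
          rw [← rpow_add_one (by positivity)]; congr 2; ring

lemma Gamma_bound_aux2 (a b : ℝ) (ha : 0 < a) : ∃ C : ℝ, 0 < C ∧ ∀ s : ℂ, a ≤ s.re → s.re ≤ b →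
    ‖Complex.Gamma s‖ * rexp (π * s.im / 2) ≤ C * (1 + |s.im|) ^ (s.re - 1/2) := by
  obtain ⟨n, hn⟩ := exists_nat_ge (max b 0)
  obtain ⟨C, hC, h⟩ := Gamma_bound_aux n
  have hb := (le_max_left b 0).trans hn
  refine ⟨C * (1 + 1/a), by positivity, fun s h1 h2 => ?_⟩
  by_cases hs : 1/2 ≤ s.re
  · refine (h s hs (by linarith)).trans ?_
    gcongr
    have : 0 < 1/a := by positivity
    nlinarith
  · push Not at hs
    have h3 := h (s + 1) (by simp; linarith) (by simp; linarith)
    have hs0 : s ≠ 0 := by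
      intro h0; rw [h0] at h1; simp at h1; linarith
    rw [Complex.Gamma_add_one s hs0, norm_mul] at h3
    simp only [add_re, one_re, add_im, one_im, add_zero] at h3
    have h5 : 1 + |s.im| ≤ (1 + 1/a) * ‖s‖ := by
      have e1 := abs_im_le_norm s
      have e2 := (re_le_norm s)
      have e3 : 1 ≤ 1/a * ‖s‖ := by
        rw [one_div_mul_eq_div, le_div_iff₀ ha]; linarith
      linarith
    have h6 : 0 < 1 + |s.im| := by positivity
    have h7 : (1 + |s.im|) * (‖Complex.Gamma s‖ * rexp (π * s.im / 2)) ≤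
        (1 + |s.im|) * (C * (1 + 1/a) * (1 + |s.im|) ^ (s.re - 1/2)) := by
      calc _ ≤ ((1 + 1/a) * ‖s‖) * (‖Complex.Gamma s‖ * rexp (π * s.im / 2)) := by gcongr
        _ = (1 + 1/a) * (‖s‖ * ‖Complex.Gamma s‖ * rexp (π * s.im / 2)) := by ring
        _ ≤ (1 + 1/a) * (C * (1 + |s.im|) ^ (s.re + 1 - 1/2)) := by gcongr
        _ = _ := by
          rw [show s.re + 1 - 1/2 = (s.re - 1/2) + 1 by ring, rpow_add_one h6.ne']; ring
    exact le_of_mul_le_mul_left h7 h6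

/-- Vertical decay of the Gamma function. -/
lemma Gamma_bound (a b : ℝ) (ha : 0 < a) : ∃ C : ℝ, 0 < C ∧ ∀ s : ℂ, a ≤ s.re → s.re ≤ b →
    ‖Complex.Gamma s‖ * rexp (π * |s.im| / 2) ≤ C * (1 + |s.im|) ^ (s.re - 1/2) := by
  obtain ⟨C, hC, h⟩ := Gamma_bound_aux2 a b ha
  refine ⟨C, hC, fun s h1 h2 => ?_⟩
  rcases le_total 0 s.im with hs | hs
  · have := h s h1 h2
    rwa [abs_of_nonneg hs] at this ⊢
  · have := h ((starRingEnd ℂ) s) (by simpa using h1) (by simpa using h2)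
    rw [Gamma_conj] at this
    simp only [norm_conj, conj_im, abs_neg] at this
    rwa [abs_of_nonpos hs] at this ⊢

end GammaBound

section LGrowth
open Set Real Finset Nat
open Complex

lemma norm_integral_Ioi_rpow_le {ρ : ℝ → ℂ} {C : ℝ} (hC : ∀ t, 1 ≤ t → ‖ρ t‖ ≤ C) {s : ℂ} (hs : 0 < s.re) :
    ‖∫ t in Set.Ioi 1, ρ t * t ^ (-(s + 1))‖ ≤ C / s.re := by
  have h1 : ∫ t in Set.Ioi 1, C * t ^ (-(s.re + 1)) = C / s.re := by
    rw [integral_const_mul, integral_Ioi_rpow_of_lt (by linarith) one_pos]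
    simp; field_simp
  rw [← h1]
  refine norm_integral_le_of_norm_le ?_ ?_
  · exact (integrableOn_Ioi_rpow_of_lt (by linarith) one_pos).const_mul _
  · filter_upwards [ae_restrict_mem measurableSet_Ioi] with t ht
    have ht0 : 0 < t := one_pos.trans ht
    rw [norm_mul, norm_cpow_eq_rpow_re_of_pos ht0]
    have := hC t (le_of_lt ht)
    simp
    gcongr

lemma differentiableOn_integral_Ioi {ρ : ℝ → ℂ} {C : ℝ} (hC : ∀ t, 1 ≤ t → ‖ρ t‖ ≤ C)
    (hm : Measurable ρ) :
    DifferentiableOn ℂ (fun s : ℂ => ∫ t in Set.Ioi 1, ρ t * t ^ (-(s + 1))) {s | 0 < s.re} := by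
  let f : ℝ → ℂ := (Set.Ioi 1).indicator ρ
  have hfm : Measurable f := hm.indicator measurableSet_Ioi
  have hC0 := (norm_nonneg _).trans (hC 1 le_rfl)
  have hfb : ∀ t, ‖f t‖ ≤ C := by
    intro t
    by_cases ht : t ∈ Set.Ioi 1
    · simp only [f, indicator_of_mem ht]; exact hC t (le_of_lt ht)
    · simp only [f, indicator_of_notMem ht]; simpa using hC0
  have key : ∀ s : ℂ, 0 < s.re → (∫ t in Set.Ioi 1, ρ t * t ^ (-(s + 1))) = mellin f (-s) := by
    intro s hs
    rw [mellin, ← integral_indicator measurableSet_Ioi, ← integral_indicator measurableSet_Ioi]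
    congr 1; ext t
    by_cases ht : 1 < t
    · have ht0 := one_pos.trans ht
      simp only [f, indicator_of_mem (show t ∈ Set.Ioi 1 from ht),
        indicator_of_mem (show t ∈ Set.Ioi 0 from ht0)]
      rw [mul_comm]; congr 2; ring
    · simp [f, indicator_apply, ht]
  have hd : ∀ s : ℂ, 0 < s.re → DifferentiableAt ℂ (mellin f) (-s) := by
    intro s hs
    refine mellin_differentiableAt_of_isBigO_rpow (a := 0) (b := -s.re - 1) ?_ ?_ ?_ ?_ ?_
    · refine LocallyIntegrable.locallyIntegrableOn ?_ _
      refine (locallyIntegrable_const C).mono hfm.aestronglyMeasurable ?_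
      filter_upwards with t
      exact (hfb t).trans (le_norm_self C)
    · refine Asymptotics.IsBigO.of_bound C ?_
      filter_upwards with t
      simpa using hfb t
    · simpa using hs
    · refine Asymptotics.IsBigO.of_bound 0 ?_
      have : ∀ᶠ t : ℝ in 𝓝[>] 0, t < 1 := by
        exact eventually_nhdsWithin_of_eventually_nhds (eventually_lt_nhds one_pos)
      filter_upwards [this] with t ht
      have : t ∉ Set.Ioi 1 := by simp [ht.le]
      simp [f, indicator_of_notMem this]
    · simp
  intro s hs
  have h2 :=
    (hd s hs).comp s differentiableAt_id.neg
  exact h2.differentiableWithinAt.congr (fun z hz => key z hz) (key s hs)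

lemma isPreconnected_re_pos : IsPreconnected {s : ℂ | 0 < s.re} :=
  (convex_halfSpace_re_gt 0).isPreconnected

lemma eqOn_re_pos {f g : ℂ → ℂ} (hf : DifferentiableOn ℂ f {s | 0 < s.re})
    (hg : DifferentiableOn ℂ g {s | 0 < s.re}) (h : ∀ s : ℂ, 1 < s.re → f s = g s) :
    ∀ s : ℂ, 0 < s.re → f s = g s := by
  have hU : IsOpen {z : ℂ | 0 < z.re} := isOpen_lt continuous_const continuous_re
  have := (hf.analyticOnNhd hU).eqOn_of_preconnected_of_eventuallyEq (hg.analyticOnNhd hU)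
    isPreconnected_re_pos (z₀ := 2) (by simp) ?_
  · exact fun s hs => this hs
  · have h1 : {z : ℂ | 1 < z.re} ∈ 𝓝 2 :=
      (isOpen_lt continuous_const continuous_re).mem_nhds (by simp)
    filter_upwards [h1] with z hz using h z hz

lemma measurable_sum_floor (f : ℕ → ℂ) :
    Measurable (fun t : ℝ => ∑ k ∈ Finset.Icc 1 ⌊t⌋₊, f k) := by
  exact (measurable_from_nat (f := fun n => ∑ k ∈ Finset.Icc 1 n, f k)).comp measurable_floor

lemma zeta_growth {s : ℂ} (hs : 0 < s.re) :
    ‖riemannZeta₁ s‖ ≤ ‖s‖ + ‖s‖ * ‖s - 1‖ / s.re := by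
  let ρ : ℝ → ℂ := fun t => (⌊t⌋₊ : ℂ) - t
  have hρ : ∀ t, 1 ≤ t → ‖ρ t‖ ≤ 1 := by
    intro t ht
    have h1 := floor_le (zero_le_one.trans ht)
    have h2 := lt_floor_add_one t
    have : ρ t = (((⌊t⌋₊ : ℝ) - t : ℝ) : ℂ) := by simp [ρ]
    rw [this, norm_real, norm_eq_abs, abs_le]
    constructor <;> linarith
  have hm : Measurable ρ := by
    have : Measurable (fun t : ℝ => ((⌊t⌋₊ : ℕ) : ℂ)) :=
      (measurable_from_nat).comp measurable_floor
    exact this.sub measurable_ofReal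
  have hd := differentiableOn_integral_Ioi hρ hm
  have key := eqOn_re_pos
    (g := fun s => s + s * (s - 1) * ∫ t in Set.Ioi 1, ρ t * t ^ (-(s + 1)))
    differentiable_riemannZeta₁.differentiableOn
    (differentiableOn_id.add ((differentiableOn_id.mul (differentiableOn_id.sub_const _)).mul hd)) ?_ s hs
  · rw [key]
    refine (norm_add_le _ _).trans ?_
    rw [norm_mul, norm_mul]
    have := norm_integral_Ioi_rpow_le hρ hs
    calc _ ≤ ‖s‖ + ‖s‖ * ‖s-1‖ * (1 / s.re) := by gcongr
      _ = _ := by ring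
  · intro z hz
    have hz1 : z ≠ 1 := by rintro rfl; simp at hz
    have h1 := LSeries_eq_mul_integral' (fun _ => (1:ℂ)) zero_le_one (s := z) (r := 1) hz ?_
    · have h2 : LSeries (fun _ => 1) z = riemannZeta z := by
        exact LSeries_one_eq_riemannZeta hz
      have hint1 : IntegrableOn (fun t : ℝ => (t:ℂ) ^ (-z)) (Set.Ioi 1) :=
        integrableOn_Ioi_cpow_of_lt (by simpa using hz) one_pos
      have hint2 : IntegrableOn (fun t : ℝ => ρ t * t ^ (-(z+1))) (Set.Ioi 1) := by
        have h0 : IntegrableOn (fun t : ℝ => (t:ℂ) ^ (-(z+1))) (Set.Ioi 1) :=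
          integrableOn_Ioi_cpow_of_lt (by simp; linarith) one_pos
        refine h0.bdd_mul (c := 1) hm.aestronglyMeasurable ?_
        filter_upwards [ae_restrict_mem measurableSet_Ioi] with t ht
        exact hρ t (le_of_lt ht)
      have h3 : (∫ t in Set.Ioi (1:ℝ), (∑ k ∈ Finset.Icc 1 ⌊t⌋₊, (1:ℂ)) * t ^ (-(z + 1))) =
          1 / (z - 1) + ∫ t in Set.Ioi 1, ρ t * t ^ (-(z + 1)) := by
        have h4 : ∫ t in Set.Ioi (1:ℝ), (t:ℂ) ^ (-z) = 1 / (z - 1) := by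
          rw [integral_Ioi_cpow_of_lt (by simpa using hz) one_pos]
          simp
          rw [← neg_div_neg_eq]; ring
        rw [← h4, ← integral_add hint1 hint2]
        refine setIntegral_congr_fun measurableSet_Ioi fun t ht => ?_
        have ht0 : (t:ℂ) ≠ 0 := by
          have : (0:ℝ) < t := one_pos.trans ht
          exact_mod_cast this.ne'
        have h5 : (t:ℂ) ^ (-z) = t * (t:ℂ) ^ (-(z+1)) := by
          rw [show -z = -(z+1) + 1 by ring, cpow_add _ _ ht0, cpow_one]; ring_nf
        simp only [h5, ρ]; simp; ring
      rw [h2, h3] at h1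
      have h6 := riemannZeta_eq_inv_sub_mul hz1
      have h7 : riemannZeta₁ z = (z - 1) * riemannZeta z := by rw [h6]; field_simp
      rw [h7, h1]; field_simp
    · refine Asymptotics.IsBigO.of_bound 1 ?_
      filter_upwards with n; simp

variable {N : ℕ} [NeZero N]

lemma exists_bound_sum (Φ : ZMod N → ℂ) (hΦ : ∑ j, Φ j = 0) :
    ∃ C : ℝ, ∀ n : ℕ, ‖∑ k ∈ Finset.Icc 1 n, Φ k‖ ≤ C := by
  let T : ℕ → ℂ := fun n => ∑ k ∈ Finset.range n, Φ k
  have hN : T N = 0 := by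
    rw [← hΦ]
    refine sum_bij' (fun k _ => (k : ZMod N)) (fun j _ => j.val) ?_ ?_ ?_ ?_ ?_
    · simp
    · intro j _; simpa using ZMod.val_lt j
    · intro k hk; exact ZMod.val_cast_of_lt (Finset.mem_range.1 hk)
    · intro j _; simp
    · simp
  have hper : Function.Periodic T N := by
    intro n
    have : T (N + n) = T N + ∑ x ∈ Finset.range n, Φ ((N + x : ℕ) : ZMod N) :=
      sum_range_add _ _ _
    rw [add_comm, this, hN, zero_add]
    simp [T]
  refine ⟨∑ r ∈ Finset.range N, ‖T r‖ + ‖Φ 0‖, fun n => ?_⟩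
  have h1 : ∑ k ∈ Finset.Icc 1 n, Φ k = T (n + 1) - Φ 0 := by
    simp only [T]
    rw [sum_range_succ', ← Finset.Ico_add_one_right_eq_Icc, sum_Ico_eq_sum_range]
    simp [add_comm]
  rw [h1, ← hper.map_mod_nat (n + 1)]
  refine (norm_sub_le _ _).trans ?_
  gcongr
  exact single_le_sum (fun _ _ => norm_nonneg _)
    (Finset.mem_range.2 (mod_lt _ (NeZero.pos N)))

lemma LFunction_growth_right (Φ : ZMod N → ℂ) (hΦ : ∑ j, Φ j = 0) :
    ∃ C : ℝ, ∀ s : ℂ, 0 < s.re → ‖ZMod.LFunction Φ s‖ ≤ C * ‖s‖ / s.re := by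
  obtain ⟨C, hC⟩ := exists_bound_sum Φ hΦ
  refine ⟨C, fun s hs => ?_⟩
  let ρ : ℝ → ℂ := fun t => ∑ k ∈ Finset.Icc 1 ⌊t⌋₊, Φ k
  have hρ : ∀ t, 1 ≤ t → ‖ρ t‖ ≤ C := fun t _ => hC _
  have hm := measurable_sum_floor fun n => Φ n
  have hd := differentiableOn_integral_Ioi hρ hm
  have key := eqOn_re_pos
    (g := fun s => s * ∫ t in Set.Ioi 1, ρ t * t ^ (-(s + 1)))
    (ZMod.differentiable_LFunction_of_sum_zero hΦ).differentiableOn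
    (differentiableOn_id.mul hd) ?_ s hs
  · rw [key, norm_mul, mul_comm C, mul_div_assoc]
    gcongr
    exact norm_integral_Ioi_rpow_le hρ hs
  · intro z hz
    rw [ZMod.LFunction_eq_LSeries Φ hz]
    refine LSeries_eq_mul_integral _ le_rfl (by linarith) (ZMod.LSeriesSummable_of_one_lt_re Φ hz) ?_
    refine Asymptotics.IsBigO.of_bound C ?_
    filter_upwards with n
    simpa using hC n
end LGrowth

section Contour
open Set Real Function
open Complex

lemma integrable_vertical {G : ℂ → ℂ} {a b C : ℝ} {x : ℝ} (hx : x ∈ Icc a b)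
    (hG : ContinuousOn G {z | a ≤ z.re ∧ z.re ≤ b})
    (hC : ∀ z : ℂ, a ≤ z.re → z.re ≤ b → ‖G z‖ ≤ C / (1 + z.im ^ 2)) :
    Integrable fun y : ℝ => G (x + y * I) := by
  have h1 := integrable_inv_one_add_sq.const_mul C
  refine h1.mono' ?_ ?_
  · refine Continuous.aestronglyMeasurable ?_
    refine hG.comp_continuous (by fun_prop) fun y => ?_
    simpa using hx
  · refine Eventually.of_forall fun y => ?_
    have := hC (x + y * I) (by simpa using hx.1) (by simpa using hx.2)
    simpa [div_eq_mul_inv] using this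

lemma integral_vertical_eq {G : ℂ → ℂ} {a b C : ℝ} (hab : a ≤ b)
    (hG : DifferentiableOn ℂ G {z | a ≤ z.re ∧ z.re ≤ b})
    (hC : ∀ z : ℂ, a ≤ z.re → z.re ≤ b → ‖G z‖ ≤ C / (1 + z.im ^ 2)) :
    ∫ y : ℝ, G (a + y * I) = ∫ y : ℝ, G (b + y * I) := by
  have hia := integrable_vertical (left_mem_Icc.2 hab) hG.continuousOn hC
  have hib := integrable_vertical (right_mem_Icc.2 hab) hG.continuousOn hC
  have ta := intervalIntegral_tendsto_integral hia tendsto_neg_atTop_atBot tendsto_id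
  have tb := intervalIntegral_tendsto_integral hib tendsto_neg_atTop_atBot tendsto_id
  have key : ∀ T : ℝ, ‖(∫ y in (-T)..T, G (b + y * I)) - ∫ y in (-T)..T, G (a + y * I)‖ ≤
      2 * (C / (1 + T ^ 2) * (b - a)) := by
    intro T
    have h := integral_boundary_rect_eq_zero_of_differentiableOn G (a + (-T : ℝ) * I) (b + T * I)
      (hG.mono ?_)
    · simp only [add_re, mul_re, I_re, mul_zero, ofReal_im, I_im, mul_one, sub_self,
        add_zero, add_im, mul_im, zero_add] at h
      have hh : ∀ t : ℝ, t ^ 2 = T ^ 2 → ‖∫ x in a..b, G (x + t * I)‖ ≤ C / (1 + T ^ 2) * (b - a) := by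
        intro t ht
        have := intervalIntegral.norm_integral_le_of_norm_le_const (a := a) (b := b)
          (f := fun x : ℝ => G (x + t * I)) (C := C / (1 + T ^ 2)) ?_
        · rwa [abs_of_nonneg (sub_nonneg.2 hab)] at this
        · intro x hx
          rw [uIoc_of_le hab] at hx
          have := hC (x + t * I) (by simpa using hx.1.le) (by simpa using hx.2)
          simpa [ht] using this
      have e : I • ((∫ y in (-T)..T, G (b + y * I)) - ∫ y in (-T)..T, G (a + y * I)) =
          (∫ x in a..b, G (x + T * I)) - ∫ x in a..b, G (x + (-T : ℝ) * I) := by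
        linear_combination h
      have e2 := congrArg norm e
      rw [norm_smul, norm_I, one_mul] at e2
      rw [e2, two_mul]
      exact (norm_sub_le _ _).trans (add_le_add (hh _ rfl) (hh _ (by ring)))
    · intro z hz
      have := hz.1
      simp [uIcc_of_le hab] at this
      exact this
  have lim : Tendsto (fun T : ℝ => 2 * (C / (1 + T ^ 2) * (b - a))) atTop (𝓝 0) := by
    have : Tendsto (fun T : ℝ => C / (1 + T ^ 2)) atTop (𝓝 0) :=
      tendsto_const_nhds.div_atTop (tendsto_atTop_add_const_left _ _ (tendsto_pow_atTop two_ne_zero))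
    simpa using (this.mul_const (b - a)).const_mul 2
  have := squeeze_zero_norm key lim
  have h2 := tendsto_nhds_unique (tb.sub ta) this
  exact (sub_eq_zero.1 h2).symm

lemma exp_mul_I_cancel w c (hc : w.re = c) : ‖cexp (w ^ 2)‖ = rexp (c ^ 2) * rexp (-w.im ^ 2) := by
  rw [norm_exp, ← Real.exp_add]
  congr 1
  simp [pow_two, hc]
  ring

lemma exp_neg_sq_le y : rexp (-y ^ 2) ≤ 1 / (1 + y ^ 2) := by
  rw [Real.exp_neg, ← one_div]
  apply one_div_le_one_div_of_le (by positivity)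
  linarith [add_one_le_exp (y ^ 2)]

/-- `exp (-y²)` beats any power -/
lemma exists_exp_neg_sq_pow_le k : ∃ C : ℝ, 0 < C ∧ ∀ y : ℝ, (1 + |y|) ^ k * rexp (-y ^ 2) ≤ C := by
  refine ⟨2 ^ k + 2 ^ k * k.factorial, by positivity, fun y => ?_⟩
  have h0 : rexp (-y ^ 2) ≤ 1 := exp_le_one_iff.2 (by nlinarith)
  rcases le_total |y| 1 with h | h
  · calc (1 + |y|) ^ k * rexp (-y ^ 2) ≤ 2 ^ k * 1 := by gcongr; linarith
      _ ≤ _ := by nlinarith [pow_pos (two_pos (α := ℝ)) k]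
  · have h1 : (1 + |y|) ^ k ≤ 2 ^ k * (y ^ 2) ^ k := by
      rw [← mul_pow]; gcongr
      nlinarith [sq_abs y]
    have h2 : (y ^ 2) ^ k ≤ k.factorial * rexp (y ^ 2) := by
      have := pow_div_factorial_le_exp (y ^ 2) (sq_nonneg y) k
      rwa [div_le_iff₀ (by positivity), mul_comm] at this
    calc (1 + |y|) ^ k * rexp (-y ^ 2) ≤ 2 ^ k * (k.factorial * rexp (y ^ 2)) * rexp (-y ^ 2) := by
          gcongr; exact h1.trans (by gcongr)
      _ = 2 ^ k * k.factorial := by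
          rw [mul_assoc, mul_assoc, ← Real.exp_add]; simp
      _ ≤ _ := by linarith [pow_pos (two_pos (α := ℝ)) k]

lemma exists_exp_neg_sq_pow_le_inv k : ∃ C : ℝ, 0 < C ∧ ∀ y : ℝ,
    (1 + |y|) ^ k * rexp (-y ^ 2) ≤ C / (1 + y ^ 2) := by
  obtain ⟨C, h0, hC⟩ := exists_exp_neg_sq_pow_le (k + 2)
  refine ⟨C, h0, fun y => ?_⟩
  rw [le_div_iff₀ (by positivity)]
  refine le_trans ?_ (hC y)
  rw [pow_add, mul_right_comm]
  gcongr
  nlinarith [sq_abs y, abs_nonneg y]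

/-- The kernel constant. -/
def kern (c : ℝ) : ℂ := ∫ v : ℝ, cexp ((c + v * I) ^ 2) / (c + v * I)

lemma kern_neg c : kern (-c) = - kern c := by
  unfold kern
  rw [← integral_neg, ← integral_neg_eq_self]
  congr 1
  ext v
  push_cast
  rw [show (-c + -↑v * I) = -(c + v * I) by ring, neg_sq, div_neg]

lemma kern_eq {c d : ℝ} (hc : 0 < c) (hcd : c ≤ d) : kern c = kern d := by
  unfold kern
  refine integral_vertical_eq (G := fun w => cexp (w ^ 2) / w) (C := rexp (d ^ 2) / c) hcd ?_ ?_
  · intro z hz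
    have : z ≠ 0 := by rintro rfl; simp at hz; linarith
    exact DifferentiableAt.differentiableWithinAt (by fun_prop)
  · intro z h1 h2
    rw [norm_div, exp_mul_I_cancel z _ rfl]
    have h3 := h1.trans ((le_abs_self _).trans (abs_re_le_norm z))
    calc _ ≤ rexp (d ^ 2) * (1 / (1 + z.im ^ 2)) / c := by
          refine div_le_div₀ (by positivity) ?_ hc h3
          refine mul_le_mul ?_ (exp_neg_sq_le _) (by positivity) (by positivity)
          refine exp_le_exp.2 ?_
          nlinarith
      _ = _ := by field_simp

lemma kern_one_ne_zero : kern 1 ≠ 0 := by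
  have h1 : ∀ v : ℝ, cexp (((1:ℝ) + v * I) ^ 2) / ((1:ℝ) + v * I) =
      ∫ u in Ioi (0:ℝ), cexp (-u ^ 2 * 0 + (1 + v * I) ^ 2 + (-((1:ℝ) + v * I)) * u) := by
    intro v
    have := integral_exp_mul_complex_Ioi (a := -((1:ℝ) + v * I)) (by simp) 0
    simp only [mul_zero, zero_add, Complex.exp_add _ (_ * ((_:ℝ):ℂ))]
    rw [integral_const_mul, this]
    simp [div_eq_mul_inv, neg_inv]
  have h2 : ∀ u : ℝ, ∫ v : ℝ, cexp (-u ^ 2 * 0 + ((1:ℝ) + v * I) ^ 2 + (-((1:ℝ) + v * I)) * u) =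
      ((Real.sqrt π * rexp (-(1/4) * u ^ 2) : ℝ) : ℂ) := by
    intro u
    have e : ∀ v : ℝ, -u ^ 2 * 0 + ((1:ℝ) + v * I) ^ 2 + (-((1:ℝ) + v * I)) * u =
        (-1) * v ^ 2 + ((2 - u) * I) * v + (1 - u) := by
      intro v
      push_cast
      linear_combination v^2 * I_sq
    simp only [e]
    rw [integral_cexp_quadratic (by simp)]
    rw [show (1 - u) - ((2 - u) * I) ^ 2 / (4 * -1) = ((-(1/4) * u ^ 2 : ℝ) : ℂ) by
      push_cast; linear_combination ((2 - u) ^ 2 / 4) * I_sq]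
    push_cast
    congr 1
    rw [neg_neg, div_one, show (1/2 : ℂ) = ((1/2 : ℝ) : ℂ) by push_cast; rfl, ← ofReal_cpow pi_pos.le,
      sqrt_eq_rpow]
  have h3 : kern 1 = ∫ u in Ioi 0, ((Real.sqrt π * rexp (-(1/4) * u ^ 2) : ℝ) : ℂ) := by
    unfold kern
    simp only [h1, ← h2]
    refine integral_integral_swap ?_
    have hig : Integrable (fun z : ℝ × ℝ => rexp (1 - z.1 ^ 2) * rexp (-1 * z.2))
        (volume.prod (volume.restrict (Ioi 0))) := by
      refine Integrable.mul_prod (f := fun v : ℝ => rexp (1 - v ^ 2)) (g := fun u : ℝ => rexp (-1 * u)) ?_ ?_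
      · have := (integrable_exp_neg_mul_sq one_pos).const_mul (rexp 1)
        refine this.congr (Eventually.of_forall fun v => ?_)
        simp only [← Real.exp_add]; ring_nf
      · exact exp_neg_integrableOn_Ioi 0 one_pos
    refine hig.mono ?_ (Eventually.of_forall fun z => ?_)
    · exact Continuous.aestronglyMeasurable (by simp only [uncurry_def]; fun_prop)
    · simp only [uncurry_def, norm_exp, ← Real.exp_add, norm_eq_abs, abs_exp]
      refine exp_le_exp.2 (le_of_eq ?_)
      simp [pow_two]
  rw [h3, integral_complex_ofReal, integral_const_mul, integral_gaussian_Ioi]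
  norm_cast
  positivity

/-- Cauchy's formula across an infinite strip. -/
lemma two_kern_mul {G : ℂ → ℂ} {c d C : ℝ} (hc : 0 < c) (hd : 0 < d) (hG : Differentiable ℂ G)
    (hC : ∀ z : ℂ, -d ≤ z.re → z.re ≤ c → ‖G z‖ ≤ C / (1 + z.im ^ 2)) :
    2 * kern 1 * G 0 = (∫ y : ℝ, G (c + y * I) / (c + y * I)) -
      ∫ y : ℝ, G ((-d : ℝ) + y * I) / ((-d : ℝ) + y * I) := by
  have hk : ∀ c : ℝ, 0 < c → kern c = kern 1 := by
    intro c hc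
    rcases le_total c 1 with h | h
    · exact kern_eq hc h
    · exact (kern_eq one_pos h).symm
  have hC0 : 0 ≤ C := by
    have := (norm_nonneg _).trans (hC 0 (by simp [hd.le]) (by simp [hc.le]))
    simpa using this
  set E := rexp (max c d ^ 2)
  have hE0 : 0 < E := exp_pos _
  have hexp : ∀ z : ℂ, -d ≤ z.re → z.re ≤ c → ‖cexp (z ^ 2)‖ ≤ E / (1 + z.im ^ 2) := by
    intro z h1 h2
    rw [exp_mul_I_cancel z _ rfl, div_eq_mul_one_div]
    refine mul_le_mul ?_ (exp_neg_sq_le _) (by positivity) (by positivity)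
    refine exp_le_exp.2 (sq_le_sq.2 ?_)
    rw [abs_of_pos (lt_max_of_lt_left hc)]
    exact abs_le.2 ⟨by linarith [le_max_right c d], h2.trans (le_max_left _ _)⟩
  let H : ℂ → ℂ := fun w => G w - G 0 * cexp (w ^ 2)
  have hH : Differentiable ℂ H := by
    fun_prop
  have hH0 : H 0 = 0 := by simp [H]
  have hHb : ∀ z : ℂ, -d ≤ z.re → z.re ≤ c → ‖H z‖ ≤ (C + ‖G 0‖ * E) / (1 + z.im ^ 2) := by
    intro z h1 h2
    refine (norm_sub_le _ _).trans ?_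
    rw [norm_mul, add_div, mul_div_assoc]
    gcongr
    · exact hC z h1 h2
    · exact hexp z h1 h2
  have hS : Differentiable ℂ (dslope H 0) := by
    intro z
    have := (differentiableOn_dslope (s := univ) (c := 0) (by simp)).2 hH.differentiableOn
    exact this.differentiableAt (by simp)
  have hSne : ∀ z : ℂ, z ≠ 0 → dslope H 0 z = H z / z := by
    intro z hz
    rw [dslope_of_ne _ hz, slope_def_field, hH0]; simp
  -- boundedness of the difference quotient on the strip
  obtain ⟨B, hB⟩ : ∃ B : ℝ, ∀ z : ℂ, -d ≤ z.re → z.re ≤ c → ‖dslope H 0 z‖ ≤ B / (1 + z.im ^ 2) := by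
    obtain ⟨B, hB⟩ := (isCompact_closedBall 0 1).exists_bound_of_continuousOn hS.continuous.continuousOn
    have hB0 := (norm_nonneg _).trans (hB 0 (by simp))
    refine ⟨2 * B + (C + ‖G 0‖ * E), fun z h1 h2 => ?_⟩
    rcases le_total ‖z‖ 1 with h | h
    · refine (hB z (by simpa using h)).trans ?_
      rw [le_div_iff₀ (by positivity)]
      have : z.im ^ 2 ≤ 1 := by
        have := (abs_im_le_norm z).trans h
        nlinarith [sq_abs z.im, abs_nonneg z.im]
      nlinarith [norm_nonneg (G 0)]
    · have hz : z ≠ 0 := by rintro rfl; simp at h; linarith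
      rw [hSne z hz, norm_div]
      refine (div_le_self (norm_nonneg _) h).trans ((hHb z h1 h2).trans ?_)
      refine div_le_div_of_nonneg_right ?_ (by positivity)
      linarith
  have hshift := integral_vertical_eq (by linarith)
    hS.differentiableOn (fun z h1 h2 => hB z h1 h2)
  have hside : ∀ x : ℝ, x ≠ 0 → x ∈ Icc (-d) c → ∫ y : ℝ, dslope H 0 (x + y * I) =
      (∫ y : ℝ, G (x + y * I) / (x + y * I)) - G 0 * kern x := by
    intro x hx hx2
    have hne : ∀ y : ℝ, (x + y * I : ℂ) ≠ 0 := by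
      intro y h
      have := congrArg re h
      simp at this
      exact hx this
    have hdiv : ∀ (F : ℂ → ℂ) K, Continuous F →
        (∀ z : ℂ, -d ≤ z.re → z.re ≤ c → ‖F z‖ ≤ K / (1 + z.im ^ 2)) →
        Integrable fun y : ℝ => F (x + y * I) / (x + y * I) := by
      intro F K hF hK
      have h1 := integrable_vertical hx2 hF.continuousOn (fun z h1 h2 => hK z h1 h2)
      refine (h1.norm.const_mul |x|⁻¹).mono' ?_ ?_
      · refine Continuous.aestronglyMeasurable ?_
        exact (hF.comp (by fun_prop)).div (by fun_prop) hne
      · refine Eventually.of_forall fun y => ?_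
        rw [norm_div, div_eq_inv_mul]
        gcongr
        have := abs_re_le_norm (x + y * I)
        simpa using this
    have i1 := hdiv G C hG.continuous hC
    have i2 := hdiv (fun w => cexp (w ^ 2)) E (by fun_prop) hexp
    unfold kern
    rw [← integral_const_mul, ← integral_sub i1 (i2.const_mul _)]
    congr 1
    ext y
    rw [hSne _ (hne y)]
    ring
  rw [hside (-d) (by linarith) ⟨le_rfl, by linarith⟩, hside c hc.ne' ⟨by linarith, le_rfl⟩, kern_neg,
    hk c hc, hk d hd] at hshift
  linear_combination hshift
end Contour

section MeanValue
open Finset Real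
open Complex

lemma sum_inv_sq_le {δ : ℝ} (hδ : 0 < δ) N :
    ∑ j ∈ Finset.range N, 1 / (1 + δ * (j + 1)) ^ 2 ≤ 1 / δ := by
  have h : ∑ j ∈ Finset.range N, 1 / (1 + δ * (j + 1)) ^ 2 ≤ 1 / δ * (1 - 1 / (1 + δ * N)) := by
    induction N with
    | zero => simp
    | succ N ih =>
      rw [sum_range_succ]
      refine (add_le_add_left ih _).trans ?_
      push_cast
      have : 1 / (1 + δ * (N + 1)) ^ 2 ≤ 1 / ((1 + δ * N) * (1 + δ * (N + 1))) := by
        apply one_div_le_one_div_of_le (by positivity)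
        rw [pow_two]; gcongr; linarith
      have e : 1 / δ * (1 - 1 / (1 + δ * (N + 1))) - 1 / δ * (1 - 1 / (1 + δ * N)) =
          1 / ((1 + δ * N) * (1 + δ * (N + 1))) := by
        field_simp
        ring
      linarith
  refine h.trans (mul_le_of_le_one_right (by positivity) ?_)
  have : 0 ≤ 1 / (1 + δ * N) := by positivity
  linarith

lemma sum_kernel_le {δ : ℝ} (hδ : 0 < δ) (S : Finset ℕ) (m : ℕ) :
    ∑ n ∈ S, 1 / (1 + δ * |(m:ℝ) - n|) ^ 2 ≤ 1 + 2 / δ := by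
  have hsplit : ∑ n ∈ S, 1 / (1 + δ * |(m:ℝ) - n|) ^ 2 ≤ ∑ n ∈ Finset.range (m + 1 + (S.sup id + 1)), 1 / (1 + δ * |(m:ℝ) - n|) ^ 2 := by
    refine sum_le_sum_of_subset_of_nonneg ?_ fun _ _ _ => by positivity
    intro n hn
    have : n ≤ S.sup id := le_sup (f := id) hn
    simp; omega
  refine hsplit.trans ?_
  rw [sum_range_add, sum_range_succ]
  have h1 : ∑ x ∈ Finset.range m, 1 / (1 + δ * |(m:ℝ) - x|) ^ 2 ≤ 1 / δ := by
    rw [← sum_range_reflect]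
    refine le_trans (le_of_eq (sum_congr rfl fun j hj => ?_)) (sum_inv_sq_le hδ m)
    rw [Finset.mem_range] at hj
    have : m - ((m - 1 - j : ℕ) : ℝ) = j + 1 := by
      rw [show m - 1 - j = m - (j + 1) by omega, Nat.cast_sub (by omega)]; push_cast; ring
    rw [this, abs_of_nonneg (by positivity)]
  have h2 : ∑ x ∈ Finset.range (S.sup id + 1), 1 / (1 + δ * |m - ((m + 1 + x : ℕ) : ℝ)|) ^ 2 ≤ 1 / δ := by
    refine le_trans (le_of_eq (sum_congr rfl fun j hj => ?_)) (sum_inv_sq_le hδ _)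
    have : m - ((m + 1 + j : ℕ) : ℝ) = -(j + 1) := by push_cast; ring
    rw [this, abs_neg, abs_of_nonneg (by positivity)]
  have h3 : 1 / (1 + δ * |(m:ℝ) - m|) ^ 2 = 1 := by simp
  have : 2 / δ = 1 / δ + 1 / δ := by ring
  linarith

lemma gauss_kernel_le {T : ℝ} (hT : 2 ≤ T) {m n : ℕ} (hm : 0 < m) (hn : 0 < n) :
    rexp (-(T ^ 2 * (Real.log m - Real.log n) ^ 2 / 4)) ≤
      rexp 1 * (1 / (1 + T / (2 * m) * |(m:ℝ) - n|) ^ 2) := by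
  have hm' : (0:ℝ) < m := mod_cast hm
  have hn' : (0:ℝ) < n := mod_cast hn
  set x := |Real.log m - Real.log n| with hx
  have h1 : rexp (-(T ^ 2 * (Real.log m - Real.log n) ^ 2 / 4)) ≤ rexp 1 * rexp (-(T * x)) := by
    rw [← Real.exp_add]
    refine exp_le_exp.2 ?_
    rw [← sq_abs (Real.log m - Real.log n), ← hx]
    nlinarith [sq_nonneg (T * x / 2 - 1)]
  refine h1.trans ?_
  gcongr
  rw [Real.exp_neg, ← one_div]
  apply one_div_le_one_div_of_le (by positivity)
  -- `exp x ≥ 1 + |m-n|/m`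
  have h2 : 1 + |(m:ℝ) - n| / m ≤ rexp x := by
    rcases le_total m n with h | h
    · have h' : (m:ℝ) ≤ n := mod_cast h
      have : x = Real.log (n / m) := by
        rw [hx, log_div hn'.ne' hm'.ne', abs_of_nonpos, neg_sub]
        have := log_le_log hm' h'; linarith
      rw [this, Real.exp_log (by positivity), abs_of_nonpos (by linarith)]
      field_simp; linarith
    · have h' : (n:ℝ) ≤ m := mod_cast h
      have : x = Real.log (m / n) := by
        rw [hx, log_div hm'.ne' hn'.ne', abs_of_nonneg]
        have := log_le_log hn' h'; linarith
      rw [this, Real.exp_log (by positivity), abs_of_nonneg (by linarith)]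
      field_simp
      nlinarith
  have h3 : 1 + T / (2 * m) * |(m:ℝ) - n| ≤ rexp (T / 2 * x) := by
    have b := one_add_mul_self_le_rpow_one_add (s := |(m:ℝ) - n| / m) (p := T / 2)
      (by have : 0 ≤ |(m:ℝ) - n| / m := by positivity
          linarith) (by linarith)
    calc 1 + T / (2 * m) * |(m:ℝ) - n| = 1 + T / 2 * (|(m:ℝ) - n| / m) := by field_simp
      _ ≤ _ := b
      _ ≤ rexp x ^ (T / 2) := rpow_le_rpow (by positivity) h2 (by linarith)
      _ = _ := by rw [← exp_mul, mul_comm]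
  calc (1 + T / (2 * m) * |(m:ℝ) - n|) ^ 2 ≤ rexp (T / 2 * x) ^ 2 := by
        gcongr
    _ = _ := by rw [← Real.exp_nat_mul]; congr 1; ring

lemma norm_gauss_integral {T : ℝ} (hT : 0 < T) (a Λ : ℝ) :
    Integrable (fun t : ℝ => cexp (-(t / T) ^ 2) * cexp (-(I * (t + a) * Λ))) ∧
    ‖∫ t : ℝ, cexp (-(t / T) ^ 2) * cexp (-(I * (t + a) * Λ))‖ =
      Real.sqrt π * T * rexp (-(T ^ 2 * Λ ^ 2 / 4)) := by
  have e : ∀ t : ℝ, cexp (-(t / T) ^ 2) * cexp (-(I * (t + a) * Λ)) =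
      cexp ((-((1 / T ^ 2 : ℝ) : ℂ)) * t ^ 2 + (-(I * Λ)) * t + (-(I * a * Λ))) := by
    intro t
    rw [← Complex.exp_add]; congr 1; push_cast; ring
  simp only [e]
  have hb : 0 < 1 / T ^ 2 := by positivity
  refine ⟨integrable_cexp_quadratic (by rw [ofReal_re]; exact hb) _ _, ?_⟩
  rw [integral_cexp_quadratic (by rw [neg_re, ofReal_re]; exact neg_lt_zero.2 hb), norm_mul, neg_neg, norm_exp]
  congr 1
  · rw [← ofReal_div, show (1/2 : ℂ) = ((1/2 : ℝ) : ℂ) by push_cast; rfl,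
      ← ofReal_cpow (by positivity), norm_real, norm_of_nonneg (by positivity), ← sqrt_eq_rpow,
      div_div_eq_mul_div, div_one, sqrt_mul pi_pos.le, sqrt_sq hT.le]
  · congr 1
    have : (-(I * a * Λ) - (-(I * Λ)) ^ 2 / (4 * -((1 / T ^ 2 : ℝ) : ℂ)) : ℂ) =
        ((-(T ^ 2 * Λ ^ 2 / 4) : ℝ) : ℂ) + ((-(a * Λ) : ℝ) : ℂ) * I := by
      push_cast
      field_simp
      linear_combination (T ^ 2 * Λ ^ 2) * I_sq
    rw [this, add_re, ofReal_re, re_ofReal_mul, I_re, mul_zero, add_zero]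

/-- The constant in the mean value theorem. -/
def cMV : ℝ := 4 * Real.sqrt π * rexp 1 ^ 2

lemma cMV_pos : 0 < cMV := by unfold cMV; have := pi_pos; positivity

lemma mean_value_finset {T : ℝ} (hT : 2 ≤ T) a (S : Finset ℕ) (hS : ∀ n ∈ S, 0 < n) (b : ℕ → ℂ) :
    ∫ t in a..(a + T), ‖∑ n ∈ S, b n * cexp (-(I * t * Real.log n))‖ ^ 2 ≤
      cMV * ∑ n ∈ S, ‖b n‖ ^ 2 * (T + n) := by
  have hT0 : 0 < T := by linarith
  set f : ℝ → ℂ := fun t => ∑ n ∈ S, b n * cexp (-(I * t * Real.log n)) with hf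
  set w := fun t => rexp (-(t / T) ^ 2) with hw
  -- the weighted integral
  set F : ℝ → ℂ := fun t => ∑ m ∈ S, ∑ n ∈ S, b m * (starRingEnd ℂ) (b n) *
    (cexp (-(t / T) ^ 2) * cexp (-(I * (t + a) * ((Real.log m - Real.log n : ℝ))))) with hF
  have hFeq : ∀ t : ℝ, F t = ((w t * ‖f (t + a)‖ ^ 2 : ℝ) : ℂ) := by
    intro t
    push_cast
    rw [← mul_conj']
    simp only [hf, hF, map_sum, map_mul, ← exp_conj]
    rw [sum_mul_sum, mul_sum]
    refine sum_congr rfl fun m _ => ?_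
    rw [mul_sum]
    refine sum_congr rfl fun n _ => ?_
    have : cexp (-(I * (t + a) * ((Real.log m - Real.log n : ℝ)))) =
      cexp (-(I * (t + a : ℝ) * Real.log m)) * cexp ((starRingEnd ℂ) (-(I * (t + a : ℝ) * Real.log n))) := by
      rw [← Complex.exp_add]; congr 1
      simp only [map_neg, map_mul, conj_I, conj_ofReal]
      push_cast; ring
    rw [this]
    simp only [hw]
    push_cast
    ring
  have hFi : ∀ m n : ℕ, Integrable fun t : ℝ => b m * (starRingEnd ℂ) (b n) *
    (cexp (-(t / T) ^ 2) * cexp (-(I * (t + a) * ((Real.log m - Real.log n : ℝ))))) :=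
    fun m n => (norm_gauss_integral hT0 a _).1.const_mul _
  have hFint : Integrable F := integrable_finsetSum _ fun m _ => integrable_finsetSum _ fun n _ => hFi m n
  have hwint : Integrable fun t : ℝ => w t * ‖f (t + a)‖ ^ 2 := by
    have := hFint.re
    refine this.congr (Eventually.of_forall fun t => ?_)
    simp only [hFeq]
    exact ofReal_re _
  set K : ℕ → ℕ → ℝ := fun m n => Real.sqrt π * T * rexp (-(T ^ 2 * (Real.log m - Real.log n) ^ 2 / 4)) with hK
  have hKsymm : ∀ m n, K m n = K n m := by
    intro m n; simp only [hK]; congr 3; ring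
  have hK0 : ∀ m n, 0 ≤ K m n := fun m n => by positivity
  have hKsum : ∀ m ∈ S, ∑ n ∈ S, K m n ≤ 4 * Real.sqrt π * rexp 1 * (T + m) := by
    intro m hm
    have hm' : 0 < m := mod_cast hS m hm
    calc ∑ n ∈ S, K m n ≤ ∑ n ∈ S, Real.sqrt π * T * (rexp 1 * (1 / (1 + T / (2 * m) * |(m:ℝ) - n|) ^ 2)) := by
          refine sum_le_sum fun n hn => ?_
          exact mul_le_mul_of_nonneg_left (gauss_kernel_le hT (hS m hm) (hS n hn)) (by positivity)
      _ = Real.sqrt π * T * rexp 1 * ∑ n ∈ S, 1 / (1 + T / (2 * m) * |(m:ℝ) - n|) ^ 2 := by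
          rw [mul_sum]; exact sum_congr rfl fun _ _ => by ring
      _ ≤ Real.sqrt π * T * rexp 1 * (1 + 2 / (T / (2 * m))) := by
          gcongr; exact sum_kernel_le (by positivity) S m
      _ = Real.sqrt π * rexp 1 * (T + 4 * m) := by field_simp; ring
      _ ≤ Real.sqrt π * rexp 1 * (4 * (T + m)) := by gcongr; linarith
      _ = _ := by ring
  have hmain : ∫ t : ℝ, w t * ‖f (t + a)‖ ^ 2 ≤ 4 * Real.sqrt π * rexp 1 * ∑ n ∈ S, ‖b n‖ ^ 2 * (T + n) := by
    have h0 : ∫ t : ℝ, w t * ‖f (t + a)‖ ^ 2 ≤ ‖∫ t, F t‖ := by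
      simp only [hFeq]
      rw [integral_complex_ofReal, norm_real]
      exact le_abs_self _
    refine h0.trans ?_
    have h1 : ∫ t, F t = ∑ m ∈ S, ∑ n ∈ S, b m * (starRingEnd ℂ) (b n) *
        ∫ t : ℝ, (cexp (-(t / T) ^ 2) * cexp (-(I * (t + a) * ((Real.log m - Real.log n : ℝ))))) := by
      rw [integral_finsetSum _ fun m _ => integrable_finsetSum _ fun n _ => hFi m n]
      refine sum_congr rfl fun m _ => ?_
      rw [integral_finsetSum _ fun n _ => hFi m n]
      exact sum_congr rfl fun n _ => integral_const_mul _ _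
    rw [h1]
    calc _ ≤ ∑ m ∈ S, ∑ n ∈ S, ‖b m‖ * ‖b n‖ * K m n := by
          refine (norm_sum_le _ _).trans (sum_le_sum fun m _ => (norm_sum_le _ _).trans
            (sum_le_sum fun n _ => le_of_eq ?_))
          rw [norm_mul, norm_mul, RCLike.norm_conj, (norm_gauss_integral hT0 a _).2]
      _ ≤ ∑ m ∈ S, ∑ n ∈ S, (‖b m‖ ^ 2 / 2 * K m n + ‖b n‖ ^ 2 / 2 * K n m) := by
          refine sum_le_sum fun m _ => sum_le_sum fun n _ => ?_
          rw [hKsymm n m, ← add_mul]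
          refine mul_le_mul_of_nonneg_right ?_ (hK0 _ _)
          nlinarith [sq_nonneg (‖b m‖ - ‖b n‖)]
      _ = ∑ m ∈ S, ‖b m‖ ^ 2 * ∑ n ∈ S, K m n := by
          simp only [sum_add_distrib]
          rw [sum_comm (f := fun m n => ‖b n‖ ^ 2 / 2 * K n m), ← two_mul, mul_sum]
          refine sum_congr rfl fun m _ => ?_
          rw [mul_sum, mul_sum]
          exact sum_congr rfl fun n _ => by ring
      _ ≤ ∑ m ∈ S, ‖b m‖ ^ 2 * (4 * Real.sqrt π * rexp 1 * (T + m)) := by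
          refine sum_le_sum fun m hm => ?_
          gcongr
          exact hKsum m hm
      _ = _ := by
          rw [mul_sum]
          exact sum_congr rfl fun n _ => by ring
  have hlocal : ∫ t in a..(a + T), ‖f t‖ ^ 2 ≤ rexp 1 * ∫ t : ℝ, w t * ‖f (t + a)‖ ^ 2 := by
    have e1 : ∫ t in a..(a + T), ‖f t‖ ^ 2 = ∫ t in 0..T, ‖f (t + a)‖ ^ 2 := by
      rw [intervalIntegral.integral_comp_add_right (fun t => ‖f t‖ ^ 2)]
      congr 1 <;> ring
    rw [e1, ← integral_const_mul, intervalIntegral.integral_of_le hT0.le]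
    refine le_trans ?_ (setIntegral_le_integral (s := Set.Ioc 0 T) (hwint.const_mul _)
      (Eventually.of_forall fun t => by positivity))
    refine setIntegral_mono_on ?_ (hwint.const_mul _).integrableOn measurableSet_Ioc ?_
    · exact (Continuous.integrableOn_Icc (by fun_prop)).mono_set Set.Ioc_subset_Icc_self
    · intro t ht
      rw [← mul_assoc]
      refine le_mul_of_one_le_left (by positivity) ?_
      rw [hw, ← Real.exp_add]
      refine one_le_exp ?_
      have h1 := (div_le_one hT0).2 ht.2
      have h2 := div_nonneg ht.1.le hT0.le
      nlinarith
  refine hlocal.trans ((mul_le_mul_of_nonneg_left hmain (exp_pos 1).le).trans (le_of_eq ?_))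
  unfold cMV
  ring

/-- Mean value theorem for absolutely convergent Dirichlet series. -/
lemma mean_value_tsum {T : ℝ} (hT : 2 ≤ T) a (b : ℕ → ℂ) (hb0 : b 0 = 0) (hb : Summable fun n => ‖b n‖)
    {B : ℝ} (hB : ∀ S : Finset ℕ, ∑ n ∈ S, ‖b n‖ ^ 2 * (T + n) ≤ B) :
    ∫ t in a..(a + T), ‖∑' n, b n * cexp (-(I * t * Real.log n))‖ ^ 2 ≤ cMV * B := by
  set S := fun N => (Finset.range N).filter (0 < ·) with hS
  set f : ℕ → ℝ → ℂ := fun N t => ∑ n ∈ S N, b n * cexp (-(I * t * Real.log n)) with hf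
  have hn1 : ∀ n (t : ℝ), ‖b n * cexp (-(I * t * Real.log n))‖ = ‖b n‖ := by
    intro n t
    have : -(I * t * (Real.log n : ℂ)) = ((-(t * Real.log n) : ℝ) : ℂ) * I := by push_cast; ring
    rw [norm_mul, this, norm_exp_ofReal_mul_I, mul_one]
  have hlim : ∀ t, Tendsto (fun N => f N t) atTop (𝓝 (∑' n, b n * cexp (-(I * t * Real.log n)))) := by
    intro t
    have hs : Summable fun n => b n * cexp (-(I * t * Real.log n)) :=
      Summable.of_norm (by simpa only [hn1] using hb)
    refine hs.hasSum.tendsto_sum_nat.congr fun N => ?_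
    rw [hf, hS]
    simp only
    rw [sum_filter_of_ne]
    intro n _ hn
    rcases Nat.eq_zero_or_pos n with h | h
    · simp [h, hb0] at hn
    · exact h
  have hbd : ∀ N t, ‖f N t‖ ≤ ∑' n, ‖b n‖ := by
    intro N t
    refine (norm_sum_le _ _).trans ?_
    simp only [hn1]
    exact hb.sum_le_tsum _ (fun _ _ => norm_nonneg _)
  have hconv : Tendsto (fun N => ∫ t in a..(a + T), ‖f N t‖ ^ 2) atTop
      (𝓝 (∫ t in a..(a + T), ‖∑' n, b n * cexp (-(I * t * Real.log n))‖ ^ 2)) := by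
    refine intervalIntegral.tendsto_integral_filter_of_dominated_convergence
      (fun _ => (∑' n, ‖b n‖) ^ 2) ?_ ?_ ?_ ?_
    · refine Eventually.of_forall fun N => Continuous.aestronglyMeasurable ?_
      fun_prop
    · refine Eventually.of_forall fun N => Eventually.of_forall fun t _ => ?_
      rw [norm_of_nonneg (by positivity)]
      gcongr
      exact hbd N t
    · exact intervalIntegrable_const
    · exact Eventually.of_forall fun t _ => ((hlim t).norm).pow 2
  refine le_of_tendsto hconv (Eventually.of_forall fun N => ?_)
  refine (mean_value_finset hT a (S N) (by simp [hS]) b).trans ?_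
  exact mul_le_mul_of_nonneg_left (hB _) cMV_pos.le
end MeanValue

section DirichletPowers
open Real Finset LSeries Complex

lemma card_divisors_le {ε : ℝ} (hε : 0 < ε) : ∃ C : ℝ, 1 ≤ C ∧ ∀ n : ℕ, n ≠ 0 →
    n.divisors.card ≤ C * n ^ ε := by
  set K := 1 + 1 / (ε * Real.log 2) with hK
  have hK1 : 1 ≤ K := by rw [hK]; have : 0 < 1 / (ε * Real.log 2) := by positivity
                         linarith
  obtain ⟨P, hP⟩ := exists_nat_ge ((2:ℝ) ^ (1 / ε))
  refine ⟨K ^ P, one_le_pow₀ hK1, fun n hn => ?_⟩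
  have h1 : ∀ q ∈ n.primeFactors, ((n.factorization q + 1 : ℕ) : ℝ) ≤
      (if q < P then K else 1) * (q ^ ε) ^ (n.factorization q) := by
    intro q hq
    have hqp := Nat.prime_of_mem_primeFactors hq
    have hq2 : (2:ℝ) ≤ q := mod_cast hqp.two_le
    set v := n.factorization q
    split_ifs with h
    · have h2 := rpow_le_rpow (by norm_num) hq2 hε.le
      have h3 : 1 + v * (ε * Real.log 2) ≤ (2 ^ ε) ^ v := by
        rw [← rpow_natCast, ← rpow_mul (by norm_num), rpow_def_of_pos (by norm_num)]
        have := add_one_le_exp (Real.log 2 * (ε * v))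
        linarith
      have h4 : (2 ^ ε) ^ v ≤ ((q:ℝ) ^ ε) ^ v := by gcongr
      have h5 : ((v + 1 : ℕ) : ℝ) ≤ K * (1 + v * (ε * Real.log 2)) := by
        push_cast
        have e : K * (1 + v * (ε * Real.log 2)) = 1 + v + v * (ε * Real.log 2) + 1 / (ε * Real.log 2) := by
          rw [hK]; field_simp; ring
        have : 0 ≤ v * (ε * Real.log 2) := by positivity
        linarith
      refine h5.trans ?_
      gcongr
      exact h3.trans h4
    · rw [one_mul]
      have h2 : 2 ≤ (q:ℝ) ^ ε := by
        have : ((2:ℝ) ^ (1 / ε)) ≤ q := hP.trans (mod_cast not_lt.1 h)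
        calc 2 = (2 ^ (1 / ε)) ^ ε := by
              rw [← rpow_mul (by norm_num), one_div_mul_cancel hε.ne', rpow_one]
          _ ≤ _ := rpow_le_rpow (by positivity) this hε.le
      calc ((v + 1 : ℕ) : ℝ) ≤ ((2 ^ v : ℕ) : ℝ) := mod_cast Nat.lt_two_pow_self
        _ = 2 ^ v := by push_cast; rfl
        _ ≤ _ := by gcongr
  rw [Nat.card_divisors hn, Nat.cast_prod]
  refine (Finset.prod_le_prod (fun _ _ => by positivity) h1).trans ?_
  rw [prod_mul_distrib]
  have e1 : ∏ q ∈ n.primeFactors, ((q:ℝ) ^ ε) ^ (n.factorization q) = n ^ ε := by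
    have e0 : n ^ ε = ((∏ q ∈ n.primeFactors, q ^ n.factorization q : ℕ) : ℝ) ^ ε := by
      congr 2
      exact (Nat.prod_factorization_pow_eq_self hn).symm
    rw [e0, Nat.cast_prod, ← finsetProd_rpow _ _ (fun _ _ => by positivity)]
    refine prod_congr rfl fun q _ => ?_
    rw [Nat.cast_pow, ← rpow_natCast, ← rpow_natCast, ← rpow_mul (by positivity),
      ← rpow_mul (by positivity), mul_comm]
  rw [e1]
  gcongr
  rw [prod_ite, prod_const, prod_const_one, mul_one]
  refine pow_le_pow_right₀ hK1 ?_
  calc _ ≤ (range P).card := card_le_card fun q hq => by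
        simp at hq; simp [hq.2]
    _ = P := card_range P

lemma norm_convolution_le {f g : ℕ → ℂ} {A B ε : ℝ} (hA : 0 ≤ A)
    (hf : ∀ n, n ≠ 0 → ‖f n‖ ≤ A * n ^ ε) (hg : ∀ n, n ≠ 0 → ‖g n‖ ≤ B * n ^ ε) n :
    ‖(LSeries.convolution f g) n‖ ≤ n.divisors.card * (A * B * n ^ ε) := by
  rw [LSeries.convolution_def]
  refine (norm_sum_le _ _).trans ?_
  rw [← Nat.map_div_right_divisors, sum_map, ← nsmul_eq_mul]
  refine sum_le_card_nsmul _ _ _ fun d hd => ?_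
  simp only [norm_mul]
  have hd' := Nat.mem_divisors.1 hd
  have h0 : d ≠ 0 := by rintro rfl; simp at hd'
  have h1 := (Nat.div_pos (Nat.le_of_dvd (Nat.pos_of_ne_zero hd'.2) hd'.1) (Nat.pos_of_ne_zero h0)).ne'
  calc ‖f d‖ * ‖g (n / d)‖ ≤ (A * d ^ ε) * (B * ((n / d : ℕ):ℝ) ^ ε) :=
        mul_le_mul (hf d h0) (hg _ h1) (norm_nonneg _) (by positivity)
    _ = A * B * (d * ((n / d : ℕ):ℝ)) ^ ε := by
        rw [mul_rpow (by positivity) (by positivity)]; ring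
    _ = _ := by rw [← Nat.cast_mul, Nat.mul_div_cancel' hd'.1]

/-- Coefficients of the `k`-th power of a Dirichlet series (`k ≥ 1`). -/
def convPow (f : ℕ → ℂ) : ℕ → ℕ → ℂ
  | 0 => f
  | k + 1 => LSeries.convolution f (convPow f k)

lemma convPow_LSeries {f : ℕ → ℂ} {s : ℂ} (hf : LSeriesSummable f s) k :
    LSeriesSummable (convPow f k) s ∧ LSeries (convPow f k) s = LSeries f s ^ (k + 1) := by
  induction k with
  | zero => simpa [convPow] using hf
  | succ k ih =>
    refine ⟨hf.convolution ih.1, ?_⟩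
    rw [convPow, LSeries_convolution' hf ih.1, ih.2, pow_succ' _ (k + 1)]

lemma convPow_bound {ε : ℝ} (hε : 0 < ε) k : ∃ C : ℝ, 0 < C ∧ ∀ (f : ℕ → ℂ) B, 0 ≤ B →
    (∀ n, ‖f n‖ ≤ B) → ∀ n, n ≠ 0 → ‖convPow f k n‖ ≤ C * B ^ (k + 1) * n ^ ε := by
  induction k generalizing ε with
  | zero =>
    refine ⟨1, one_pos, fun f B hB hf n hn => ?_⟩
    simp
    refine (hf n).trans (le_mul_of_one_le_right hB (one_le_rpow ?_ hε.le))
    exact_mod_cast Nat.one_le_iff_ne_zero.2 hn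
  | succ k ih =>
    obtain ⟨C, hC, h⟩ := ih (ε := ε / 2) (by linarith)
    obtain ⟨D, hD, hd⟩ := card_divisors_le (ε := ε / 2) (by linarith)
    refine ⟨D * C, by positivity, fun f B hB hf n hn => ?_⟩
    have h1 := norm_convolution_le (f := f)
      hB (fun n hn => ?_) (fun n hn => h f B hB hf n hn) n
    · refine h1.trans ?_
      calc n.divisors.card * (B * (C * B ^ (k + 1)) * n ^ (ε / 2))
          ≤ (D * n ^ (ε / 2)) * (B * (C * B ^ (k + 1)) * n ^ (ε / 2)) := by
            gcongr; exact hd n hn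
        _ = D * C * B ^ (k + 1 + 1) * (n ^ (ε / 2) * n ^ (ε / 2)) := by ring
        _ = _ := by
            rw [← rpow_add (mod_cast Nat.pos_of_ne_zero hn)]; ring_nf
    · refine (hf n).trans (le_mul_of_one_le_right hB (one_le_rpow ?_ (by linarith)))
      exact_mod_cast Nat.one_le_iff_ne_zero.2 hn

lemma convPow_eq_zero_of_gt {f : ℕ → ℂ} {Y : ℝ} (hY : 0 ≤ Y) (hf : ∀ n : ℕ, Y < n → f n = 0) k :
    ∀ n : ℕ, Y ^ (k + 1) < n → convPow f k n = 0 := by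
  induction k with
  | zero => simpa [convPow] using hf
  | succ k ih =>
    intro n hn
    rw [convPow, LSeries.convolution_def]
    refine sum_eq_zero fun p hp => ?_
    by_contra h
    have h1 := not_lt.1 fun h' => h (by rw [hf _ h', zero_mul])
    have h2 := not_lt.1 fun h' => h (by rw [ih _ h', mul_zero])
    have h3 : (n:ℝ) = p.1 * p.2 := mod_cast (Nat.mem_divisorsAntidiagonal.1 hp).1.symm
    rw [h3, pow_succ'] at hn
    exact absurd (mul_le_mul h1 h2 (by positivity) hY) (not_le.2 hn)

lemma convPow_eq_zero_of_le {f : ℕ → ℂ} {Y : ℝ} (hY : 0 ≤ Y) (hf : ∀ n : ℕ, n ≤ Y → f n = 0) k :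
    ∀ n : ℕ, n ≤ Y ^ (k + 1) → convPow f k n = 0 := by
  induction k with
  | zero => simpa [convPow] using hf
  | succ k ih =>
    intro n hn
    rw [convPow, LSeries.convolution_def]
    refine sum_eq_zero fun p hp => ?_
    by_contra h
    have h1 := not_le.1 fun h' => h (by rw [hf _ h', zero_mul])
    have h2 := not_le.1 fun h' => h (by rw [ih _ h', mul_zero])
    have h3 : (n:ℝ) = p.1 * p.2 := mod_cast (Nat.mem_divisorsAntidiagonal.1 hp).1.symm
    rw [h3, pow_succ'] at hn
    exact absurd (mul_lt_mul'' h1 h2 hY (by positivity)) (not_lt.2 hn)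

lemma mean_value_LSeries {T : ℝ} (hT : 2 ≤ T) (a σ : ℝ) (g : ℕ → ℂ) (hg : LSeriesSummable g σ)
    {B : ℝ} (hB : ∀ S : Finset ℕ, (∀ n ∈ S, n ≠ 0) → ∑ n ∈ S, (‖g n‖ * n ^ (-σ)) ^ 2 * (T + n) ≤ B) :
    ∫ t in a..(a + T), ‖LSeries g (σ + t * I)‖ ^ 2 ≤ cMV * B := by
  set b := fun n => term g σ n with hb
  have hterm : ∀ t n, term g (σ + t * I) n =
      b n * Complex.exp (-(I * t * Real.log n)) := by
    intro t n
    rcases eq_or_ne n 0 with rfl | hn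
    · simp [hb]
    · rw [hb]
      simp only [term_of_ne_zero hn]
      have hn' : (n:ℂ) ≠ 0 := mod_cast hn
      rw [cpow_add _ _ hn', div_mul_eq_div_div, Complex.exp_neg, div_eq_mul_inv _ ((n:ℂ) ^ (_ * _))]
      congr 2
      rw [cpow_def_of_ne_zero hn', ← natCast_log]
      congr 1; ring
  have e : ∀ t : ℝ, LSeries g (σ + t * I) = ∑' n, b n * Complex.exp (-(I * t * Real.log n)) := by
    intro t
    unfold LSeries
    simp only [hterm]
  simp only [e]
  have hbn : ∀ n, n ≠ 0 → ‖b n‖ = ‖g n‖ * n ^ (-σ) := by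
    intro n hn
    rw [hb]; simp only [norm_term_eq, if_neg hn]
    rw [ofReal_re, rpow_neg (by positivity), div_eq_mul_inv]
  refine mean_value_tsum hT a b (by simp [hb]) hg.norm fun S => ?_
  have : ∑ n ∈ S, ‖b n‖ ^ 2 * (T + n) = ∑ n ∈ S.filter (· ≠ 0), (‖g n‖ * n ^ (-σ)) ^ 2 * (T + n) := by
    rw [sum_filter]
    refine sum_congr rfl fun n _ => ?_
    split_ifs with h
    · rw [hbn n h]
    · rw [not_not] at h
      simp [h, hb]
  rw [this]
  exact hB _ (by simp)

lemma moment_aux {ε : ℝ} (hε : 0 < ε) k B (hB : 0 ≤ B) : ∃ C : ℝ, 0 < C ∧ ∀ (f : ℕ → ℂ) (T a σ E₁ E₂ : ℝ),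
    2 ≤ T → (∀ n, ‖f n‖ ≤ B) → LSeriesSummable f σ → 0 ≤ E₁ → 0 ≤ E₂ →
    (∀ n : ℕ, n ≠ 0 → convPow f k n ≠ 0 → n ^ (3 * ε + 1 - 2 * σ) ≤ E₁) →
    (∀ n : ℕ, n ≠ 0 → convPow f k n ≠ 0 → n ^ (3 * ε + 2 - 2 * σ) ≤ E₂) →
    ∫ t in a..(a + T), ‖LSeries f (σ + t * I)‖ ^ (2 * (k + 1)) ≤ C * (T * E₁ + E₂) := by
  obtain ⟨C, hC, hCb⟩ := convPow_bound hε k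
  have hsum : Summable fun n : ℕ => 1 / (n:ℝ) ^ (1 + ε) := summable_one_div_nat_rpow.2 (by linarith)
  set Z := ∑' n : ℕ, 1 / (n:ℝ) ^ (1 + ε)
  refine ⟨cMV * ((C * B ^ (k + 1)) ^ 2 * Z + 1), by have := cMV_pos; positivity, ?_⟩
  intro f T a σ E₁ E₂ hT hf hs hE1 hE2 h1 h2
  have hLs : ∀ t : ℝ, LSeriesSummable f (σ + t * I) := fun t => hs.of_re_le_re (by simp)
  have e : ∀ t : ℝ, ‖LSeries f (σ + t * I)‖ ^ (2 * (k + 1)) = ‖LSeries (convPow f k) (σ + t * I)‖ ^ 2 := by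
    intro t
    rw [(convPow_LSeries (hLs t) k).2, norm_pow, ← pow_mul, mul_comm 2]
  simp only [e]
  rw [mul_assoc]
  refine (mean_value_LSeries hT a σ _ (convPow_LSeries hs k).1 (B := ((C * B ^ (k + 1)) ^ 2 * Z) * (T * E₁ + E₂)) ?_).trans ?_
  · intro S hS
    calc ∑ n ∈ S, (‖convPow f k n‖ * n ^ (-σ)) ^ 2 * (T + n)
        ≤ ∑ n ∈ S, (C * B ^ (k + 1)) ^ 2 * (T * E₁ + E₂) * (1 / n ^ (1 + ε)) := by
          refine sum_le_sum fun n hn => ?_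
          have hn0 := hS n hn
          have hnp : (0:ℝ) < n := mod_cast Nat.pos_of_ne_zero hn0
          rcases eq_or_ne (convPow f k n) 0 with h0 | h0
          · rw [h0, norm_zero, zero_mul, zero_pow two_ne_zero, zero_mul]; positivity
          · have a1 := h1 n hn0 h0
            have a2 := h2 n hn0 h0
            have a3 := hCb f B hB hf n hn0
            calc (‖convPow f k n‖ * n ^ (-σ)) ^ 2 * (T + n)
                ≤ (C * B ^ (k + 1) * n ^ ε * n ^ (-σ)) ^ 2 * (T + n) := by gcongr
              _ = (C * B ^ (k + 1)) ^ 2 * (T * n ^ (3 * ε + 1 - 2 * σ) + n ^ (3 * ε + 2 - 2 * σ)) * (1 / n ^ (1 + ε)) := by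
                  have r1 : n ^ (3 * ε + 1 - 2 * σ) = (n ^ ε * n ^ (-σ)) ^ 2 * (n:ℝ) ^ (1 + ε) := by
                    rw [← rpow_add hnp, ← rpow_natCast, ← rpow_mul hnp.le, ← rpow_add hnp]
                    congr 1; ring
                  have r2 : n ^ (3 * ε + 2 - 2 * σ) = n * (n ^ ε * n ^ (-σ)) ^ 2 * (n:ℝ) ^ (1 + ε) := by
                    rw [mul_assoc, ← r1]
                    nth_rewrite 2 [← rpow_one n]
                    rw [← rpow_add hnp]; congr 1; ring
                  rw [r1, r2]
                  field_simp
              _ ≤ _ := by gcongr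
      _ = (C * B ^ (k + 1)) ^ 2 * (T * E₁ + E₂) * ∑ n ∈ S, (1 / (n:ℝ) ^ (1 + ε)) := by rw [mul_sum]
      _ ≤ (C * B ^ (k + 1)) ^ 2 * (T * E₁ + E₂) * Z := by
          gcongr
          exact hsum.sum_le_tsum _ fun _ _ => by positivity
      _ = _ := by ring
  · have := cMV_pos
    gcongr
    linarith

lemma moment_short {ε : ℝ} (hε : 0 < ε) k B (hB : 0 ≤ B) : ∃ C : ℝ, 0 < C ∧ ∀ (f : ℕ → ℂ) (T a σ Y : ℝ),
    2 ≤ T → 1 ≤ Y → (∀ n, ‖f n‖ ≤ B) → (∀ n : ℕ, Y < n → f n = 0) →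
    ∫ t in a..(a + T), ‖LSeries f (σ + t * I)‖ ^ (2 * (k + 1)) ≤
      C * (T * (Y ^ (k + 1)) ^ (max 0 (3 * ε + 1 - 2 * σ)) + (Y ^ (k + 1)) ^ (max 0 (3 * ε + 2 - 2 * σ))) := by
  obtain ⟨C, hC, h⟩ := moment_aux hε k B hB
  refine ⟨C, hC, fun f T a σ Y hT hY hf hs => ?_⟩
  have key : ∀ (e : ℝ) n, n ≠ 0 → convPow f k n ≠ 0 → n ^ e ≤ (Y ^ (k + 1)) ^ (max 0 e) := by
    intro e n hn h0
    have h1 := not_lt.1 fun h' => h0 (convPow_eq_zero_of_gt (by linarith) hs k n h')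
    have hn1 : (1:ℝ) ≤ n := mod_cast Nat.one_le_iff_ne_zero.2 hn
    calc n ^ e ≤ (n:ℝ) ^ (max 0 e) := rpow_le_rpow_of_exponent_le hn1 (le_max_right _ _)
      _ ≤ _ := rpow_le_rpow (by positivity) h1 (le_max_left _ _)
  refine h f T a σ _ _ hT hf ?_ (by positivity) (by positivity) (key _) (key _)
  refine LSeriesSummable_congr' _ ?_ |>.2 (LSeriesSummable_zero)
  obtain ⟨N, hN⟩ := exists_nat_gt Y
  filter_upwards [Filter.eventually_ge_atTop N] with n hn
  exact hs n (hN.trans_le (mod_cast hn))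

lemma moment_tail {ε : ℝ} (hε : 0 < ε) k B (hB : 0 ≤ B) : ∃ C : ℝ, 0 < C ∧ ∀ (f : ℕ → ℂ) (T a σ Y : ℝ),
    2 ≤ T → 1 ≤ Y → (∀ n, ‖f n‖ ≤ B) → (∀ n : ℕ, n ≤ Y → f n = 0) → 3 * ε + 2 - 2 * σ ≤ 0 →
    ∫ t in a..(a + T), ‖LSeries f (σ + t * I)‖ ^ (2 * (k + 1)) ≤
      C * (T * (Y ^ (k + 1)) ^ (3 * ε + 1 - 2 * σ) + (Y ^ (k + 1)) ^ (3 * ε + 2 - 2 * σ)) := by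
  obtain ⟨C, hC, h⟩ := moment_aux hε k B hB
  refine ⟨C, hC, fun f T a σ Y hT hY hf hs hσ => ?_⟩
  have key : ∀ (e : ℝ), e ≤ 0 → ∀ n, n ≠ 0 → convPow f k n ≠ 0 → n ^ e ≤ (Y ^ (k + 1)) ^ e := by
    intro e he n hn h0
    have h1 := (not_le.1 fun h' => h0 (convPow_eq_zero_of_le (by linarith) hs k n h')).le
    exact rpow_le_rpow_of_nonpos (by positivity) h1 he
  refine h f T a σ _ _ hT hf ?_ (by positivity) (by positivity) (key _ (by linarith)) (key _ hσ)
  refine LSeriesSummable_of_bounded_of_one_lt_re (fun n _ => hf n) ?_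
  simp; linarith
end DirichletPowers

section Avg
open Set Real Function

lemma pow_integral_le {ρ h : ℝ → ℝ} (hρ0 : ∀ v, 0 ≤ ρ v) (hh0 : ∀ v, 0 ≤ h v) (hρ : Integrable ρ)
    (hρpos : 0 < ∫ v, ρ v) {m : ℕ} (hm : 0 < m) (h1 : Integrable fun v => ρ v * h v) (h2 : Integrable fun v => ρ v * h v ^ m) :
    (∫ v, ρ v * h v) ^ m ≤ (∫ v, ρ v) ^ (m - 1) * ∫ v, ρ v * h v ^ m := by
  set A := ∫ v, ρ v
  set g := ∫ v, ρ v * h v with hg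
  have hg0 : 0 ≤ g := integral_nonneg fun v => mul_nonneg (hρ0 v) (hh0 v)
  rcases hg0.eq_or_lt with h0 | h0
  · rw [← h0, zero_pow hm.ne']
    have : 0 ≤ ∫ v, ρ v * h v ^ m := integral_nonneg fun v => mul_nonneg (hρ0 v) (pow_nonneg (hh0 v) m)
    positivity
  set z := g / A with hz
  have hz0 : 0 < z := by positivity
  have hgz : g = z * A := by rw [hz]; field_simp
  have tangent : ∀ x : ℝ, 0 ≤ x → z ^ m + m * z ^ (m - 1) * (x - z) ≤ x ^ m := by
    intro x hx
    have b := one_add_mul_le_pow (a := x / z - 1) (by have : 0 ≤ x / z := by positivity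
                                                      linarith) m
    rw [add_sub_cancel, div_pow, le_div_iff₀ (by positivity)] at b
    refine le_trans (le_of_eq ?_) b
    have : z ^ m = z ^ (m - 1) * z := by rw [← pow_succ, Nat.sub_add_cancel hm]
    rw [add_mul, one_mul, this]
    field_simp
  have key : A * z ^ m ≤ ∫ v, ρ v * h v ^ m := by
    have e : A * z ^ m = ∫ v, (z ^ m - m * z ^ (m - 1) * z) * ρ v + m * z ^ (m - 1) * (ρ v * h v) := by
      rw [integral_add (hρ.const_mul _) (h1.const_mul _), integral_const_mul, integral_const_mul, ← hg, hgz]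
      ring
    rw [e]
    refine integral_mono ((hρ.const_mul _).add (h1.const_mul _)) h2 fun v => ?_
    have := mul_le_mul_of_nonneg_left (tangent (h v) (hh0 v)) (hρ0 v)
    refine le_trans (le_of_eq ?_) this
    ring
  calc g ^ m = A ^ (m - 1) * (A * z ^ m) := by
        rw [hgz, mul_pow, ← mul_assoc, ← pow_succ, Nat.sub_add_cancel hm, mul_comm]
    _ ≤ _ := by gcongr

/-- Averaging a `m`-th moment bound against an integrable weight. -/
lemma moment_average {ρ h F : ℝ → ℝ} (hρ0 : ∀ v, 0 ≤ ρ v) (hh0 : ∀ v, 0 ≤ h v) (hF0 : ∀ t, 0 ≤ F t)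
    (hρ : Integrable ρ) (hρc : Continuous ρ) (hρpos : 0 < ∫ v, ρ v)
    (hhc : Continuous h) {K : ℝ} (hK : ∀ v, h v ≤ K) (hFc : Continuous F) {m : ℕ} (hm : 0 < m) {a T M : ℝ} (hT : 0 ≤ T)
    (hF : ∀ t ∈ Icc a (a + T), F t ≤ ∫ v, ρ v * h (t + v))
    (hM : ∀ b, ∫ t in b..(b + T), h t ^ m ≤ M) :
    ∫ t in a..(a + T), F t ^ m ≤ (∫ v, ρ v) ^ m * M := by
  set A := ∫ v, ρ v
  have i1 : ∀ t j, Integrable fun v => ρ v * h (t + v) ^ j := by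
    intro t j
    refine (hρ.mul_const (K ^ j)).mono' (by fun_prop) (Eventually.of_forall fun v => ?_)
    rw [norm_of_nonneg (mul_nonneg (hρ0 v) (pow_nonneg (hh0 _) _))]
    exact mul_le_mul_of_nonneg_left (pow_le_pow_left₀ (hh0 _) (hK _) _) (hρ0 v)
  have step1 : ∀ t ∈ Icc a (a + T), F t ^ m ≤ A ^ (m - 1) * ∫ v, ρ v * h (t + v) ^ m := by
    intro t ht
    refine (pow_le_pow_left₀ (hF0 t) (hF t ht) m).trans ?_
    exact pow_integral_le hρ0 (fun v => hh0 _) hρ hρpos hm (by simpa using i1 t 1) (i1 t m)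
  have hprod : Integrable (uncurry fun t v => ρ v * h (t + v) ^ m)
      ((volume.restrict (Ioc a (a + T))).prod volume) := by
    have hb : Integrable (fun z : ℝ × ℝ => (K ^ m) * ρ z.2) ((volume.restrict (Ioc a (a + T))).prod volume) := by
      refine Integrable.mul_prod (f := fun _ : ℝ => K ^ m) (integrable_const _) hρ
    refine hb.mono' ?_ (Eventually.of_forall fun z => ?_)
    · exact Continuous.aestronglyMeasurable (by simp only [uncurry_def]; fun_prop)
    · simp only [uncurry_def]
      rw [norm_of_nonneg (mul_nonneg (hρ0 _) (pow_nonneg (hh0 _) _)), mul_comm]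
      exact mul_le_mul_of_nonneg_right (pow_le_pow_left₀ (hh0 _) (hK _) _) (hρ0 _)
  rw [intervalIntegral.integral_of_le (by linarith)]
  calc ∫ t in Ioc a (a + T), F t ^ m
      ≤ ∫ t in Ioc a (a + T), A ^ (m - 1) * ∫ v, ρ v * h (t + v) ^ m := by
        refine setIntegral_mono_on ?_ (hprod.integral_prod_left.const_mul _) measurableSet_Ioc
          fun t ht => step1 t (Ioc_subset_Icc_self ht)
        exact (Continuous.integrableOn_Icc (by fun_prop)).mono_set Ioc_subset_Icc_self
    _ = A ^ (m - 1) * ∫ v, ρ v * ∫ t in Ioc a (a + T), h (t + v) ^ m := by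
        rw [integral_const_mul, integral_integral_swap hprod]
        simp only [integral_const_mul]
    _ ≤ A ^ (m - 1) * ∫ v, ρ v * M := by
        refine mul_le_mul_of_nonneg_left ?_ (by positivity)
        refine integral_mono ?_ (hρ.mul_const _) fun v => ?_
        · have := hprod.integral_prod_right
          simpa only [uncurry_def, integral_const_mul] using this
        · refine mul_le_mul_of_nonneg_left ?_ (hρ0 v)
          have := hM (a + v)
          rw [← intervalIntegral.integral_of_le (by linarith),
            intervalIntegral.integral_comp_add_right (fun t => h t ^ m)]
          rwa [show a + T + v = a + v + T by ring]
    _ = A ^ m * M := by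
        rw [integral_mul_const, ← mul_assoc, ← pow_succ, Nat.sub_add_cancel hm]
end Avg

section FuncEq
open Complex ZMod

/-- A function on `ZMod N` vanishing at `0` and with sum zero. -/
structure Balanced {N : ℕ} [NeZero N] (Φ : ZMod N → ℂ) : Prop where
  zero : Φ 0 = 0
  sum : ∑ j, Φ j = 0

variable {N : ℕ} [NeZero N]

lemma Balanced.dft {Φ : ZMod N → ℂ} (h : Balanced Φ) : Balanced (𝓕 Φ) := by
  refine ⟨by rw [ZMod.dft_apply_zero, h.sum], ?_⟩
  have := ZMod.dft_apply_zero (𝓕 Φ)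
  rw [← this, ZMod.dft_dft]
  simp [h.zero]

lemma Balanced.neg {Φ : ZMod N → ℂ} (h : Balanced Φ) : Balanced (fun x => Φ (-x)) := by
  refine ⟨by simpa using h.zero, ?_⟩
  rw [← h.sum]
  exact Equiv.sum_comp (Equiv.neg (ZMod N)) Φ

/-- The factor in the asymmetric functional equation. -/
def feFactor (N : ℕ) (e : ℝ) (s : ℂ) : ℂ :=
  N ^ (s - 1) * (2 * Real.pi) ^ (-s) * Gamma s * cexp (e * Real.pi * I * s / 2)

lemma feFactor_bound {a b : ℝ} (ha : 0 < a) {e : ℝ} (he : |e| ≤ 1) : ∃ C : ℝ, 0 < C ∧ ∀ s : ℂ, a ≤ s.re → s.re ≤ b →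
    ‖feFactor N e s‖ ≤ C * (1 + |s.im|) ^ (s.re - 1/2) := by
  obtain ⟨C, hC, h⟩ := Gamma_bound a b ha
  have hN : (1:ℝ) ≤ N := mod_cast NeZero.one_le
  refine ⟨N ^ |b - 1| * C, by positivity, fun s h1 h2 => ?_⟩
  have e1 : ‖((N:ℂ)) ^ (s - 1)‖ ≤ N ^ |b - 1| := by
    rw [show N = ((N:ℝ):ℂ) by simp, norm_cpow_eq_rpow_re_of_pos (by linarith)]
    refine Real.rpow_le_rpow_of_exponent_le hN ?_
    exact (by linarith : s.re - 1 ≤ b - 1).trans (le_abs_self _)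
  have e2 : ‖(2 * (Real.pi:ℂ)) ^ (-s)‖ ≤ 1 := by
    rw [show (2 * Real.pi) = ((2 * Real.pi : ℝ):ℂ) by push_cast; rfl,
      norm_cpow_eq_rpow_re_of_pos (by have := Real.pi_pos; linarith)]
    refine Real.rpow_le_one_of_one_le_of_nonpos (by have := Real.pi_gt_three; linarith) ?_
    simp; linarith
  have e3 : ‖cexp (e * Real.pi * I * s / 2)‖ ≤ Real.exp (Real.pi * |s.im| / 2) := by
    rw [norm_exp]
    refine Real.exp_le_exp.2 ?_
    have : (e * Real.pi * I * s / 2).re = - (e * s.im) * (Real.pi / 2) := by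
      simp; ring
    have h3 : - (e * s.im) ≤ |s.im| := by
      refine (neg_le_abs _).trans ?_
      rw [abs_mul]
      exact mul_le_of_le_one_left (abs_nonneg _) he
    have := mul_le_mul_of_nonneg_right h3 (by have := Real.pi_pos; linarith : 0 ≤ Real.pi / 2)
    linarith
  unfold feFactor
  rw [norm_mul, norm_mul, norm_mul, mul_assoc]
  have := h s h1 h2
  calc _ ≤ (N ^ |b - 1| * 1) * (‖Gamma s‖ * Real.exp (Real.pi * |s.im| / 2)) := by gcongr
    _ ≤ (N ^ |b - 1| * 1) * (C * (1 + |s.im|) ^ (s.re - 1/2)) := by gcongr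
    _ = _ := by ring

lemma feFactor_differentiableOn e : DifferentiableOn ℂ (feFactor N e) {s | 0 < s.re} := by
  intro s hs
  have hs' := hs
  have hG : DifferentiableAt ℂ Gamma s := differentiableAt_Gamma _ fun m h => by
    rw [h] at hs'
    simp at hs'
    exact absurd (hs'.trans_le' (Nat.cast_nonneg m)) (lt_irrefl _)
  have hN : (N:ℂ) ≠ 0 := mod_cast NeZero.ne N
  have hp : (2 * (Real.pi:ℂ)) ≠ 0 := mod_cast Real.two_pi_pos.ne'
  refine DifferentiableAt.differentiableWithinAt ?_
  unfold feFactor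
  refine ((DifferentiableAt.mul ?_ ?_).mul hG).mul (by fun_prop)
  · exact (by fun_prop : DifferentiableAt ℂ (fun s : ℂ => s - 1) s).const_cpow (Or.inl hN)
  · exact (by fun_prop : DifferentiableAt ℂ (fun s : ℂ => -s) s).const_cpow (Or.inl hp)

lemma Balanced.one_sub {Φ : ZMod N → ℂ} (h : Balanced Φ) {s : ℂ} (hs : 0 < s.re) :
    LFunction Φ (1 - s) = feFactor N 1 s * LFunction (𝓕 Φ) s +
      feFactor N (-1) s * LFunction (𝓕 fun x => Φ (-x)) s := by
  rw [ZMod.LFunction_one_sub Φ (fun n hn => by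
    rw [hn] at hs; simp at hs; exact absurd (hs.trans_le' (Nat.cast_nonneg n)) (lt_irrefl _)) (Or.inl h.zero)]
  unfold feFactor
  push_cast
  ring_nf

lemma Balanced.differentiable {Φ : ZMod N → ℂ} (h : Balanced Φ) : Differentiable ℂ (LFunction Φ) :=
  ZMod.differentiable_LFunction_of_sum_zero h.sum

lemma norm_le_of_strip {A B : ℝ} {s : ℂ} (h1 : -A ≤ s.re) (h2 : s.re ≤ B) :
    ‖s‖ ≤ (1 + |A| + |B|) * (1 + |s.im|) := by
  refine (norm_le_abs_re_add_abs_im s).trans ?_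
  have : |s.re| ≤ |A| + |B| := abs_le.2 ⟨by linarith [le_abs_self A, abs_nonneg B], by linarith [le_abs_self B, abs_nonneg A]⟩
  nlinarith [abs_nonneg A, abs_nonneg B, abs_nonneg s.im]

/-- Polynomial growth of balanced `L`-functions in vertical strips. -/
lemma Balanced.growth {Φ : ZMod N → ℂ} (h : Balanced Φ) (A B : ℝ) : ∃ C : ℝ, 0 < C ∧ ∃ k : ℕ, ∀ s : ℂ,
    -A ≤ s.re → s.re ≤ B → ‖LFunction Φ s‖ ≤ C * (1 + |s.im|) ^ k := by
  have right : ∀ (Ψ : ZMod N → ℂ), Balanced Ψ → ∀ D : ℝ, ∃ C : ℝ, 0 < C ∧ ∀ s : ℂ, 1/2 ≤ s.re → s.re ≤ D →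
      ‖LFunction Ψ s‖ ≤ C * (1 + |s.im|) := by
    intro Ψ hΨ D
    obtain ⟨C, hC⟩ := LFunction_growth_right Ψ hΨ.sum
    refine ⟨2 * (|C| + 1) * (1 + |0| + |D|), by positivity, fun s h1 h2 => (hC s (by linarith)).trans ?_⟩
    have h3 := norm_le_of_strip (A := 0) (by linarith) h2
    calc C * ‖s‖ / s.re ≤ (|C| + 1) * ‖s‖ / (1/2) := by gcongr; linarith [le_abs_self C]
      _ = 2 * (|C| + 1) * ‖s‖ := by ring
      _ ≤ 2 * (|C| + 1) * ((1 + |0| + |D|) * (1 + |s.im|)) := by gcongr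
      _ = _ := by ring
  obtain ⟨C₀, hC₀, h0⟩ := right Φ h B
  obtain ⟨C₁, hC₁, h1⟩ := right _ h.dft (1 + A)
  obtain ⟨C₂, hC₂, h2⟩ := right _ h.neg.dft (1 + A)
  obtain ⟨D₁, hD₁, f1⟩ := feFactor_bound (N := N) one_half_pos (e := 1) (by simp)
  obtain ⟨D₂, hD₂, f2⟩ := feFactor_bound (N := N) one_half_pos (e := -1) (by simp)
  obtain ⟨k, hk⟩ := exists_nat_ge (|A| + 1)
  refine ⟨C₀ + D₁ * C₁ + D₂ * C₂, by positivity, k + 1, fun s hs1 hs2 => ?_⟩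
  have hb : 1 ≤ 1 + |s.im| := by linarith [abs_nonneg s.im]
  rcases le_total (1/2) s.re with hr | hr
  · refine (h0 s hr hs2).trans ?_
    have : 1 + |s.im| ≤ (1 + |s.im|) ^ (k + 1) := le_self_pow₀ hb (by simp)
    have h3 : 0 ≤ (D₁ * C₁ + D₂ * C₂) * (1 + |s.im|) ^ (k + 1) := by positivity
    nlinarith
  · set s' := 1 - s with hs'
    have r1 : 1/2 ≤ s'.re := by simp [hs']; linarith
    have r2 : s'.re ≤ 1 + A := by simp [hs']; linarith
    have im' : |s'.im| = |s.im| := by simp [hs']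
    have : s = 1 - s' := by simp [hs']
    rw [this, h.one_sub (by linarith)]
    refine (norm_add_le _ _).trans ?_
    rw [norm_mul, norm_mul, ← this]
    have pw : (1 + |s.im|) ^ (s'.re - 1/2) ≤ (1 + |s.im|) ^ k := by
      rw [← Real.rpow_natCast]
      exact Real.rpow_le_rpow_of_exponent_le hb (by linarith [le_abs_self A])
    have g1 := f1 s' r1 r2
    have g2 := f2 s' r1 r2
    have g3 := h1 s' r1 r2
    have g4 := h2 s' r1 r2
    rw [im'] at g1 g2 g3 g4
    calc _ ≤ (D₁ * (1 + |s.im|) ^ k) * (C₁ * (1 + |s.im|)) + (D₂ * (1 + |s.im|) ^ k) * (C₂ * (1 + |s.im|)) := by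
          refine add_le_add (mul_le_mul (g1.trans ?_) g3 (norm_nonneg _) (by positivity))
            (mul_le_mul (g2.trans ?_) g4 (norm_nonneg _) (by positivity)) <;> gcongr
      _ = (D₁ * C₁ + D₂ * C₂) * (1 + |s.im|) ^ (k + 1) := by ring
      _ ≤ _ := by gcongr; linarith
end FuncEq

section LineBounds
open Complex

lemma LSeries_line_bound {f : ℕ → ℂ} {x : ℝ} (hf : LSeriesSummable f x) {z : ℂ} (hz : x ≤ z.re) :
    ‖LSeries f z‖ ≤ ∑' n, ‖LSeries.term f x n‖ := by
  refine tsum_of_norm_bounded hf.norm.hasSum fun n => ?_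
  exact LSeries.norm_term_le_of_re_le_re f (by simpa using hz) n

lemma LSeries_line_continuous {f : ℕ → ℂ} {x : ℝ} (hf : LSeriesSummable f x) e :
    Continuous fun u : ℝ => LSeries f (x + (e * u : ℝ) * I) := by
  refine continuous_tsum (fun n => ?_) hf.norm fun n u => ?_
  · rcases eq_or_ne n 0 with rfl | hn
    · simpa using continuous_const
    · have :=
        continuous_iff_continuousAt.2 fun z => (LSeries.hasDerivAt_term f n z).continuousAt
      exact this.comp (by fun_prop)
  · exact LSeries.norm_term_le_of_re_le_re f (by simp) n

lemma LSeries_finite {f : ℕ → ℂ} {Y : ℝ} (hf : ∀ n : ℕ, Y < n → f n = 0) s :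
    LSeries f s = ∑ n ∈ Finset.range (⌊Y⌋₊ + 1), LSeries.term f s n := by
  refine tsum_eq_sum fun n hn => ?_
  have := Nat.lt_of_floor_lt (by simp at hn; omega)
  rcases eq_or_ne n 0 with rfl | h0
  · simp
  · rw [LSeries.term_of_ne_zero h0, hf n this, zero_div]

lemma LSeriesSummable_finite {f : ℕ → ℂ} {Y : ℝ} (hf : ∀ n : ℕ, Y < n → f n = 0) s :
    LSeriesSummable f s := by
  refine summable_of_ne_finset_zero (s := Finset.range (⌊Y⌋₊ + 1)) fun n hn => ?_
  have := Nat.lt_of_floor_lt (by simp at hn; omega)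
  rcases eq_or_ne n 0 with rfl | h0
  · simp
  · rw [LSeries.term_of_ne_zero h0, hf n this, zero_div]

lemma LSeries_finite_differentiable {f : ℕ → ℂ} {Y : ℝ} (hf : ∀ n : ℕ, Y < n → f n = 0) :
    Differentiable ℂ (LSeries f) := by
  have := funext (LSeries_finite hf)
  rw [this]
  exact Differentiable.fun_sum fun n _ z => (LSeries.hasDerivAt_term f n z).differentiableAt

/-- The Mellin-type integrand. -/
def melIntegrand (P : ℂ → ℂ) (Y : ℝ) (w : ℂ) : ℂ := P w * Y ^ w * cexp (w ^ 2) / w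

lemma melIntegrand_bound {Y : ℝ} (hY : 1 ≤ Y) {x1 x2 C : ℝ} {k : ℕ} {P : ℂ → ℂ} (hC : 0 ≤ C)
    (hPb : ∀ z : ℂ, x1 ≤ z.re → z.re ≤ x2 → ‖P z‖ ≤ C * (1 + |z.im|) ^ k) :
    ∃ K : ℝ, 0 ≤ K ∧ ∀ z : ℂ, x1 ≤ z.re → z.re ≤ x2 → ‖P z * Y ^ z * cexp (z ^ 2)‖ ≤ K / (1 + z.im ^ 2) := by
  obtain ⟨D, hD, h⟩ := exists_exp_neg_sq_pow_le_inv k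
  refine ⟨C * Y ^ (|x1| + |x2|) * Real.exp ((|x1| + |x2|) ^ 2) * D, by positivity, fun z h1 h2 => ?_⟩
  have hr : |z.re| ≤ |x1| + |x2| :=
    abs_le.2 ⟨by linarith [neg_abs_le x1, abs_nonneg x2], by linarith [le_abs_self x2, abs_nonneg x1]⟩
  rw [norm_mul, norm_mul, norm_cpow_eq_rpow_re_of_pos (by linarith), exp_mul_I_cancel z _ rfl]
  have e1 := Real.rpow_le_rpow_of_exponent_le hY ((le_abs_self _).trans hr)
  have e2 :=
    Real.exp_le_exp.2 (sq_le_sq.2 (hr.trans (le_abs_self _)))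
  calc _ ≤ (C * (1 + |z.im|) ^ k) * Y ^ (|x1| + |x2|) * (Real.exp ((|x1| + |x2|) ^ 2) * Real.exp (-z.im ^ 2)) := by
        gcongr
        exact hPb z h1 h2
    _ = C * Y ^ (|x1| + |x2|) * Real.exp ((|x1| + |x2|) ^ 2) * ((1 + |z.im|) ^ k * Real.exp (-z.im ^ 2)) := by ring
    _ ≤ C * Y ^ (|x1| + |x2|) * Real.exp ((|x1| + |x2|) ^ 2) * (D / (1 + z.im ^ 2)) := by gcongr; exact h _
    _ = _ := by ring

lemma melIntegrand_shift {Y : ℝ} (hY : 1 ≤ Y) {x1 x2 C : ℝ} (h12 : x1 ≤ x2) (h0 : 0 < x1 ∨ x2 < 0) {k : ℕ} {P : ℂ → ℂ}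
    (hC : 0 ≤ C) (hP : DifferentiableOn ℂ P {z | x1 ≤ z.re ∧ z.re ≤ x2})
    (hPb : ∀ z : ℂ, x1 ≤ z.re → z.re ≤ x2 → ‖P z‖ ≤ C * (1 + |z.im|) ^ k) :
    ∫ y : ℝ, melIntegrand P Y (x1 + y * I) = ∫ y : ℝ, melIntegrand P Y (x2 + y * I) := by
  obtain ⟨K, hK, h⟩ := melIntegrand_bound hY hC hPb
  obtain ⟨m, hm, hm'⟩ : ∃ m : ℝ, 0 < m ∧ ∀ z : ℂ, x1 ≤ z.re → z.re ≤ x2 → m ≤ ‖z‖ := by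
    rcases h0 with h0 | h0
    · exact ⟨x1, h0, fun z h1 _ => (h1.trans (le_abs_self _)).trans (abs_re_le_norm z)⟩
    · exact ⟨-x2, by linarith, fun z _ h2 => ((by linarith : -x2 ≤ -z.re).trans (neg_le_abs _)).trans (abs_re_le_norm z)⟩
  have hne : ∀ z : ℂ, x1 ≤ z.re → z.re ≤ x2 → z ≠ 0 := fun z h1 h2 h => by
    have := hm' z h1 h2; rw [h, norm_zero] at this; linarith
  refine integral_vertical_eq (C := K / m) h12 ?_ fun z h1 h2 => ?_
  · have hY0 : (Y:ℂ) ≠ 0 := mod_cast (by linarith : Y ≠ 0)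
    refine DifferentiableOn.div ((hP.mul ?_).mul (by fun_prop)) (by fun_prop) fun z hz => hne z hz.1 hz.2
    exact fun z _ => (differentiableAt_id.const_cpow (Or.inl hY0)).differentiableWithinAt
  · unfold melIntegrand
    rw [norm_div, div_right_comm]
    gcongr
    · exact h z h1 h2
    · exact hm' z h1 h2

lemma melIntegrand_integrable {Y : ℝ} (hY : 1 ≤ Y) {x C : ℝ} (h0 : x ≠ 0) {k : ℕ} {P : ℂ → ℂ}
    (hC : 0 ≤ C) (hP : Continuous fun y : ℝ => P (x + y * I))
    (hPb : ∀ y : ℝ, ‖P (x + y * I)‖ ≤ C * (1 + |y|) ^ k) :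
    Integrable fun y : ℝ => melIntegrand P Y (x + y * I) := by
  obtain ⟨D, hD, h⟩ := exists_exp_neg_sq_pow_le_inv k
  have hne : ∀ y : ℝ, (x + y * I : ℂ) ≠ 0 := fun y h => h0 (by simpa using congrArg re h)
  have hY0 : (Y:ℂ) ≠ 0 := mod_cast (by linarith : Y ≠ 0)
  refine (integrable_inv_one_add_sq.const_mul (C * Y ^ x * Real.exp (x ^ 2) * D / |x|)).mono' ?_ (Eventually.of_forall fun y => ?_)
  · refine Continuous.aestronglyMeasurable ?_
    refine ((hP.mul ?_).mul (by fun_prop)).div (by fun_prop) hne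
    exact (by fun_prop : Continuous fun y : ℝ => (x + y * I : ℂ)).const_cpow (Or.inl hY0)
  · unfold melIntegrand
    have hn : |x| ≤ ‖(x + y * I : ℂ)‖ := by simpa using abs_re_le_norm (x + y * I : ℂ)
    rw [norm_div, norm_mul, norm_mul, norm_cpow_eq_rpow_re_of_pos (by linarith), exp_mul_I_cancel _ x (by simp)]
    simp
    calc _ ≤ (C * (1 + |y|) ^ k) * Y ^ x * (Real.exp (x ^ 2) * Real.exp (-y ^ 2)) / |x| := by
          gcongr
          exact hPb y
      _ = C * Y ^ x * Real.exp (x ^ 2) / |x| * ((1 + |y|) ^ k * Real.exp (-y ^ 2)) := by ring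
      _ ≤ C * Y ^ x * Real.exp (x ^ 2) / |x| * (D / (1 + y ^ 2)) := by gcongr; exact h y
      _ = _ := by ring

/-- Bound for a line integral in terms of a majorant. -/
lemma melIntegrand_norm_le {Y : ℝ} (hY : 1 ≤ Y) {x : ℝ} (h0 : x ≠ 0) {P : ℂ → ℂ} {g : ℝ → ℝ} 
    {K : ℝ} (hg : Integrable g)
    (hPg : ∀ y : ℝ, Y ^ x * (Real.exp (-y ^ 2) * ‖P (x + y * I)‖) ≤ K * g y) :
    ‖∫ y : ℝ, melIntegrand P Y (x + y * I)‖ ≤ (Real.exp (x ^ 2) / |x| * K) * ∫ v, g v := by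
  rw [← integral_const_mul]
  refine norm_integral_le_of_norm_le (hg.const_mul _) (Eventually.of_forall fun y => ?_)
  unfold melIntegrand
  have hn : |x| ≤ ‖(x + y * I : ℂ)‖ := by simpa using abs_re_le_norm (x + y * I : ℂ)
  rw [norm_div, norm_mul, norm_mul, norm_cpow_eq_rpow_re_of_pos (by linarith), exp_mul_I_cancel _ x (by simp)]
  simp
  calc _ ≤ ‖P (x + y * I)‖ * Y ^ x * (Real.exp (x ^ 2) * Real.exp (-y ^ 2)) / |x| := by gcongr
    _ = (Real.exp (x ^ 2) / |x|) * (Y ^ x * (Real.exp (-y ^ 2) * ‖P (x + y * I)‖)) := by ring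
    _ ≤ (Real.exp (x ^ 2) / |x|) * (K * g y) :=
          mul_le_mul_of_nonneg_left (hPg y) (by positivity)
    _ = _ := by ring
end LineBounds

section Approx
open Real LSeries Set
open Complex ZMod
variable {N : ℕ} [NeZero N]

lemma peetre {T t v e : ℝ} (hT : 2 ≤ T) (h1 : T ≤ |t|) (h2 : |t| ≤ 2 * T) (he : |e| ≤ 3) :
    (1 + |t + v|) ^ e ≤ 27 * T ^ e * (1 + |v|) ^ 3 := by
  have hv : 1 ≤ 1 + |v| := by linarith [abs_nonneg v]
  have hq : 0 < 1 + |t + v| := by positivity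
  have hpw : ∀ x : ℝ, x ≤ 3 → (1 + |v|) ^ x ≤ (1 + |v|) ^ 3 := by
    intro x hx
    have := rpow_le_rpow_of_exponent_le hv hx
    exact_mod_cast this
  rcases le_total 0 e with h | h
  · have a1 : 1 + |t + v| ≤ 3 * T * (1 + |v|) := by
      have := abs_add_le t v
      nlinarith
    have h3 : (3:ℝ) ^ e ≤ 27 := by
      calc 3 ^ e ≤ 3 ^ 3 := rpow_le_rpow_of_exponent_le (by norm_num) ((le_abs_self _).trans he)
        _ = 27 := by norm_num
    calc (1 + |t + v|) ^ e ≤ (3 * T * (1 + |v|)) ^ e := rpow_le_rpow hq.le a1 h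
      _ = 3 ^ e * T ^ e * (1 + |v|) ^ e := by
        rw [mul_rpow (by positivity) (by positivity), mul_rpow (by positivity) (by positivity)]
      _ ≤ 27 * T ^ e * (1 + |v|) ^ 3 := by
        gcongr
        exact hpw e ((le_abs_self _).trans he)
  · have a1 : T / (1 + |v|) ≤ 1 + |t + v| := by
      rw [div_le_iff₀ (by positivity)]
      have := abs_sub (t + v) v
      rw [add_sub_cancel_right] at this
      nlinarith [abs_nonneg (t + v)]
    calc (1 + |t + v|) ^ e ≤ (T / (1 + |v|)) ^ e := rpow_le_rpow_of_nonpos (by positivity) a1 h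
      _ = T ^ e * (1 + |v|) ^ (-e) := by
        rw [div_rpow (by positivity) (by positivity), rpow_neg (by positivity), div_eq_mul_inv]
      _ ≤ T ^ e * (1 + |v|) ^ 3 := by gcongr; exact hpw _ ((neg_le_abs _).trans he)
      _ ≤ _ := by
        have : 0 ≤ T ^ e * (1 + |v|) ^ 3 := by positivity
        linarith

/-- The part of a sequence supported on `n ≤ Y`. -/
def shortPart (f : ℕ → ℂ) (Y : ℝ) (n : ℕ) : ℂ := if (n:ℝ) ≤ Y then f n else 0
/-- The part of a sequence supported on `n > Y`. -/
def longPart (f : ℕ → ℂ) (Y : ℝ) (n : ℕ) : ℂ := if (n:ℝ) ≤ Y then 0 else f n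

lemma shortPart_zero {f : ℕ → ℂ} {Y : ℝ} (n : ℕ) (h : Y < n) : shortPart f Y n = 0 := by
  simp [shortPart, h]
lemma longPart_zero {f : ℕ → ℂ} {Y : ℝ} (n : ℕ) (h : n ≤ Y) : longPart f Y n = 0 := by
  simp [longPart, h]
lemma shortPart_bound {f : ℕ → ℂ} {Y B : ℝ} (hf : ∀ n, ‖f n‖ ≤ B) n : ‖shortPart f Y n‖ ≤ B := by
  unfold shortPart; split_ifs
  · exact hf n
  · simpa using (norm_nonneg _).trans (hf 0)
lemma longPart_bound {f : ℕ → ℂ} {Y B : ℝ} (hf : ∀ n, ‖f n‖ ≤ B) n : ‖longPart f Y n‖ ≤ B := by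
  unfold longPart; split_ifs
  · simpa using (norm_nonneg _).trans (hf 0)
  · exact hf n
lemma shortPart_add_longPart (f : ℕ → ℂ) Y : shortPart f Y + longPart f Y = f := by
  ext n; simp only [Pi.add_apply, shortPart, longPart]; split_ifs <;> simp

lemma coeff_bound (Φ : ZMod N → ℂ) : ∀ n : ℕ, ‖Φ n‖ ≤ ∑ j, ‖Φ j‖ :=
  fun n => Finset.single_le_sum (fun _ _ => norm_nonneg _) (Finset.mem_univ (n : ZMod N))

lemma longPart_summable (Φ : ZMod N → ℂ) Y {x : ℂ} (hx : 1 < x.re) :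
    LSeriesSummable (longPart (fun n => Φ n) Y) x :=
  LSeriesSummable_of_bounded_of_one_lt_re (fun n _ => longPart_bound (coeff_bound Φ) n) hx

lemma LFunction_split (Φ : ZMod N → ℂ) Y {s : ℂ} (hs : 1 < s.re) :
    LFunction Φ s = LSeries (shortPart (fun n => Φ n) Y) s + LSeries (longPart (fun n => Φ n) Y) s := by
  rw [LFunction_eq_LSeries Φ hs, ← LSeries_add (LSeriesSummable_finite shortPart_zero s) (longPart_summable Φ Y hs),
    shortPart_add_longPart]

/-- The weight. -/
def wt (v : ℝ) : ℝ := (1 + |v|) ^ 3 * rexp (-v ^ 2)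
lemma wt_nonneg v : 0 ≤ wt v := by unfold wt; positivity
lemma wt_pos v : 0 < wt v := by unfold wt; positivity
lemma wt_continuous : Continuous wt := by unfold wt; fun_prop
lemma wt_integrable : Integrable wt := by
  obtain ⟨D, hD, h⟩ := exists_exp_neg_sq_pow_le_inv 3
  refine (integrable_inv_one_add_sq.const_mul D).mono' wt_continuous.aestronglyMeasurable (Eventually.of_forall fun y => ?_)
  rw [norm_of_nonneg (wt_nonneg y)]
  simpa [wt, div_eq_mul_inv] using h y
lemma wt_integral_pos : 0 < ∫ v, wt v :=
  integral_pos_of_integrable_nonneg_nonzero wt_continuous wt_integrable wt_nonneg (wt_pos 0).ne'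
lemma exp_le_wt v : rexp (-v ^ 2) ≤ wt v := by
  unfold wt
  exact le_mul_of_one_le_left (exp_pos _).le (one_le_pow₀ (by linarith [abs_nonneg v]))

/-- One Dirichlet polynomial/series component on a vertical line. -/
def comp (f : ℕ → ℂ) (x e u : ℝ) : ℝ := ‖LSeries f (x + (e * u : ℝ) * I)‖

/-- Majorant in the approximate functional equation. -/
def majorant (Φ : ZMod N → ℂ) (σ ε T Y u : ℝ) : ℝ :=
  Y ^ ε * comp (shortPart (fun n => Φ n) Y) (σ + ε) 1 u + Y ^ (2:ℝ) * comp (longPart (fun n => Φ n) Y) (σ + 2) 1 u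
  + (Y ^ (-ε) * T ^ (1/2 - σ + ε) * comp (shortPart (fun n => 𝓕 Φ n) Y) (1 - σ + ε) (-1) u
    + Y ^ (-2:ℝ) * T ^ (1/2 - σ + 2) * comp (longPart (fun n => 𝓕 Φ n) Y) (1 - σ + 2) (-1) u)
  + (Y ^ (-ε) * T ^ (1/2 - σ + ε) * comp (shortPart (fun n => (𝓕 fun x => Φ (-x)) n) Y) (1 - σ + ε) (-1) u
    + Y ^ (-2:ℝ) * T ^ (1/2 - σ + 2) * comp (longPart (fun n => (𝓕 fun x => Φ (-x)) n) Y) (1 - σ + 2) (-1) u)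

lemma comp_nonneg (f : ℕ → ℂ) (x e u : ℝ) : 0 ≤ comp f x e u := norm_nonneg _

lemma comp_continuous {f : ℕ → ℂ} {x : ℝ} (hf : LSeriesSummable f x) e : Continuous (comp f x e) :=
  (LSeries_line_continuous hf e).norm

lemma comp_le {f : ℕ → ℂ} {x : ℝ} (hf : LSeriesSummable f x) (e u : ℝ) : comp f x e u ≤ ∑' n, ‖term f x n‖ :=
  LSeries_line_bound hf (by simp)

lemma majorant_continuous (Φ : ZMod N → ℂ) {σ ε T Y : ℝ} (h0 : 0 < σ) (h1 : σ < 1) :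
    Continuous (majorant Φ σ ε T Y) := by
  have a1 : ∀ (Ψ : ZMod N → ℂ) (x e : ℝ), Continuous (comp (shortPart (fun n => Ψ n) Y) x e) :=
    fun Ψ x e => comp_continuous (LSeriesSummable_finite shortPart_zero _) e
  have a2 : ∀ (Ψ : ZMod N → ℂ) (x e : ℝ), 1 < x → Continuous (comp (longPart (fun n => Ψ n) Y) x e) :=
    fun Ψ x e hx => comp_continuous (longPart_summable Ψ Y (by simpa using hx)) e
  have b1 := a1 Φ (σ + ε) 1
  have b2 := a2 Φ (σ + 2) 1 (by linarith)
  have b3 := a1 (𝓕 Φ) (1 - σ + ε) (-1)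
  have b4 := a2 (𝓕 Φ) (1 - σ + 2) (-1) (by linarith)
  have b5 := a1 (𝓕 fun x => Φ (-x)) (1 - σ + ε) (-1)
  have b6 := a2 (𝓕 fun x => Φ (-x)) (1 - σ + 2) (-1) (by linarith)
  unfold majorant
  exact ((continuous_const.mul b1).add (continuous_const.mul b2)).add ((continuous_const.mul b3).add (continuous_const.mul b4))
    |>.add ((continuous_const.mul b5).add (continuous_const.mul b6))

lemma majorant_bounded (Φ : ZMod N → ℂ) {σ ε T Y : ℝ} (h0 : 0 < σ) (h1 : σ < 1) (hT : 0 < T) (hY : 0 < Y) :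
    ∃ K, ∀ u, majorant Φ σ ε T Y u ≤ K := by
  have a1 : ∀ (Ψ : ZMod N → ℂ) (x e : ℝ), ∃ K, ∀ u, comp (shortPart (fun n => Ψ n) Y) x e u ≤ K :=
    fun Ψ x e => ⟨_, fun u => comp_le (LSeriesSummable_finite shortPart_zero _) e u⟩
  have a2 : ∀ (Ψ : ZMod N → ℂ) (x e : ℝ), 1 < x → ∃ K, ∀ u, comp (longPart (fun n => Ψ n) Y) x e u ≤ K :=
    fun Ψ x e hx => ⟨_, fun u => comp_le (longPart_summable Ψ Y (by simpa using hx)) e u⟩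
  obtain ⟨K1, b1⟩ := a1 Φ (σ + ε) 1
  obtain ⟨K2, b2⟩ := a2 Φ (σ + 2) 1 (by linarith)
  obtain ⟨K3, b3⟩ := a1 (𝓕 Φ) (1 - σ + ε) (-1)
  obtain ⟨K4, b4⟩ := a2 (𝓕 Φ) (1 - σ + 2) (-1) (by linarith)
  obtain ⟨K5, b5⟩ := a1 (𝓕 fun x => Φ (-x)) (1 - σ + ε) (-1)
  obtain ⟨K6, b6⟩ := a2 (𝓕 fun x => Φ (-x)) (1 - σ + 2) (-1) (by linarith)
  refine ⟨Y ^ ε * K1 + Y ^ (2:ℝ) * K2 + (Y ^ (-ε) * T ^ (1/2 - σ + ε) * K3 + Y ^ (-2:ℝ) * T ^ (1/2 - σ + 2) * K4)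
    + (Y ^ (-ε) * T ^ (1/2 - σ + ε) * K5 + Y ^ (-2:ℝ) * T ^ (1/2 - σ + 2) * K6), fun u => ?_⟩
  unfold majorant
  gcongr
  exacts [b1 u, b2 u, b3 u, b4 u, b5 u, b6 u]

lemma wt_mul_integrable {h : ℝ → ℝ} (hc : Continuous h) {K : ℝ} (hK : ∀ u, h u ≤ K) (h0 : ∀ u, 0 ≤ h u) t :
    Integrable fun v => wt v * h (t + v) := by
  refine (wt_integrable.mul_const K).mono' ((wt_continuous.mul (hc.comp (by fun_prop))).aestronglyMeasurable)
    (Eventually.of_forall fun v => ?_)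
  rw [norm_of_nonneg (mul_nonneg (wt_nonneg v) (h0 _))]
  exact mul_le_mul_of_nonneg_left (hK _) (wt_nonneg v)

/-- The dual contribution to the approximate functional equation. -/
lemma dual_part (Ψ : ZMod N → ℂ) {σ ε e : ℝ} (h0 : 0 < σ) (h1 : σ < 1) (hε : 0 < ε) (hε1 : ε ≤ 1) (he : |e| ≤ 1) :
    ∃ C : ℝ, 0 < C ∧ ∀ (T Y t : ℝ) (h : ℝ → ℝ), 2 ≤ T → 1 ≤ Y → T ≤ |t| → |t| ≤ 2 * T →
      Integrable (fun v => wt v * h (t + v)) →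
      (∀ u, Y ^ (-ε) * T ^ (1/2 - σ + ε) * comp (shortPart (fun n => Ψ n) Y) (1 - σ + ε) (-1) u ≤ h u) →
      (∀ u, Y ^ (-2:ℝ) * T ^ (1/2 - σ + 2) * comp (longPart (fun n => Ψ n) Y) (1 - σ + 2) (-1) u ≤ h u) →
      Integrable (fun y : ℝ => melIntegrand (fun w => feFactor N e (1 - (σ + t * I) - w) *
        LFunction Ψ (1 - (σ + t * I) - w)) Y ((-2 : ℝ) + y * I)) ∧
      ‖∫ y : ℝ, melIntegrand (fun w => feFactor N e (1 - (σ + t * I) - w) * LFunction Ψ (1 - (σ + t * I) - w)) Y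
        ((-2 : ℝ) + y * I)‖ ≤ C * ∫ v, wt v * h (t + v) := by
  obtain ⟨D, hD, hf⟩ := feFactor_bound (N := N) (a := 1 - σ) (b := 3) (by linarith) he
  refine ⟨rexp ((-ε) ^ 2) / |-ε| * (D * 27) + rexp ((-2) ^ 2) / |-2| * (D * 27), by positivity, ?_⟩
  intro T Y t h hT hY ht1 ht2 hig hh1 hh2
  set s := σ + t * I with hs
  have hsre : s.re = σ := by simp [hs]
  have hsim : s.im = t := by simp [hs]
  set f1 := shortPart (fun n => Ψ n) Y
  set f2 := longPart (fun n => Ψ n) Y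
  set P1 := fun w => feFactor N e (1 - s - w) * LSeries f1 (1 - s - w) with hP1
  set P2 := fun w => feFactor N e (1 - s - w) * LSeries f2 (1 - s - w) with hP2
  have hre : ∀ w : ℂ, (1 - s - w).re = 1 - σ - w.re := fun w => by simp [hsre]
  have him : ∀ w : ℂ, |(1 - s - w).im| = |t + w.im| := fun w => by
    rw [← abs_neg]; simp [hsim]; ring_nf
  have hsum1 : LSeriesSummable f1 ((1 - σ : ℝ) : ℂ) := LSeriesSummable_finite shortPart_zero _
  have hsum2 : LSeriesSummable f2 ((1 - σ + 2 : ℝ) : ℂ) := longPart_summable Ψ Y (by rw [ofReal_re]; linarith)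
  -- polynomial bound for the factor
  have fpoly : ∀ w : ℂ, -2 ≤ w.re → w.re ≤ 0 → ‖feFactor N e (1 - s - w)‖ ≤ (D * (1 + |t|) ^ 3) * (1 + |w.im|) ^ 3 := by
    intro w w1 w2
    refine (hf _ (by rw [hre]; linarith) (by rw [hre]; linarith)).trans ?_
    rw [him, hre, mul_assoc, ← mul_pow]
    have a1 : 1 + |t + w.im| ≤ (1 + |t|) * (1 + |w.im|) := by
      have := abs_add_le t w.im
      nlinarith [abs_nonneg w.im]
    have a2 : 1 ≤ 1 + |t + w.im| := by linarith [abs_nonneg (t + w.im)]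
    refine mul_le_mul_of_nonneg_left ?_ hD.le
    calc (1 + |t + w.im|) ^ (1 - σ - w.re - 1/2) ≤ (1 + |t + w.im|) ^ (3:ℝ) :=
          rpow_le_rpow_of_exponent_le a2 (by linarith)
      _ = (1 + |t + w.im|) ^ 3 := rpow_natCast _ _
      _ ≤ _ := by gcongr
  have fdiff : DifferentiableOn ℂ (fun w => feFactor N e (1 - s - w)) {w | -2 ≤ w.re ∧ w.re ≤ -ε} := by
    refine (feFactor_differentiableOn e).comp (by fun_prop) fun w hw => ?_
    have := hw.2
    simp only [mem_ofPred_eq] at this ⊢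
    rw [hre]; linarith
  have fcont : ∀ x : ℝ, x < 0 → Continuous fun y : ℝ => feFactor N e (1 - s - (x + y * I)) := by
    intro x hx
    refine continuousOn_univ.1 ((feFactor_differentiableOn e).continuousOn.comp (by fun_prop) fun y _ => ?_)
    simp only [mem_ofPred_eq]
    rw [hre]; simp; linarith
  have p1b : ∀ w : ℂ, -2 ≤ w.re → w.re ≤ -ε → ‖P1 w‖ ≤
      (D * (1 + |t|) ^ 3 * ∑' n, ‖term f1 ((1 - σ : ℝ) : ℂ) n‖) * (1 + |w.im|) ^ 3 := by
    intro w w1 w2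
    rw [hP1, norm_mul, mul_right_comm]
    exact mul_le_mul (fpoly w w1 (by linarith)) (LSeries_line_bound hsum1 (by rw [hre]; linarith)) (norm_nonneg _) (by positivity)
  have line : ∀ (x y : ℝ), 1 - s - (x + y * I) = ((1 - σ - x : ℝ) : ℂ) + ((-1) * (t + y) : ℝ) * I := by
    intro x y; rw [hs]; push_cast; ring
  have p2b : ∀ y : ℝ, ‖P2 ((-2 : ℝ) + y * I)‖ ≤
      (D * (1 + |t|) ^ 3 * ∑' n, ‖term f2 ((1 - σ + 2 : ℝ) : ℂ) n‖) * (1 + |y|) ^ 3 := by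
    intro y
    rw [hP2, norm_mul, mul_right_comm]
    have := fpoly (-2 + y * I) (by simp) (by simp)
    refine mul_le_mul (by simpa using this) (LSeries_line_bound hsum2 (by rw [hre]; simp)) (norm_nonneg _) (by positivity)
  have i1 : Integrable fun y : ℝ => melIntegrand P1 Y ((-2 : ℝ) + y * I) := by
    refine melIntegrand_integrable hY (by norm_num)
      (C := D * (1 + |t|) ^ 3 * ∑' n, ‖term f1 ((1 - σ : ℝ) : ℂ) n‖) (by positivity) ?_ fun y => by
      have := p1b ((-2 : ℝ) + y * I) (by simp) (by simp; linarith)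
      rwa [show ((-2 : ℝ) + y * I : ℂ).im = y by simp] at this
    exact (fcont (-2) (by norm_num)).mul ((LSeries_finite_differentiable shortPart_zero).continuous.comp (by fun_prop))
  have i2 : Integrable fun y : ℝ => melIntegrand P2 Y ((-2 : ℝ) + y * I) := by
    refine melIntegrand_integrable hY (by norm_num) (by positivity) ?_ p2b
    refine (fcont (-2) (by norm_num)).mul ?_
    have := (LSeries_line_continuous hsum2 (-1)).comp (by fun_prop : Continuous fun y : ℝ => t + y)
    refine this.congr fun y => ?_
    simp only [Function.comp]
    rw [line]
    congr 3; ring_nf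
  have eq : ∀ y : ℝ, melIntegrand (fun w => feFactor N e (1 - s - w) * LFunction Ψ (1 - s - w)) Y ((-2 : ℝ) + y * I) =
      melIntegrand P1 Y ((-2 : ℝ) + y * I) + melIntegrand P2 Y ((-2 : ℝ) + y * I) := by
    intro y
    have := LFunction_split Ψ Y (s := 1 - s - ((-2 : ℝ) + y * I)) (by rw [hre]; simp; linarith)
    simp only [melIntegrand, hP1, hP2, this]
    ring
  simp only [eq]
  refine ⟨i1.add i2, ?_⟩
  rw [integral_add i1 i2, melIntegrand_shift (P := P1) hY (by linarith) (Or.inr (by linarith : -ε < 0)) (k := 3) (by positivity)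
    (fdiff.mul (((LSeries_finite_differentiable shortPart_zero).comp (by fun_prop : Differentiable ℂ fun w => 1 - s - w)).differentiableOn)) p1b, add_mul]
  have wbound : ∀ (x y : ℝ), -2 ≤ x → x ≤ 0 → rexp (-y ^ 2) * ‖feFactor N e (1 - s - (x + y * I))‖ ≤
      (D * 27) * (T ^ (1/2 - σ - x) * wt y) := by
    intro x y hx1 hx2
    have b := hf (1 - s - (x + y * I)) (by rw [hre]; simp; linarith) (by rw [hre]; simp; linarith)
    rw [him, hre] at b
    simp only [add_re, ofReal_re, mul_re, I_re, mul_zero, ofReal_im, I_im, mul_one, sub_self, add_zero, add_im, mul_im,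
      zero_add] at b
    have := peetre (v := y) hT ht1 ht2 (e := 1 - σ - x - 1/2) (abs_le.2 ⟨by linarith, by linarith⟩)
    have e2 : (1:ℝ)/2 - σ - x = 1 - σ - x - 1/2 := by ring
    unfold wt
    calc _ ≤ rexp (-y ^ 2) * (D * (27 * T ^ (1 - σ - x - 1/2) * (1 + |y|) ^ 3)) := by
          gcongr
          exact b.trans (by gcongr)
      _ = _ := by ring
  refine (norm_add_le _ _).trans (add_le_add ?_ ?_)
  · refine melIntegrand_norm_le hY (by linarith) hig fun y => ?_
    have a := wbound (-ε) y (by linarith) (by linarith)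
    have c := hh1 (t + y)
    have l := line (-ε) y
    rw [sub_neg_eq_add] at a l
    calc _ = Y ^ (-ε) * (rexp (-y ^ 2) * ‖feFactor N e (1 - s - ((-ε : ℝ) + y * I))‖) * ‖LSeries f1 (1 - s - ((-ε : ℝ) + y * I))‖ := by
          simp only [hP1, norm_mul]; ring
      _ ≤ Y ^ (-ε) * ((D * 27) * (T ^ (1/2 - σ + ε) * wt y)) * comp f1 (1 - σ + ε) (-1) (t + y) := by
          rw [l] at a ⊢
          unfold comp
          gcongr
      _ = (D * 27) * (wt y * (Y ^ (-ε) * T ^ (1/2 - σ + ε) * comp f1 (1 - σ + ε) (-1) (t + y))) := by ring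
      _ ≤ _ := by gcongr; exact wt_nonneg y
  · refine melIntegrand_norm_le hY (by norm_num) hig fun y => ?_
    have a := wbound (-2) y (by linarith) (by linarith)
    have c := hh2 (t + y)
    have l := line (-2) y
    rw [sub_neg_eq_add] at a l
    calc _ = Y ^ (-2:ℝ) * (rexp (-y ^ 2) * ‖feFactor N e (1 - s - ((-2 : ℝ) + y * I))‖) * ‖LSeries f2 (1 - s - ((-2 : ℝ) + y * I))‖ := by
          simp only [hP2, norm_mul]; ring
      _ ≤ Y ^ (-2:ℝ) * ((D * 27) * (T ^ (1/2 - σ + 2) * wt y)) * comp f2 (1 - σ + 2) (-1) (t + y) := by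
          rw [l] at a ⊢
          unfold comp
          gcongr
      _ = (D * 27) * (wt y * (Y ^ (-2:ℝ) * T ^ (1/2 - σ + 2) * comp f2 (1 - σ + 2) (-1) (t + y))) := by ring
      _ ≤ _ := by gcongr; exact wt_nonneg y
end Approx

section Moments
open LSeries
open Complex ZMod
variable {N : ℕ} [NeZero N]

lemma primal_part (Φ : ZMod N → ℂ) {σ ε : ℝ} (h0 : 0 < σ) (hε : 0 < ε) (hε1 : ε ≤ 1) :
    ∃ C : ℝ, 0 < C ∧ ∀ (Y t : ℝ) (h : ℝ → ℝ), 1 ≤ Y →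
      Integrable (fun v => wt v * h (t + v)) →
      (∀ u, Y ^ ε * comp (shortPart (fun n => Φ n) Y) (σ + ε) 1 u ≤ h u) →
      (∀ u, Y ^ (2:ℝ) * comp (longPart (fun n => Φ n) Y) (σ + 2) 1 u ≤ h u) →
      ‖∫ y : ℝ, melIntegrand (fun w => LFunction Φ (σ + t * I + w)) Y ((2 : ℝ) + y * I)‖
        ≤ C * ∫ v, wt v * h (t + v) := by
  refine ⟨Real.exp (ε ^ 2) / |ε| * 1 + Real.exp (2 ^ 2) / |2| * 1, by positivity, ?_⟩
  intro Y t h hY hig hh1 hh2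
  set s := σ + t * I with hs
  have hsre : s.re = σ := by simp [hs]
  set f1 := shortPart (fun n => Φ n) Y
  set f2 := longPart (fun n => Φ n) Y
  set P1 := fun w => LSeries f1 (s + w) with hP1
  set P2 := fun w => LSeries f2 (s + w) with hP2
  have hre : ∀ w : ℂ, (s + w).re = σ + w.re := fun w => by simp [hsre]
  have hsum1 : LSeriesSummable f1 σ := LSeriesSummable_finite shortPart_zero _
  have hsum2 : LSeriesSummable f2 ((σ + 2 : ℝ) : ℂ) := longPart_summable Φ Y (by rw [ofReal_re]; linarith)
  have p1b : ∀ w : ℂ, ε ≤ w.re → w.re ≤ 2 → ‖P1 w‖ ≤ (∑' n, ‖term f1 σ n‖) * (1 + |w.im|) ^ 0 := by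
    intro w w1 w2
    rw [pow_zero, mul_one]
    exact LSeries_line_bound hsum1 (by rw [hre]; linarith)
  have line : ∀ (x y : ℝ), s + (x + y * I) = ((σ + x : ℝ) : ℂ) + (1 * (t + y) : ℝ) * I := by
    intro x y; rw [hs]; push_cast; ring
  have p2b : ∀ y : ℝ, ‖P2 (2 + y * I)‖ ≤ (∑' n, ‖term f2 ((σ + 2 : ℝ) : ℂ) n‖) * (1 + |y|) ^ 0 := by
    intro y
    rw [pow_zero, mul_one]
    exact LSeries_line_bound hsum2 (by rw [hre]; simp)
  have d1 : Differentiable ℂ P1 := (LSeries_finite_differentiable shortPart_zero).comp (by fun_prop)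
  have t1 : 0 ≤ ∑' n, ‖term f1 σ n‖ := tsum_nonneg fun _ => norm_nonneg _
  have t2 : 0 ≤ ∑' n, ‖term f2 ((σ + 2 : ℝ) : ℂ) n‖ := tsum_nonneg fun _ => norm_nonneg _
  have i1 : Integrable fun y : ℝ => melIntegrand P1 Y ((2 : ℝ) + y * I) := by
    refine melIntegrand_integrable hY (by norm_num) (k := 0) t1 (d1.continuous.comp (by fun_prop)) fun y => ?_
    have := p1b ((2 : ℝ) + y * I) (by simp; linarith) (by simp)
    rwa [show ((2 : ℝ) + y * I : ℂ).im = y by simp] at this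
  have i2 : Integrable fun y : ℝ => melIntegrand P2 Y ((2 : ℝ) + y * I) := by
    refine melIntegrand_integrable hY (by norm_num) t2 ?_ p2b
    have := (LSeries_line_continuous hsum2 1).comp (by fun_prop : Continuous fun y : ℝ => t + y)
    refine this.congr fun y => ?_
    simp only [Function.comp, hP2]
    rw [line]
  have eq : ∀ y : ℝ, melIntegrand (fun w => LFunction Φ (s + w)) Y ((2 : ℝ) + y * I) =
      melIntegrand P1 Y ((2 : ℝ) + y * I) + melIntegrand P2 Y ((2 : ℝ) + y * I) := by
    intro y
    have := LFunction_split Φ Y (s := s + ((2 : ℝ) + y * I)) (by rw [hre]; simp; linarith)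
    simp only [melIntegrand, this]
    ring
  simp only [eq]
  rw [integral_add i1 i2, ← melIntegrand_shift hY (by linarith : ε ≤ 2) (Or.inl hε) t1
    d1.differentiableOn p1b, add_mul]
  refine (norm_add_le _ _).trans (add_le_add ?_ ?_)
  · refine melIntegrand_norm_le hY (by linarith) hig fun y => ?_
    have c := hh1 (t + y)
    calc _ ≤ Y ^ ε * (wt y * comp f1 (σ + ε) 1 (t + y)) := by
          simp only [hP1]
          rw [line]
          unfold comp
          gcongr
          exact exp_le_wt y
      _ = 1 * (wt y * (Y ^ ε * comp f1 (σ + ε) 1 (t + y))) := by ring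
      _ ≤ _ := by gcongr; exact wt_nonneg y
  · refine melIntegrand_norm_le hY (by norm_num) hig fun y => ?_
    have c := hh2 (t + y)
    calc _ ≤ Y ^ (2:ℝ) * (wt y * comp f2 (σ + 2) 1 (t + y)) := by
          simp only [hP2]
          rw [line]
          unfold comp
          gcongr
          exact exp_le_wt y
      _ = 1 * (wt y * (Y ^ (2:ℝ) * comp f2 (σ + 2) 1 (t + y))) := by ring
      _ ≤ _ := by gcongr; exact wt_nonneg y

/-- Approximate functional equation as an averaged upper bound. -/
lemma approx_bound {Φ : ZMod N → ℂ} (hΦ : Balanced Φ) {σ ε : ℝ} (h0 : 0 < σ) (h1 : σ < 1) (hε : 0 < ε) (hε1 : ε ≤ 1) :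
    ∃ C : ℝ, 0 < C ∧ ∀ (T Y t : ℝ), 2 ≤ T → 1 ≤ Y → T ≤ |t| → |t| ≤ 2 * T →
      ‖LFunction Φ (σ + t * I)‖ ≤ C * ∫ v, wt v * majorant Φ σ ε T Y (t + v) := by
  obtain ⟨C1, hC1, A1⟩ := primal_part Φ h0 hε hε1
  obtain ⟨C2, hC2, A2⟩ := dual_part (𝓕 Φ) h0 h1 hε hε1 (e := 1) (by simp)
  obtain ⟨C3, hC3, A3⟩ := dual_part (𝓕 fun x => Φ (-x)) h0 h1 hε hε1 (e := -1) (by simp)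
  have hk := norm_pos_iff.2 (mul_ne_zero two_ne_zero kern_one_ne_zero)
  refine ⟨(C1 + C2 + C3) / ‖2 * kern 1‖, by positivity, fun T Y t hT hY ht1 ht2 => ?_⟩
  set s := σ + t * I with hs
  set h := majorant Φ σ ε T Y with hh
  set m1 := fun u => Y ^ ε * comp (shortPart (fun n => Φ n) Y) (σ + ε) 1 u
  set m2 := fun u => Y ^ (2:ℝ) * comp (longPart (fun n => Φ n) Y) (σ + 2) 1 u
  set m3 := fun u => Y ^ (-ε) * T ^ (1/2 - σ + ε) * comp (shortPart (fun n => 𝓕 Φ n) Y) (1 - σ + ε) (-1) u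
  set m4 := fun u => Y ^ (-2:ℝ) * T ^ (1/2 - σ + 2) * comp (longPart (fun n => 𝓕 Φ n) Y) (1 - σ + 2) (-1) u
  set m5 := fun u => Y ^ (-ε) * T ^ (1/2 - σ + ε) *
    comp (shortPart (fun n => (𝓕 fun x => Φ (-x)) n) Y) (1 - σ + ε) (-1) u
  set m6 := fun u => Y ^ (-2:ℝ) * T ^ (1/2 - σ + 2) *
    comp (longPart (fun n => (𝓕 fun x => Φ (-x)) n) Y) (1 - σ + 2) (-1) u
  have hsum : ∀ u, h u = m1 u + m2 u + (m3 u + m4 u) + (m5 u + m6 u) := fun u => rfl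
  have n1 : ∀ u, 0 ≤ m1 u := fun u => mul_nonneg (by positivity) (comp_nonneg _ _ _ _)
  have n2 : ∀ u, 0 ≤ m2 u := fun u => mul_nonneg (by positivity) (comp_nonneg _ _ _ _)
  have n3 : ∀ u, 0 ≤ m3 u := fun u => mul_nonneg (by positivity) (comp_nonneg _ _ _ _)
  have n4 : ∀ u, 0 ≤ m4 u := fun u => mul_nonneg (by positivity) (comp_nonneg _ _ _ _)
  have n5 : ∀ u, 0 ≤ m5 u := fun u => mul_nonneg (by positivity) (comp_nonneg _ _ _ _)
  have n6 : ∀ u, 0 ≤ m6 u := fun u => mul_nonneg (by positivity) (comp_nonneg _ _ _ _)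
  obtain ⟨K, hK⟩ := majorant_bounded Φ h0 h1 (by linarith : 0 < T) (by linarith : 0 < Y)
  have hig :=
    wt_mul_integrable (majorant_continuous Φ h0 h1) hK
      (fun u => by rw [← hh, hsum]; linarith [n1 u, n2 u, n3 u, n4 u, n5 u, n6 u]) t
  have B1 := A1 Y t h hY hig (fun u => by rw [hsum]; linarith [n2 u, n3 u, n4 u, n5 u, n6 u])
    (fun u => by rw [hsum]; linarith [n1 u, n3 u, n4 u, n5 u, n6 u])
  obtain ⟨I2, B2⟩ := A2 T Y t h hT hY ht1 ht2 hig (fun u => by rw [hsum]; linarith [n1 u, n2 u, n4 u, n5 u, n6 u])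
    (fun u => by rw [hsum]; linarith [n1 u, n2 u, n3 u, n5 u, n6 u])
  obtain ⟨I3, B3⟩ := A3 T Y t h hT hY ht1 ht2 hig (fun u => by rw [hsum]; linarith [n1 u, n2 u, n3 u, n4 u, n6 u])
    (fun u => by rw [hsum]; linarith [n1 u, n2 u, n3 u, n4 u, n5 u])
  obtain ⟨G, hG, k, hgr⟩ := hΦ.growth (-(σ - 2)) (σ + 2)
  have hgr' : ∀ w : ℂ, -2 ≤ w.re → w.re ≤ 2 → ‖LFunction Φ (s + w)‖ ≤ (G * (1 + |t|) ^ k) * (1 + |w.im|) ^ k := by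
    intro w w1 w2
    have hre : (s + w).re = σ + w.re := by simp [hs]
    have him : (s + w).im = t + w.im := by simp [hs]
    refine (hgr _ (by rw [hre]; linarith) (by rw [hre]; linarith)).trans ?_
    rw [him, mul_assoc, ← mul_pow]
    gcongr
    have := abs_add_le t w.im
    nlinarith [abs_nonneg w.im]
  obtain ⟨D, hD, hbd⟩ := melIntegrand_bound hY (by positivity) hgr'
  have hYne : (Y:ℂ) ≠ 0 := mod_cast (by linarith : Y ≠ 0)
  have cauchy := two_kern_mul (G := fun w => LFunction Φ (s + w) * Y ^ w * cexp (w ^ 2)) (c := 2) (d := 2) (C := D)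
    two_pos two_pos ?_ hbd
  swap
  · refine ((hΦ.differentiable.comp (by fun_prop)).mul ?_).mul (by fun_prop)
    exact fun z => differentiableAt_id.const_cpow (Or.inl hYne)
  simp only [add_zero, cpow_zero, mul_one, ne_eq, OfNat.ofNat_ne_zero, not_false_eq_true, zero_pow, Complex.exp_zero] at cauchy
  have left : (∫ y : ℝ, LFunction Φ (s + ((-2 : ℝ) + y * I)) * Y ^ ((-2 : ℝ) + y * I : ℂ) * cexp (((-2 : ℝ) + y * I) ^ 2)
      / ((-2 : ℝ) + y * I)) = (∫ y : ℝ, melIntegrand (fun w => feFactor N 1 (1 - s - w) * LFunction (𝓕 Φ) (1 - s - w)) Y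
        ((-2 : ℝ) + y * I)) + ∫ y : ℝ, melIntegrand (fun w => feFactor N (-1) (1 - s - w) *
          LFunction (𝓕 fun x => Φ (-x)) (1 - s - w)) Y ((-2 : ℝ) + y * I) := by
    rw [← integral_add I2 I3]
    congr 1
    ext y
    have hr : 0 < (1 - s - ((-2 : ℝ) + y * I)).re := by simp [hs]; linarith
    have := hΦ.one_sub hr
    rw [show 1 - (1 - s - ((-2 : ℝ) + y * I)) = s + ((-2 : ℝ) + y * I) by ring] at this
    rw [this]
    unfold melIntegrand
    ring
  rw [left] at cauchy
  have : ‖2 * kern 1‖ * ‖LFunction Φ s‖ ≤ (C1 + C2 + C3) * ∫ v, wt v * h (t + v) := by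
    rw [← norm_mul, cauchy]
    refine (norm_sub_le _ _).trans ?_
    have := norm_add_le (∫ y : ℝ, melIntegrand (fun w => feFactor N 1 (1 - s - w) * LFunction (𝓕 Φ) (1 - s - w)) Y
        ((-2 : ℝ) + y * I)) (∫ y : ℝ, melIntegrand (fun w => feFactor N (-1) (1 - s - w) *
          LFunction (𝓕 fun x => Φ (-x)) (1 - s - w)) Y ((-2 : ℝ) + y * I))
    simp only [melIntegrand] at B1 B2 B3 this ⊢
    linarith
  rw [div_mul_eq_mul_div, le_div_iff₀ hk, mul_comm]
  exact this
end Moments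

section MomentThm
open Real Finset
open Complex ZMod
variable {N : ℕ} [NeZero N]

lemma comp_integral_sign (f : ℕ → ℂ) (x : ℝ) {e : ℝ} (he : e = 1 ∨ e = -1) m {T M : ℝ}
    (h : ∀ b, ∫ t in b..(b + T), ‖LSeries f (x + t * I)‖ ^ m ≤ M) b :
    ∫ u in b..(b + T), comp f x e u ^ m ≤ M := by
  rcases he with rfl | rfl
  · simpa [comp] using h b
  · have := intervalIntegral.integral_comp_neg (a := b) (b := b + T) (fun t : ℝ => ‖LSeries f (x + t * I)‖ ^ m)
    have e : (∫ u in b..(b + T), comp f x (-1) u ^ m) = ∫ t in (-(b + T))..(-b), ‖LSeries f (x + t * I)‖ ^ m := by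
      rw [← this]; simp [comp]
    rw [e]
    have := h (-(b + T))
    rwa [show -(b + T) + T = -b by ring] at this

lemma scaled_moment {f : ℕ → ℂ} {x e α b T M E₁ E₂ β C : ℝ} {K : ℕ} (hT : 2 ≤ T)
    (h : ∫ u in b..(b + T), comp f x e u ^ (2 * K) ≤ M) (hC : 0 ≤ C)
    (hM : M ≤ C * (T * ((T ^ (1/2 : ℝ)) ^ K) ^ E₁ + ((T ^ (1/2 : ℝ)) ^ K) ^ E₂))
    (h1 : 2 * K * α + K / 2 * E₁ ≤ β) (h2 : 2 * K * α + K / 2 * E₂ ≤ 1 + β) :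
    ∫ u in b..(b + T), (T ^ α * comp f x e u) ^ (2 * K) ≤ (2 * C) * T ^ (1 + β) := by
  have hT0 : 0 < T := by linarith
  have hT1 : 1 ≤ T := by linarith
  simp only [mul_pow]
  rw [intervalIntegral.integral_const_mul]
  have hp : (T ^ α) ^ (2 * K) = T ^ (2 * K * α) := by
    rw [← rpow_natCast, ← rpow_mul hT0.le]; push_cast; ring_nf
  have hy : ∀ E : ℝ, ((T ^ (1/2 : ℝ)) ^ K) ^ E = T ^ (K / 2 * E) := by
    intro E
    rw [← rpow_natCast, ← rpow_mul hT0.le, ← rpow_mul hT0.le]; ring_nf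
  rw [hy, hy] at hM
  rw [hp]
  calc T ^ (2 * K * α) * ∫ u in b..(b + T), comp f x e u ^ (2 * K)
      ≤ T ^ (2 * K * α) * (C * (T * T ^ (K / 2 * E₁) + T ^ (K / 2 * E₂))) := by gcongr; exact h.trans hM
    _ = C * (T ^ (1 + (2 * K * α + K / 2 * E₁)) + T ^ (2 * K * α + K / 2 * E₂)) := by
        rw [rpow_add hT0, rpow_add hT0, rpow_add hT0, rpow_one]; ring
    _ ≤ C * (T ^ (1 + β) + T ^ (1 + β)) := by
        gcongr C * (?_ + ?_)
        · exact rpow_le_rpow_of_exponent_le hT1 (by linarith)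
        · exact rpow_le_rpow_of_exponent_le hT1 (by linarith)
    _ = _ := by ring

lemma short_moment (Ψ : ZMod N → ℂ) {ε : ℝ} (hε : 0 < ε) k {x e α β : ℝ} (he : e = 1 ∨ e = -1)
    (h1 : 2 * (k + 1 : ℕ) * α + (k + 1 : ℕ) / 2 * max 0 (3 * ε + 1 - 2 * x) ≤ β)
    (h2 : 2 * (k + 1 : ℕ) * α + (k + 1 : ℕ) / 2 * max 0 (3 * ε + 2 - 2 * x) ≤ 1 + β) :
    ∃ C : ℝ, 0 < C ∧ ∀ T b : ℝ, 2 ≤ T →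
      ∫ u in b..(b + T), (T ^ α * comp (shortPart (fun n => Ψ n) (T ^ (1/2 : ℝ))) x e u) ^ (2 * (k + 1)) ≤ C * T ^ (1 + β) := by
  obtain ⟨C, hC, h⟩ := moment_short hε k (∑ j, ‖Ψ j‖) (sum_nonneg fun _ _ => norm_nonneg _)
  refine ⟨2 * C, by positivity, fun T b hT => ?_⟩
  have hY : 1 ≤ T ^ (1/2 : ℝ) := one_le_rpow (by linarith) (by norm_num)
  exact scaled_moment hT (comp_integral_sign _ x he _ (fun b => h _ T b x (T ^ (1/2 : ℝ)) hT hY (shortPart_bound (coeff_bound Ψ))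
    shortPart_zero) b) hC.le le_rfl h1 h2

lemma long_moment (Ψ : ZMod N → ℂ) {ε : ℝ} (hε : 0 < ε) k {x e α β : ℝ} (he : e = 1 ∨ e = -1)
    (hx : 3 * ε + 2 - 2 * x ≤ 0)
    (h1 : 2 * (k + 1 : ℕ) * α + (k + 1 : ℕ) / 2 * (3 * ε + 1 - 2 * x) ≤ β)
    (h2 : 2 * (k + 1 : ℕ) * α + (k + 1 : ℕ) / 2 * (3 * ε + 2 - 2 * x) ≤ 1 + β) :
    ∃ C : ℝ, 0 < C ∧ ∀ T b : ℝ, 2 ≤ T →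
      ∫ u in b..(b + T), (T ^ α * comp (longPart (fun n => Ψ n) (T ^ (1/2 : ℝ))) x e u) ^ (2 * (k + 1)) ≤ C * T ^ (1 + β) := by
  obtain ⟨C, hC, h⟩ := moment_tail hε k (∑ j, ‖Ψ j‖) (sum_nonneg fun _ _ => norm_nonneg _)
  refine ⟨2 * C, by positivity, fun T b hT => ?_⟩
  have hY : 1 ≤ T ^ (1/2 : ℝ) := one_le_rpow (by linarith) (by norm_num)
  exact scaled_moment hT (comp_integral_sign _ x he _ (fun b => h _ T b x (T ^ (1/2 : ℝ)) hT hY (longPart_bound (coeff_bound Ψ))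
    longPart_zero hx) b) hC.le le_rfl h1 h2

lemma add_pow_le_two_pow {a b : ℝ} (ha : 0 ≤ a) (hb : 0 ≤ b) m : (a + b) ^ m ≤ 2 ^ m * (a ^ m + b ^ m) := by
  calc (a + b) ^ m ≤ (2 * max a b) ^ m := by gcongr; linarith [le_max_left a b, le_max_right a b]
    _ = 2 ^ m * (max a b) ^ m := mul_pow _ _ _
    _ ≤ _ := by
      gcongr
      rcases max_choice a b with h | h <;> rw [h]
      · linarith [pow_nonneg hb m]
      · linarith [pow_nonneg ha m]

lemma moment_add {F G : ℝ → ℝ} (hF : Continuous F) (hG : Continuous G) (hF0 : ∀ u, 0 ≤ F u) (hG0 : ∀ u, 0 ≤ G u)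
    {m : ℕ} {a T A B : ℝ} (hT : 0 ≤ T) (hA : ∫ u in a..(a + T), F u ^ m ≤ A) (hB : ∫ u in a..(a + T), G u ^ m ≤ B) :
    ∫ u in a..(a + T), (F u + G u) ^ m ≤ 2 ^ m * (A + B) := by
  calc _ ≤ ∫ u in a..(a + T), 2 ^ m * (F u ^ m + G u ^ m) := by
        refine intervalIntegral.integral_mono_on (by linarith) (Continuous.intervalIntegrable (by fun_prop) _ _)
          (Continuous.intervalIntegrable (by fun_prop) _ _) fun u _ => add_pow_le_two_pow (hF0 u) (hG0 u) m
    _ = 2 ^ m * ((∫ u in a..(a + T), F u ^ m) + ∫ u in a..(a + T), G u ^ m) := by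
        rw [intervalIntegral.integral_const_mul, intervalIntegral.integral_add
          (Continuous.intervalIntegrable (by fun_prop) _ _) (Continuous.intervalIntegrable (by fun_prop) _ _)]
    _ ≤ _ := by gcongr

/-- Moments of balanced `L`-functions in the critical strip. -/
theorem Balanced.moment {Φ : ZMod N → ℂ} (hΦ : Balanced Φ) {σ β : ℝ} (k : ℕ) (h0 : 0 < σ) (h1 : σ < 1) (hβ : 0 < β)
    (hb1 : (k + 1) * (1 - 2 * σ) < β) (hb2 : (k + 1) * (1 - σ) < 1 + β) :
    ∃ C : ℝ, 0 < C ∧ ∀ T a : ℝ, 2 ≤ T → (∀ t ∈ Set.Icc a (a + T), T ≤ |t| ∧ |t| ≤ 2 * T) →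
      ∫ t in a..(a + T), ‖LFunction Φ (σ + t * I)‖ ^ (2 * (k + 1)) ≤ C * T ^ (1 + β) := by
  set κ := ((k + 1 : ℕ) : ℝ) with hκ
  have hκ' : κ = k + 1 := by rw [hκ]; push_cast; rfl
  rw [← hκ'] at hb1 hb2
  have hκ1 : 1 ≤ κ := by rw [hκ']; linarith [(Nat.cast_nonneg k : (0:ℝ) ≤ k)]
  obtain ⟨ε, hε, hε1, e1, e2, e3⟩ : ∃ ε : ℝ, 0 < ε ∧ ε ≤ min (1/3) σ ∧ 3 * (ε * κ) ≤ β ∧ 3 * (ε * κ) ≤ β - κ * (1 - 2 * σ) ∧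
      3 * (ε * κ) ≤ 1 + β - κ * (1 - σ) := by
    refine ⟨min (min (1/3) σ) (min β (min (β - κ * (1 - 2 * σ)) (1 + β - κ * (1 - σ))) / (3 * κ)), ?_, min_le_left _ _, ?_⟩
    · refine lt_min (lt_min (by norm_num) h0) (div_pos (lt_min hβ (lt_min (by linarith) (by linarith))) (by positivity))
    · set m := min β (min (β - κ * (1 - 2 * σ)) (1 + β - κ * (1 - σ)))
      have : 3 * (min (min (1/3) σ) (m / (3 * κ)) * κ) ≤ m := by
        calc _ ≤ 3 * (m / (3 * κ) * κ) := by gcongr; exact min_le_right _ _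
          _ = m := by field_simp
      exact ⟨this.trans (min_le_left _ _), this.trans ((min_le_right _ _).trans (min_le_left _ _)),
        this.trans ((min_le_right _ _).trans (min_le_right _ _))⟩
  have hε3 := hε1.trans (min_le_left _ _)
  have hmax : ∀ A B : ℝ, A ≤ B → ∀ y, A + κ / 2 * y ≤ B → A + κ / 2 * max 0 y ≤ B := by
    intro A B hA y hy
    rcases max_choice 0 y with h | h <;> rw [h]
    · simpa using hA
    · exact hy
  obtain ⟨C0, hC0, happ⟩ := approx_bound hΦ h0 h1 hε (by linarith)
  obtain ⟨C1, hC1, M1⟩ := short_moment Φ hε k (x := σ + ε) (α := ε / 2) (β := β) (Or.inl rfl)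
    (by rw [← hκ]; refine hmax _ _ ?_ _ ?_ <;> nlinarith) (by rw [← hκ]; refine hmax _ _ ?_ _ ?_ <;> nlinarith)
  obtain ⟨C2, hC2, M2⟩ := long_moment Φ hε k (x := σ + 2) (α := 1) (β := β) (Or.inl rfl) (by linarith)
    (by rw [← hκ]; nlinarith) (by rw [← hκ]; nlinarith)
  have Md : ∀ Ψ : ZMod N → ℂ, _ := fun Ψ => short_moment Ψ hε k (x := 1 - σ + ε) (e := -1) (α := 1/2 - σ + ε / 2) (β := β) (Or.inr rfl)
    (by rw [← hκ]; refine hmax _ _ ?_ _ ?_ <;> nlinarith) (by rw [← hκ]; refine hmax _ _ ?_ _ ?_ <;> nlinarith)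
  have Ml : ∀ Ψ : ZMod N → ℂ, _ := fun Ψ => long_moment Ψ hε k (x := 1 - σ + 2) (e := -1) (α := 3/2 - σ) (β := β) (Or.inr rfl) (by linarith)
    (by rw [← hκ]; nlinarith) (by rw [← hκ]; nlinarith)
  obtain ⟨C3, hC3, M3⟩ := Md (𝓕 Φ)
  obtain ⟨C4, hC4, M4⟩ := Ml (𝓕 Φ)
  obtain ⟨C5, hC5, M5⟩ := Md (𝓕 fun x => Φ (-x))
  obtain ⟨C6, hC6, M6⟩ := Ml (𝓕 fun x => Φ (-x))
  set m := 2 * (k + 1)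
  set Ctot := 2 ^ m * (2 ^ m * (2 ^ m * (C1 + C2) + 2 ^ m * (C3 + C4)) + 2 ^ m * (C5 + C6)) with hCt
  refine ⟨C0 ^ m * ((∫ v, wt v) ^ m * Ctot), by have := wt_integral_pos; positivity, fun T a hT hta => ?_⟩
  have hT0 : 0 < T := by linarith
  set Y := T ^ (1/2 : ℝ) with hY
  have hY1 : 1 ≤ Y := one_le_rpow (by linarith) (by norm_num)
  have hYp : ∀ e : ℝ, Y ^ e = T ^ (e / 2) := fun e => by rw [hY, ← rpow_mul hT0.le]; ring_nf
  have hmaj : ∀ u, majorant Φ σ ε T Y u =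
      T ^ (ε / 2) * comp (shortPart (fun n => Φ n) Y) (σ + ε) 1 u + T ^ (1:ℝ) * comp (longPart (fun n => Φ n) Y) (σ + 2) 1 u
  + (T ^ (1/2 - σ + ε / 2) * comp (shortPart (fun n => 𝓕 Φ n) Y) (1 - σ + ε) (-1) u
    + T ^ (3/2 - σ) * comp (longPart (fun n => 𝓕 Φ n) Y) (1 - σ + 2) (-1) u)
  + (T ^ (1/2 - σ + ε / 2) * comp (shortPart (fun n => (𝓕 fun x => Φ (-x)) n) Y) (1 - σ + ε) (-1) u
    + T ^ (3/2 - σ) * comp (longPart (fun n => (𝓕 fun x => Φ (-x)) n) Y) (1 - σ + 2) (-1) u) := by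
    intro u
    unfold majorant
    rw [hYp, hYp, hYp, hYp, ← rpow_add hT0, ← rpow_add hT0, div_self two_ne_zero,
      show -ε / 2 + (1/2 - σ + ε) = 1/2 - σ + ε / 2 by ring, show (-2:ℝ) / 2 + (1/2 - σ + 2) = 3/2 - σ by ring]
  have cS : ∀ (Ψ : ZMod N → ℂ) (c x e : ℝ), Continuous fun u => c * comp (shortPart (fun n => Ψ n) Y) x e u :=
    fun Ψ c x e => continuous_const.mul (comp_continuous (LSeriesSummable_finite shortPart_zero _) e)
  have cL : ∀ (Ψ : ZMod N → ℂ) (c x e : ℝ), 1 < x → Continuous fun u => c * comp (longPart (fun n => Ψ n) Y) x e u :=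
    fun Ψ c x e hx => continuous_const.mul (comp_continuous (longPart_summable Ψ Y (by simpa using hx)) e)
  have nn : ∀ (f : ℕ → ℂ) (c x e u : ℝ), 0 ≤ T ^ c * comp f x e u :=
    fun f c x e u => mul_nonneg (by positivity) (comp_nonneg _ _ _ _)
  have hmom : ∀ b, ∫ t in b..(b + T), majorant Φ σ ε T Y t ^ m ≤ Ctot * T ^ (1 + β) := by
    intro b
    simp only [hmaj]
    refine (moment_add (((cS _ _ _ _).add (cL _ _ _ _ (by linarith))).add ((cS _ _ _ _).add (cL _ _ _ _ (by linarith))))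
      ((cS _ _ _ _).add (cL _ _ _ _ (by linarith)))
      (fun u => add_nonneg (add_nonneg (nn _ _ _ _ _) (nn _ _ _ _ _)) (add_nonneg (nn _ _ _ _ _) (nn _ _ _ _ _)))
      (fun u => add_nonneg (nn _ _ _ _ _) (nn _ _ _ _ _)) hT0.le
      (moment_add ((cS _ _ _ _).add (cL _ _ _ _ (by linarith))) ((cS _ _ _ _).add (cL _ _ _ _ (by linarith)))
        (fun u => add_nonneg (nn _ _ _ _ _) (nn _ _ _ _ _)) (fun u => add_nonneg (nn _ _ _ _ _) (nn _ _ _ _ _)) hT0.le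
        (moment_add (cS _ _ _ _) (cL _ _ _ _ (by linarith)) (nn _ _ _ _) (nn _ _ _ _) hT0.le (M1 T b hT) (M2 T b hT))
        (moment_add (cS _ _ _ _) (cL _ _ _ _ (by linarith)) (nn _ _ _ _) (nn _ _ _ _) hT0.le (M3 T b hT) (M4 T b hT)))
      (moment_add (cS _ _ _ _) (cL _ _ _ _ (by linarith)) (nn _ _ _ _) (nn _ _ _ _) hT0.le (M5 T b hT) (M6 T b hT))).trans_eq ?_
    rw [hCt]; ring
  obtain ⟨K, hK⟩ := majorant_bounded Φ h0 h1 hT0 (by linarith : 0 < Y)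
  have hLc : Continuous fun t : ℝ => ‖LFunction Φ (σ + t * I)‖ := (hΦ.differentiable.continuous.comp (by fun_prop)).norm
  have := moment_average wt_nonneg
    (fun u => by rw [hmaj]; exact add_nonneg (add_nonneg (add_nonneg (nn _ _ _ _ _) (nn _ _ _ _ _))
      (add_nonneg (nn _ _ _ _ _) (nn _ _ _ _ _))) (add_nonneg (nn _ _ _ _ _) (nn _ _ _ _ _)))
    (fun t => by positivity) wt_integrable wt_continuous wt_integral_pos (majorant_continuous Φ h0 h1) hK
    (hLc.div_const _) (by omega) hT0.le
    (fun t ht => (div_le_iff₀' hC0).2 (happ T Y t hT hY1 (hta t ht).1 (hta t ht).2)) hmom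
  simp only [div_pow] at this
  rw [intervalIntegral.integral_div, div_le_iff₀ (by positivity)] at this
  refine this.trans_eq ?_
  ring
end MomentThm

section Kernel
open Real Function Set
open Complex

lemma tendsto_mul_exp_neg {b : ℝ} (hb : 0 < b) : Tendsto (fun v : ℝ => v * rexp (-b * v)) atTop (𝓝 0) := by
  have := tendsto_pow_mul_exp_neg_atTop_nhds_zero 1
  have h2 := (this.comp (tendsto_id.const_mul_atTop hb)).const_mul (1 / b)
  simp only [mul_zero] at h2
  refine h2.congr fun v => ?_
  simp
  field_simp

lemma integrableOn_mul_exp_neg {b : ℝ} (hb : 0 < b) :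
    IntegrableOn (fun v : ℝ => v * rexp (-b * v)) (Ioi 0) := by
  have := integrableOn_rpow_mul_exp_neg_mul_rpow (p := 1) (s := 1) (by norm_num) (by norm_num) hb
  simpa using this

lemma laplace_id {z : ℂ} (hz : 0 < z.re) :
    ∫ v in Ioi (0 : ℝ), v * cexp (-z * v) = 1 / z ^ 2 := by
  have hz0 : z ≠ 0 := by rintro rfl; simp at hz
  have hd : ∀ x ∈ Ici (0 : ℝ), HasDerivAt (fun v : ℝ => -(v / z + 1 / z ^ 2) * cexp (-z * v))
      (x * cexp (-z * x)) x := by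
    intro x _
    have h1 : HasDerivAt (fun v : ℝ => (v : ℂ)) 1 x := by simpa using (hasDerivAt_id x).ofReal_comp
    have h2 := ((h1.div_const z).add_const (1 / z ^ 2)).neg.mul ((h1.const_mul (-z)).cexp)
    refine h2.congr_deriv ?_
    simp
    field_simp
    ring
  have hn : ∀ v : ℝ, ‖cexp (-z * v)‖ = rexp (-z.re * v) := by
    intro v; rw [norm_exp]; simp
  have hig : IntegrableOn (fun v : ℝ => v * cexp (-z * v)) (Ioi 0) := by
    refine (integrableOn_mul_exp_neg hz).mono' (by fun_prop) ?_
    filter_upwards [self_mem_ae_restrict measurableSet_Ioi] with v hv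
    rw [norm_mul, hn, norm_real, norm_of_nonneg (le_of_lt hv)]
  have ht : Tendsto (fun v : ℝ => -(v / z + 1 / z ^ 2) * cexp (-z * v)) atTop (𝓝 0) := by
    have h0 : Tendsto (fun v : ℝ => rexp (-z.re * v)) atTop (𝓝 0) := by
      have := tendsto_exp_neg_atTop_nhds_zero.comp (tendsto_id.const_mul_atTop hz)
      exact this.congr fun v => by simp
    have h1 := ((tendsto_mul_exp_neg hz).mul_const (1 / ‖z‖)).add (h0.mul_const (1 / ‖z‖ ^ 2))
    simp at h1
    refine squeeze_zero_norm' ?_ h1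
    filter_upwards [eventually_ge_atTop 0] with v hv
    rw [norm_mul, norm_neg, hn]
    calc ‖v / z + 1 / z ^ 2‖ * rexp (-z.re * v)
        ≤ (v / ‖z‖ + 1 / ‖z‖ ^ 2) * rexp (-z.re * v) := by
          gcongr
          refine (norm_add_le _ _).trans_eq ?_
          rw [norm_div, norm_div, norm_pow, norm_real, norm_of_nonneg hv, norm_one]
      _ = _ := by ring
  rw [integral_Ioi_of_hasDerivAt_of_tendsto' hd hig ht]
  simp

lemma norm_inv_sq_le {B : ℝ} (hB : 0 < B) {x t : ℝ} (hx : B ≤ x) :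
    ‖1 / (x + t * I) ^ 2‖ ≤ (1 + 1 / B ^ 2) / (1 + t ^ 2) := by
  have h1 : ‖x + t * I‖ ^ 2 = x ^ 2 + t ^ 2 := by
    rw [← normSq_eq_norm_sq, normSq_add_mul_I]
  rw [norm_div, norm_pow, h1, norm_one]
  have : B ^ 2 ≤ x ^ 2 := by gcongr
  have hx0 : 0 < x := by linarith
  have hB2 : 0 < B ^ 2 := by positivity
  rw [div_le_div_iff₀ (by positivity) (by positivity)]
  have : 1 ≤ (1 / B ^ 2) * x ^ 2 := by
    rw [one_div, inv_mul_eq_div, le_div_iff₀ hB2]; linarith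
  nlinarith

lemma integrable_inv_sq_line {B : ℝ} (hB : 0 < B) :
    Integrable fun t : ℝ => 1 / (B + t * I) ^ 2 := by
  have h1 : Integrable fun y : ℝ => (1 + 1 / B ^ 2) * (1 + y ^ 2)⁻¹ := integrable_inv_one_add_sq.const_mul _
  refine h1.mono' ?_ (Eventually.of_forall fun t => ?_)
  · refine Continuous.aestronglyMeasurable (Continuous.div continuous_const (by fun_prop) fun t => ?_)
    refine pow_ne_zero _ fun h => ?_
    have := congrArg re h
    simp at this; linarith
  · rw [← div_eq_mul_inv]
    exact norm_inv_sq_le hB le_rfl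

lemma integral_line_inv_sq {B : ℝ} (hB : 0 < B) (v : ℝ) :
    ∫ t : ℝ, cexp ((B + t * I) * v) / (B + t * I) ^ 2 = 2 * π * (max v 0 : ℝ) := by
  set g := fun v => ((rexp (-B * v) * max v 0 : ℝ) : ℂ) with hg
  have hgc : Continuous g := by fun_prop
  have hind : g = (Ioi 0).indicator fun v : ℝ => ((v * rexp (-B * v) : ℝ) : ℂ) := by
    ext v
    by_cases hv : v ∈ Ioi 0
    · rw [indicator_of_mem hv, hg]
      simp only [max_eq_left (mem_Ioi.1 hv).le, mul_comm]
    · rw [indicator_of_notMem hv, hg]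
      simp only [max_eq_right (not_lt.1 (mt mem_Ioi.2 hv)), mul_zero, ofReal_zero]
  have hgi : Integrable g := by
    rw [hind, integrable_indicator_iff measurableSet_Ioi]
    exact (integrableOn_mul_exp_neg hB).ofReal
  have hF : ∀ w : ℝ, FourierTransform.fourier g w = 1 / (B + (2 * π * w : ℝ) * I) ^ 2 := by
    intro w
    rw [fourier_real_eq_integral_exp_smul, ← laplace_id (by simpa using hB), ← integral_indicator measurableSet_Ioi]
    congr 1; ext v
    by_cases hv : v ∈ Ioi 0
    · rw [indicator_of_mem hv, hind, indicator_of_mem hv, smul_eq_mul]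
      push_cast
      rw [mul_left_comm, ← Complex.exp_add]
      congr 2; ring
    · rw [indicator_of_notMem hv, hind, indicator_of_notMem hv, smul_zero]
  have hFi : Integrable (FourierTransform.fourier g) := by
    have := funext hF
    rw [this]
    exact (integrable_inv_sq_line hB).comp_mul_left' (by positivity)
  have key := congrFun (hgc.fourierInv_fourier_eq hgi hFi) v
  rw [fourierInv_eq'] at key
  simp only [hF] at key
  have hsub := Measure.integral_comp_mul_left (fun t : ℝ => cexp (t * v * I) / (B + t * I) ^ 2) (2 * π)
  have e1 : ∫ t : ℝ, cexp ((B + t * I) * v) / (B + t * I) ^ 2 =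
      cexp (B * v) * ∫ t : ℝ, cexp (t * v * I) / (B + t * I) ^ 2 := by
    rw [← integral_const_mul]
    congr 1; ext t
    rw [← mul_div_assoc, ← Complex.exp_add]; congr 2; ring
  have e2 : (∫ x : ℝ, cexp ((2 * π * x : ℝ) * v * I) / (B + (2 * π * x : ℝ) * I) ^ 2) = g v := by
    rw [← key]
    congr 1; ext x
    congr 2
    simp
    ring
  rw [e2] at hsub
  have hpi : (0 : ℝ) < 2 * π := by positivity
  rw [abs_of_pos (inv_pos.2 hpi)] at hsub
  have e3 : (∫ t : ℝ, cexp (t * v * I) / ((B : ℂ) + t * I) ^ 2) = (2 * π : ℝ) * g v := by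
    rw [hsub, real_smul, ← mul_assoc, ← ofReal_mul, mul_inv_cancel₀ hpi.ne', ofReal_one, one_mul]
  rw [e1, e3, hg]
  push_cast
  have : cexp (B * v) * cexp (-B * v) = 1 := by
    rw [← Complex.exp_add]; simp
  linear_combination (2 * π * ((max v 0 : ℝ) : ℂ)) * this

/-- The smoothing kernel on the transform side. -/
def qk (h : ℝ) (K : ℕ) (s : ℂ) : ℂ := ((cexp (h * s) - 1) / (h * s)) ^ K / s

lemma norm_qk_le {B h b : ℝ} {K : ℕ} {s : ℂ} (hh : 0 < h) (h1 : h ≤ 1) (hs : 0 < s.re) (hsB : s.re ≤ B)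
    (hb : 0 ≤ b) (hbK : b ≤ K) :
    ‖qk h K s‖ ≤ (rexp B + 1) ^ K * (h * ‖s‖) ^ (-b) / ‖s‖ := by
  have hs0 : s ≠ 0 := by rintro rfl; simp at hs
  have hz : 0 < h * ‖s‖ := by positivity
  have hB := hs.trans_le hsB
  have hE := one_le_exp hB.le
  have hnz : ‖h * s‖ = h * ‖s‖ := by rw [norm_mul, norm_real, norm_of_nonneg hh.le]
  rw [qk, norm_div, norm_pow, norm_div, hnz]
  gcongr
  rcases le_total 1 (h * ‖s‖) with hc | hc
  · have : ‖cexp (h * s) - 1‖ ≤ rexp B + 1 := by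
      refine (norm_sub_le _ _).trans ?_
      rw [norm_one, norm_exp]
      gcongr
      simp only [re_ofReal_mul]
      nlinarith
    calc (‖cexp (h * s) - 1‖ / (h * ‖s‖)) ^ K ≤ ((rexp B + 1) / (h * ‖s‖)) ^ K := by gcongr
      _ = (rexp B + 1) ^ K * (h * ‖s‖) ^ (-(K : ℝ)) := by
          rw [div_pow, rpow_neg hz.le, rpow_natCast, div_eq_mul_inv]
      _ ≤ _ := by
          gcongr
  · have : ‖cexp (h * s) - 1‖ ≤ (rexp B + 1) * (h * ‖s‖) := by
      have := norm_exp_sub_one_le (by rw [hnz]; exact hc)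
      nlinarith
    calc (‖cexp (h * s) - 1‖ / (h * ‖s‖)) ^ K ≤ (((rexp B + 1) * (h * ‖s‖)) / (h * ‖s‖)) ^ K := by gcongr
      _ = (rexp B + 1) ^ K * 1 := by rw [mul_div_cancel_right₀ _ hz.ne', mul_one]
      _ ≤ _ := by
          gcongr
          exact one_le_rpow_of_pos_of_le_one_of_nonpos hz hc (by linarith)

lemma line_ne_zero {B : ℝ} (hB : 0 < B) (t : ℝ) : B + t * I ≠ 0 := by
  intro h
  have := congrArg re h
  simp at this; linarith

lemma continuous_qk_line {B h : ℝ} (hB : 0 < B) (hh : 0 < h) K :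
    Continuous fun t : ℝ => qk h K (B + t * I) := by
  unfold qk
  refine Continuous.div (Continuous.pow (Continuous.div (by fun_prop) (by fun_prop) fun t => ?_) _) (by fun_prop)
    (line_ne_zero hB)
  exact mul_ne_zero (mod_cast hh.ne') (line_ne_zero hB t)

lemma norm_qk_line_le {B h : ℝ} (hB : 0 < B) (hh : 0 < h) (h1 : h ≤ 1) {K : ℕ} (hK : 1 ≤ K) :
    ∃ C : ℝ, ∀ t : ℝ, ‖qk h K (B + t * I)‖ ≤ C * (1 + t ^ 2)⁻¹ := by
  refine ⟨(rexp B + 1) ^ K / h * (1 + 1 / B ^ 2), fun t => ?_⟩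
  have := norm_qk_le (s := B + t * I) (B := B) (b := 1) hh h1 (by simpa using hB) (by simp) (by norm_num)
    (mod_cast hK)
  refine this.trans ?_
  have h2 := norm_inv_sq_le (t := t) hB le_rfl
  rw [norm_div, norm_pow, norm_one] at h2
  rw [rpow_neg_one]
  calc (rexp B + 1) ^ K * (h * ‖B + t * I‖)⁻¹ / ‖B + t * I‖
      = (rexp B + 1) ^ K / h * (1 / ‖B + t * I‖ ^ 2) := by field_simp
    _ ≤ (rexp B + 1) ^ K / h * ((1 + 1 / B ^ 2) / (1 + t ^ 2)) := by gcongr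
    _ = _ := by ring

lemma norm_cexp_line (B t v : ℝ) : ‖cexp ((B + t * I) * v)‖ = rexp (B * v) := by
  rw [norm_exp]; simp

lemma integrable_qk {B h : ℝ} (hB : 0 < B) (hh : 0 < h) (h1 : h ≤ 1) {K : ℕ} (hK : 1 ≤ K) (v : ℝ) :
    Integrable fun t : ℝ => cexp ((B + t * I) * v) * qk h K (B + t * I) := by
  obtain ⟨C, hC⟩ := norm_qk_line_le hB hh h1 hK
  refine ((integrable_inv_one_add_sq.const_mul C).const_mul (rexp (B * v))).mono' ?_
    (Eventually.of_forall fun t => ?_)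
  · exact (Continuous.mul (by fun_prop) (continuous_qk_line hB hh K)).aestronglyMeasurable
  · rw [norm_mul, norm_cexp_line]
    gcongr
    exact hC t

lemma qk_succ {h : ℝ} (hh : 0 < h) K {s : ℂ} (hs : s ≠ 0) :
    qk h (K + 1) s = (1 / h) * ((∫ τ in 0..h, cexp (s * τ)) * qk h K s) := by
  rw [integral_exp_mul_complex hs]
  unfold qk
  rw [pow_succ, ofReal_zero, mul_zero, Complex.exp_zero, mul_comm s h]
  field_simp

theorem exists_smoothing {B h : ℝ} (hB : 0 < B) (hh : 0 < h) (h1 : h ≤ 1) K :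
    ∃ w : ℝ → ℝ, Continuous w ∧ (∀ v, 0 ≤ w v) ∧ (∀ v, w v ≤ 1) ∧ (∀ v, 0 ≤ v → w v = 1) ∧
      (∀ v, v ≤ -((K + 1 : ℕ) * h) → w v = 0) ∧
      ∀ v : ℝ, ∫ t : ℝ, cexp ((B + t * I) * v) * qk h (K + 1) (B + t * I) = 2 * π * (w v : ℝ) := by
  induction K with
  | zero =>
    refine ⟨fun v => (max (v + h) 0 - max v 0) / h, by fun_prop, fun v => ?_, fun v => ?_, fun v hv => ?_, fun v hv => ?_,
      fun v => ?_⟩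
    · refine div_nonneg (sub_nonneg.2 (max_le_max (by linarith) le_rfl)) hh.le
    · rw [div_le_one hh]
      have : max (v + h) 0 ≤ max v 0 + h := max_le (by linarith [le_max_left v 0]) (by linarith [le_max_right v 0])
      linarith
    · simp only [max_eq_left hv, max_eq_left (by linarith : 0 ≤ v + h)]
      field_simp; ring
    · simp at hv
      simp [max_eq_right (by linarith : v + h ≤ 0), max_eq_right (by linarith : v ≤ 0)]
    · have hI : ∀ u : ℝ, Integrable fun t : ℝ => cexp ((B + t * I) * u) / (B + t * I) ^ 2 := by
        intro u
        refine ((integrable_inv_sq_line hB).norm.const_mul (rexp (B * u))).mono' ?_ (Eventually.of_forall fun t => ?_)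
        · refine Continuous.aestronglyMeasurable (Continuous.div (by fun_prop) (by fun_prop) fun t => ?_)
          exact pow_ne_zero _ (line_ne_zero hB t)
        · rw [div_eq_mul_one_div, norm_mul, norm_cexp_line]
      have e : (fun t : ℝ => cexp ((B + t * I) * v) * qk h (0 + 1) (B + t * I)) = fun t : ℝ =>
          (1 / h : ℂ) * (cexp ((B + t * I) * (v + h : ℝ)) / (B + t * I) ^ 2 -
            cexp ((B + t * I) * v) / (B + t * I) ^ 2) := by
        ext t
        have h4 : cexp ((B + t * I) * (v + h : ℝ)) = cexp ((B + t * I) * v) * cexp (h * (B + t * I)) := by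
          rw [← Complex.exp_add]; congr 1; push_cast; ring
        rw [h4]
        simp only [qk, zero_add]
        field_simp
      rw [e, integral_const_mul, integral_sub (hI _) (hI _), integral_line_inv_sq hB, integral_line_inv_sq hB]
      push_cast
      field_simp
  | succ K ih =>
    obtain ⟨w, hc, w0, w1, wp, wm, hw⟩ := ih
    have hci : ∀ v a b : ℝ, IntervalIntegrable (fun τ => w (v + τ)) volume a b := fun v a b =>
      (Continuous.intervalIntegrable (by fun_prop) _ _)
    refine ⟨fun v => (1 / h) * ∫ τ in 0..h, w (v + τ), ?_, fun v => ?_, fun v => ?_, fun v hv => ?_, fun v hv => ?_,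
      fun v => ?_⟩
    · refine continuous_const.mul ?_
      exact intervalIntegral.continuous_parametric_intervalIntegral_of_continuous' (by fun_prop) _ _
    · exact mul_nonneg (by positivity) (intervalIntegral.integral_nonneg hh.le fun _ _ => w0 _)
    · have : ∫ τ in 0..h, w (v + τ) ≤ ∫ τ in 0..h, 1 :=
        intervalIntegral.integral_mono_on hh.le (hci _ _ _) (by simp) fun _ _ => w1 _
      rw [intervalIntegral.integral_const, sub_zero, smul_eq_mul, mul_one] at this
      simp only [one_div]
      rw [inv_mul_le_iff₀ hh]; linarith
    · have : ∫ τ in 0..h, w (v + τ) = ∫ τ in 0..h, 1 := by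
        refine intervalIntegral.integral_congr fun τ hτ => ?_
        rw [uIcc_of_le hh.le] at hτ
        exact wp _ (by linarith [hτ.1])
      simp only [this]; simp; field_simp
    · have : ∫ τ in 0..h, w (v + τ) = ∫ τ in 0..h, 0 := by
        refine intervalIntegral.integral_congr fun τ hτ => ?_
        rw [uIcc_of_le hh.le] at hτ
        refine wm _ ?_
        push_cast at hv ⊢
        linarith [hτ.2]
      simp only [this]; simp
    · obtain ⟨C, hC⟩ := norm_qk_line_le hB hh h1 (K := K + 1) (by omega)
      have hsw := integral_integral_swap (μ := volume.restrict (Ioc 0 h)) (ν := (volume : Measure ℝ))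
        (f := fun τ t : ℝ => cexp ((B + t * I) * (v + τ : ℝ)) * qk h (K + 1) (B + t * I)) ?_
      · rw [integral_congr_ae (Eventually.of_forall fun τ => hw (v + τ))] at hsw
        have e : (fun t : ℝ => cexp ((B + t * I) * v) * qk h (K + 1 + 1) (B + t * I)) = fun t : ℝ =>
            (1 / h : ℂ) * ∫ τ in Ioc 0 h, cexp ((B + t * I) * (v + τ : ℝ)) * qk h (K + 1) (B + t * I) := by
          ext t
          rw [qk_succ hh _ (line_ne_zero hB t), integral_mul_const]
          have : ∀ τ : ℝ, cexp ((B + t * I) * (v + τ : ℝ)) = cexp ((B + t * I) * v) * cexp ((B + t * I) * τ) := by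
            intro τ
            rw [← Complex.exp_add]; congr 1; push_cast; ring
          simp only [this]
          rw [integral_const_mul, intervalIntegral.integral_of_le hh.le]
          ring
        rw [e, integral_const_mul, ← hsw, integral_const_mul, integral_complex_ofReal, ← intervalIntegral.integral_of_le hh.le]
        push_cast; ring
      · have hd : Integrable (uncurry fun (τ t : ℝ) => rexp (|B| * (|v| + h)) * (C * (1 + t ^ 2)⁻¹))
            ((volume.restrict (Ioc 0 h)).prod volume) :=
          (integrable_const (rexp (|B| * (|v| + h)))).mul_prod (integrable_inv_one_add_sq.const_mul C)
        refine hd.mono' ?_ ?_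
        · refine Continuous.aestronglyMeasurable ?_
          exact Continuous.mul (by fun_prop) ((continuous_qk_line hB hh _).comp continuous_snd)
        · have hm : MeasurableSet {z : ℝ × ℝ | z.1 ∈ Ioc 0 h} := measurable_fst measurableSet_Ioc
          have : ((volume.restrict (Ioc 0 h)).prod (volume : Measure ℝ)) =
              (volume.prod volume).restrict (Ioc 0 h ×ˢ univ) := by
            rw [← Measure.prod_restrict, Measure.restrict_univ]
          rw [this]
          filter_upwards [self_mem_ae_restrict (measurableSet_Ioc.prod MeasurableSet.univ)] with z hz
          obtain ⟨τ, t⟩ := z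
          have h5 := hz.1
          simp only [uncurry]
          rw [norm_mul, norm_cexp_line]
          have := hC t
          have : B * (v + τ) ≤ |B| * (|v| + h) := by
            rw [abs_of_pos hB]
            have := le_abs_self v
            gcongr
            exact h5.2
          gcongr
end Kernel

section Tauber
open Real Finset LSeries Set
open Complex

lemma cexp_log_mul {x : ℝ} (hx : 0 < x) s : cexp (s * (Real.log x : ℝ)) = x ^ s := by
  rw [cpow_def_of_ne_zero (mod_cast hx.ne'), ofReal_log hx.le, mul_comm]

lemma smooth_sum {a : ℕ → ℝ} {B h κ x : ℝ} {K M : ℕ} {w : ℝ → ℝ} (hB : 0 < B) (hh : 0 < h) (h1 : h ≤ 1)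
    (hK : 1 ≤ K) (hx : 0 < x) (hs : LSeriesSummable (fun n => (a n : ℂ)) B)
    (hw0 : ∀ v, v ≤ -κ → w v = 0) (hM : ∀ n : ℕ, M < n → x * rexp κ ≤ n)
    (hw : ∀ v : ℝ, ∫ t : ℝ, cexp ((B + t * I) * v) * qk h K (B + t * I) = 2 * π * (w v : ℝ)) :
    ∫ t : ℝ, LSeries (fun n => (a n : ℂ)) (B + t * I) * x ^ (B + t * I) * qk h K (B + t * I) =
      2 * π * ((∑ n ∈ Finset.Icc 1 M, a n * w (Real.log (x / n)) : ℝ) : ℂ) := by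
  set g : ℕ → ℝ → ℂ := fun n t =>
    term (fun n => (a n : ℂ)) (B + t * I) n * x ^ (B + t * I) * qk h K (B + t * I) with hg
  have hg0 : ∀ t, g 0 t = 0 := by intro t; simp [hg]
  have hgn : ∀ n : ℕ, n ≠ 0 → ∀ t, g n t =
      a n * (cexp ((B + t * I) * (Real.log (x / n) : ℝ)) * qk h K (B + t * I)) := by
    intro n hn t
    have hn' : (0 : ℝ) < n := by positivity
    simp only [hg]
    rw [term_of_ne_zero hn, log_div hx.ne' hn'.ne', ofReal_sub, mul_sub, Complex.exp_sub,
      cexp_log_mul hx, cexp_log_mul hn']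
    simp
    field_simp
  have hgi : ∀ n, Integrable (g n) := by
    intro n
    rcases eq_or_ne n 0 with rfl | hn
    · rw [show g 0 = fun _ => 0 from funext hg0]; exact integrable_zero _ _ _
    · rw [show g n = _ from funext (hgn n hn)]
      exact (integrable_qk hB hh h1 hK _).const_mul _
  have hnorm : ∀ n, ∫ t, ‖g n t‖ = ‖term (fun n => (a n : ℂ)) B n‖ *
      (x ^ B * ∫ t : ℝ, ‖qk h K (B + t * I)‖) := by
    intro n
    rw [← integral_const_mul, ← integral_const_mul]
    congr 1; ext t
    rw [norm_mul, norm_mul, mul_assoc, norm_cpow_eq_rpow_re_of_pos hx, norm_term_eq, norm_term_eq]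
    simp
  have hsum : Summable fun n => ∫ t, ‖g n t‖ := by
    simp only [hnorm]
    exact hs.norm.mul_right _
  have key := hasSum_integral_of_summable_integral_norm hgi hsum
  have e : ∀ t : ℝ, ∑' n, g n t =
      LSeries (fun n => (a n : ℂ)) (B + t * I) * x ^ (B + t * I) * qk h K (B + t * I) := by
    intro t
    rw [tsum_mul_right, tsum_mul_right]; rfl
  simp only [e] at key
  rw [← key.tsum_eq, tsum_eq_sum]
  · push_cast
    rw [mul_sum]
    refine sum_congr rfl fun n hn => ?_
    have hn0 : n ≠ 0 := by have := (Finset.mem_Icc.1 hn).1; omega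
    simp only [hgn n hn0]
    rw [integral_const_mul, hw]; ring
  · intro n hn
    rcases eq_or_ne n 0 with rfl | hn0
    · simp [hg0]
    · have hMn : M < n := by
        by_contra hc
        exact hn (Finset.mem_Icc.2 ⟨by omega, by omega⟩)
      simp only [hgn n hn0]
      have hn' : (0 : ℝ) < n := by positivity
      rw [integral_const_mul, hw, hw0, ofReal_zero, mul_zero, mul_zero]
      have h3 := log_le_log (by positivity) (hM n hMn)
      rw [Real.log_mul hx.ne' (exp_pos _).ne', Real.log_exp] at h3
      rw [log_div hx.ne' hn'.ne']; linarith

lemma inv_sub_eq_integral {p : ℝ} {s : ℂ} (h : p < s.re) :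
    ∫ u in Set.Ioi (1 : ℝ), (u : ℂ) ^ (p - 1 - s) = 1 / (s - p) := by
  rw [integral_Ioi_cpow_of_lt (by simp; linarith) one_pos, ofReal_one, one_cpow, neg_div, ← div_neg]
  congr 1; ring

lemma smooth_main {B h x p : ℝ} {K : ℕ} {w : ℝ → ℝ} (hB : 0 < B) (hh : 0 < h) (h1 : h ≤ 1)
    (hK : 1 ≤ K) (hx : 0 < x) (hp : p < B)
    (hw : ∀ v : ℝ, ∫ t : ℝ, cexp ((B + t * I) * v) * qk h K (B + t * I) = 2 * π * (w v : ℝ)) :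
    ∫ t : ℝ, 1 / (B + t * I - p) * x ^ (B + t * I) * qk h K (B + t * I) =
      2 * π * ((∫ u in Set.Ioi 1, u ^ (p - 1) * w (Real.log (x / u)) : ℝ) : ℂ) := by
  obtain ⟨C, hC⟩ := norm_qk_line_le hB hh h1 hK
  have key : ∀ u : ℝ, u ∈ Set.Ioi 1 → ∀ t : ℝ,
      ((u ^ (p - 1) : ℝ) : ℂ) * (cexp ((B + t * I) * (Real.log (x / u) : ℝ)) * qk h K (B + t * I)) =
      u ^ (p - 1 - (B + t * I)) * (x ^ (B + t * I) * qk h K (B + t * I)) := by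
    intro u hu t
    have hu0 : 0 < u := by have := Set.mem_Ioi.1 hu; linarith
    have hu1 : (u : ℂ) ≠ 0 := mod_cast hu0.ne'
    rw [log_div hx.ne' hu0.ne', ofReal_sub, mul_sub, Complex.exp_sub,
      cexp_log_mul hx, cexp_log_mul hu0, cpow_sub _ _ hu1, ofReal_cpow hu0.le]
    push_cast
    ring
  have hsw := integral_integral_swap (μ := volume.restrict (Set.Ioi 1)) (ν := (volume : Measure ℝ))
    (f := fun u t : ℝ => ((u ^ (p - 1) : ℝ) : ℂ) *
      (cexp ((B + t * I) * (Real.log (x / u) : ℝ)) * qk h K (B + t * I))) ?_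
  · have e1 : ∀ u : ℝ, ∫ t : ℝ, ((u ^ (p - 1) : ℝ) : ℂ) *
      (cexp ((B + t * I) * (Real.log (x / u) : ℝ)) * qk h K (B + t * I)) =
        2 * π * ((u ^ (p - 1) * w (Real.log (x / u)) : ℝ) : ℂ) := by
      intro u
      rw [integral_const_mul, hw]; push_cast; ring
    simp only [e1] at hsw
    rw [integral_const_mul, integral_complex_ofReal] at hsw
    rw [hsw]
    congr 1; ext t
    rw [setIntegral_congr_fun measurableSet_Ioi (fun u hu => key u hu t), integral_mul_const,
      inv_sub_eq_integral (by simpa using hp)]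
    ring
  · have hi : IntegrableOn (fun u : ℝ => x ^ B * u ^ (p - 1 - B)) (Set.Ioi 1) :=
      (integrableOn_Ioi_rpow_of_lt (by linarith) one_pos).const_mul _
    have hd :=
      hi.mul_prod (integrable_inv_one_add_sq.const_mul C)
    refine hd.mono' ?_ ?_
    · refine AEStronglyMeasurable.mul ?_ (AEStronglyMeasurable.mul ?_ ?_)
      · exact (Measurable.aestronglyMeasurable (by fun_prop))
      · exact (Measurable.aestronglyMeasurable (by fun_prop))
      · exact ((continuous_qk_line hB hh _).comp continuous_snd).aestronglyMeasurable
    · have : ((volume.restrict (Set.Ioi 1)).prod (volume : Measure ℝ)) =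
          (volume.prod volume).restrict (Set.Ioi (1 : ℝ) ×ˢ Set.univ) := by
        rw [← Measure.prod_restrict, Measure.restrict_univ]
      rw [this]
      filter_upwards [self_mem_ae_restrict (measurableSet_Ioi.prod MeasurableSet.univ)] with z hz
      obtain ⟨u, t⟩ := z
      have hu := hz.1
      have hu0 : 0 < u := by have := Set.mem_Ioi.1 hu; linarith
      simp only [Function.uncurry]
      rw [key u hu t, norm_mul, norm_mul, norm_cpow_eq_rpow_re_of_pos hu0, norm_cpow_eq_rpow_re_of_pos hx]
      have := hC t
      simp
      calc u ^ (p - 1 - B) * (x ^ B * ‖qk h K (B + t * I)‖)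
          ≤ u ^ (p - 1 - B) * (x ^ B * (C * (1 + t ^ 2)⁻¹)) := by gcongr
        _ = _ := by ring

lemma integral_rpow_indicator {p y : ℝ} (hp : 0 < p) (hy : 1 ≤ y) :
    IntegrableOn (fun u : ℝ => (Set.Ioc 1 y).indicator (fun u => u ^ (p - 1)) u) (Set.Ioi 1) ∧
    ∫ u in Set.Ioi 1, (Set.Ioc 1 y).indicator (fun u => u ^ (p - 1)) u = (y ^ p - 1) / p := by
  have hi : IntegrableOn (fun u : ℝ => u ^ (p - 1)) (Set.Ioc 1 y) :=
    (intervalIntegrable_iff_integrableOn_Ioc_of_le hy).1 (intervalIntegral.intervalIntegrable_rpow' (by linarith))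
  constructor
  · exact ((integrable_indicator_iff measurableSet_Ioc).2 hi).integrableOn
  · rw [setIntegral_indicator measurableSet_Ioc, Set.inter_eq_right.2 Set.Ioc_subset_Ioi_self,
      ← intervalIntegral.integral_of_le hy, integral_rpow (Or.inl (by linarith))]
    simp

lemma smooth_main_bounds {κ x p : ℝ} {w : ℝ → ℝ} (hwc : Continuous w) (hx : 1 ≤ x) (hp : 0 < p) (hκ : 0 ≤ κ)
    (h0 : ∀ v, 0 ≤ w v) (h1 : ∀ v, w v ≤ 1) (hw1 : ∀ v, 0 ≤ v → w v = 1)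
    (hw0 : ∀ v, v ≤ -κ → w v = 0) :
    (x ^ p - 1) / p ≤ ∫ u in Set.Ioi 1, u ^ (p - 1) * w (Real.log (x / u)) ∧
    ∫ u in Set.Ioi 1, u ^ (p - 1) * w (Real.log (x / u)) ≤ ((x * rexp κ) ^ p - 1) / p := by
  have hx0 : 0 < x := by linarith
  have hxk := le_mul_of_one_le_right hx0.le (one_le_exp hκ)
  obtain ⟨i1, e1⟩ := integral_rpow_indicator hp hx
  obtain ⟨i2, e2⟩ := integral_rpow_indicator hp (hx.trans hxk)
  have hub : ∀ u ∈ Set.Ioi 1, u ^ (p - 1) * w (Real.log (x / u)) ≤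
      (Set.Ioc 1 (x * rexp κ)).indicator (fun u => u ^ (p - 1)) u := by
    intro u hu
    have hu1 : 1 < u := hu
    have hu0 : 0 < u := by linarith
    by_cases hc : u ≤ x * rexp κ
    · rw [indicator_of_mem (show u ∈ Set.Ioc 1 (x * rexp κ) from ⟨hu1, hc⟩)]
      exact mul_le_of_le_one_right (by positivity) (h1 _)
    · rw [indicator_of_notMem (fun h => hc h.2), hw0, mul_zero]
      rw [log_div hx0.ne' hu0.ne']
      have := log_le_log (by positivity) (not_le.1 hc).le
      rw [Real.log_mul hx0.ne' (exp_pos _).ne', Real.log_exp] at this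
      linarith
  have hlb : ∀ u ∈ Set.Ioi 1, (Set.Ioc 1 x).indicator (fun u => u ^ (p - 1)) u ≤
      u ^ (p - 1) * w (Real.log (x / u)) := by
    intro u hu
    have hu1 : 1 < u := hu
    have hu0 : 0 < u := by linarith
    by_cases hc : u ≤ x
    · rw [indicator_of_mem (show u ∈ Set.Ioc 1 x from ⟨hu1, hc⟩), hw1, mul_one]
      exact log_nonneg ((one_le_div hu0).2 hc)
    · rw [indicator_of_notMem (fun h => hc h.2)]
      exact mul_nonneg (by positivity) (h0 _)
  have hm : IntegrableOn (fun u : ℝ => u ^ (p - 1) * w (Real.log (x / u))) (Set.Ioi 1) := by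
    refine i2.mono' (Measurable.aestronglyMeasurable (by fun_prop)) ?_
    filter_upwards [self_mem_ae_restrict measurableSet_Ioi] with u hu
    have hu0 : 0 < u := lt_trans one_pos hu
    rw [norm_of_nonneg (mul_nonneg (by positivity) (h0 _))]
    exact hub u hu
  rw [← e1, ← e2]
  exact ⟨setIntegral_mono_on i1 hm measurableSet_Ioi hlb, setIntegral_mono_on hm i2 measurableSet_Ioi hub⟩
end Tauber

section Tauberian
open Set Real Finset Nat
open Complex

/-- Dyadic mean value bounds `∫ G ≪ T ^ (1 + β)` over intervals of length `T` at height `T`. -/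
def DyadicBound (G : ℝ → ℝ) (β : ℝ) : Prop :=
  ∃ C : ℝ, ∀ T a : ℝ, 2 ≤ T → (∀ t ∈ Set.Icc a (a + T), T ≤ |t| ∧ |t| ≤ 2 * T) →
    ∫ t in a..(a + T), G t ≤ C * T ^ (1 + β)

lemma integrableOn_of_dyadic {G : ℝ → ℝ} (hc : Continuous G) (h0 : ∀ t, 0 ≤ G t) {β β' C : ℝ} (hβ : β < β')
    (hb0 : 0 ≤ β)
    (hT : ∀ T, 2 ≤ T → ∫ t in T..(T + T), G t ≤ C * T ^ (1 + β)) :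
    IntegrableOn (fun t => G t * t ^ (-1 - β')) (Set.Ioi 2) := by
  have hcont : ContinuousOn (fun t : ℝ => G t * t ^ (-1 - β')) (Set.Ici 2) := by
    refine hc.continuousOn.mul (ContinuousOn.rpow_const continuousOn_id fun t ht => Or.inl ?_)
    have : 2 ≤ t := ht
    exact (by linarith : 0 < t).ne'
  have hii : ∀ a b : ℝ, 2 ≤ a → a ≤ b → IntervalIntegrable (fun t => G t * t ^ (-1 - β')) volume a b := by
    intro a b ha hab
    refine ContinuousOn.intervalIntegrable (hcont.mono ?_)
    rw [Set.uIcc_of_le hab]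
    intro t ht; exact ha.trans ht.1
  set r : ℝ := 2 ^ (β - β') with hr
  have hr0 : 0 ≤ r := by positivity
  have hr1 : r < 1 := rpow_lt_one_of_one_lt_of_neg (by norm_num) (by linarith)
  set b : ℕ → ℝ := fun i => 2 ^ (i + 1) with hb
  have hb2 : ∀ i, 2 ≤ b i := by
    intro i
    simp only [hb, pow_succ]
    have : (1 : ℝ) ≤ 2 ^ i := one_le_pow₀ (by norm_num)
    linarith
  have hbs : ∀ i, b (i + 1) = b i + b i := by intro i; simp only [hb]; ring
  have hC0 : 0 ≤ C := by
    have := (intervalIntegral.integral_nonneg (by norm_num : (2 : ℝ) ≤ 2 + 2) fun t _ => h0 t).trans (hT 2 le_rfl)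
    exact nonneg_of_mul_nonneg_left this (by positivity)
  have piece : ∀ i, ∫ t in (b i)..(b (i + 1)), G t * t ^ (-1 - β') ≤ C * r ^ (i + 1) := by
    intro i
    have hbi : 0 < b i := by linarith [hb2 i]
    have hle : b i ≤ b (i + 1) := by rw [hbs]; linarith
    calc ∫ t in (b i)..(b (i + 1)), G t * t ^ (-1 - β')
        ≤ ∫ t in (b i)..(b (i + 1)), G t * (b i) ^ (-1 - β') := by
          refine intervalIntegral.integral_mono_on hle (hii _ _ (hb2 i) hle)
            ((hc.mul continuous_const).intervalIntegrable _ _) fun t ht => ?_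
          refine mul_le_mul_of_nonneg_left ?_ (h0 t)
          exact rpow_le_rpow_of_nonpos hbi ht.1 (by linarith)
      _ = (b i) ^ (-1 - β') * ∫ t in (b i)..(b i + b i), G t := by
          rw [intervalIntegral.integral_mul_const, hbs, mul_comm]
      _ ≤ (b i) ^ (-1 - β') * (C * (b i) ^ (1 + β)) := by gcongr; exact hT _ (hb2 i)
      _ = C * (b i) ^ (β - β') := by
          rw [mul_left_comm, ← rpow_add hbi]; congr 2; ring
      _ = C * r ^ (i + 1) := by
          simp only [hb]
          rw [← rpow_natCast, ← rpow_mul (by norm_num), ← rpow_natCast, ← rpow_mul (by norm_num),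
            mul_comm (β - β')]
  refine integrableOn_Ioi_of_intervalIntegral_norm_bounded (l := atTop) (b := b) (C * (1 - r)⁻¹) 2 (fun i => ?_) ?_
    (Eventually.of_forall fun i => ?_)
  · exact (intervalIntegrable_iff_integrableOn_Ioc_of_le (hb2 i)).1 (hii _ _ le_rfl (hb2 i))
  · exact (tendsto_pow_atTop_atTop_of_one_lt (by norm_num : (1 : ℝ) < 2)).comp (tendsto_add_atTop_nat 1)
  · have e : ∫ t in 2..(b i), ‖G t * t ^ (-1 - β')‖ = ∫ t in (b 0)..(b i), G t * t ^ (-1 - β') := by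
      have : b 0 = 2 := by simp [hb]
      rw [this]
      refine intervalIntegral.integral_congr fun t ht => ?_
      rw [Set.uIcc_of_le (hb2 i)] at ht
      have : 0 < t := by linarith [ht.1]
      exact norm_of_nonneg (mul_nonneg (h0 t) (by positivity))
    rw [e, ← intervalIntegral.sum_integral_adjacent_intervals (fun k _ => hii _ _ (hb2 k) (by rw [hbs]; linarith [hb2 k]))]
    calc ∑ k ∈ Finset.range i, ∫ t in (b k)..(b (k + 1)), G t * t ^ (-1 - β')
        ≤ ∑ k ∈ Finset.range i, C * r ^ k := by
          refine sum_le_sum fun k _ => (piece k).trans ?_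
          gcongr C * ?_
          exact pow_le_pow_of_le_one hr0 hr1.le (by omega)
      _ = C * ∑ k ∈ Finset.range i, r ^ k := by rw [mul_sum]
      _ ≤ C * (1 - r)⁻¹ := by
          gcongr
          rw [← tsum_geometric_of_lt_one hr0 hr1]
          exact (summable_geometric_of_lt_one hr0 hr1).sum_le_tsum _ fun _ _ => by positivity

lemma abs_im_le_norm_line (σ t : ℝ) : |t| ≤ ‖σ + t * I‖ := by
  simpa using abs_im_le_norm (σ + t * I)

lemma integrable_of_dyadic {G : ℝ → ℝ} (hc : Continuous G) (h0 : ∀ t, 0 ≤ G t) {β β' σ : ℝ} (hβ : β < β')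
    (hb0 : 0 ≤ β) (hσ : 0 < σ) (hG : DyadicBound G β) :
    Integrable (fun t => G t * ‖σ + t * I‖ ^ (-1 - β')) := by
  obtain ⟨C, hC⟩ := hG
  have hline : Continuous fun t : ℝ => ‖σ + t * I‖ ^ (-1 - β') :=
    Continuous.rpow_const (by fun_prop) fun t => Or.inl (norm_ne_zero_iff.2 (line_ne_zero hσ t))
  have h1 := integrableOn_of_dyadic hc h0 hβ hb0 (fun T hT => hC T T hT fun t ht => by
    rw [abs_of_nonneg (by linarith [ht.1])]; exact ⟨ht.1, by linarith [ht.2]⟩)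
  have h2 := integrableOn_of_dyadic (G := fun t => G (-t)) (by fun_prop) (fun t => h0 _) hβ hb0 (fun T hT => by
    rw [intervalIntegral.integral_comp_neg (fun t => G t)]
    have := hC T (-(T + T)) hT fun t ht => by
      rw [abs_of_nonpos (by linarith [ht.2])]; constructor <;> linarith [ht.1, ht.2]
    rwa [show -(T + T) + T = -T by ring] at this)
  have gen : ∀ H : ℝ → ℝ, Continuous H → (∀ t, 0 ≤ H t) → IntegrableOn (fun t => H t * t ^ (-1 - β')) (Set.Ioi 2) →
      IntegrableOn (fun t => H t * ‖σ + t * I‖ ^ (-1 - β')) (Set.Ioi 0) := by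
    intro H hHc hH0 hH
    rw [← Ioc_union_Ioi_eq_Ioi (by norm_num : (0 : ℝ) ≤ 2)]
    refine IntegrableOn.union ?_ ?_
    · exact ((hHc.mul hline).integrableOn_Icc).mono_set Set.Ioc_subset_Icc_self
    · refine hH.mono' (hHc.mul hline).aestronglyMeasurable ?_
      filter_upwards [self_mem_ae_restrict measurableSet_Ioi] with t ht
      have ht2 : 2 < t := ht
      rw [norm_of_nonneg (mul_nonneg (hH0 t) (by positivity))]
      refine mul_le_mul_of_nonneg_left ?_ (hH0 t)
      refine rpow_le_rpow_of_nonpos (by linarith) ?_ (by linarith)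
      exact (le_abs_self t).trans (abs_im_le_norm_line σ t)
  rw [← integrableOn_univ, ← Iic_union_Ioi]
  refine IntegrableOn.union ?_ (gen G hc h0 h1)
  have h3 := gen _ (by fun_prop) (fun t => h0 _) h2
  rw [integrableOn_Iic_iff_integrableOn_Iio, ← integrable_indicator_iff measurableSet_Iio]
  refine (((integrable_indicator_iff measurableSet_Ioi).2 h3).comp_neg).congr (Eventually.of_forall fun t => ?_)
  beta_reduce
  by_cases ht : t < 0
  · rw [indicator_of_mem (by simpa using ht : -t ∈ Set.Ioi 0), indicator_of_mem (by simpa using ht : t ∈ Set.Iio 0)]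
    simp only [neg_neg, ofReal_neg]
    congr 2
    rw [← norm_conj]
    congr 1
    simp
  · rw [indicator_of_notMem (by simpa using ht : -t ∉ Set.Ioi 0), indicator_of_notMem (by simpa using ht : t ∉ Set.Iio 0)]
lemma exists_norm_ge {σ : ℝ} (hσ : 0 < σ) : ∃ c : ℝ, 0 < c ∧ ∀ z : ℂ, σ ≤ z.re → c * (1 + |z.im|) ≤ ‖z‖ := by
  refine ⟨min σ 1 / 2, by positivity, fun z hz => ?_⟩
  have h1 := hz.trans ((le_abs_self _).trans (abs_re_le_norm z))
  have h2 := abs_im_le_norm z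
  have h3 : min σ 1 ≤ σ := min_le_left _ _
  have h4 : min σ 1 * |z.im| ≤ 1 * |z.im| := by gcongr; exact min_le_right _ _
  linarith

lemma smoothed_bound {F : ℂ → ℂ} {σ B β β' Cg : ℝ} {k K : ℕ} (hσ : 0 < σ) (hσB : σ ≤ B)
    (hF : DifferentiableOn ℂ F {s | σ ≤ s.re})
    (hg : ∀ s : ℂ, σ ≤ s.re → s.re ≤ B → ‖F s‖ ≤ Cg * (1 + |s.im|) ^ k)
    (hβ0 : 0 ≤ β) (hβ : β < β') (hG : DyadicBound (fun t => ‖F (σ + t * I)‖) β)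
    (hkK : k + 1 ≤ K) (hβK : β' ≤ K) :
    ∃ C : ℝ, 0 ≤ C ∧ ∀ h x : ℝ, 0 < h → h ≤ 1 → 0 < x →
      (Integrable fun t : ℝ => F (B + t * I) * x ^ (B + t * I) * qk h K (B + t * I)) ∧
      ‖∫ t : ℝ, F (B + t * I) * x ^ (B + t * I) * qk h K (B + t * I)‖ ≤
        C * (x ^ σ * h ^ (-β')) := by
  have hFc : Continuous fun t : ℝ => F (σ + t * I) :=
    hF.continuousOn.comp_continuous (by fun_prop) fun t => by simp
  have hig := integrable_of_dyadic hFc.norm (fun t => norm_nonneg _) hβ hβ0 hσ hG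
  refine ⟨(rexp B + 1) ^ K * ∫ t : ℝ, ‖F (σ + t * I)‖ * ‖σ + t * I‖ ^ (-1 - β'),
    mul_nonneg (by positivity) (integral_nonneg fun t => by positivity), fun h x hh h1 hx => ?_⟩
  set G := fun z => F z * x ^ z * qk h K z with hGdef
  have hne : ∀ z : ℂ, σ ≤ z.re → z ≠ 0 := by rintro z hz rfl; simp at hz; linarith
  have hGd : DifferentiableOn ℂ G {z | σ ≤ z.re ∧ z.re ≤ B} := by
    refine DifferentiableOn.mul (DifferentiableOn.mul (hF.mono fun z hz => hz.1) ?_) ?_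
    · intro z _
      exact (DifferentiableAt.const_cpow differentiableAt_id (Or.inl (mod_cast hx.ne'))).differentiableWithinAt
    · unfold qk
      intro z hz
      have hz0 := hne z hz.1
      refine DifferentiableAt.differentiableWithinAt (DifferentiableAt.div (DifferentiableAt.pow
        (DifferentiableAt.div (by fun_prop) (by fun_prop) ?_) _) (by fun_prop) hz0)
      exact mul_ne_zero (mod_cast hh.ne') hz0
  obtain ⟨c, hc0, hc⟩ := exists_norm_ge hσ
  have hCg : 0 ≤ Cg := by
    have := (norm_nonneg _).trans (hg σ (by simp) (by simpa using hσB))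
    simpa using this
  have hGb : ∀ z : ℂ, σ ≤ z.re → z.re ≤ B → ‖G z‖ ≤
      (Cg * (max x 1) ^ B * ((rexp B + 1) ^ K * (h * c) ^ (-((k + 1 : ℕ) : ℝ)) / c)) / (1 + z.im ^ 2) := by
    intro z hz1 hz2
    have hz0 := hσ.trans_le hz1
    have hq := norm_qk_le (b := (k + 1 : ℕ)) hh h1 hz0 hz2 (by positivity) (mod_cast hkK)
    set u := 1 + |z.im| with hu
    have hu1 : 1 ≤ u := by simp [hu]
    have hu0 : 0 < u := by linarith
    have hx' : ‖(x : ℂ) ^ z‖ ≤ (max x 1) ^ B := by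
      rw [norm_cpow_eq_rpow_re_of_pos hx]
      calc x ^ z.re ≤ (max x 1) ^ z.re := by gcongr; exact le_max_left _ _
        _ ≤ _ := rpow_le_rpow_of_exponent_le (le_max_right _ _) hz2
    have hq2 : ‖qk h K z‖ ≤ ((rexp B + 1) ^ K * (h * c) ^ (-((k + 1 : ℕ) : ℝ)) / c) / (u ^ k * u ^ 2) := by
      refine hq.trans ?_
      calc (rexp B + 1) ^ K * (h * ‖z‖) ^ (-((k + 1 : ℕ) : ℝ)) / ‖z‖
          ≤ (rexp B + 1) ^ K * (h * (c * u)) ^ (-((k + 1 : ℕ) : ℝ)) / (c * u) := by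
            have h3 : (h * ‖z‖) ^ (-((k + 1 : ℕ) : ℝ)) ≤ (h * (c * u)) ^ (-((k + 1 : ℕ) : ℝ)) :=
              rpow_le_rpow_of_nonpos (by positivity) (by gcongr; exact hc z hz1) (by rw [neg_nonpos]; positivity)
            gcongr
            exact hc z hz1
        _ = _ := by
            rw [← mul_assoc h c u, mul_rpow (by positivity) hu0.le, rpow_neg hu0.le, rpow_natCast]
            field_simp
            ring
    have hu2 : 1 + z.im ^ 2 ≤ u ^ 2 := by
      rw [hu]; nlinarith [sq_abs z.im]
    calc ‖G z‖ = ‖F z‖ * ‖(x : ℂ) ^ z‖ * ‖qk h K z‖ := by simp only [hGdef, norm_mul]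
      _ ≤ (Cg * u ^ k) * (max x 1) ^ B *
          (((rexp B + 1) ^ K * (h * c) ^ (-((k + 1 : ℕ) : ℝ)) / c) / (u ^ k * u ^ 2)) := by
          gcongr
          exact hg z hz1 hz2
      _ = (Cg * (max x 1) ^ B * ((rexp B + 1) ^ K * (h * c) ^ (-((k + 1 : ℕ) : ℝ)) / c)) / u ^ 2 := by
          field_simp
      _ ≤ _ := by gcongr
  refine ⟨integrable_vertical ⟨hσB, le_rfl⟩ hGd.continuousOn hGb, ?_⟩
  have hsh := integral_vertical_eq hσB hGd hGb
  rw [← hsh]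
  refine (norm_integral_le_integral_norm _).trans ?_
  rw [mul_right_comm, ← integral_const_mul]
  refine integral_mono (integrable_vertical ⟨le_rfl, hσB⟩ hGd.continuousOn hGb).norm (hig.const_mul _) fun t => ?_
  have hq := norm_qk_le (s := σ + t * I) hh h1 (by simpa using hσ) (by simpa using hσB) (by linarith) hβK
  have hn := norm_pos_iff.2 (line_ne_zero hσ t)
  simp only [hGdef, norm_mul]
  rw [norm_cpow_eq_rpow_re_of_pos hx]
  simp
  calc ‖F (σ + t * I)‖ * x ^ σ * ‖qk h K (σ + t * I)‖
      ≤ ‖F (σ + t * I)‖ * x ^ σ * ((rexp B + 1) ^ K * (h * ‖σ + t * I‖) ^ (-β') / ‖σ + t * I‖) := by gcongr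
    _ = _ := by
      rw [mul_rpow hh.le hn.le, sub_eq_add_neg, rpow_add hn, rpow_neg_one]
      field_simp

lemma smooth_main_close {κ x y p K : ℝ} {w : ℝ → ℝ} (hwc : Continuous w) (hy : 1 ≤ y) (hp : 0 < p) (hκ : 0 ≤ κ)
    (hκK : κ ≤ K)
    (hxy : y = x ∨ y = x * rexp (-κ))
    (h0 : ∀ v, 0 ≤ w v) (h1 : ∀ v, w v ≤ 1) (hw1 : ∀ v, 0 ≤ v → w v = 1)
    (hw0 : ∀ v, v ≤ -κ → w v = 0) :
    |(∫ u in Set.Ioi 1, u ^ (p - 1) * w (Real.log (y / u))) - (x ^ p - 1) / p| ≤ κ * rexp (K * p) * x ^ p := by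
  have hx0 : 0 < x := by
    rcases hxy with rfl | rfl
    · linarith
    · exact pos_of_mul_pos_left (one_pos.trans_le hy) (exp_pos _).le
  obtain ⟨l, u⟩ := smooth_main_bounds hwc hy hp hκ h0 h1 hw1 hw0
  have hE : 1 ≤ rexp (K * p) := one_le_exp (by nlinarith)
  have hexp := fun z => (exp_mul z p).symm
  rcases hxy with rfl | rfl
  · rw [mul_rpow hx0.le (exp_pos _).le, hexp] at u
    have h2 : rexp (κ * p) - 1 ≤ κ * p * rexp (K * p) := by
      have h3 := add_one_le_exp (-(κ * p))
      have h4 : rexp (κ * p) * rexp (-(κ * p)) = 1 := by rw [← Real.exp_add]; simp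
      have h5 : rexp (κ * p) ≤ rexp (K * p) := by gcongr
      have h6 : 0 ≤ κ * p := by positivity
      nlinarith [exp_pos (κ * p)]
    rw [abs_of_nonneg (by linarith)]
    calc _ ≤ (y ^ p * rexp (κ * p) - 1) / p - (y ^ p - 1) / p := by linarith
      _ = y ^ p * (rexp (κ * p) - 1) / p := by ring
      _ ≤ y ^ p * (κ * p * rexp (K * p)) / p := by gcongr
      _ = _ := by field_simp
  · have e : x * rexp (-κ) * rexp κ = x := by
      rw [mul_assoc, ← Real.exp_add]; simp
    rw [e] at u
    rw [mul_rpow hx0.le (exp_pos _).le, hexp] at l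
    rw [abs_of_nonpos (by linarith)]
    have h3 := add_one_le_exp (-κ * p)
    calc _ ≤ (x ^ p - 1) / p - (x ^ p * rexp (-κ * p) - 1) / p := by linarith
      _ = x ^ p * (1 - rexp (-κ * p)) / p := by ring
      _ ≤ x ^ p * (κ * p * rexp (K * p)) / p := by
        gcongr
        have : κ * p * 1 ≤ κ * p * rexp (K * p) := by gcongr
        linarith
      _ = _ := by field_simp
theorem tauberian {ι : Type} (J : Finset ι) (p : ι → ℝ) (c : ι → ℂ) {a : ℕ → ℝ} {F : ℂ → ℂ} {σ S β β' Cg : ℝ} {k : ℕ}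
    (ha : ∀ n, 0 ≤ a n) (hσ : 0 < σ) (hp : ∀ j ∈ J, σ < p j ∧ p j ≤ S) (hσS : σ ≤ S)
    (hsum : LSeriesSummable (fun n => (a n : ℂ)) ((S + 1 : ℝ) : ℂ))
    (hF : DifferentiableOn ℂ F {s | σ ≤ s.re})
    (hFD : ∀ s : ℂ, s.re = S + 1 → F s = LSeries (fun n => (a n : ℂ)) s - ∑ j ∈ J, c j * (1 / (s - p j)))
    (hg : ∀ s : ℂ, σ ≤ s.re → s.re ≤ S + 1 → ‖F s‖ ≤ Cg * (1 + |s.im|) ^ k)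
    (hβ0 : 0 ≤ β) (hβ : β < β') (hG : DyadicBound (fun t => ‖F (σ + t * I)‖) β) :
    ∃ C x0 : ℝ, 1 ≤ x0 ∧ ∀ h x : ℝ, 0 < h → h ≤ 1 → x0 ≤ x →
      |∑ n ∈ Finset.Icc 1 ⌊x⌋₊, a n - ∑ j ∈ J, (c j).re / p j * x ^ p j| ≤ C * (x ^ σ * h ^ (-β') + x ^ S * h + 1) := by
  set B := S + 1 with hBdef
  have hB : 0 < B := by linarith
  set K₀ := k + ⌈β'⌉₊ with hK₀
  set K := K₀ + 1 with hK
  have hβK : β' ≤ K := by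
    have := le_ceil β'
    simp only [hK, hK₀]; push_cast
    linarith
  obtain ⟨C₁, hC₁0, hC₁⟩ := smoothed_bound hσ (by linarith) hF hg hβ0 hβ hG (by omega) hβK
  set E := ∑ j ∈ J, |(c j).re| * (K * rexp (K * p j)) with hE
  have hE0 : 0 ≤ E := sum_nonneg fun j _ => by positivity
  set D := |∑ j ∈ J, (c j).re / p j|
  refine ⟨C₁ + E + D, rexp K, one_le_exp (by positivity), fun h x hh h1 hx => ?_⟩
  have hx1 := (one_le_exp (by positivity)).trans hx
  have hx0 : 0 < x := by linarith
  obtain ⟨w, hwc, w0, w1, wp, wm, hw⟩ := exists_smoothing hB hh h1 K₀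
  set κ := K * h with hκ
  have hκ0 : 0 ≤ κ := by positivity
  have hκK : κ ≤ K := mul_le_of_le_one_right (by positivity) h1
  set Ij := fun j y => ∫ u in Set.Ioi 1, u ^ (p j - 1) * w (Real.log (y / u)) with hI
  have core : ∀ y M, 0 < y → y ≤ x → (∀ n : ℕ, M < n → y * rexp κ ≤ n) →
      |∑ n ∈ Finset.Icc 1 M, a n * w (Real.log (y / n)) - ∑ j ∈ J, (c j).re * Ij j y| ≤ C₁ * (x ^ σ * h ^ (-β')) := by
    intro y M hy hyx hM
    obtain ⟨i1, b1⟩ := hC₁ h y hh h1 hy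
    have e1 := smooth_sum hB hh h1 (by omega) hy hsum wm hM hw
    have e2 : ∀ j ∈ J, _ := fun j hj => smooth_main hB hh h1 (by omega) hy
      (by have := (hp j hj).2; linarith) hw
    have i2 : ∀ j ∈ J, Integrable fun t : ℝ => 1 / (B + t * I - p j) * y ^ (B + t * I) * qk h K (B + t * I) := by
      intro j hj
      have hjB : 0 < B - p j := by have := (hp j hj).2; linarith
      have hne : ∀ t : ℝ, B + t * I - p j ≠ 0 := by
        intro t
        have := line_ne_zero hjB t
        push_cast at this
        rwa [sub_add_eq_add_sub] at this
      have base := (integrable_qk hB hh h1 (K := K) (by omega) (Real.log y)).bdd_mul (c := 1 / (B - p j))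
        (f := fun t : ℝ => 1 / (B + t * I - p j))
        (Continuous.aestronglyMeasurable (Continuous.div continuous_const (by fun_prop) hne))
        (Eventually.of_forall fun t => ?_)
      · refine base.congr (Eventually.of_forall fun t => ?_)
        simp only [cexp_log_mul hy, mul_assoc]
      · rw [norm_div, norm_one]
        gcongr
        have := abs_re_le_norm (B + t * I - p j)
        simp at this
        exact (le_abs_self _).trans this
    have e3 : ∫ t : ℝ, F (B + t * I) * y ^ (B + t * I) * qk h K (B + t * I) =
        2 * π * (((∑ n ∈ Finset.Icc 1 M, a n * w (Real.log (y / n)) : ℝ) : ℂ) - ∑ j ∈ J, c j * (Ij j y : ℂ)) := by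
      have e4 : (fun t : ℝ => LSeries (fun n => (a n : ℂ)) (B + t * I) * y ^ (B + t * I) * qk h K (B + t * I)) =
          fun t : ℝ => F (B + t * I) * y ^ (B + t * I) * qk h K (B + t * I) + ∑ j ∈ J, c j *
            (1 / (B + t * I - p j) * y ^ (B + t * I) * qk h K (B + t * I)) := by
        ext t
        rw [hFD _ (by simp)]
        simp only [sub_mul, sum_mul]
        ring
      rw [e4, integral_add i1 (integrable_finsetSum _ fun j hj => (i2 j hj).const_mul _),
        integral_finsetSum _ fun j hj => (i2 j hj).const_mul _] at e1
      rw [sum_congr rfl fun j hj => by rw [integral_const_mul, e2 j hj]] at e1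
      rw [eq_sub_of_add_eq e1, mul_sub]
      congr 1
      rw [mul_sum]
      refine sum_congr rfl fun j _ => by simp only [hI]; ring
    have e5 : ∑ n ∈ Finset.Icc 1 M, a n * w (Real.log (y / n)) - ∑ j ∈ J, (c j).re * Ij j y =
        (((∑ n ∈ Finset.Icc 1 M, a n * w (Real.log (y / n)) : ℝ) : ℂ) - ∑ j ∈ J, c j * (Ij j y : ℂ)).re := by
      simp
    rw [e3, norm_mul] at b1
    rw [e5]
    refine (abs_re_le_norm _).trans ?_
    have h2pi : 1 ≤ ‖(2 * π : ℂ)‖ := by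
      rw [norm_mul, norm_real, norm_of_nonneg pi_pos.le]
      have := pi_gt_three
      simp; linarith
    calc _ ≤ ‖(2 * π : ℂ)‖ * _ := le_mul_of_one_le_left (norm_nonneg _) h2pi
      _ ≤ _ := b1
      _ ≤ _ := by gcongr
  have close : ∀ y : ℝ, 1 ≤ y → (y = x ∨ y = x * rexp (-κ)) →
      |∑ j ∈ J, (c j).re * Ij j y - ∑ j ∈ J, (c j).re / p j * x ^ p j| ≤ E * (x ^ S * h) + D := by
    intro y hy hxy
    have e : ∑ j ∈ J, (c j).re * Ij j y - ∑ j ∈ J, (c j).re / p j * x ^ p j =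
        ∑ j ∈ J, (c j).re * (Ij j y - (x ^ p j - 1) / p j) - ∑ j ∈ J, (c j).re / p j := by
      rw [← sum_sub_distrib, ← sum_sub_distrib]
      refine sum_congr rfl fun j _ => by ring
    rw [e]
    refine (abs_sub _ _).trans (add_le_add ?_ le_rfl)
    refine (abs_sum_le_sum_abs _ _).trans ?_
    rw [hE, sum_mul]
    refine sum_le_sum fun j hj => ?_
    have hj0 := hσ.trans (hp j hj).1
    have := smooth_main_close hwc hy hj0 hκ0 hκK hxy w0 w1 wp wm
    rw [abs_mul]
    calc |(c j).re| * |Ij j y - (x ^ p j - 1) / p j| ≤ |(c j).re| * (κ * rexp (K * p j) * x ^ p j) := by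
          gcongr
      _ ≤ |(c j).re| * (κ * rexp (K * p j) * x ^ S) := by
          gcongr
          exact (hp j hj).2
      _ = _ := by rw [hκ]; ring
  have hfin : C₁ * (x ^ σ * h ^ (-β')) + (E * (x ^ S * h) + D) ≤ (C₁ + E + D) * (x ^ σ * h ^ (-β') + x ^ S * h + 1) := by
    have t1 : 0 ≤ x ^ σ * h ^ (-β') := by positivity
    have t2 : 0 ≤ x ^ S * h := by positivity
    have hD0 : 0 ≤ D := abs_nonneg _
    nlinarith [mul_nonneg hD0 t2]
  have hy1 : 1 ≤ x * rexp (-κ) := by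
    rw [Real.exp_neg, ← div_eq_mul_inv, one_le_div (exp_pos _)]
    exact (exp_le_exp.2 hκK).trans hx
  refine le_trans (abs_le.2 ⟨?_, ?_⟩) hfin
  · have c1 := core (x * rexp (-κ)) ⌊x⌋₊ (by positivity)
      (mul_le_of_le_one_right hx0.le (exp_le_one_iff.2 (by linarith))) (fun n hn => by
        rw [mul_assoc, ← Real.exp_add]; simp
        exact ((floor_lt hx0.le).1 hn).le)
    have c2 := close _ hy1 (Or.inr rfl)
    have c3 : ∑ n ∈ Finset.Icc 1 ⌊x⌋₊, a n * w (Real.log (x * rexp (-κ) / n)) ≤ ∑ n ∈ Finset.Icc 1 ⌊x⌋₊, a n :=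
      sum_le_sum fun n _ => mul_le_of_le_one_right (ha n) (w1 _)
    have := (abs_le.1 c1).1
    have := (abs_le.1 c2).1
    linarith
  · have c1 := core x ⌊x * rexp κ⌋₊ hx0 le_rfl (fun n hn => ((floor_lt (by positivity)).1 hn).le)
    have c2 := close x hx1 (Or.inl rfl)
    have c3 : ∑ n ∈ Finset.Icc 1 ⌊x⌋₊, a n ≤ ∑ n ∈ Finset.Icc 1 ⌊x * rexp κ⌋₊, a n * w (Real.log (x / n)) := by
      calc ∑ n ∈ Finset.Icc 1 ⌊x⌋₊, a n = ∑ n ∈ Finset.Icc 1 ⌊x⌋₊, a n * w (Real.log (x / n)) := by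
            refine sum_congr rfl fun n hn => ?_
            obtain ⟨h3, h4⟩ := Finset.mem_Icc.1 hn
            have h5 := (le_floor_iff hx0.le).1 h4
            have h6 : (0 : ℝ) < n := mod_cast h3
            rw [wp _ (log_nonneg ((one_le_div h6).2 h5)), mul_one]
        _ ≤ _ := by
            refine sum_le_sum_of_subset_of_nonneg (Finset.Icc_subset_Icc le_rfl (floor_mono ?_)) fun n _ _ =>
              mul_nonneg (ha n) (w0 _)
            exact le_mul_of_one_le_right hx0.le (one_le_exp hκ0)
    have := (abs_le.1 c1).2
    have := (abs_le.1 c2).2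
    linarith
end Tauberian

section Dyadic
open Real Finset LSeries Function Nat

lemma DyadicBound.scale {G : ℝ → ℝ} {β r : ℝ} (hr : 1 ≤ r) (h : DyadicBound G β) :
    DyadicBound (fun t => G (r * t)) β := by
  obtain ⟨C, hC⟩ := h
  have hr0 : 0 < r := by linarith
  refine ⟨r⁻¹ * (C * r ^ (1 + β)), fun T a hT ha => ?_⟩
  have h1 : ∀ t ∈ Set.Icc (r * a) (r * a + r * T), r * T ≤ |t| ∧ |t| ≤ 2 * (r * T) := by
    intro t ht
    have := ha (t / r) ⟨by rw [le_div_iff₀ hr0]; linarith [ht.1], by rw [div_le_iff₀ hr0]; linarith [ht.2]⟩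
    rw [abs_div, abs_of_pos hr0, le_div_iff₀ hr0, div_le_iff₀ hr0] at this
    constructor <;> linarith [this.2]
  have h2 := hC (r * T) (r * a) (by nlinarith) h1
  rw [intervalIntegral.integral_comp_mul_left G hr0.ne', smul_eq_mul, mul_add, mul_assoc]
  refine mul_le_mul_of_nonneg_left (h2.trans_eq ?_) (by positivity)
  rw [mul_rpow hr0.le (by linarith), mul_assoc]

lemma DyadicBound.mono {G H : ℝ → ℝ} {β : ℝ} (hG : Continuous G) (hH : Continuous H)
    (h : DyadicBound H β) (hGH : ∀ t, 2 ≤ |t| → G t ≤ H t) : DyadicBound G β := by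
  obtain ⟨C, hC⟩ := h
  refine ⟨C, fun T a hT ha => (intervalIntegral.integral_mono_on (by linarith) (hG.intervalIntegrable _ _)
    (hH.intervalIntegrable _ _) fun t ht => hGH t (hT.trans (ha t ht).1)).trans (hC T a hT ha)⟩

lemma DyadicBound.const_mul {G : ℝ → ℝ} {β c : ℝ} (hc : 0 ≤ c) (h : DyadicBound G β) :
    DyadicBound (fun t => c * G t) β := by
  obtain ⟨C, hC⟩ := h
  refine ⟨c * C, fun T a hT ha => ?_⟩
  rw [intervalIntegral.integral_const_mul, mul_assoc]
  exact mul_le_mul_of_nonneg_left (hC T a hT ha) hc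

lemma DyadicBound.add {G H : ℝ → ℝ} {β : ℝ} (hG : Continuous G) (hH : Continuous H)
    (h : DyadicBound G β) (h' : DyadicBound H β) : DyadicBound (fun t => G t + H t) β := by
  obtain ⟨C, hC⟩ := h
  obtain ⟨C', hC'⟩ := h'
  refine ⟨C + C', fun T a hT ha => ?_⟩
  rw [intervalIntegral.integral_add (hG.intervalIntegrable _ _) (hH.intervalIntegrable _ _), add_mul]
  exact add_le_add (hC T a hT ha) (hC' T a hT ha)

lemma DyadicBound.const {β : ℝ} c (hc : 0 ≤ c) (hβ : 0 ≤ β) : DyadicBound (fun _ => c) β := by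
  refine ⟨c, fun T a hT _ => ?_⟩
  rw [intervalIntegral.integral_const, smul_eq_mul, add_sub_cancel_left, mul_comm]
  refine mul_le_mul_of_nonneg_left ?_ hc
  calc T = T ^ 1 := (rpow_one T).symm
    _ ≤ _ := rpow_le_rpow_of_exponent_le (by linarith) (by linarith)

lemma DyadicBound.sum {ι : Type*} (s : Finset ι) {G : ι → ℝ → ℝ} {β : ℝ} (hβ : 0 ≤ β) (hG : ∀ i ∈ s, Continuous (G i))
    (h : ∀ i ∈ s, DyadicBound (G i) β) : DyadicBound (fun t => ∑ i ∈ s, G i t) β := by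
  induction s using Finset.induction_on with
  | empty => simpa using DyadicBound.const 0 le_rfl hβ
  | insert i s hi ih =>
    simp only [sum_insert hi]
    have hGs := fun j hj => hG j (Finset.mem_insert_of_mem hj)
    exact (h i (mem_insert_self _ _)).add (hG i (mem_insert_self _ _))
      (continuous_finset_sum _ hGs) (ih hGs fun j hj => h j (Finset.mem_insert_of_mem hj))

/-- Young's inequality in mean: `x A B` is controlled by the moments of `x ^ 4`, `A ^ 2`, `B ^ 4`. -/
lemma DyadicBound.young {x A B : ℝ → ℝ} (hx : Continuous x) (hA : Continuous A) (hB : Continuous B)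
    {b d β : ℝ} (h4 : DyadicBound (fun t => x t ^ 4) (4 * d + b)) (hA2 : DyadicBound (fun t => A t ^ 2) b)
    (hB4 : DyadicBound (fun t => B t ^ 4) b) (hβ : β = d + b) :
    DyadicBound (fun t => x t * A t * B t) β := by
  obtain ⟨C1, h4⟩ := h4
  obtain ⟨C2, hA2⟩ := hA2
  obtain ⟨C3, hB4⟩ := hB4
  refine ⟨C1 / 4 + C3 / 4 + C2 / 2, fun T a hT ha => ?_⟩
  have hT0 : 0 < T := by linarith
  have key : ∀ t, x t * A t * B t ≤ T ^ (-(3 * d)) / 4 * x t ^ 4 + T ^ d / 4 * B t ^ 4 + T ^ d / 2 * A t ^ 2 := by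
    intro t
    have hd : 0 < T ^ d := by positivity
    have h3 : T ^ (-(3 * d)) = (T ^ d)⁻¹ ^ 3 := by
      rw [← rpow_neg hT0.le, ← rpow_natCast, ← rpow_mul hT0.le]; congr 1; ring
    rw [h3]
    set l := T ^ d
    have f1 : x t * A t * B t ≤ l⁻¹ / 2 * (x t * B t) ^ 2 + l / 2 * A t ^ 2 := by
      have e : l⁻¹ / 2 * (x t * B t) ^ 2 + l / 2 * A t ^ 2 - x t * A t * B t = l⁻¹ / 2 * (x t * B t - l * A t) ^ 2 := by
        field_simp; ring
      have : 0 ≤ l⁻¹ / 2 * (x t * B t - l * A t) ^ 2 := by positivity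
      linarith
    have f2 : l⁻¹ / 2 * (x t * B t) ^ 2 ≤ l⁻¹ ^ 3 / 4 * x t ^ 4 + l / 4 * B t ^ 4 := by
      have e : l⁻¹ ^ 3 / 4 * x t ^ 4 + l / 4 * B t ^ 4 - l⁻¹ / 2 * (x t * B t) ^ 2
          = l⁻¹ ^ 3 / 4 * (x t ^ 2 - l ^ 2 * B t ^ 2) ^ 2 := by
        field_simp; ring
      have : 0 ≤ l⁻¹ ^ 3 / 4 * (x t ^ 2 - l ^ 2 * B t ^ 2) ^ 2 := by positivity
      linarith
    linarith
  have i1 : IntervalIntegrable (fun t => x t ^ 4) volume a (a + T) := (hx.pow 4).intervalIntegrable _ _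
  have i2 : IntervalIntegrable (fun t => B t ^ 4) volume a (a + T) := (hB.pow 4).intervalIntegrable _ _
  have i3 : IntervalIntegrable (fun t => A t ^ 2) volume a (a + T) := (hA.pow 2).intervalIntegrable _ _
  calc ∫ t in a..(a + T), x t * A t * B t
      ≤ ∫ t in a..(a + T), (T ^ (-(3 * d)) / 4 * x t ^ 4 + T ^ d / 4 * B t ^ 4 + T ^ d / 2 * A t ^ 2) :=
        intervalIntegral.integral_mono_on (by linarith) (((hx.mul hA).mul hB).intervalIntegrable _ _)
          (((i1.const_mul _).add (i2.const_mul _)).add (i3.const_mul _)) fun t _ => key t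
    _ = T ^ (-(3 * d)) / 4 * (∫ t in a..(a + T), x t ^ 4) + T ^ d / 4 * (∫ t in a..(a + T), B t ^ 4)
          + T ^ d / 2 * (∫ t in a..(a + T), A t ^ 2) := by
        rw [← intervalIntegral.integral_const_mul, ← intervalIntegral.integral_const_mul,
          ← intervalIntegral.integral_const_mul, ← intervalIntegral.integral_add (i1.const_mul _) (i2.const_mul _),
          ← intervalIntegral.integral_add ((i1.const_mul _).add (i2.const_mul _)) (i3.const_mul _)]
    _ ≤ T ^ (-(3 * d)) / 4 * (C1 * T ^ (1 + (4 * d + b))) + T ^ d / 4 * (C3 * T ^ (1 + b))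
          + T ^ d / 2 * (C2 * T ^ (1 + b)) := by
        gcongr
        · exact h4 T a hT ha
        · exact hB4 T a hT ha
        · exact hA2 T a hT ha
    _ = (C1 / 4 + C3 / 4 + C2 / 2) * T ^ (1 + β) := by
        have g1 : T ^ (-(3 * d)) * T ^ (1 + (4 * d + b)) = T ^ (1 + β) := by
          rw [← rpow_add hT0]; congr 1; rw [hβ]; ring
        have g2 : T ^ d * T ^ (1 + b) = T ^ (1 + β) := by
          rw [← rpow_add hT0]; congr 1; rw [hβ]; ring
        linear_combination C1 / 4 * g1 + (C3 / 4 + C2 / 2) * g2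

end Dyadic
section Moments
open Complex

lemma LSeries_dvd_indicator {d : ℕ} (hd : 0 < d) {s : ℂ} (hs : 1 < s.re) :
    LSeriesHasSum (fun n => if d ∣ n then 1 else 0) s (d ^ (-s) * riemannZeta s) := by
  have h0 : HasSum (LSeries.term 1 s) (riemannZeta s) := by
    rw [← LSeries_one_eq_riemannZeta hs]
    exact (LSeriesSummable_one_iff.2 hs).LSeriesHasSum
  have h1 := h0.mul_left ((d : ℂ) ^ (-s))
  have hinj : Function.Injective fun n : ℕ => d * n := fun a b h => Nat.eq_of_mul_eq_mul_left hd h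
  rw [LSeriesHasSum, ← hinj.hasSum_iff]
  · refine h1.congr_fun fun n => ?_
    rcases eq_or_ne n 0 with rfl | hn
    · simp
    · simp
      rw [LSeries.term_of_ne_zero (by positivity), LSeries.term_of_ne_zero hn, if_pos (dvd_mul_right _ _)]
      push_cast
      rw [natCast_mul_natCast_cpow, cpow_neg]
      simp
      ring
  · intro n hn
    have : ¬ d ∣ n := fun ⟨m, hm⟩ => hn ⟨m, hm.symm⟩
    simp [LSeries.term, this]

/-- A balanced function on `ZMod 4` whose L-function is an elementary multiple of `ζ`. -/
def zetaPhi (n : ZMod 4) : ℂ := if n = 0 then 0 else if n = 2 then -2 else 1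

lemma balanced_zetaPhi : Balanced zetaPhi where
  zero := by simp [zetaPhi]
  sum := by
    have : (Finset.univ : Finset (ZMod 4)) = {0, 1, 2, 3} := by decide
    rw [this]
    have h3 : (3 : ZMod 4) ≠ 2 := by decide
    have h4 : (3 : ZMod 4) ≠ 0 := by decide
    have h5 : (1 : ZMod 4) ≠ 2 := by decide
    have h6 : (2 : ZMod 4) ≠ 0 := by decide
    have h7 : (1 : ZMod 4) ≠ 0 := by decide
    rw [Finset.sum_insert, Finset.sum_insert, Finset.sum_insert, Finset.sum_singleton]
    · simp [zetaPhi, h3, h4, h5, h6, h7]; norm_num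
    all_goals decide

lemma zetaPhi_natCast (n : ℕ) : zetaPhi (n : ZMod 4) =
    1 - 3 * (if 2 ∣ n then 1 else 0) + 2 * (if 4 ∣ n then 1 else 0) := by
  have h0 := ZMod.natCast_eq_zero_iff n 4
  have h2 : ((n : ZMod 4) = 2) ↔ n % 4 = 2 := by
    have := ZMod.natCast_eq_natCast_iff' n 2 4
    simpa using this
  simp only [zetaPhi, h0, h2]
  rcases (by omega : n % 4 = 0 ∨ n % 4 = 1 ∨ n % 4 = 2 ∨ n % 4 = 3) with h | h | h | h
  · have a : 4 ∣ n := by omega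
    have b : 2 ∣ n := by omega
    simp [a, b]; norm_num
  · have a : ¬ 4 ∣ n := by omega
    have b : ¬ 2 ∣ n := by omega
    simp [a, b, h]
  · have a : ¬ 4 ∣ n := by omega
    have b : 2 ∣ n := by omega
    simp [a, b, h]; norm_num
  · have a : ¬ 4 ∣ n := by omega
    have b : ¬ 2 ∣ n := by omega
    simp [a, b, h]

lemma LFunction_zetaPhi {s : ℂ} (hs : 0 < s.re) :
    (s - 1) * ZMod.LFunction zetaPhi s = (1 - 2 ^ (1 - s)) * (1 - 2 ^ (-s)) * riemannZeta₁ s := by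
  refine eqOn_re_pos (f := fun s => (s - 1) * ZMod.LFunction zetaPhi s)
    (g := fun s => (1 - (2 : ℂ) ^ (1 - s)) * (1 - (2 : ℂ) ^ (-s)) * riemannZeta₁ s) ?_ ?_ ?_ s hs
  · exact ((differentiable_id.sub_const 1).mul balanced_zetaPhi.differentiable).differentiableOn
  · refine Differentiable.differentiableOn (.mul (.mul ?_ ?_) differentiable_riemannZeta₁)
    · exact (((differentiable_const _).sub differentiable_id).const_cpow (Or.inl two_ne_zero)).const_sub 1
    · exact (differentiable_id.neg.const_cpow (Or.inl two_ne_zero)).const_sub 1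
  · intro s hs
    have hs1 : s ≠ 1 := by rintro rfl; simp at hs
    have e := ((LSeries_dvd_indicator one_pos hs).add ((LSeries_dvd_indicator two_pos hs).smul (-3))).add
      ((LSeries_dvd_indicator (d := 4) (by norm_num) hs).smul 2)
    have e2 := (LSeriesHasSum_congr (g := fun n => zetaPhi n) s _ (fun {n} _ => by
      rw [zetaPhi_natCast]; simp; ring)).1 e
    have h4 : 4 ^ (-s) = 2 ^ (-s) * (2 : ℂ) ^ (-s) := by
      have := natCast_mul_natCast_cpow 2 2 (-s)
      norm_num at this ⊢
      exact this
    have h2 : (2 : ℂ) ^ (1 - s) = 2 * 2 ^ (-s) := by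
      rw [sub_eq_add_neg, cpow_add _ _ two_ne_zero, cpow_one]
    rw [ZMod.LFunction_eq_LSeries _ hs, e2.LSeries_eq, riemannZeta_eq_inv_sub_mul hs1]
    push_cast
    rw [h4, h2, one_cpow]
    field_simp
    ring

lemma zeta_moment {σ β : ℝ} (k : ℕ) (h0 : 0 < σ) (h1 : σ < 1) (hβ : 0 < β)
    (hb1 : (k + 1) * (1 - 2 * σ) < β) (hb2 : (k + 1) * (1 - σ) < 1 + β) :
    DyadicBound (fun t => ‖riemannZeta (σ + t * I)‖ ^ (2 * (k + 1))) β := by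
  obtain ⟨C, hC, h⟩ := balanced_zetaPhi.moment k h0 h1 hβ hb1 hb2
  have hd : 0 < ((2 : ℝ) ^ (1 - σ) - 1) * (1 - 2 ^ (-σ)) :=
    mul_pos (sub_pos.2 (Real.one_lt_rpow one_lt_two (by linarith)))
      (sub_pos.2 (Real.rpow_lt_one_of_one_lt_of_neg one_lt_two (by linarith)))
  set c := ((2 : ℝ) ^ (1 - σ) - 1) * (1 - 2 ^ (-σ))
  have hre : ∀ t : ℝ, (σ + t * I).re = σ := fun t => by simp
  have hne : ∀ t : ℝ, σ + t * I ≠ 1 := fun t ht => by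
    have := congrArg re ht
    rw [hre] at this; simp at this; linarith
  have hcont : Continuous fun t : ℝ => ‖riemannZeta (σ + t * I)‖ ^ (2 * (k + 1)) := by
    refine (Continuous.norm (continuous_iff_continuousAt.2 fun t => ?_)).pow _
    exact ContinuousAt.comp (differentiableAt_riemannZeta (hne t)).continuousAt
      (by fun_prop)
  have hcont2 : Continuous fun t : ℝ => ‖ZMod.LFunction zetaPhi (σ + t * I)‖ ^ (2 * (k + 1)) :=
    ((balanced_zetaPhi.differentiable.continuous.comp (by fun_prop)).norm).pow _
  have key : ∀ t : ℝ, c * ‖riemannZeta (σ + t * I)‖ ≤ ‖ZMod.LFunction zetaPhi (σ + t * I)‖ := by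
    intro t
    have hs2 := sub_ne_zero.2 (hne t)
    have e := LFunction_zetaPhi (s := σ + t * I) (by rw [hre]; exact h0)
    have e2 : ZMod.LFunction zetaPhi (σ + t * I) =
        (1 - 2 ^ (1 - (σ + t * I))) * (1 - 2 ^ (-(σ + t * I))) * riemannZeta (σ + t * I) := by
      rw [riemannZeta_eq_inv_sub_mul (hne t)]
      field_simp
      rw [mul_comm, e]
    rw [e2, norm_mul, norm_mul]
    have n1 : ‖(2 : ℂ) ^ (1 - (σ + t * I))‖ = 2 ^ (1 - σ) := by
      have := norm_natCast_cpow_of_pos two_pos (1 - (σ + t * I))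
      simpa using this
    have n2 : ‖(2 : ℂ) ^ (-(σ + t * I))‖ = 2 ^ (-σ) := by
      have := norm_natCast_cpow_of_pos two_pos (-(σ + t * I))
      simpa using this
    gcongr
    have b1 : 2 ^ (1 - σ) - 1 ≤ ‖1 - (2 : ℂ) ^ (1 - (σ + t * I))‖ := by
      have := norm_sub_norm_le ((2 : ℂ) ^ (1 - (σ + t * I))) 1
      rw [norm_sub_rev, n1, norm_one] at this
      exact this
    have b2 : 1 - 2 ^ (-σ) ≤ ‖1 - (2 : ℂ) ^ (-(σ + t * I))‖ := by
      have := norm_sub_norm_le 1 ((2 : ℂ) ^ (-(σ + t * I)))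
      rw [n2, norm_one] at this
      exact this
    exact mul_le_mul b1 b2 (sub_pos.2 (Real.rpow_lt_one_of_one_lt_of_neg one_lt_two (by linarith))).le (norm_nonneg _)
  refine DyadicBound.mono hcont (hcont2.const_mul (c⁻¹ ^ (2 * (k + 1)))) (DyadicBound.const_mul (by positivity) ⟨C, h⟩)
    fun t _ => ?_
  rw [← mul_pow]
  gcongr
  rw [inv_mul_eq_div, le_div_iff₀ hd, mul_comm]
  exact key t

end Moments
section Chars
open Complex
variable {p : ℕ} [NeZero p]

/-- The zeta function for the trivial character, the Dirichlet L-function otherwise. -/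
def Lf (χ : DirichletCharacter ℂ p) (s : ℂ) : ℂ :=
  if χ = 1 then riemannZeta s else DirichletCharacter.LFunction χ s

/-- The coefficients of the Euler product of `Lf`. -/
def cf (χ : DirichletCharacter ℂ p) (l : ℕ) : ℂ := if χ = 1 then 1 else χ l

lemma norm_cf_le (χ : DirichletCharacter ℂ p) l : ‖cf χ l‖ ≤ 1 := by
  unfold cf
  split_ifs
  · simp
  · exact χ.norm_le_one l

lemma Lf_hasProd (χ : DirichletCharacter ℂ p) {s : ℂ} (hs : 1 < s.re) :
    HasProd (fun l : Nat.Primes => (1 - cf χ l * l ^ (-s))⁻¹) (Lf χ s) := by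
  unfold Lf cf
  split_ifs with h
  · simpa using riemannZeta_eulerProduct_hasProd hs
  · rw [DirichletCharacter.LFunction_eq_LSeries χ hs]
    exact DirichletCharacter.LSeries_eulerProduct_hasProd χ hs

lemma balanced_char {χ : DirichletCharacter ℂ p} (hp : p ≠ 1) (h : χ ≠ 1) : Balanced (fun j => χ j) where
  zero := by
    have := ZMod.nontrivial_iff.2 hp
    exact χ.map_zero
  sum := MulChar.sum_eq_zero_of_ne_one h

lemma Lf_moment (hp : p ≠ 1) (χ : DirichletCharacter ℂ p) {σ β : ℝ} (k : ℕ) (h0 : 0 < σ) (h1 : σ < 1) (hβ : 0 < β)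
    (hb1 : (k + 1) * (1 - 2 * σ) < β) (hb2 : (k + 1) * (1 - σ) < 1 + β) :
    DyadicBound (fun t => ‖Lf χ (σ + t * I)‖ ^ (2 * (k + 1))) β := by
  by_cases h : χ = 1
  · simpa [Lf, h] using zeta_moment k h0 h1 hβ hb1 hb2
  · obtain ⟨C, -, hC⟩ := (balanced_char hp h).moment k h0 h1 hβ hb1 hb2
    simp only [Lf, h]
    exact ⟨C, hC⟩

lemma sum_cf (hp : p.Prime) {l : ℕ} (hl : l.Prime) (hlp : l ≠ p) :
    ∑ χ : DirichletCharacter ℂ p, cf χ l = if l % p = 1 then ((p - 1 : ℕ) : ℂ) else 0 := by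
  have hu : IsUnit (l : ZMod p) := by
    rw [ZMod.isUnit_iff_coprime]
    exact (Nat.coprime_primes hl hp).2 hlp
  have e : ∀ χ : DirichletCharacter ℂ p, cf χ l = χ l := by
    intro χ
    unfold cf
    split_ifs with h
    · rw [h, MulChar.one_apply hu]
    · rfl
  simp only [e]
  rw [DirichletCharacter.sum_characters_eq, Nat.totient_prime hp]
  have : ((l : ZMod p) = 1) ↔ l % p = 1 := by
    have := ZMod.natCast_eq_natCast_iff' l 1 p
    rwa [Nat.mod_eq_of_lt hp.one_lt, Nat.cast_one] at this
  simp only [this]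

lemma card_characters (hp : p.Prime) : Fintype.card (DirichletCharacter ℂ p) = p - 1 := by
  have : Fact p.Prime := ⟨hp⟩
  rw [← Nat.card_eq_fintype_card, DirichletCharacter.card_eq_totient_of_hasEnoughRootsOfUnity, Nat.totient_prime hp]

end Chars

section Local
open Finset Nat Real
open Complex

lemma prod_one_sub_approx {ι : Type*} (s : Finset ι) (u : ι → ℂ) {Y : ℝ} (hY0 : 0 ≤ Y) (hY : Y ≤ 1)
    (hu : ∀ i ∈ s, ‖u i‖ ≤ Y) : ‖∏ i ∈ s, (1 - u i) - 1 + ∑ i ∈ s, u i‖ ≤ 4 ^ s.card * Y ^ 2 := by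
  induction s using Finset.induction_on with
  | empty => simp; positivity
  | insert i s hi ih =>
    have h1 := ih fun j hj => hu j (mem_insert_of_mem hj)
    have h2 := hu i (mem_insert_self _ _)
    have h3 : ‖∑ j ∈ s, u j‖ ≤ s.card * Y :=
      (norm_sum_le_of_le s fun j hj => hu j (mem_insert_of_mem hj)).trans_eq (by simp)
    have h4 : ‖∏ j ∈ s, (1 - u j) - 1‖ ≤ 4 ^ s.card * Y + s.card * Y := by
      calc ‖∏ j ∈ s, (1 - u j) - 1‖ = ‖(∏ j ∈ s, (1 - u j) - 1 + ∑ j ∈ s, u j) - ∑ j ∈ s, u j‖ := by ring_nf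
        _ ≤ 4 ^ s.card * Y ^ 2 + s.card * Y := (norm_sub_le _ _).trans (add_le_add h1 h3)
        _ ≤ _ := by gcongr; nlinarith
    have h5 : (s.card : ℝ) ≤ 4 ^ s.card := mod_cast (Nat.lt_pow_self (by norm_num : 1 < 4)).le
    rw [prod_insert hi, sum_insert hi, card_insert_of_notMem hi]
    calc ‖(1 - u i) * ∏ j ∈ s, (1 - u j) - 1 + (u i + ∑ j ∈ s, u j)‖
        = ‖(∏ j ∈ s, (1 - u j) - 1 + ∑ j ∈ s, u j) - u i * (∏ j ∈ s, (1 - u j) - 1)‖ := by ring_nf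
      _ ≤ 4 ^ s.card * Y ^ 2 + Y * (4 ^ s.card * Y + s.card * Y) := by
        refine (norm_sub_le _ _).trans (add_le_add h1 ?_)
        rw [norm_mul]; gcongr
      _ ≤ 4 ^ (s.card + 1) * Y ^ 2 := by
        have g1 := mul_le_mul_of_nonneg_right h5 (sq_nonneg Y)
        have g2 : 0 ≤ 4 ^ s.card * Y ^ 2 := by positivity
        calc 4 ^ s.card * Y ^ 2 + Y * (4 ^ s.card * Y + s.card * Y) = 2 * (4 ^ s.card * Y ^ 2) + s.card * Y ^ 2 := by ring
          _ ≤ 4 * (4 ^ s.card * Y ^ 2) := by linarith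
          _ = _ := by ring

lemma norm_prod_one_sub_le {ι : Type*} (s : Finset ι) (u : ι → ℂ) (hu : ∀ i ∈ s, ‖u i‖ ≤ 1) :
    ‖∏ i ∈ s, (1 - u i)‖ ≤ 2 ^ s.card := by
  rw [norm_prod, ← prod_const]
  refine Finset.prod_le_prod (fun i _ => norm_nonneg _) fun i hi => ?_
  calc ‖1 - u i‖ ≤ ‖1‖ + ‖u i‖ := norm_sub_le _ _
    _ ≤ 2 := by rw [norm_one]; linarith [hu i hi]

/-- The number of nontrivial tame characters of order `p` at a prime. -/
def tau (p l : ℕ) : ℕ := if l % p = 1 then p - 1 else 0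

/-- The Euler factor of the counting series. -/
def locA (p e1 e2 l : ℕ) (x y z : ℂ) : ℂ :=
  1 + if l ∣ 2 * p then 0 else e1 * x + e2 * tau p l * y + e1 * e2 * tau p l * z

/-- The deviation from `1` of the Euler factor divided by those of the zeta and L-functions. -/
def locR (p e1 e2 l : ℕ) [NeZero p] (x y z : ℂ) : ℂ :=
  locA p e1 e2 l x y z * (1 + e1 * x)⁻¹ * ((∏ χ : DirichletCharacter ℂ p, (1 - e2 * (cf χ l * y))) *
    ∏ χ : DirichletCharacter ℂ p, (1 - (e1 * e2 : ℕ) * (cf χ l * z))) - 1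

lemma norm_flag_mul_le {e : ℕ} (he : e ≤ 1) u : ‖(e : ℂ) * u‖ ≤ ‖u‖ := by
  interval_cases e <;> simp

lemma norm_inv_one_add_le {x : ℂ} {r : ℝ} (hr : r < 1) (hx : ‖x‖ ≤ r) : 1 + x ≠ 0 ∧ ‖(1 + x)⁻¹‖ ≤ (1 - r)⁻¹ := by
  have h1 : 1 - r ≤ ‖1 + x‖ := by
    have := norm_sub_norm_le 1 (-x)
    rw [norm_neg, norm_one, sub_neg_eq_add] at this
    linarith
  have h2 : 0 < ‖1 + x‖ := by linarith
  refine ⟨norm_pos_iff.1 h2, ?_⟩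
  rw [norm_inv]
  exact inv_anti₀ (by linarith) h1

lemma locR_bound {p e1 e2 : ℕ} [NeZero p] (hp : p.Prime) (h1 : e1 ≤ 1) (h2 : e2 ≤ 1) :
    ∃ C : ℝ, 0 < C ∧ ∀ l : ℕ, l.Prime → ∀ x y z : ℂ, ‖x‖ ≤ l ^ (-(9 / 20) : ℝ) → ‖y‖ ≤ l ^ (-(3 / 4) : ℝ) →
      ‖z‖ ≤ l ^ (-(3 / 4) : ℝ) → 1 + e1 * x ≠ 0 ∧ ‖locR p e1 e2 l x y z‖ ≤ C * l ^ (-(6 / 5) : ℝ) := by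
  set D : ℝ := (1 - 2 ^ (-(9 / 20) : ℝ))⁻¹
  have hr : (2 : ℝ) ^ (-(9 / 20) : ℝ) < 1 := rpow_lt_one_of_one_lt_of_neg one_lt_two (by norm_num)
  set m := Fintype.card (DirichletCharacter ℂ p) with hm
  set K1 := 2 * p * D + 4 * p ^ 2 * D + 4 ^ (m + m) * (1 + 2 * p * D) with hK1
  set K2 := (D * (2 ^ m * 2 ^ m) + 1) * (2 * p : ℝ) ^ (6 / 5 : ℝ) with hK2
  have hK10 : 0 < K1 := by positivity
  have hK20 : 0 < K2 := by have := hp.pos; positivity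
  refine ⟨K1 + K2, by positivity, fun l hl x y z hx hy hz => ?_⟩
  have hl0 : (0 : ℝ) < l := mod_cast hl.pos
  have hl2 : (2 : ℝ) ≤ l := mod_cast hl.two_le
  have he12 : e1 * e2 ≤ 1 := by nlinarith
  set X := (l : ℝ) ^ (-(9 / 20) : ℝ) with hX
  set Y := (l : ℝ) ^ (-(3 / 4) : ℝ) with hY
  have hX2 : X ≤ 2 ^ (-(9 / 20) : ℝ) := rpow_le_rpow_of_nonpos two_pos hl2 (by norm_num)
  have hY0 : 0 < Y := by positivity
  have hY1 : Y ≤ 1 := rpow_le_one_of_one_le_of_nonpos (by linarith) (by norm_num)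
  have hXY : X * Y = l ^ (-(6 / 5) : ℝ) := by rw [hX, hY, ← rpow_add hl0]; norm_num
  have hYY : Y ^ 2 ≤ l ^ (-(6 / 5) : ℝ) := by
    rw [hY, ← rpow_natCast, ← rpow_mul hl0.le]
    exact rpow_le_rpow_of_exponent_le (by linarith) (by norm_num)
  obtain ⟨hne, hinv⟩ := norm_inv_one_add_le hr ((norm_flag_mul_le h1 x).trans (hx.trans hX2))
  refine ⟨hne, ?_⟩
  set u := (1 + e1 * x)⁻¹ with hu
  have hcy : ∀ χ : DirichletCharacter ℂ p, ‖e2 * (cf χ l * y)‖ ≤ Y := fun χ => by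
    refine (norm_flag_mul_le h2 _).trans ?_
    rw [norm_mul]
    calc _ ≤ 1 * Y := mul_le_mul (norm_cf_le χ l) hy (norm_nonneg _) zero_le_one
      _ = Y := one_mul _
  have hcz : ∀ χ : DirichletCharacter ℂ p, ‖((e1 * e2 : ℕ) : ℂ) * (cf χ l * z)‖ ≤ Y := fun χ => by
    refine (norm_flag_mul_le he12 _).trans ?_
    rw [norm_mul]
    calc _ ≤ 1 * Y := mul_le_mul (norm_cf_le χ l) hz (norm_nonneg _) zero_le_one
      _ = Y := one_mul _
  by_cases hb : l ∣ 2 * p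
  · have hle : (l : ℝ) ≤ 2 * p := mod_cast le_of_dvd (by have := hp.pos; omega) hb
    have n1 := norm_prod_one_sub_le univ _ fun χ _ => (hcy χ).trans hY1
    have n2 := norm_prod_one_sub_le univ _ fun χ _ => (hcz χ).trans hY1
    rw [Finset.card_univ, ← hm] at n1 n2
    have hbd : ‖locR p e1 e2 l x y z‖ ≤ D * (2 ^ m * 2 ^ m) + 1 := by
      rw [locR, locA, if_pos hb, add_zero, one_mul]
      refine (norm_sub_le _ _).trans (add_le_add ?_ norm_one.le)
      rw [norm_mul, norm_mul]
      gcongr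
    have : 1 ≤ (2 * p : ℝ) ^ (6 / 5 : ℝ) * l ^ (-(6 / 5) : ℝ) := by
      rw [rpow_neg hl0.le, ← div_eq_mul_inv, one_le_div (by positivity)]
      gcongr
    calc _ ≤ (D * (2 ^ m * 2 ^ m) + 1) * 1 := by rw [mul_one]; exact hbd
      _ ≤ (D * (2 ^ m * 2 ^ m) + 1) * ((2 * p : ℝ) ^ (6 / 5 : ℝ) * l ^ (-(6 / 5) : ℝ)) := by gcongr
      _ = K2 * l ^ (-(6 / 5) : ℝ) := by rw [hK2]; ring
      _ ≤ _ := by gcongr; linarith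
  · have hlp : l ≠ p := by rintro rfl; exact hb (dvd_mul_left _ _)
    have hs : ∑ χ : DirichletCharacter ℂ p, cf χ l = (tau p l : ℂ) := by
      rw [sum_cf hp hl hlp, tau]; split_ifs <;> simp
    set a := e2 * tau p l * y + e1 * e2 * tau p l * z with ha
    have htau : ‖(tau p l : ℂ)‖ ≤ p := by
      rw [tau]; split_ifs
      · rw [Complex.norm_natCast]; exact_mod_cast sub_le p 1
      · simp
    have han : ‖a‖ ≤ 2 * p * Y := by
      have t1 : ‖e2 * (tau p l * y)‖ ≤ p * Y := (norm_flag_mul_le h2 _).trans (by rw [norm_mul]; gcongr)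
      have t2 : ‖((e1 * e2 : ℕ) : ℂ) * (tau p l * z)‖ ≤ p * Y := (norm_flag_mul_le he12 _).trans (by rw [norm_mul]; gcongr)
      have : a = e2 * (tau p l * y) + ((e1 * e2 : ℕ) : ℂ) * (tau p l * z) := by rw [ha]; push_cast; ring
      rw [this]
      exact (norm_add_le _ _).trans (by linarith)
    set w : DirichletCharacter ℂ p ⊕ DirichletCharacter ℂ p → ℂ :=
      Sum.elim (fun χ => e2 * (cf χ l * y)) (fun χ => (e1 * e2 : ℕ) * (cf χ l * z)) with hw
    have hP := prod_one_sub_approx univ w hY0.le hY1 (by rintro (χ | χ) -; exacts [hcy χ, hcz χ])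
    have hsum : ∑ i, w i = a := by
      simp only [hw, Fintype.sum_sum_type, Sum.elim_inl, Sum.elim_inr, ← mul_sum, ← sum_mul, hs]
      push_cast; ring
    rw [hsum, Finset.card_univ, Fintype.card_sum, ← hm] at hP
    set c := ∏ i, (1 - w i) - 1 + a with hc
    have hr : locR p e1 e2 l x y z = a * (-(e1 * x) * u) - a ^ 2 * u + c + a * u * c := by
      have e : ∏ i, (1 - w i) = (∏ χ : DirichletCharacter ℂ p, (1 - e2 * (cf χ l * y))) *
          ∏ χ : DirichletCharacter ℂ p, (1 - (e1 * e2 : ℕ) * (cf χ l * z)) := by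
        simp [hw]
      have e3 := inv_mul_cancel₀ hne
      rw [locR, ← e, locA, if_neg hb, hc, ← hu]
      set Q := ∏ i, (1 - w i)
      linear_combination (Q + a) * e3
    rw [hr]
    have f1 : ‖a * (-(e1 * x) * u)‖ ≤ 2 * p * Y * (X * D) := by
      rw [norm_mul, norm_mul, norm_neg]; gcongr; exact (norm_flag_mul_le h1 x).trans hx
    have f2 : ‖a ^ 2 * u‖ ≤ (2 * p * Y) ^ 2 * D := by rw [norm_mul, norm_pow]; gcongr
    have f3 : ‖a * u * c‖ ≤ 2 * p * D * (4 ^ (m + m) * Y ^ 2) := by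
      rw [norm_mul, norm_mul]
      have : 2 * (p : ℝ) * Y ≤ 2 * p := mul_le_of_le_one_right (by positivity) hY1
      gcongr
      exact han.trans this
    calc ‖a * (-(e1 * x) * u) - a ^ 2 * u + c + a * u * c‖
        ≤ 2 * p * Y * (X * D) + (2 * p * Y) ^ 2 * D + 4 ^ (m + m) * Y ^ 2 + 2 * p * D * (4 ^ (m + m) * Y ^ 2) := by
          refine (norm_add_le _ _).trans (add_le_add ((norm_add_le _ _).trans (add_le_add ((norm_sub_le _ _).trans
            (add_le_add f1 f2)) hP)) f3)
      _ = 2 * p * D * (X * Y) + (4 * p ^ 2 * D + 4 ^ (m + m) * (1 + 2 * p * D)) * Y ^ 2 := by ring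
      _ ≤ 2 * p * D * l ^ (-(6 / 5) : ℝ) + (4 * p ^ 2 * D + 4 ^ (m + m) * (1 + 2 * p * D)) * l ^ (-(6 / 5) : ℝ) := by
          rw [hXY]; gcongr
      _ = K1 * l ^ (-(6 / 5) : ℝ) := by rw [hK1]; ring
      _ ≤ _ := by gcongr; linarith

lemma norm_prime_cpow {l : Primes} (w : ℂ) : ‖(l : ℂ) ^ w‖ = l ^ w.re :=
  norm_natCast_cpow_of_pos l.2.pos w

lemma norm_prime_cpow_le {l : Primes} {w : ℂ} {r : ℝ} (h : r ≤ w.re) :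
    ‖(l : ℂ) ^ (-w)‖ ≤ l ^ (-r) := by
  rw [norm_prime_cpow, neg_re]
  exact rpow_le_rpow_of_exponent_le (mod_cast l.2.one_le) (by linarith)

/-- The Euler product of the correction factors. -/
def eulerR (p e1 e2 : ℕ) [NeZero p] (s : ℂ) : ℂ :=
  ∏' l : Primes, (1 + locR p e1 e2 l ((l : ℕ) ^ (-(p * s))) ((l : ℕ) ^ (-((2 * p - 2 : ℕ) * s)))
    ((l : ℕ) ^ (-((2 * p - 1 : ℕ) * s))))

lemma re_bounds {p : ℕ} (hp5 : 5 ≤ p) {s : ℂ} (hs : 12 / (25 * p : ℝ) ≤ s.re) :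
    9 / 20 ≤ (p * s).re ∧ 3 / 4 ≤ (((2 * p - 2 : ℕ) : ℂ) * s).re ∧ 3 / 4 ≤ (((2 * p - 1 : ℕ) : ℂ) * s).re := by
  have hp : (5 : ℝ) ≤ p := mod_cast hp5
  have h0 : 12 ≤ 25 * p * s.re := by
    rw [div_le_iff₀ (by positivity)] at hs; linarith
  have h1 : ∀ n : ℕ, (n * s).re = n * s.re := fun n => by simp
  rw [h1, h1, h1]
  have e1 : ((2 * p - 2 : ℕ) : ℝ) = 2 * p - 2 := by rw [cast_sub (by omega)]; push_cast; ring
  have e2 : ((2 * p - 1 : ℕ) : ℝ) = 2 * p - 1 := by rw [cast_sub (by omega)]; push_cast; ring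
  refine ⟨by linarith, ?_, ?_⟩ <;> nlinarith

lemma eulerR_hasProd {p e1 e2 : ℕ} [NeZero p] (hp : p.Prime) (hp5 : 5 ≤ p) (h1 : e1 ≤ 1) (h2 : e2 ≤ 1) :
    DifferentiableOn ℂ (eulerR p e1 e2) {s | 12 / (25 * p : ℝ) < s.re} ∧
    (∃ C : ℝ, ∀ s : ℂ, 12 / (25 * p : ℝ) < s.re → ‖eulerR p e1 e2 s‖ ≤ C) ∧
    ∀ s : ℂ, 12 / (25 * p : ℝ) < s.re → HasProd (fun l : Primes => 1 + locR p e1 e2 l (l ^ (-(p * s)))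
      (l ^ (-((2 * p - 2 : ℕ) * s))) (l ^ (-((2 * p - 1 : ℕ) * s)))) (eulerR p e1 e2 s) := by
  obtain ⟨C, hC, hb⟩ := locR_bound hp h1 h2
  set r : Primes → ℂ → ℂ := fun l s => locR p e1 e2 l (l ^ (-(p * s)))
      (l ^ (-((2 * p - 2 : ℕ) * s))) (l ^ (-((2 * p - 1 : ℕ) * s)))
  set U : Set ℂ := {s | 12 / (25 * p : ℝ) < s.re}
  have hUo : IsOpen U := isOpen_lt continuous_const continuous_re
  have hbd : ∀ (l : Primes), ∀ s ∈ U, 1 + e1 * (l : ℂ) ^ (-(p * s)) ≠ 0 ∧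
      ‖r l s‖ ≤ C * (l : ℝ) ^ (-(6 / 5) : ℝ) := by
    intro l s hs
    obtain ⟨b1, b2, b3⟩ := re_bounds hp5 (le_of_lt hs)
    exact hb l l.2 _ _ _ (norm_prime_cpow_le b1) (norm_prime_cpow_le b2) (norm_prime_cpow_le b3)
  have hsum : Summable fun l : Primes => C * (l : ℝ) ^ (-(6 / 5) : ℝ) :=
    (Primes.summable_rpow.2 (by norm_num)).mul_left _
  have hdiff : ∀ l, DifferentiableOn ℂ (r l) U := by
    intro l
    have hl : (l : ℂ) ≠ 0 := mod_cast l.2.ne_zero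
    have hd : ∀ n : ℕ, Differentiable ℂ fun s : ℂ => (l : ℂ) ^ (-(n * s)) := fun n =>
      (differentiable_id.const_mul _).neg.const_cpow (Or.inl hl)
    have d1 := hd p
    have d2 := hd (2 * p - 2)
    have d3 := hd (2 * p - 1)
    have hA : Differentiable ℂ fun s : ℂ => locA p e1 e2 l (l ^ (-(p * s)))
      (l ^ (-((2 * p - 2 : ℕ) * s))) (l ^ (-((2 * p - 1 : ℕ) * s))) := by
      unfold locA
      split_ifs
      · exact differentiable_const _
      · fun_prop
    have hI :=
      DifferentiableOn.inv ((d1.const_mul _).const_add 1).differentiableOn fun s hs => (hbd l s hs).1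
    have hP : Differentiable ℂ fun s : ℂ => (∏ χ : DirichletCharacter ℂ p, (1 - e2 * (cf χ l * (l : ℂ) ^ (-((2 * p - 2 : ℕ) * s))))) *
        ∏ χ : DirichletCharacter ℂ p, (1 - (e1 * e2 : ℕ) * (cf χ l * (l : ℂ) ^ (-((2 * p - 1 : ℕ) * s)))) := by
      refine Differentiable.mul (Differentiable.fun_finset_prod fun χ _ => ?_) (Differentiable.fun_finset_prod fun χ _ => ?_)
      · exact ((d2.const_mul _).const_mul _).const_sub _
      · exact ((d3.const_mul _).const_mul _).const_sub _
    exact ((hA.differentiableOn.mul hI).mul hP.differentiableOn).sub_const _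
  have hprod := Summable.hasProdLocallyUniformlyOn_one_add hUo hsum
    (Eventually.of_forall fun l s hs => (hbd l s hs).2) fun l => (hdiff l).continuousOn
  refine ⟨?_, ⟨rexp (∑' l : Primes, C * (l : ℝ) ^ (-(6 / 5) : ℝ)), fun s hs => ?_⟩, fun s hs => hprod.hasProd hs⟩
  · refine TendstoLocallyUniformlyOn.differentiableOn
      (hasProdLocallyUniformlyOn_iff_tendstoLocallyUniformlyOn.1 hprod) (Eventually.of_forall fun t => ?_) hUo
    exact DifferentiableOn.fun_finset_prod fun l _ => (hdiff l).const_add 1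
  · refine le_of_tendsto ((continuous_norm.tendsto _).comp (hprod.hasProd hs)) (Eventually.of_forall fun t => ?_)
    calc ‖∏ l ∈ t, (1 + r l s)‖ ≤ ∏ l ∈ t, rexp (C * (l : ℝ) ^ (-(6 / 5) : ℝ)) := by
          rw [norm_prod]
          refine Finset.prod_le_prod (fun _ _ => norm_nonneg _) fun l _ => ?_
          calc ‖1 + r l s‖ ≤ ‖1‖ + ‖r l s‖ := norm_add_le _ _
            _ ≤ C * (l : ℝ) ^ (-(6 / 5) : ℝ) + 1 := by rw [norm_one]; linarith [(hbd l s hs).2]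
            _ ≤ _ := add_one_le_exp _
      _ = rexp (∑ l ∈ t, C * (l : ℝ) ^ (-(6 / 5) : ℝ)) := (Real.exp_sum _ _).symm
      _ ≤ _ := exp_le_exp.2 (hsum.sum_le_tsum _ fun l _ => by positivity)

end Local

section Euler
open Finset LSeries Real
open Complex

lemma sum_le_of_hasSum_subtype {α : Type*} {P : α → Prop} {f : α → ℝ} {a : ℝ} (h0 : ∀ n, 0 ≤ f n) {t : Finset α}
    (hP : ∀ n ∈ t, P n) (h : HasSum (fun x : {x // P x} => f x) a) : ∑ n ∈ t, f n ≤ a := by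
  rw [← sum_subtype_of_mem f hP]
  exact sum_le_hasSum _ (fun _ _ => h0 _) h

lemma summable_of_euler {F : ℕ → ℝ} (h0 : ∀ n, 0 ≤ F n) (h1 : F 1 = 1)
    (hm : ∀ {m n : ℕ}, m.Coprime n → F (m * n) = F m * F n)
    (hl : ∀ {l : ℕ}, l.Prime → Summable fun e => F (l ^ e)) {B : ℝ}
    (hB : ∀ N : ℕ, ∏ l ∈ N.primesBelow, ∑' e, F (l ^ e) ≤ B) : Summable F := by
  refine summable_of_sum_le h0 (c := F 0 + B) fun t => ?_
  set N := t.sup id + 1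
  have hS := EulerProduct.summable_and_hasSum_smoothNumbers_prod_primesBelow_tsum h1 hm
    (fun hp => (hl hp).norm) N
  have hle : ∑ n ∈ t.erase 0, F n ≤ B := by
    have hmem : ∀ n ∈ t.erase 0, n ∈ N.smoothNumbers := by
      intro n hn
      have h2 : n ≤ t.sup id := le_sup (f := id) (mem_of_mem_erase hn)
      refine Nat.mem_smoothNumbers'.2 fun q hq hqn => ?_
      have := Nat.le_of_dvd (Nat.pos_of_ne_zero (ne_of_mem_erase hn)) hqn
      omega
    calc ∑ n ∈ t.erase 0, F n ≤ ∏ l ∈ N.primesBelow, ∑' e, F (l ^ e) := sum_le_of_hasSum_subtype h0 hmem hS.2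
      _ ≤ B := hB N
  calc ∑ n ∈ t, F n ≤ ∑ n ∈ insert 0 (t.erase 0), F n := by
        refine sum_le_sum_of_subset_of_nonneg (fun n hn => ?_) fun _ _ _ => h0 _
        by_cases h : n = 0 <;> simp [h, hn]
    _ = F 0 + ∑ n ∈ t.erase 0, F n := sum_insert (notMem_erase _ _)
    _ ≤ F 0 + B := by gcongr

/-- Number of local ramification data at `l` with discriminant exponent `e`. -/
def gc (p e1 e2 l e : ℕ) : ℕ :=
  if e = 0 then 1 else if l ∣ 2 * p then 0 else if e = p then e1 else
    if e = 2 * p - 2 then e2 * tau p l else if e = 2 * p - 1 then e1 * e2 * tau p l else 0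

/-- The multiplicative function with local values `gc`. -/
def fc (p e1 e2 n : ℕ) : ℕ := if n = 0 then 0 else n.factorization.prod (gc p e1 e2)

lemma gc_zero (p e1 e2 l : ℕ) : gc p e1 e2 l 0 = 1 := by simp [gc]

lemma fc_one (p e1 e2 : ℕ) : fc p e1 e2 1 = 1 := by simp [fc]

lemma fc_prime_pow {p e1 e2 l : ℕ} (hl : l.Prime) e : fc p e1 e2 (l ^ e) = gc p e1 e2 l e := by
  rw [fc, if_neg (pow_ne_zero _ hl.ne_zero), hl.factorization_pow, Finsupp.prod_single_index (gc_zero _ _ _ _)]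

lemma fc_mul {p e1 e2 m n : ℕ} (h : m.Coprime n) : fc p e1 e2 (m * n) = fc p e1 e2 m * fc p e1 e2 n := by
  unfold fc
  rcases eq_or_ne m 0 with rfl | hm
  · simp
  rcases eq_or_ne n 0 with rfl | hn
  · simp
  rw [if_neg hm, if_neg hn, if_neg (mul_ne_zero hm hn), Nat.factorization_mul hm hn,
    Finsupp.prod_add_index_of_disjoint]
  exact h.disjoint_primeFactors

lemma gc_hasSum {p e1 e2 : ℕ} (hp5 : 5 ≤ p) l {R : Type*} [CommRing R] [TopologicalSpace R] (φ : ℕ → R) :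
    HasSum (fun e => (gc p e1 e2 l e : R) * φ e) (φ 0 + if l ∣ 2 * p then 0 else
      e1 * φ p + e2 * tau p l * φ (2 * p - 2) + e1 * e2 * tau p l * φ (2 * p - 1)) := by
  have h1 : HasSum (fun e => (gc p e1 e2 l e : R) * φ e)
      (∑ e ∈ ({0, p, 2 * p - 2, 2 * p - 1} : Finset ℕ), (gc p e1 e2 l e : R) * φ e) :=
    hasSum_sum_of_ne_finset_zero fun e he => by
      simp at he
      simp [gc, he.1, he.2.1, he.2.2.1, he.2.2.2]
  convert h1 using 1
  rw [sum_insert, sum_insert, sum_insert, sum_singleton]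
  · have a1 : p ≠ 0 := by omega
    have a2 : 2 * p - 2 ≠ 0 := by omega
    have a3 : 2 * p - 1 ≠ 0 := by omega
    have a4 : 2 * p - 2 ≠ p := by omega
    have a5 : 2 * p - 1 ≠ p := by omega
    have a6 : 2 * p - 1 ≠ 2 * p - 2 := by omega
    simp only [gc, if_false]
    split_ifs <;> push_cast <;> ring
  all_goals simp; omega

lemma term_prime_pow {p e1 e2 l : ℕ} (hl : l.Prime) s e :
    term (fun n => (fc p e1 e2 n : ℂ)) s (l ^ e) = gc p e1 e2 l e * l ^ (-(e * s)) := by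
  rw [term_of_ne_zero (pow_ne_zero _ hl.ne_zero), fc_prime_pow hl, div_eq_mul_inv, ← cpow_neg, Nat.cast_pow,
    ← natCast_cpow_natCast_mul, mul_neg]

lemma term_fc_mul {p e1 e2 : ℕ} s {m n : ℕ} (h : m.Coprime n) :
    term (fun n => (fc p e1 e2 n : ℂ)) s (m * n) =
      term (fun n => (fc p e1 e2 n : ℂ)) s m * term (fun n => (fc p e1 e2 n : ℂ)) s n := by
  rcases eq_or_ne m 0 with rfl | hm
  · simp
  rcases eq_or_ne n 0 with rfl | hn
  · simp
  rw [term_of_ne_zero hm, term_of_ne_zero hn, term_of_ne_zero (mul_ne_zero hm hn), fc_mul h]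
  push_cast
  rw [natCast_mul_natCast_cpow]
  field_simp

lemma fc_summable {p e1 e2 : ℕ} (hp : p.Prime) (hp5 : 5 ≤ p) (h1 : e1 ≤ 1) (h2 : e2 ≤ 1) {s : ℂ} (hs : 1 / p < s.re) :
    LSeriesSummable (fun n => (fc p e1 e2 n : ℂ)) s := by
  have hp0 : (0 : ℝ) < p := mod_cast hp.pos
  have hps : 1 < p * s.re := by rwa [div_lt_iff₀ hp0, mul_comm] at hs
  set F := fun n => ‖term (fun n => (fc p e1 e2 n : ℂ)) s n‖ with hF
  have hloc : ∀ {l : ℕ}, l.Prime → HasSum (fun e => F (l ^ e)) (1 + if l ∣ 2 * p then 0 else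
      e1 * l ^ (-(p * s.re)) + e2 * tau p l * l ^ (-((2 * p - 2 : ℕ) * s.re))
        + e1 * e2 * tau p l * (l : ℝ) ^ (-((2 * p - 1 : ℕ) * s.re))) := by
    intro l hl
    have := gc_hasSum (e1 := e1) (e2 := e2) hp5 l (fun e : ℕ => (l : ℝ) ^ (-(e * s.re)))
    simp at this
    refine this.congr_fun fun e => ?_
    simp only [hF]
    rw [term_prime_pow hl, norm_mul, Complex.norm_natCast, norm_natCast_cpow_of_pos hl.pos]
    simp
  have hsum : Summable fun l : Nat.Primes => (3 * p : ℝ) * (l : ℝ) ^ (-(p * s.re)) :=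
    (Nat.Primes.summable_rpow.2 (by linarith)).mul_left _
  refine Summable.of_norm (summable_of_euler (F := F) (fun n => norm_nonneg _) ?_ ?_ (fun hl => (hloc hl).summable)
    (B := rexp (∑' l : Nat.Primes, (3 * p : ℝ) * (l : ℝ) ^ (-(p * s.re)))) fun N => ?_)
  · simp [hF, fc_one]
  · intro m n h
    simp only [hF]
    rw [term_fc_mul s h, norm_mul]
  · have hle : ∀ l ∈ N.primesBelow, ∑' e, F (l ^ e) ≤ rexp ((3 * p : ℝ) * l ^ (-(p * s.re))) := by
      intro l hl
      have hlp := Nat.prime_of_mem_primesBelow hl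
      have hl1 : (1 : ℝ) ≤ l := mod_cast hlp.one_le
      rw [(hloc hlp).tsum_eq, add_comm]
      refine le_trans (add_le_add_left ?_ 1) (add_one_le_exp _)
      split_ifs
      · positivity
      · have b1 : l ^ (-((2 * p - 2 : ℕ) * s.re)) ≤ (l : ℝ) ^ (-(p * s.re)) :=
          rpow_le_rpow_of_exponent_le hl1 (by
            have : (p : ℝ) ≤ (2 * p - 2 : ℕ) := mod_cast (by omega : p ≤ 2 * p - 2)
            nlinarith)
        have b2 : (l : ℝ) ^ (-((2 * p - 1 : ℕ) * s.re)) ≤ (l : ℝ) ^ (-(p * s.re)) :=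
          rpow_le_rpow_of_exponent_le hl1 (by
            have : (p : ℝ) ≤ (2 * p - 1 : ℕ) := mod_cast (by omega : p ≤ 2 * p - 1)
            nlinarith)
        have c1 : (e1 : ℝ) ≤ 1 := mod_cast h1
        have c2 : (e2 : ℝ) ≤ 1 := mod_cast h2
        have c3 : (tau p l : ℝ) ≤ p := by
          rw [tau]; split_ifs
          · exact_mod_cast Nat.sub_le p 1
          · simp
        have cp : (1 : ℝ) ≤ p := mod_cast hp.one_le
        have W : 0 ≤ (l : ℝ) ^ (-(p * s.re)) := by positivity
        calc _ ≤ 1 * l ^ (-(p * s.re)) + 1 * p * l ^ (-(p * s.re)) + 1 * 1 * p * (l : ℝ) ^ (-(p * s.re)) := by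
              gcongr
          _ ≤ _ := by nlinarith
    calc ∏ l ∈ N.primesBelow, ∑' e, F (l ^ e) ≤ ∏ l ∈ N.primesBelow, rexp ((3 * p : ℝ) * l ^ (-(p * s.re))) :=
          Finset.prod_le_prod (fun l _ => tsum_nonneg fun e => norm_nonneg _) hle
      _ = rexp (∑ l ∈ N.primesBelow, (3 * p : ℝ) * l ^ (-(p * s.re))) := (Real.exp_sum _ _).symm
      _ ≤ _ := exp_le_exp.2 ?_
    exact sum_le_of_hasSum_subtype
      (fun l => by positivity) (fun l hl => Nat.prime_of_mem_primesBelow hl) hsum.hasSum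

lemma fc_hasProd {p e1 e2 : ℕ} (hp : p.Prime) (hp5 : 5 ≤ p) (h1 : e1 ≤ 1) (h2 : e2 ≤ 1) {s : ℂ} (hs : 1 / p < s.re) :
    HasProd (fun l : Nat.Primes => locA p e1 e2 l (l ^ (-(p * s)))
      (l ^ (-((2 * p - 2 : ℕ) * s))) (l ^ (-((2 * p - 1 : ℕ) * s))))
      (LSeries (fun n => (fc p e1 e2 n : ℂ)) s) := by
  have := EulerProduct.eulerProduct_hasProd
    (by simp [fc_one]) (fun h => term_fc_mul s h) (fc_summable hp hp5 h1 h2 hs).norm (by simp)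
  refine this.congr_fun fun l => ?_
  have h := gc_hasSum (e1 := e1) (e2 := e2) hp5 l (fun e : ℕ => (l : ℂ) ^ (-(e * s)))
  simp at h
  simp only [term_prime_pow l.2, h.tsum_eq, locA]

lemma hasProd_pow' {ι : Type*} {f : ι → ℂ} {a : ℂ} (h : HasProd f a) e : HasProd (fun i => f i ^ e) (a ^ e) := by
  induction e with
  | zero => simpa using hasProd_one
  | succ e ih => simpa only [pow_succ] using ih.mul h

lemma hasProd_finset_prod {ι κ : Type*} (t : Finset κ) {f : κ → ι → ℂ} {a : κ → ℂ} (h : ∀ k ∈ t, HasProd (f k) (a k)) :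
    HasProd (fun i => ∏ k ∈ t, f k i) (∏ k ∈ t, a k) := hasProd_prod h

lemma inv_flag_mul {e : ℕ} (he : e ≤ 1) {w : ℂ} (hw : ‖w‖ < 1) : ((1 - w)⁻¹) ^ e * (1 - e * w) = 1 := by
  have : 1 - w ≠ 0 := fun h => by
    rw [← sub_eq_zero.1 h] at hw; simp at hw
  interval_cases e <;> simp [this]

lemma euler_factor_eq {p e1 e2 : ℕ} [NeZero p] (h1 : e1 ≤ 1) (h2 : e2 ≤ 1) l {x y z : ℂ}
    (hx : ‖x‖ < 1) (hy : ‖y‖ < 1) (hz : ‖z‖ < 1) :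
    locA p e1 e2 l x y z * ((1 - x ^ 2)⁻¹) ^ e1 = ((1 - x)⁻¹) ^ e1 *
      (∏ χ : DirichletCharacter ℂ p, ((1 - cf χ l * y)⁻¹) ^ e2) *
      (∏ χ : DirichletCharacter ℂ p, ((1 - cf χ l * z)⁻¹) ^ (e1 * e2)) * (1 + locR p e1 e2 l x y z) := by
  have h12 : e1 * e2 ≤ 1 := by nlinarith
  have hc : ∀ (χ : DirichletCharacter ℂ p) {w : ℂ}, ‖w‖ < 1 → ‖cf χ l * w‖ < 1 := fun χ w hw => by
    rw [norm_mul]; nlinarith [norm_cf_le χ l, norm_nonneg w]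
  have hP : ∀ {e : ℕ} {w : ℂ}, e ≤ 1 → ‖w‖ < 1 → (∏ χ : DirichletCharacter ℂ p, ((1 - cf χ l * w)⁻¹) ^ e) *
      (∏ χ : DirichletCharacter ℂ p, (1 - e * (cf χ l * w))) = 1 := fun he hw => by
    rw [← prod_mul_distrib]
    exact prod_eq_one fun χ _ => inv_flag_mul he (hc χ hw)
  have hX : ((1 - x ^ 2)⁻¹) ^ e1 = ((1 - x)⁻¹) ^ e1 * (1 + e1 * x)⁻¹ := by
    interval_cases e1
    · simp
    · rw [show 1 - x ^ 2 = (1 - x) * (1 + x) by ring]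
      simp [mul_comm]
  have q1 := hP h2 hy
  have q2 := hP h12 hz
  rw [hX, locR]
  linear_combination (-(locA p e1 e2 l x y z * ((1 - x)⁻¹) ^ e1 * (1 + e1 * x)⁻¹)) * q1 -
    (locA p e1 e2 l x y z * ((1 - x)⁻¹) ^ e1 * (1 + e1 * x)⁻¹) *
    (∏ χ : DirichletCharacter ℂ p, ((1 - cf χ l * y)⁻¹) ^ e2) *
      (∏ χ : DirichletCharacter ℂ p, (1 - e2 * (cf χ l * y))) * q2

theorem euler_identity {p e1 e2 : ℕ} [NeZero p] (hp : p.Prime) (hp5 : 5 ≤ p) (h1 : e1 ≤ 1) (h2 : e2 ≤ 1) {s : ℂ}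
    (hs : 1 / p < s.re) :
    LSeries (fun n => (fc p e1 e2 n : ℂ)) s * riemannZeta (2 * p * s) ^ e1 =
      riemannZeta (p * s) ^ e1 * (∏ χ : DirichletCharacter ℂ p, Lf χ ((2 * p - 2 : ℕ) * s) ^ e2) *
      (∏ χ : DirichletCharacter ℂ p, Lf χ ((2 * p - 1 : ℕ) * s) ^ (e1 * e2)) * eulerR p e1 e2 s := by
  have hp0 : (0 : ℝ) < p := mod_cast hp.pos
  have hps : 1 < p * s.re := by rwa [div_lt_iff₀ hp0, mul_comm] at hs
  have hre : ∀ n : ℕ, p ≤ n → 1 < (n * s).re := by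
    intro n hn
    have : (n * s).re = n * s.re := by simp
    have : (p : ℝ) ≤ n := mod_cast hn
    nlinarith
  have hs' : 12 / (25 * p : ℝ) < s.re := lt_of_le_of_lt (by
    rw [div_le_div_iff₀ (by positivity) hp0]; linarith) hs
  have z1 := riemannZeta_eulerProduct_hasProd (hre p le_rfl)
  have z2 := riemannZeta_eulerProduct_hasProd (hre (2 * p) (by omega))
  have H1 := (fc_hasProd hp hp5 h1 h2 hs).mul (hasProd_pow' z2 e1)
  have H2 := (((hasProd_pow' z1 e1).mul
    (hasProd_finset_prod univ fun (χ : DirichletCharacter ℂ p) _ => hasProd_pow' (Lf_hasProd χ (hre (2 * p - 2) (by omega))) e2)).mul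
    (hasProd_finset_prod univ fun (χ : DirichletCharacter ℂ p) _ => hasProd_pow' (Lf_hasProd χ (hre (2 * p - 1) (by omega))) (e1 * e2))).mul
    ((eulerR_hasProd hp hp5 h1 h2).2.2 s hs')
  rw [show ((2 * p : ℕ) : ℂ) = 2 * p by push_cast; rfl] at H1
  refine H1.unique (H2.congr_fun fun l => ?_)
  have hn : ∀ {w : ℂ}, 1 < w.re → ‖(l : ℂ) ^ (-w)‖ < 1 := fun {w} hw => by
    rw [norm_prime_cpow, neg_re]
    exact rpow_lt_one_of_one_lt_of_neg (mod_cast l.2.one_lt) (by linarith)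
  have := euler_factor_eq (p := p) h1 h2 l (hn (hre p le_rfl)) (hn (hre (2 * p - 2) (by omega))) (hn (hre (2 * p - 1) (by omega)))
  rw [← cpow_nat_mul, show ((2 : ℕ) : ℂ) * (-(p * s)) = -(2 * p * s) by ring] at this
  exact this

end Euler

section Continuation
open Finset Nat
open Complex

lemma exists_partial_fractions {U : Set ℂ} (hU : IsOpen U) {E : ℂ → ℂ} (hE : DifferentiableOn ℂ E U) (a : Fin 3 → ℝ)
    (ha : ∀ j, (a j : ℂ) ∈ U) (h01 : a 0 ≠ a 1) (h02 : a 0 ≠ a 2) (h12 : a 1 ≠ a 2) :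
    ∃ F : ℂ → ℂ, ∃ c : Fin 3 → ℂ, DifferentiableOn ℂ F U ∧ ∀ s : ℂ, (∀ j, s ≠ a j) →
      E s / ∏ j, (s - a j) = F s + ∑ j, c j * (1 / (s - a j)) := by
  have k01 : (a 0 : ℂ) - a 1 ≠ 0 := sub_ne_zero.2 (mod_cast h01)
  have k02 : (a 0 : ℂ) - a 2 ≠ 0 := sub_ne_zero.2 (mod_cast h02)
  have k12 : (a 1 : ℂ) - a 2 ≠ 0 := sub_ne_zero.2 (mod_cast h12)
  set A : Fin 3 → ℂ := ![1 / ((a 0 - a 1) * (a 0 - a 2)), -1 / ((a 0 - a 1) * (a 1 - a 2)),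
    1 / ((a 0 - a 2) * (a 1 - a 2))] with hA
  refine ⟨fun s => ∑ j, A j * dslope E (a j) s, fun j => A j * E (a j), ?_, fun s hs => ?_⟩
  · exact DifferentiableOn.fun_sum fun j _ =>
      ((differentiableOn_dslope (hU.mem_nhds (ha j))).2 hE).const_mul _
  · have hd : ∀ j, dslope E (a j) s = (E s - E (a j)) / (s - a j) := fun j => by
      rw [dslope_of_ne _ (hs j), slope_def_field]
    have n0 := sub_ne_zero.2 (hs 0)
    have n1 := sub_ne_zero.2 (hs 1)
    have n2 := sub_ne_zero.2 (hs 2)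
    simp only [Fin.prod_univ_three, Fin.sum_univ_three, hd]
    have t : ∀ j, A j * ((E s - E (a j)) / (s - a j)) = E s * (A j / (s - a j)) - A j * E (a j) * (1 / (s - a j)) := by
      intro j; ring
    have : A 0 / (s - a 0) + A 1 / (s - a 1) + A 2 / (s - a 2) = 1 / ((s - a 0) * (s - a 1) * (s - a 2)) := by
      simp only [hA, Matrix.cons_val]
      field_simp
      ring
    linear_combination -(E s) * this

/-- Polynomial growth in the vertical strip `A ≤ re s ≤ B`. -/
def PolyGrowth (f : ℂ → ℂ) (A B : ℝ) : Prop :=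
  ∃ C : ℝ, 0 < C ∧ ∃ k : ℕ, ∀ s : ℂ, A ≤ s.re → s.re ≤ B → ‖f s‖ ≤ C * (1 + |s.im|) ^ k

lemma PolyGrowth.mul {f g : ℂ → ℂ} {A B : ℝ} (hf : PolyGrowth f A B) (hg : PolyGrowth g A B) :
    PolyGrowth (fun s => f s * g s) A B := by
  obtain ⟨C, hC, k, h⟩ := hf
  obtain ⟨D, hD, l, h'⟩ := hg
  refine ⟨C * D, mul_pos hC hD, k + l, fun s a b => ?_⟩
  rw [norm_mul, pow_add, mul_mul_mul_comm]
  exact mul_le_mul (h s a b) (h' s a b) (norm_nonneg _) (by positivity)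

lemma PolyGrowth.of_bounded {f : ℂ → ℂ} {A B C : ℝ} (h : ∀ s : ℂ, A ≤ s.re → ‖f s‖ ≤ C) : PolyGrowth f A B :=
  ⟨max C 1, by positivity, 0, fun s a _ => by simpa using Or.inl (h s a)⟩

lemma PolyGrowth.prod {ι : Type*} (t : Finset ι) {f : ι → ℂ → ℂ} {A B : ℝ} (h : ∀ i ∈ t, PolyGrowth (f i) A B) :
    PolyGrowth (fun s => ∏ i ∈ t, f i s) A B := by
  induction t using Finset.induction_on with
  | empty => exact .of_bounded (C := 1) fun s _ => by simp
  | insert i t hi ih =>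
    simp only [Finset.prod_insert hi]
    exact (h i (mem_insert_self _ _)).mul (ih fun j hj => h j (Finset.mem_insert_of_mem hj))

lemma PolyGrowth.pow {f : ℂ → ℂ} {A B : ℝ} (h : PolyGrowth f A B) e : PolyGrowth (fun s => f s ^ e) A B := by
  simpa using PolyGrowth.prod (Finset.range e) fun _ _ => h

lemma PolyGrowth.scale {f : ℂ → ℂ} {A B : ℝ} {n : ℕ} (hn : 1 ≤ n) (h : PolyGrowth f (n * A) (n * B)) :
    PolyGrowth (fun s => f (n * s)) A B := by
  obtain ⟨C, hC, k, h⟩ := h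
  have hn' : (1 : ℝ) ≤ n := mod_cast hn
  refine ⟨C * n ^ k, by positivity, k, fun s a b => ?_⟩
  refine (h (n * s) ?_ ?_).trans ?_
  · simp; gcongr
  · simp; gcongr
  · rw [mul_assoc, ← mul_pow]
    simp
    gcongr
    nlinarith

/-- `(s - 1) * ζ(s) ^ e` for `e ∈ {0, 1}`. -/
def zf (e : ℕ) (s : ℂ) : ℂ := if e = 0 then s - 1 else riemannZeta₁ s

/-- The product of the nontrivial Dirichlet L-functions, to the power `e`. -/
def lf (p e : ℕ) [NeZero p] (s : ℂ) : ℂ :=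
  ∏ χ ∈ (Finset.univ : Finset (DirichletCharacter ℂ p)).erase 1, DirichletCharacter.LFunction χ s ^ e

lemma differentiable_zf e : Differentiable ℂ (zf e) := by
  unfold zf
  split_ifs
  · exact differentiable_id.sub_const _
  · exact differentiable_riemannZeta₁

lemma zf_eq {e : ℕ} (he : e ≤ 1) {s : ℂ} (hs : s ≠ 1) : zf e s = (s - 1) * riemannZeta s ^ e := by
  interval_cases e
  · simp [zf]
  · rw [zf, if_neg one_ne_zero, riemannZeta_eq_inv_sub_mul hs, pow_one]; field_simp

lemma zf_growth e {A : ℝ} B (hA : 0 < A) : PolyGrowth (zf e) A B := by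
  have h1 : ∀ s : ℂ, A ≤ s.re → s.re ≤ B → ‖s‖ ≤ (B + 1) * (1 + |s.im|) ∧ ‖s - 1‖ ≤ (B + 2) * (1 + |s.im|) := by
    intro s h1 h2
    have := norm_le_abs_re_add_abs_im s
    rw [abs_of_pos (by linarith)] at this
    have h3 : ‖s - 1‖ ≤ ‖s‖ + 1 := (norm_sub_le _ _).trans (by simp)
    constructor <;> nlinarith [abs_nonneg s.im]
  refine ⟨|B| + 2 + ((|B| + 1) + (|B| + 1) * (|B| + 2) / A), by positivity, 2, fun s ha hb => ?_⟩
  obtain ⟨n1, n2⟩ := h1 s ha hb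
  have hB := le_abs_self B
  set u := 1 + |s.im| with hu
  have hu1 : 1 ≤ u := by rw [hu]; linarith [abs_nonneg s.im]
  have hu2 : u ≤ u ^ 2 := by nlinarith
  replace n1 : ‖s‖ ≤ (|B| + 1) * u := n1.trans (by gcongr)
  replace n2 : ‖s - 1‖ ≤ (|B| + 2) * u := n2.trans (by gcongr)
  unfold zf
  split_ifs
  · have : (|B| + 2) * u ≤ (|B| + 2) * u ^ 2 := by gcongr
    have : 0 ≤ ((|B| + 1) + (|B| + 1) * (|B| + 2) / A) * u ^ 2 := by positivity
    linarith
  · refine (zeta_growth (by linarith)).trans ?_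
    have : ‖s‖ ≤ (|B| + 1) * u ^ 2 := n1.trans (by gcongr)
    have : 0 ≤ (|B| + 2) * u ^ 2 := by positivity
    calc _ ≤ (|B| + 1) * u ^ 2 + ((|B| + 1) * u) * ((|B| + 2) * u) / A := by gcongr
      _ = ((|B| + 1) + (|B| + 1) * (|B| + 2) / A) * u ^ 2 := by ring
      _ ≤ _ := by linarith

variable {p : ℕ} [NeZero p]

lemma differentiable_lf (hp : p ≠ 1) e : Differentiable ℂ (lf p e) :=
  Differentiable.fun_finset_prod fun _ h =>
    ((balanced_char hp (ne_of_mem_erase h)).differentiable).pow e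

lemma lf_growth (hp : p ≠ 1) e (A B : ℝ) : PolyGrowth (lf p e) A B :=
  PolyGrowth.prod _ fun χ h => PolyGrowth.pow (by
    have := (balanced_char hp (ne_of_mem_erase h)).growth (-A) B
    rw [neg_neg] at this
    exact this) e

lemma prod_Lf e s : ∏ χ : DirichletCharacter ℂ p, Lf χ s ^ e = riemannZeta s ^ e * lf p e s := by
  rw [← mul_prod_erase _ _ (Finset.mem_univ 1), lf]
  congr 1
  · simp [Lf]
  · exact prod_congr rfl fun χ h => by simp [Lf, ne_of_mem_erase h]

/-- The continuation of the generating series. -/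
def genG (p e1 e2 : ℕ) [NeZero p] (s : ℂ) : ℂ :=
  riemannZeta (p * s) ^ e1 * (∏ χ : DirichletCharacter ℂ p, Lf χ ((2 * p - 2 : ℕ) * s) ^ e2) *
      (∏ χ : DirichletCharacter ℂ p, Lf χ ((2 * p - 1 : ℕ) * s) ^ (e1 * e2)) * eulerR p e1 e2 s

/-- `genG` with its poles removed. -/
def genE (p e1 e2 : ℕ) [NeZero p] (s : ℂ) : ℂ :=
  ((p : ℂ) * (2 * p - 2 : ℕ) * (2 * p - 1 : ℕ))⁻¹ * (zf e1 (p * s) * (zf e2 ((2 * p - 2 : ℕ) * s) * lf p e2 ((2 * p - 2 : ℕ) * s)) *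
    (zf (e1 * e2) ((2 * p - 1 : ℕ) * s) * lf p (e1 * e2) ((2 * p - 1 : ℕ) * s)) * eulerR p e1 e2 s)

/-- The possible poles of the generating series. -/
def genPole (p : ℕ) : Fin 3 → ℝ := ![1 / (p : ℝ), 1 / (2 * p - 2 : ℕ), 1 / (2 * p - 1 : ℕ)]

lemma pole_identity {P Q R u v w a b c d e g : ℂ} (hP : P ≠ 0) (hQ : Q ≠ 0) (hR : R ≠ 0) :
    a * (b * c) * (d * e) * g * (u * v * w) =
      (P * Q * R)⁻¹ * (P * u * a * (Q * v * b * c) * (R * w * d * e) * g) := by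
  field_simp

lemma genE_eq (hp5 : 5 ≤ p) {e1 e2 : ℕ} (h1 : e1 ≤ 1) (h2 : e2 ≤ 1) {s : ℂ} (hs : ∀ j, s ≠ genPole p j) :
    genG p e1 e2 s = genE p e1 e2 s / ∏ j, (s - genPole p j) := by
  have h12 : e1 * e2 ≤ 1 := by nlinarith
  have n0 := sub_ne_zero.2 (hs 0)
  have n1 := sub_ne_zero.2 (hs 1)
  have n2 := sub_ne_zero.2 (hs 2)
  have p0 : (p : ℂ) ≠ 0 := mod_cast (by omega : p ≠ 0)
  have p1 : ((2 * p - 2 : ℕ) : ℂ) ≠ 0 := mod_cast (by omega : 2 * p - 2 ≠ 0)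
  have p2 : ((2 * p - 1 : ℕ) : ℂ) ≠ 0 := mod_cast (by omega : 2 * p - 1 ≠ 0)
  rw [eq_div_iff (prod_ne_zero_iff.2 fun j _ => sub_ne_zero.2 (hs j)), Fin.prod_univ_three]
  simp only [genPole, Matrix.cons_val, ofReal_div, ofReal_one] at n0 n1 n2 ⊢
  have m : ∀ {a : ℂ}, a ≠ 0 → s - 1 / a ≠ 0 → a * s ≠ 1 := fun {a} ha h h' => h (by
    rw [eq_div_of_mul_eq ha ((mul_comm s a).trans h'), sub_self])
  have m' : ∀ {a : ℂ}, a ≠ 0 → a * s - 1 = a * (s - 1 / a) := fun {a} ha => by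
    rw [mul_sub, mul_one_div_cancel ha]
  rw [genE, genG, zf_eq h1 (m p0 n0), zf_eq h2 (m p1 n1), zf_eq h12 (m p2 n2), prod_Lf, prod_Lf, m' p0, m' p1, m' p2]
  exact pole_identity p0 p1 p2

lemma genE_differentiableOn (hp : p.Prime) (hp5 : 5 ≤ p) {e1 e2 : ℕ} (h1 : e1 ≤ 1) (h2 : e2 ≤ 1) :
    DifferentiableOn ℂ (genE p e1 e2) {s | 12 / (25 * p : ℝ) < s.re} := by
  have a : ∀ (n : ℕ) {f : ℂ → ℂ}, Differentiable ℂ f →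
      DifferentiableOn ℂ (fun s => f (n * s)) {s | 12 / (25 * p : ℝ) < s.re} := fun n f hf =>
    (hf.comp (differentiable_id.const_mul _)).differentiableOn
  exact ((((a _ (differentiable_zf _)).mul ((a _ (differentiable_zf _)).mul (a _ (differentiable_lf hp.ne_one _)))).mul
    ((a _ (differentiable_zf _)).mul (a _ (differentiable_lf hp.ne_one _)))).mul
    (eulerR_hasProd hp hp5 h1 h2).1).const_mul _

lemma genE_growth (hp : p.Prime) (hp5 : 5 ≤ p) {e1 e2 : ℕ} (h1 : e1 ≤ 1) (h2 : e2 ≤ 1) {A : ℝ} B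
    (hA : 12 / (25 * p : ℝ) < A) : PolyGrowth (genE p e1 e2) A B := by
  have hA0 := lt_of_le_of_lt (by positivity) hA
  have z : ∀ (n e : ℕ), 1 ≤ n → PolyGrowth (fun s => zf e (n * s)) A B := fun n e hn =>
    PolyGrowth.scale hn (zf_growth e _ (by have : (0 : ℝ) < n := mod_cast hn
                                           positivity))
  have l : ∀ (n e : ℕ), 1 ≤ n → PolyGrowth (fun s => lf p e (n * s)) A B := fun n e hn =>
    PolyGrowth.scale hn (lf_growth hp.ne_one e _ _)
  obtain ⟨C, hC⟩ := (eulerR_hasProd hp hp5 h1 h2).2.1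
  exact (PolyGrowth.of_bounded fun s _ => le_rfl).mul ((((z _ _ (by omega)).mul ((z _ _ (by omega)).mul (l _ _ (by omega)))).mul
    ((z _ _ (by omega)).mul (l _ _ (by omega)))).mul (.of_bounded fun s hs => hC s (hA.trans_le hs)))

/-- The generating series is the sum of its polar parts and a holomorphic function of polynomial growth. -/
theorem exists_genF (hp : p.Prime) (hp5 : 5 ≤ p) {e1 e2 : ℕ} (h1 : e1 ≤ 1) (h2 : e2 ≤ 1) {A B : ℝ}
    (hA : 12 / (25 * p : ℝ) < A) : ∃ F : ℂ → ℂ, ∃ c : Fin 3 → ℂ, DifferentiableOn ℂ F {s | A ≤ s.re} ∧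
      (∀ s : ℂ, (∀ j, s ≠ genPole p j) → genG p e1 e2 s = F s + ∑ j, c j * (1 / (s - genPole p j))) ∧ PolyGrowth F A B := by
  set U : Set ℂ := {s | 12 / (25 * p : ℝ) < s.re}
  have hUo : IsOpen U := isOpen_lt continuous_const continuous_re
  have hp0 : (5 : ℝ) ≤ p := mod_cast hp5
  have q1 : ((2 * p - 2 : ℕ) : ℝ) = 2 * p - 2 := by rw [cast_sub (by omega)]; push_cast; ring
  have r1 : ((2 * p - 1 : ℕ) : ℝ) = 2 * p - 1 := by rw [cast_sub (by omega)]; push_cast; ring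
  have o01 : genPole p 0 ≠ genPole p 1 := by
    simp only [genPole, Matrix.cons_val, q1]
    exact fun h => by rw [div_eq_div_iff (by linarith) (by linarith)] at h; linarith
  have o02 : genPole p 0 ≠ genPole p 2 := by
    simp only [genPole, Matrix.cons_val, r1]
    exact fun h => by rw [div_eq_div_iff (by linarith) (by linarith)] at h; linarith
  have o12 : genPole p 1 ≠ genPole p 2 := by
    simp only [genPole, Matrix.cons_val, r1]
    exact fun h => by rw [div_eq_div_iff (by linarith) (by linarith)] at h; linarith
  have om : ∀ j, (genPole p j : ℂ) ∈ U := by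
    intro j
    show 12 / (25 * p : ℝ) < (genPole p j : ℂ).re
    rw [ofReal_re]
    fin_cases j <;> simp only [genPole, Fin.reduceFinMk, Matrix.cons_val, r1] <;>
    rw [div_lt_div_iff₀ (by positivity) (by linarith)] <;> linarith
  obtain ⟨F, c, hF, hFE⟩ := exists_partial_fractions hUo (genE_differentiableOn hp hp5 h1 h2) (genPole p) om o01 o02 o12
  have hAU : {s : ℂ | A ≤ s.re} ⊆ U := fun s hs => hA.trans_le hs
  refine ⟨F, c, hF.mono hAU, fun s hs => (genE_eq hp5 h1 h2 hs).trans (hFE s hs), ?_⟩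
  obtain ⟨C, hC, k, hk⟩ := genE_growth hp hp5 h1 h2 B hA
  have hK : IsCompact (Set.Icc A B ×ℂ Set.Icc (-1) 1) := isCompact_Icc.reProdIm isCompact_Icc
  obtain ⟨D, hD⟩ := hK.exists_bound_of_continuousOn (hF.continuousOn.mono fun s hs => hAU (mem_reProdIm.1 hs).1.1)
  refine ⟨C + |D| + ∑ j, ‖c j‖, by positivity, k, fun s ha hb => ?_⟩
  have hpow : 1 ≤ (1 + |s.im|) ^ k := one_le_pow₀ (by linarith [abs_nonneg s.im])
  have hcs : 0 ≤ ∑ j, ‖c j‖ := by positivity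
  rcases le_total |s.im| 1 with h | h
  · have := hD s (mem_reProdIm.2 ⟨⟨ha, hb⟩, abs_le.1 h⟩)
    nlinarith [le_abs_self D, abs_nonneg D]
  · have hj := fun j => h.trans (by
      simpa using abs_im_le_norm (s - genPole p j))
    have hne : ∀ j, s ≠ genPole p j := fun j e => by
      have := hj j; rw [e] at this; simp at this; linarith
    have hFs : F s = genE p e1 e2 s / ∏ j, (s - genPole p j) - ∑ j, c j * (1 / (s - genPole p j)) := by
      rw [hFE s hne]; ring
    rw [hFs]
    have b1 : ‖genE p e1 e2 s / ∏ j, (s - genPole p j)‖ ≤ C * (1 + |s.im|) ^ k := by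
      rw [norm_div, norm_prod]
      refine (div_le_self (norm_nonneg _) ?_).trans (hk s ha hb)
      rw [Fin.prod_univ_three]
      nlinarith [hj 2, one_le_mul_of_one_le_of_one_le (hj 0) (hj 1)]
    have b2 : ‖∑ j, c j * (1 / (s - genPole p j))‖ ≤ ∑ j, ‖c j‖ := norm_sum_le_of_le _ fun j _ => by
      rw [norm_mul, norm_div, norm_one]
      exact mul_le_of_le_one_right (norm_nonneg _) (div_le_one_of_le₀ (hj j) (norm_nonneg _))
    refine (norm_sub_le _ _).trans ?_
    nlinarith [abs_nonneg D]

end Continuation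

section Dyadic
open Finset
open Complex

lemma prod_flag_pow_le {ι : Type*} {t : Finset ι} (ht : t.Nonempty) {u : ι → ℝ} (hu : ∀ i, 0 ≤ u i) {e : ℕ} (he : e ≤ 1)
    m : (∏ i ∈ t, u i ^ e) ^ m ≤ ∑ i ∈ t, u i ^ (m * t.card) + 1 := by
  have hs : 0 ≤ ∑ i ∈ t, u i ^ (m * t.card) := sum_nonneg fun i _ => pow_nonneg (hu i) _
  interval_cases e
  · simpa using hs
  · obtain ⟨j, hj, hmax⟩ := exists_max_image t u ht
    have h1 : (∏ i ∈ t, u i ^ 1) ≤ u j ^ t.card := by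
      simpa using Finset.prod_le_prod (fun i _ => hu i) hmax
    calc (∏ i ∈ t, u i ^ 1) ^ m ≤ (u j ^ t.card) ^ m :=
          pow_le_pow_left₀ (prod_nonneg fun i _ => pow_nonneg (hu i) _) h1 m
      _ = u j ^ (m * t.card) := by rw [← pow_mul, mul_comm]
      _ ≤ ∑ i ∈ t, u i ^ (m * t.card) := single_le_sum (fun i _ => pow_nonneg (hu i) _) hj
      _ ≤ _ := by linarith

variable {p : ℕ} [NeZero p]

lemma continuous_Lf_line (hp : p ≠ 1) (χ : DirichletCharacter ℂ p) {σ : ℝ} n (h : n * σ ≠ 1) :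
    Continuous fun t : ℝ => Lf χ (n * (σ + t * I)) := by
  have hc : Continuous fun t : ℝ => n * (σ + t * I) := by fun_prop
  unfold Lf
  split_ifs
  · refine continuous_iff_continuousAt.2 fun t => ContinuousAt.comp ?_ hc.continuousAt
    refine (differentiableAt_riemannZeta fun e => h ?_).continuousAt
    simpa using congrArg re e
  · rename_i hχ
    exact (balanced_char hp hχ).differentiable.continuous.comp hc

lemma Lf_line_moment (hp : p ≠ 1) (χ : DirichletCharacter ℂ p) {σ β : ℝ} {n : ℕ} (hn : 1 ≤ n) (k : ℕ) (h0 : 0 < σ)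
    (h1 : n * σ < 1) (hβ : 0 < β) (hb1 : (k + 1) * (1 - 2 * (n * σ)) < β) (hb2 : (k + 1) * (1 - n * σ) < 1 + β) :
    DyadicBound (fun t => ‖Lf χ (n * (σ + t * I))‖ ^ (2 * (k + 1))) β := by
  have hn' : (1 : ℝ) ≤ n := mod_cast hn
  have := (Lf_moment hp χ k (by positivity) h1 hβ hb1 hb2).scale hn'
  refine (congrArg (DyadicBound · β) (funext fun t => ?_)).mp this
  congr 3
  push_cast
  ring

lemma dyadic_prod_Lf (hp : p.Prime) {e : ℕ} (he : e ≤ 1) {σ β : ℝ} {n : ℕ} (hn : 1 ≤ n) (m : ℕ) (hm : 1 ≤ m) (h0 : 0 < σ)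
    (h1 : n * σ < 1) (hβ : 0 < β) (hh : 1 ≤ 2 * (n * σ)) (hb2 : m * (p - 1) * (1 - n * σ) < 1 + β) :
    DyadicBound (fun t => (∏ χ : DirichletCharacter ℂ p, ‖Lf χ (n * (σ + t * I))‖ ^ e) ^ (2 * m)) β := by
  have hp1 := hp.ne_one
  have hp2 := hp.two_le
  have hc := fun χ : DirichletCharacter ℂ p => (continuous_Lf_line hp1 χ n h1.ne).norm
  obtain ⟨k, hk⟩ : ∃ k, m * (p - 1) = k + 1 := ⟨m * (p - 1) - 1, by
    have : 1 ≤ m * (p - 1) := one_le_mul_of_one_le_of_one_le hm (by omega)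
    omega⟩
  have hk' : (m : ℝ) * (p - 1) = k + 1 := by
    have : ((m * (p - 1) : ℕ) : ℝ) = k + 1 := mod_cast hk
    rw [← this]; push_cast [Nat.cast_sub (show 1 ≤ p by omega)]; ring
  have hcard : 2 * m * (univ : Finset (DirichletCharacter ℂ p)).card = 2 * (k + 1) := by
    rw [card_univ, card_characters hp, mul_assoc, hk]
  rw [hk'] at hb2
  refine DyadicBound.mono (H := fun t => (∑ χ : DirichletCharacter ℂ p, ‖Lf χ (n * (σ + t * I))‖ ^ (2 * (k + 1))) + 1)
    ((continuous_finset_prod _ fun χ _ => (hc χ).pow e).pow _)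
    ((continuous_finset_sum _ fun χ _ => (hc χ).pow _).add continuous_const) ?_ fun t _ => ?_
  · refine DyadicBound.add (continuous_finset_sum _ fun χ _ => (hc χ).pow _) continuous_const
      (DyadicBound.sum _ hβ.le (fun χ _ => (hc χ).pow _) fun χ _ => Lf_line_moment hp1 χ hn k h0 h1 hβ ?_ hb2)
      (DyadicBound.const 1 zero_le_one hβ.le)
    have : (k + 1) * (1 - 2 * (n * σ)) ≤ 0 := mul_nonpos_of_nonneg_of_nonpos (by positivity) (by linarith)
    linarith
  · rw [← hcard]
    exact prod_flag_pow_le univ_nonempty (fun _ => norm_nonneg _) he _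

theorem genG_dyadic (hp : p.Prime) (hp5 : 5 ≤ p) {e1 e2 : ℕ} (h1 : e1 ≤ 1) (h2 : e2 ≤ 1) {d σ : ℝ}
    (hd : d = 1 / (8 * p ^ 2)) (hσ : σ = (1 / 2 - d) / p) :
    ∃ C : ℝ, 0 ≤ C ∧ ∃ H : ℝ → ℝ, Continuous H ∧ DyadicBound H (5 * d / 4) ∧
      ∀ t : ℝ, ‖genG p e1 e2 (σ + t * I)‖ ≤ C * H t := by
  have hp0 : (5 : ℝ) ≤ p := mod_cast hp5
  have q1 : ((2 * p - 2 : ℕ) : ℝ) = 2 * p - 2 := by rw [Nat.cast_sub (by omega)]; push_cast; ring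
  have r1 : ((2 * p - 1 : ℕ) : ℝ) = 2 * p - 1 := by rw [Nat.cast_sub (by omega)]; push_cast; ring
  have hd0 : 0 < d := by rw [hd]; positivity
  have hdp : d * p ^ 2 = 1 / 8 := by rw [hd]; field_simp
  have hd1 : d ≤ 1 / 200 := by nlinarith [mul_nonneg hd0.le (by nlinarith : (0:ℝ) ≤ p ^ 2 - 25)]
  have hσp : p * σ = 1 / 2 - d := by rw [hσ]; field_simp
  have hσ0 : 0 < σ := by rw [hσ]; apply div_pos <;> linarith
  have h12 : e1 * e2 ≤ 1 := by nlinarith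
  have hlow : 12 / (25 * p : ℝ) < σ := by
    rw [hσ, div_lt_div_iff₀ (by positivity) (by positivity)]; nlinarith
  obtain ⟨C, hC⟩ := (eulerR_hasProd hp hp5 h1 h2).2.1
  have cq : ((2 * p - 2 : ℕ) : ℝ) * σ < 1 := by rw [q1]; nlinarith
  have cr : ((2 * p - 1 : ℕ) : ℝ) * σ < 1 := by rw [r1]; nlinarith
  have cp : (p : ℝ) * σ ≠ 1 := by rw [hσp]; linarith
  set x : ℝ → ℝ := fun t => ‖riemannZeta (p * (σ + t * I))‖ ^ e1 with hx
  set A : ℝ → ℝ := fun t => ∏ χ : DirichletCharacter ℂ p, ‖Lf χ ((2 * p - 2 : ℕ) * (σ + t * I))‖ ^ e2 with hA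
  set B : ℝ → ℝ := fun t => ∏ χ : DirichletCharacter ℂ p, ‖Lf χ ((2 * p - 1 : ℕ) * (σ + t * I))‖ ^ (e1 * e2) with hB
  have hz : Continuous fun t : ℝ => ‖riemannZeta (p * (σ + t * I))‖ := by
    simpa [Lf] using (continuous_Lf_line hp.ne_one (1 : DirichletCharacter ℂ p) p cp).norm
  have xc : Continuous x := hz.pow _
  have Ac : Continuous A := continuous_finset_prod _ fun χ _ => (continuous_Lf_line hp.ne_one χ _ cq.ne).norm.pow _
  have Bc : Continuous B := continuous_finset_prod _ fun χ _ => (continuous_Lf_line hp.ne_one χ _ cr.ne).norm.pow _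
  refine ⟨max C 0, le_max_right _ _, fun t => x t * A t * B t, (xc.mul Ac).mul Bc,
    DyadicBound.young xc Ac Bc (b := d / 4) ?_ ?_ ?_ (by ring), fun t => ?_⟩
  · have m : DyadicBound (fun t : ℝ => ‖riemannZeta (p * (σ + t * I))‖ ^ 4) (4 * d + d / 4) := by
      have := Lf_line_moment hp.ne_one (1 : DirichletCharacter ℂ p) (β := 4 * d + d / 4) (n := p) (by omega) 1 hσ0
        (by rw [hσp]; linarith) (by linarith) (by rw [hσp]; push_cast; linarith) (by rw [hσp]; push_cast; linarith)
      simpa [Lf] using this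
    refine DyadicBound.mono (xc.pow 4)
      ((hz.pow 4).add continuous_const) (m.add (hz.pow 4) continuous_const (.const 1 zero_le_one (by linarith)))
      fun t _ => ?_
    simp only [hx]
    interval_cases e1
    · simp
    · simp
  · refine dyadic_prod_Lf hp h2 (by omega) 1 le_rfl hσ0 cq (by linarith) ?_ ?_
    · rw [q1]; nlinarith
    · rw [q1]
      nlinarith
  · refine dyadic_prod_Lf hp h12 (by omega) 2 (by norm_num) hσ0 cr (by linarith) ?_ ?_
    · rw [r1]; nlinarith
    · rw [r1]
      nlinarith
  · have hR : ‖eulerR p e1 e2 (σ + t * I)‖ ≤ max C 0 := (hC _ (by simpa using hlow)).trans (le_max_left _ _)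
    calc ‖genG p e1 e2 (σ + t * I)‖ = x t * A t * B t * ‖eulerR p e1 e2 (σ + t * I)‖ := by
          simp [genG, norm_mul, norm_prod, norm_pow, hx, hA, hB]
      _ ≤ _ := by rw [mul_comm]; gcongr

end Dyadic

section Mobius
open Nat Real Finset
open ArithmeticFunction
open scoped ArithmeticFunction.Moebius ArithmeticFunction.zeta

lemma rpow_sub_rpow_pred_ge {α : ℝ} (h0 : 0 ≤ α) (h1 : α ≤ 1) k :
    (1 - α) * ((k + 1 : ℕ) : ℝ) ^ (-α) ≤ ((k + 1 : ℕ) : ℝ) ^ (1 - α) - k ^ (1 - α) := by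
  have hk : (0 : ℝ) < (k + 1 : ℕ) := by positivity
  set u : ℝ := 1 / (k + 1 : ℕ) with hu
  have hu1 : u ≤ 1 := by rw [hu, div_le_one hk]; push_cast; linarith
  have hke : k = (k + 1 : ℕ) * (1 + -u) := by rw [hu]; field_simp; push_cast; ring
  have hB := rpow_one_add_le_one_add_mul_self (s := -u) (by linarith) (p := 1 - α) (by linarith) (by linarith)
  have h2 : ((k + 1 : ℕ) : ℝ) ^ (-α) = ((k + 1 : ℕ) : ℝ) ^ (1 - α) * u := by
    rw [hu, sub_eq_neg_add, rpow_add hk, rpow_one]; field_simp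
  have h3 : k ^ (1 - α) = ((k + 1 : ℕ) : ℝ) ^ (1 - α) * (1 + -u) ^ (1 - α) := by
    rw [← mul_rpow hk.le (by linarith), ← hke]
  have : 0 ≤ ((k + 1 : ℕ) : ℝ) ^ (1 - α) := by positivity
  nlinarith

lemma sum_rpow_neg_le {α : ℝ} (h0 : 0 ≤ α) (h1 : α < 1) (K : ℕ) :
    ∑ k ∈ Ioc 0 K, (k : ℝ) ^ (-α) ≤ (1 - α)⁻¹ * K ^ (1 - α) := by
  have h1' : 0 < 1 - α := by linarith
  induction K with
  | zero => simp [zero_rpow h1'.ne']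
  | succ K ih =>
    rw [sum_Ioc_succ_top (Nat.zero_le K)]
    have := rpow_sub_rpow_pred_ge h0 h1.le K
    rw [← le_div_iff₀' h1', div_eq_inv_mul, mul_sub] at this
    linarith

lemma rpow_pred_sub_rpow_ge {γ : ℝ} (h0 : 0 < γ) {k : ℕ} (hk1 : 1 ≤ k) :
    γ * ((k + 1 : ℕ) : ℝ) ^ (-(1 + γ)) ≤ k ^ (-γ) - ((k + 1 : ℕ) : ℝ) ^ (-γ) := by
  have hk : (0 : ℝ) < (k + 1 : ℕ) := by positivity
  have hk0 : (0 : ℝ) < k := mod_cast hk1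
  set u : ℝ := 1 / (k + 1 : ℕ) with hu
  have hu1 : u < 1 := by rw [hu, div_lt_one hk]; push_cast; linarith
  have hke : k = (k + 1 : ℕ) * (1 - u) := by rw [hu]; field_simp; push_cast; ring
  have h2 : ((k + 1 : ℕ) : ℝ) ^ (-(1 + γ)) = ((k + 1 : ℕ) : ℝ) ^ (-γ) * u := by
    rw [hu, neg_add, rpow_add hk, rpow_neg_one]; field_simp
  have h3 : k ^ (-γ) = ((k + 1 : ℕ) : ℝ) ^ (-γ) * (1 - u) ^ (-γ) := by
    rw [← mul_rpow hk.le (by linarith), ← hke]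
  have hB : 1 + γ * u ≤ (1 - u) ^ (-γ) := by
    have h5 : (1 - u) ^ (-γ) = rexp (Real.log (1 - u) * (-γ)) := rpow_def_of_pos (by linarith) _
    rw [h5]
    have h6 := log_le_sub_one_of_pos (show 0 < 1 - u by linarith)
    refine le_trans ?_ (add_one_le_exp _)
    nlinarith
  have : 0 ≤ ((k + 1 : ℕ) : ℝ) ^ (-γ) := by positivity
  nlinarith

lemma sum_Ico_rpow_neg_le {γ : ℝ} (h0 : 0 < γ) {K : ℕ} (hK : 1 ≤ K) n :
    ∑ i ∈ range n, ((i + (K + 1) : ℕ) : ℝ) ^ (-(1 + γ)) ≤ γ⁻¹ * K ^ (-γ) := by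
  have : ∑ i ∈ range n, ((i + (K + 1) : ℕ) : ℝ) ^ (-(1 + γ)) ≤ γ⁻¹ * (K ^ (-γ) - ((n + K : ℕ) : ℝ) ^ (-γ)) := by
    induction n with
    | zero => simp
    | succ n ih =>
      rw [sum_range_succ]
      have := rpow_pred_sub_rpow_ge h0 (k := n + K) (by omega)
      rw [← le_div_iff₀' h0, div_eq_inv_mul] at this
      rw [show n + 1 + K = n + K + 1 by ring, ← add_assoc]
      linarith
  refine this.trans ?_
  have : 0 ≤ ((n + K : ℕ) : ℝ) ^ (-γ) := by positivity
  gcongr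
  linarith

/-- A partial sum of `∑ μ(k) k^{-α}` approximates the full sum with the trivial error. -/
lemma moebius_partial {α : ℝ} (h : 1 < α) : ∃ m C : ℝ, ∀ K : ℕ, 1 ≤ K →
    |∑ k ∈ Ioc 0 K, (μ k : ℝ) * k ^ (-α) - m| ≤ C * K ^ (1 - α) := by
  have hμ : ∀ k : ℕ, |(μ k : ℝ) * k ^ (-α)| ≤ k ^ (-α) := fun k => by
    rw [abs_mul, abs_of_nonneg (by positivity : 0 ≤ (k : ℝ) ^ (-α))]
    refine mul_le_of_le_one_left (by positivity) ?_
    exact_mod_cast abs_moebius_le_one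
  have hs0 : Summable fun k : ℕ => (k : ℝ) ^ (-α) := summable_nat_rpow.2 (by linarith)
  have hs : Summable fun k : ℕ => (μ k : ℝ) * k ^ (-α) := Summable.of_norm_bounded hs0 hμ
  refine ⟨∑' k : ℕ, (μ k : ℝ) * k ^ (-α), (α - 1)⁻¹, fun K hK => ?_⟩
  have e1 : ∑ k ∈ Ioc 0 K, (μ k : ℝ) * k ^ (-α) = ∑ k ∈ range (K + 1), (μ k : ℝ) * k ^ (-α) := by
    refine sum_subset (fun k hk => ?_) fun k hk hk' => ?_
    · rw [mem_Ioc] at hk; rw [mem_range]; omega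
    · rw [mem_Ioc] at hk'
      rw [mem_range] at hk
      obtain rfl : k = 0 := by omega
      simp
  rw [e1, ← hs.sum_add_tsum_nat_add (K + 1), sub_add_cancel_left, abs_neg]
  have t0 := (summable_nat_add_iff (K + 1)).2 hs0
  refine (norm_tsum_le_tsum_norm ((summable_nat_add_iff (K + 1)).2 hs).norm).trans ?_
  refine (((summable_nat_add_iff (K + 1)).2 hs).norm.tsum_le_tsum (fun i => hμ _) t0).trans ?_
  refine t0.tsum_le_of_sum_range_le fun n => ?_
  have := sum_Ico_rpow_neg_le (γ := α - 1) (by linarith) hK n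
  rwa [add_sub_cancel, neg_sub] at this

lemma moebius_double_sum {T : ℕ → ℝ} (hT : T 0 = 0) {M : ℕ} (hM : M ≠ 0) {N : ℕ} (hN : 1 ≤ N) :
    ∑ k ∈ Ioc 0 N, (μ k : ℝ) * ∑ m ∈ Ioc 0 N, T (N / (k ^ M * m ^ M)) = T N := by
  have h1 : ∀ n ∈ Ioc 0 N, ∑ x ∈ (Ioc 0 N ×ˢ Ioc 0 N).filter (fun x => x.1 * x.2 = n),
      (μ x.1 : ℝ) * T (N / (x.1 ^ M * x.2 ^ M)) = if n = 1 then T N else 0 := by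
    intro n hn
    rw [mem_Ioc] at hn
    rw [← divisorsAntidiagonal_eq_prod_filter_of_le hn.1.ne' hn.2]
    have : ∑ x ∈ n.divisorsAntidiagonal, (μ x.1 : ℝ) * T (N / (x.1 ^ M * x.2 ^ M)) =
        (∑ x ∈ n.divisorsAntidiagonal, ((μ : ArithmeticFunction ℝ) x.1 * (ζ : ArithmeticFunction ℝ) x.2)) * T (N / n ^ M) := by
      rw [sum_mul]
      refine sum_congr rfl fun x hx => ?_
      obtain ⟨hx, hn0⟩ := mem_divisorsAntidiagonal.1 hx
      have : x.2 ≠ 0 := by rintro h; simp [h] at hx; omega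
      rw [← mul_pow, hx]
      simp [this]
    rw [this, ← mul_apply, coe_moebius_mul_coe_zeta, one_apply]
    split_ifs with h
    · subst h; simp
    · simp
  simp_rw [mul_sum]
  rw [← sum_product']
  trans ∑ x ∈ Ioc 0 N ×ˢ Ioc 0 N, ∑ n ∈ Ioc 0 N,
      if x.1 * x.2 = n then (μ x.1 : ℝ) * T (N / (x.1 ^ M * x.2 ^ M)) else 0
  · refine sum_congr rfl fun x hx => ?_
    rw [sum_ite_eq]
    split_ifs with h
    · rfl
    · rw [mem_product, mem_Ioc, mem_Ioc] at hx
      have h2 : N < x.1 * x.2 := by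
        by_contra h3
        exact h (mem_Ioc.2 ⟨Nat.mul_pos hx.1.1 hx.2.1, by omega⟩)
      rw [← mul_pow, div_eq_of_lt (h2.trans_le (Nat.le_self_pow hM _)), hT, mul_zero]
  · rw [sum_comm]
    simp_rw [← sum_filter]
    rw [sum_congr rfl h1, sum_ite_eq', if_pos (mem_Ioc.2 ⟨one_pos, hN⟩)]

theorem moebius_transfer {ι : Type} [Fintype ι] {T : ℕ → ℝ} (hT : T 0 = 0) {M : ℕ} (hM : M ≠ 0) {θ C : ℝ}
    (hθ : 0 < θ) (hθM : M * θ < 1) (s b : ι → ℝ) (hs : ∀ j, 1 < M * s j)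
    (h : ∀ Y : ℝ, 1 ≤ Y → |∑ m ∈ Ioc 0 ⌊Y⌋₊, T (⌊Y⌋₊ / m ^ M) - ∑ j, b j * Y ^ s j| ≤ C * Y ^ θ) :
    ∃ b' : ι → ℝ, ∃ C' : ℝ, ∀ Y : ℝ, 1 ≤ Y → |T ⌊Y⌋₊ - ∑ j, b' j * Y ^ s j| ≤ C' * Y ^ (1 / (M : ℝ)) := by
  choose m D hD using fun j => moebius_partial (hs j)
  have hC : 0 ≤ C := by simpa using (abs_nonneg _).trans (h 1 le_rfl)
  refine ⟨fun j => b j * m j, C * (1 - M * θ)⁻¹ + ∑ j, |b j| * (|D j| * 2 ^ (M * s j - 1)), fun Y hY => ?_⟩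
  have hY0 : 0 < Y := by linarith
  set N := ⌊Y⌋₊ with hN
  have hN1 : 1 ≤ N := le_floor (by simpa using hY)
  set Z := Y ^ (1 / (M : ℝ)) with hZ
  have hZ1 : 1 ≤ Z := one_le_rpow hY (by positivity)
  have hZM : Z ^ M = Y := by rw [hZ, ← rpow_natCast, ← rpow_mul hY0.le]; field_simp; simp
  set K := ⌊Z⌋₊ with hK
  have hK1 : 1 ≤ K := le_floor (by simpa using hZ1)
  have hKZ : K ≤ Z := floor_le (by linarith)
  have hKZ' : Z / 2 ≤ K := by
    have := lt_floor_add_one Z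
    have h1 : (1 : ℝ) ≤ K := mod_cast hK1
    rw [← hK] at this; linarith
  have hkK : ∀ k : ℕ, k ≤ K ↔ k ^ M ≤ Y := fun k => by
    rw [hK, le_floor_iff (by linarith), ← hZM, pow_le_pow_iff_left₀ (by positivity) (by linarith) hM]
  have hKN : K ≤ N := by
    rw [hN, le_floor_iff (by linarith)]
    exact (le_self_pow₀ (mod_cast hK1) hM).trans ((hkK K).1 le_rfl)
  set S : ℝ → ℝ := fun Y => ∑ m ∈ Ioc 0 ⌊Y⌋₊, T (⌊Y⌋₊ / m ^ M) with hS
  have hTN : T N = ∑ k ∈ Ioc 0 K, (μ k : ℝ) * S (Y / k ^ M) := by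
    rw [← moebius_double_sum hT hM hN1]
    symm
    refine sum_subset_zero_on_sdiff (Ioc_subset_Ioc_right hKN) (fun k hk => ?_) fun k hk => ?_
    · rw [Finset.mem_sdiff, mem_Ioc, mem_Ioc] at hk
      have hk1 : ¬ k ≤ K := fun hh => hk.2 ⟨hk.1.1, hh⟩
      rw [hkK, not_le] at hk1
      have hNk : N < k ^ M := by
        rw [hN, floor_lt hY0.le]; exact_mod_cast hk1
      rw [sum_eq_zero, mul_zero]
      intro m hm
      rw [← Nat.div_div_eq_div_mul, div_eq_of_lt hNk, Nat.zero_div, hT]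
    · congr 1
      have hfl : ⌊Y / k ^ M⌋₊ = N / k ^ M := by
        rw [← cast_pow, floor_div_natCast]
      simp only [hS, hfl]
      refine (sum_congr rfl fun m _ => by rw [Nat.div_div_eq_div_mul]).trans
        (sum_subset (Ioc_subset_Ioc_right (Nat.div_le_self _ _)) fun m hm hm' => ?_)
      rw [mem_Ioc] at hm hm'
      have : N / k ^ M < m ^ M := lt_of_lt_of_le (by omega) (Nat.le_self_pow hM m)
      rw [← Nat.div_div_eq_div_mul, div_eq_of_lt this, hT]
  have hdec : T N - ∑ j, b j * m j * Y ^ s j =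
      ∑ k ∈ Ioc 0 K, (μ k : ℝ) * (S (Y / k ^ M) - ∑ j, b j * (Y / k ^ M) ^ s j) +
      ∑ j, b j * Y ^ s j * (∑ k ∈ Ioc 0 K, (μ k : ℝ) * k ^ (-(M * s j)) - m j) := by
    have h1 : ∑ k ∈ Ioc 0 K, (μ k : ℝ) * ∑ j, b j * (Y / k ^ M) ^ s j =
        ∑ j, b j * Y ^ s j * ∑ k ∈ Ioc 0 K, (μ k : ℝ) * k ^ (-(M * s j)) := by
      simp_rw [mul_sum]
      rw [sum_comm]
      refine sum_congr rfl fun j _ => sum_congr rfl fun k hk => ?_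
      rw [div_rpow hY0.le (by positivity), ← rpow_natCast, ← rpow_mul (by positivity), rpow_neg (by positivity)]
      ring
    simp_rw [mul_sub, sum_sub_distrib]
    rw [h1, ← hTN]
    simp_rw [mul_right_comm]
    ring
  rw [hdec, add_mul]
  refine (abs_add_le _ _).trans (add_le_add ?_ ?_)
  · calc _ ≤ ∑ k ∈ Ioc 0 K, C * Y ^ θ * k ^ (-(M * θ)) := by
          refine (abs_sum_le_sum_abs _ _).trans (sum_le_sum fun k hk => ?_)
          rw [mem_Ioc] at hk
          have hk0 : 0 < k := mod_cast hk.1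
          have h2 := h (Y / k ^ M) (by rw [one_le_div (by positivity)]; exact (hkK k).1 hk.2)
          rw [abs_mul]
          have h3 : |(μ k : ℝ)| ≤ 1 := mod_cast abs_moebius_le_one
          calc _ ≤ 1 * (C * (Y / k ^ M) ^ θ) := mul_le_mul h3 h2 (abs_nonneg _) zero_le_one
            _ = _ := by
              rw [div_rpow hY0.le (by positivity), ← rpow_natCast, ← rpow_mul (by positivity), rpow_neg (by positivity)]
              ring
      _ ≤ C * Y ^ θ * ((1 - M * θ)⁻¹ * K ^ (1 - M * θ)) := by
          rw [← mul_sum]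
          exact mul_le_mul_of_nonneg_left (sum_rpow_neg_le (by positivity) hθM K) (by positivity)
      _ ≤ C * Y ^ θ * ((1 - M * θ)⁻¹ * Z ^ (1 - M * θ)) := by
          gcongr
      _ = C * (1 - M * θ)⁻¹ * Z := by
          have : Y ^ θ * Z ^ (1 - M * θ) = Z := by
            rw [hZ, ← rpow_mul hY0.le, ← rpow_add hY0]
            congr 1
            field_simp
            ring
          linear_combination (C * (1 - M * θ)⁻¹) * this
  · rw [sum_mul]
    refine (abs_sum_le_sum_abs _ _).trans (sum_le_sum fun j _ => ?_)
    rw [abs_mul, abs_mul, abs_of_pos (rpow_pos_of_pos hY0 (s j)), mul_assoc, mul_assoc]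
    refine mul_le_mul_of_nonneg_left ?_ (abs_nonneg _)
    have hsj := hs j
    calc _ ≤ Y ^ s j * (|D j| * K ^ (1 - M * s j)) := by
          refine mul_le_mul_of_nonneg_left ((hD j K hK1).trans ?_) (by positivity)
          gcongr
          exact le_abs_self _
      _ ≤ Y ^ s j * (|D j| * (Z / 2) ^ (1 - M * s j)) := by
          have : K ^ (1 - M * s j) ≤ (Z / 2) ^ (1 - M * s j) :=
            rpow_le_rpow_of_nonpos (by linarith) hKZ' (by linarith)
          gcongr
      _ = _ := by
          have h1 : Y ^ s j * Z ^ (1 - M * s j) = Z := by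
            rw [hZ, ← rpow_mul hY0.le, ← rpow_add hY0]
            congr 1
            field_simp
            ring
          have h2 : 2 ^ (M * s j - 1) = ((2 : ℝ) ^ (1 - M * s j))⁻¹ := by
            rw [← rpow_neg (by norm_num)]; congr 1; ring
          rw [div_rpow (by linarith) (by norm_num), h2]
          linear_combination (|D j| * (2 ^ (1 - M * s j))⁻¹) * h1

end Mobius

section Count
open Finset Nat LSeries ArithmeticFunction Real
open Complex

variable {p : ℕ} [NeZero p]

/-- `fc` as a real arithmetic function. -/
def fcA (p e1 e2 : ℕ) : ArithmeticFunction ℝ := ⟨fun n => (fc p e1 e2 n : ℝ), by simp [fc]⟩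

lemma convolution_count (hp : p.Prime) (hp5 : 5 ≤ p) {e1 e2 : ℕ} (h1 : e1 ≤ 1) (h2 : e2 ≤ 1) {κ : ArithmeticFunction ℝ}
    (hκ0 : ∀ n, 0 ≤ κ n) (hκ : ∀ s : ℂ, 1 / p < s.re →
      LSeriesSummable (fun n => (κ n : ℂ)) s ∧ LSeries (fun n => (κ n : ℂ)) s = riemannZeta (2 * p * s) ^ e1) :
    ∃ b : Fin 3 → ℝ, ∃ C θ : ℝ, 0 < θ ∧ 2 * p * θ < 1 ∧ ∀ Y : ℝ, 1 ≤ Y →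
      |∑ n ∈ Ioc 0 ⌊Y⌋₊, (κ * fcA p e1 e2) n - ∑ j, b j * Y ^ genPole p j| ≤ C * Y ^ θ := by
  have hp0 : (5 : ℝ) ≤ p := mod_cast hp5
  have q1 : ((2 * p - 2 : ℕ) : ℝ) = 2 * p - 2 := by rw [cast_sub (by omega)]; push_cast; ring
  have r1 : ((2 * p - 1 : ℕ) : ℝ) = 2 * p - 1 := by rw [cast_sub (by omega)]; push_cast; ring
  set d : ℝ := 1 / (8 * p ^ 2) with hd
  have hd0 : 0 < d := by positivity
  have hd1 : d ≤ 1 / 200 := by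
    rw [hd]; apply one_div_le_one_div_of_le (by norm_num); nlinarith
  set σ := (1 / 2 - d) / p with hσ
  set S := 1 / (p : ℝ) with hS
  have hσ0 : 0 < σ := div_pos (by linarith) (by linarith)
  have hσS : σ ≤ S := by rw [hσ, hS]; gcongr; linarith
  have hσ2 : σ < 1 / (2 * p) := by
    rw [hσ, div_lt_div_iff₀ (by linarith) (by linarith)]; nlinarith
  have hpole : ∀ j, σ < genPole p j ∧ genPole p j ≤ S := by
    have e1 : 1 / (2 * p : ℝ) ≤ 1 / (2 * p - 1) := one_div_le_one_div_of_le (by linarith) (by linarith)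
    have e2 : 1 / (2 * p : ℝ) ≤ 1 / (2 * p - 2) := one_div_le_one_div_of_le (by linarith) (by linarith)
    have e3 : 1 / (2 * p - 1 : ℝ) ≤ S := one_div_le_one_div_of_le (by linarith) (by linarith)
    have e4 : 1 / (2 * p - 2 : ℝ) ≤ S := one_div_le_one_div_of_le (by linarith) (by linarith)
    intro j
    fin_cases j <;> simp only [genPole, q1, r1, Fin.reduceFinMk, Matrix.cons_val] <;>
      constructor <;> linarith
  have hA : 12 / (25 * p : ℝ) < σ := by
    rw [hσ, div_lt_div_iff₀ (by linarith) (by linarith)]; nlinarith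
  obtain ⟨F, c, hF, hFG, Cg, hCg, k, hg⟩ := exists_genF hp hp5 h1 h2 hA
  obtain ⟨C0, hC0, H, hHc, hHd, hGH⟩ := genG_dyadic hp hp5 h1 h2 hd hσ
  have hfs : ∀ s : ℂ, S < s.re → LSeriesSummable (fun n => ((fcA p e1 e2 n : ℝ) : ℂ)) s := fun s hs => by
    simpa [fcA] using fc_summable hp hp5 h1 h2 hs
  have hconv : (fun n => (((κ * fcA p e1 e2) n : ℝ) : ℂ)) =
      LSeries.convolution (fun n => ((κ n : ℝ) : ℂ)) (fun n => ((fcA p e1 e2 n : ℝ) : ℂ)) := by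
    rw [LSeries.convolution_def]; funext n; simp
  have hS1 : S < (((S + 1 : ℝ) : ℂ)).re := by simp
  have hcontF : Continuous fun t : ℝ => ‖F (σ + t * I)‖ :=
    (hF.continuousOn.comp_continuous (by fun_prop) (fun t => by simp)).norm
  have hDy : DyadicBound (fun t : ℝ => ‖F (σ + t * I)‖) (5 * d / 4) := by
    set K := ∑ j, ‖c j‖
    have hK : 0 ≤ K := sum_nonneg fun j _ => norm_nonneg _
    refine DyadicBound.mono hcontF (by fun_prop)
      (DyadicBound.add (by fun_prop) (by fun_prop) (hHd.const_mul hC0) (DyadicBound.const K hK (by positivity)))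
      fun t ht => ?_
    have hne : ∀ j, (σ + t * I : ℂ) ≠ genPole p j := fun j h => by
      have := congrArg re h
      simp at this
      linarith [(hpole j).1]
    have := hFG _ hne
    rw [show F (σ + t * I) = genG p e1 e2 (σ + t * I) - ∑ j, c j * (1 / ((σ + t * I : ℂ) - genPole p j)) by rw [this]; ring]
    refine (norm_sub_le _ _).trans (add_le_add (hGH t) ((norm_sum_le _ _).trans (sum_le_sum fun j _ => ?_)))
    rw [norm_mul, norm_div, norm_one]
    refine mul_le_of_le_one_right (norm_nonneg _) ?_
    have h3 : |t| ≤ ‖(σ + t * I : ℂ) - genPole p j‖ := by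
      simpa using abs_im_le_norm ((σ + t * I : ℂ) - genPole p j)
    rw [div_le_one (by linarith)]; linarith
  obtain ⟨C, x0, hx0, hT⟩ := tauberian univ (genPole p) c (a := fun n => (κ * fcA p e1 e2) n)
    (β' := 3 * d / 2)
    (fun n => by
      rw [ArithmeticFunction.mul_apply]
      exact sum_nonneg fun x _ => mul_nonneg (hκ0 _) (by simp [fcA])) hσ0 (fun j _ => hpole j) hσS
    (by rw [hconv]; exact (hκ _ hS1).1.convolution (hfs _ hS1)) hF
    (fun s hs => by
      have hs1 : S < s.re := by rw [hs]; linarith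
      rw [hconv, LSeries_convolution' (hκ _ hs1).1 (hfs _ hs1), (hκ _ hs1).2]
      have h3 := euler_identity hp hp5 h1 h2 hs1
      have h4 := hFG s (fun j h => by
        have := congrArg re h
        simp at this
        linarith [(hpole j).2])
      rw [genG, ← h3] at h4
      simp only [fcA, coe_mk, ofReal_natCast]
      rw [mul_comm, h4]; ring)
    hg (by positivity) (by linarith) hDy
  set b := fun j => (c j).re / genPole p j
  set θ := (1 / 2 - d / 10) / p with hθ
  have hθ0 : 0 < θ := div_pos (by linarith) (by linarith)
  have hann : ∀ n, 0 ≤ (κ * fcA p e1 e2) n := fun n => by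
    rw [ArithmeticFunction.mul_apply]
    exact sum_nonneg fun x _ => mul_nonneg (hκ0 _) (by simp [fcA])
  refine ⟨b, 3 * |C| + (∑ n ∈ Ioc 0 ⌊x0⌋₊, (κ * fcA p e1 e2) n + ∑ j, |b j| * x0 ^ genPole p j), θ, hθ0, ?_, ?_⟩
  · rw [hθ]; field_simp; linarith
  intro Y hY
  have hY0 : 0 < Y := by linarith
  have hYθ := one_le_rpow hY hθ0.le
  have hnn : 0 ≤ ∑ n ∈ Ioc 0 ⌊x0⌋₊, (κ * fcA p e1 e2) n + ∑ j, |b j| * x0 ^ genPole p j :=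
    add_nonneg (sum_nonneg fun n _ => hann n) (sum_nonneg fun j _ => by positivity)
  rcases le_total x0 Y with h | h
  · have h3 := hT (Y ^ (-(3 / 5) / p : ℝ)) Y (by positivity) (rpow_le_one_of_one_le_of_nonpos hY
      (div_nonpos_of_nonpos_of_nonneg (by norm_num) (by linarith))) h
    have e1 : Y ^ σ * (Y ^ (-(3 / 5) / p : ℝ)) ^ (-(3 * d / 2)) = Y ^ θ := by
      rw [← rpow_mul hY0.le, ← rpow_add hY0]; congr 1; rw [hσ, hθ]; field_simp; ring
    have e2 : Y ^ S * Y ^ (-(3 / 5) / p : ℝ) ≤ Y ^ θ := by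
      rw [← rpow_add hY0]
      refine rpow_le_rpow_of_exponent_le hY ?_
      rw [hS, hθ, ← add_div]; gcongr; linarith
    refine h3.trans ?_
    rw [e1]
    calc C * (Y ^ θ + Y ^ S * Y ^ (-(3 / 5) / p : ℝ) + 1) ≤ |C| * (Y ^ θ + Y ^ θ + Y ^ θ) := by
          gcongr; exact le_abs_self C
      _ ≤ _ := by nlinarith
  · refine (abs_sub _ _).trans ?_
    have e1 : |∑ n ∈ Ioc 0 ⌊Y⌋₊, (κ * fcA p e1 e2) n| ≤ ∑ n ∈ Ioc 0 ⌊x0⌋₊, (κ * fcA p e1 e2) n := by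
      rw [abs_of_nonneg (sum_nonneg fun n _ => hann n)]
      exact sum_le_sum_of_subset_of_nonneg (Ioc_subset_Ioc_right (floor_le_floor h)) fun n _ _ => hann n
    have e2 : |∑ j, b j * Y ^ genPole p j| ≤ ∑ j, |b j| * x0 ^ genPole p j := by
      refine (abs_sum_le_sum_abs _ _).trans (sum_le_sum fun j _ => ?_)
      rw [abs_mul, abs_of_pos (rpow_pos_of_pos hY0 _)]
      have := hσ0.trans (hpole j).1
      gcongr
    have := abs_nonneg C
    nlinarith

/-- The indicator function of the positive `M`-th powers. -/
def powIndicator (M : ℕ) : ArithmeticFunction ℝ := ⟨fun n => if n ≠ 0 ∧ ∃ m : ℕ, n = m ^ M then 1 else 0, by simp⟩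

lemma powIndicator_pow {M m : ℕ} (hm : m ≠ 0) : powIndicator M (m ^ M) = 1 := by
  rw [powIndicator, coe_mk, if_pos ⟨pow_ne_zero _ hm, m, rfl⟩]

lemma powIndicator_LSeries {M : ℕ} (hM : M ≠ 0) {s : ℂ} (hs : 1 < (M * s).re) :
    LSeriesHasSum (fun n => ((powIndicator M n : ℝ) : ℂ)) s (riemannZeta (M * s)) := by
  have hinj := Nat.pow_left_injective hM
  have h0 := (summable_one_div_nat_cpow.2 hs).hasSum
  rw [← zeta_eq_tsum_one_div_nat_cpow hs] at h0
  rw [LSeriesHasSum, ← hinj.hasSum_iff]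
  · refine h0.congr_fun ?_
    intro m
    rcases eq_or_ne m 0 with rfl | hm
    · have : M * s ≠ 0 := fun h => by rw [h] at hs; simp at hs; linarith
      simp [hM, zero_cpow this]
    · simp
      rw [term_of_ne_zero (pow_ne_zero _ hm), powIndicator_pow hm, natCast_cpow_natCast_mul]; simp
  · intro n hn
    rcases eq_or_ne n 0 with rfl | h
    · simp
    · rw [term_of_ne_zero h, powIndicator, coe_mk, if_neg]
      · simp
      · rintro ⟨-, m, rfl⟩; exact hn ⟨m, rfl⟩

lemma sum_powIndicator {M : ℕ} (hM : M ≠ 0) (T : ℕ → ℝ) (hT : T 0 = 0) N :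
    ∑ n ∈ Ioc 0 N, powIndicator M n * T (N / n) = ∑ m ∈ Ioc 0 N, T (N / m ^ M) := by
  have hinj := Nat.pow_left_injective hM
  have h1 : ∑ m ∈ Ioc 0 N, T (N / m ^ M) =
      ∑ n ∈ (Ioc 0 N).image fun m => m ^ M, powIndicator M n * T (N / n) := by
    rw [sum_image fun a _ b _ h => hinj h]
    refine sum_congr rfl fun m hm => ?_
    rw [powIndicator_pow (by simp at hm; omega), one_mul]
  rw [h1]
  have hz : ∀ n, N < n → T (N / n) = 0 := fun n hn => by rw [div_eq_of_lt hn, hT]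
  have : ∀ A : Finset ℕ, ∑ n ∈ A, powIndicator M n * T (N / n) =
      ∑ n ∈ A.filter (fun n => (n ≠ 0 ∧ ∃ m : ℕ, n = m ^ M) ∧ n ≤ N), powIndicator M n * T (N / n) := fun A => by
    rw [sum_filter]
    refine sum_congr rfl fun n _ => ?_
    split_ifs with h
    · rfl
    · rcases not_and_or.1 h with h | h
      · rw [powIndicator, coe_mk, if_neg h, zero_mul]
      · rw [hz n (by omega), mul_zero]
  rw [this, this ((Ioc 0 N).image _)]
  congr 1
  ext n
  simp only [mem_filter, mem_Ioc, mem_image]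
  constructor
  · rintro ⟨-, ⟨h, m, rfl⟩, h2⟩
    refine ⟨⟨m, ⟨Nat.pos_of_ne_zero fun h0 => h (by simp [h0, hM]), ?_⟩, rfl⟩, ⟨h, m, rfl⟩, h2⟩
    exact (Nat.le_self_pow hM m).trans h2
  · rintro ⟨-, h, h2⟩
    exact ⟨⟨Nat.pos_of_ne_zero h.1, h2⟩, h, h2⟩

/-- The asymptotic count of the states. -/
theorem fc_count (hp : p.Prime) (hp5 : 5 ≤ p) {e1 e2 : ℕ} (h1 : e1 ≤ 1) (h2 : e2 ≤ 1) :
    ∃ b : Fin 3 → ℝ, ∃ C : ℝ, ∀ Y : ℝ, 1 ≤ Y →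
      |∑ n ∈ Ioc 0 ⌊Y⌋₊, (fc p e1 e2 n : ℝ) - ∑ j, b j * Y ^ genPole p j| ≤ C * Y ^ (1 / (2 * p : ℝ)) := by
  have hp0 : (5 : ℝ) ≤ p := mod_cast hp5
  have hM : 2 * p ≠ 0 := by omega
  have hmp : ∀ s : ℂ, 1 / p < s.re → 1 < (((2 * p : ℕ) : ℂ) * s).re := fun s hs => by
    rw [div_lt_iff₀ (by linarith)] at hs
    simp
    nlinarith
  obtain ⟨b, C, θ, hθ, hθp, h⟩ := convolution_count (κ := if e1 = 0 then 1 else powIndicator (2 * p)) hp hp5 h1 h2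
    (by
      intro n
      split_ifs
      · rw [ArithmeticFunction.one_apply]; split_ifs <;> norm_num
      · rw [powIndicator, coe_mk]; split_ifs <;> norm_num)
    (by
      intro s hs
      interval_cases e1
      · have e : (fun n => (((1 : ArithmeticFunction ℝ) n : ℝ) : ℂ)) = delta := by
          funext n; rw [ArithmeticFunction.one_apply, delta]; split_ifs <;> simp
        simp only [if_true]
        rw [e, pow_zero, LSeries_delta]
        refine ⟨?_, rfl⟩
        exact (hasSum_ite_eq 1 1).summable.congr fun n => by rw [term_delta]
      · have := powIndicator_LSeries hM (hmp s hs)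
        simp
        refine ⟨this.LSeriesSummable, this.LSeries_eq.trans (by push_cast; rfl)⟩)
  interval_cases e1
  · refine ⟨b, |C|, fun Y hY => ?_⟩
    have := h Y hY
    rw [if_pos rfl, one_mul] at this
    refine this.trans (mul_le_mul (le_abs_self C) (rpow_le_rpow_of_exponent_le hY ?_) (by positivity) (abs_nonneg _))
    rw [le_div_iff₀ (by linarith)]; linarith
  · have hs : ∀ j, 1 < ((2 * p : ℕ) : ℝ) * genPole p j := by
      have q1 : ((2 * p - 2 : ℕ) : ℝ) = 2 * p - 2 := by rw [cast_sub (by omega)]; push_cast; ring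
      have r1 : ((2 * p - 1 : ℕ) : ℝ) = 2 * p - 1 := by rw [cast_sub (by omega)]; push_cast; ring
      intro j
      fin_cases j <;> simp only [genPole, Fin.reduceFinMk, Matrix.cons_val] <;>
        rw [mul_one_div, lt_div_iff₀ (by linarith)] <;> push_cast <;> linarith
    obtain ⟨b', C', h'⟩ := moebius_transfer (T := fun N => ∑ n ∈ Ioc 0 N, (fc p 1 e2 n : ℝ)) (by simp) hM hθ
      (by push_cast; exact hθp) (genPole p) b hs (fun Y hY => by
        have := h Y hY
        rw [if_neg one_ne_zero, sum_Ioc_mul_eq_sum_sum] at this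
        rw [← sum_powIndicator hM (fun N => ∑ n ∈ Ioc 0 N, (fc p 1 e2 n : ℝ)) (by simp)]
        exact this)
    exact ⟨b', C', fun Y hY => by simpa using h' Y hY⟩

end Count

section Tame
open Ideal Function
open scoped Pointwise
variable {S : Type*} [CommRing S] {G : Type*} [Group G] [MulSemiringAction G S] {Q : Ideal S}

lemma smul_mem_pow (σ : G) (hσ : ∀ y ∈ Q, σ • y ∈ Q) n (y : S) (hy : y ∈ Q ^ n) :
    σ • y ∈ Q ^ n := by
  have h1 : Q ≤ Q.comap (MulSemiringAction.toRingHom G S σ) := fun y hy => hσ y hy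
  exact le_comap_pow _ n (pow_right_mono h1 n hy)

lemma inertia_smul_mem {σ : G} (hσ : σ ∈ Q.inertia G) (y : S) (hy : y ∈ Q) : σ • y ∈ Q := by
  have := Q.add_mem (hσ y) hy; simpa using this

/-- An automorphism acting trivially on `S / Q` and on `Q / Q ^ 2` acts trivially on all
`Q ^ i / Q ^ (i + 1)`. -/
lemma smul_sub_mem_pow_succ {τ : G} (h1 : τ ∈ Q.inertia G) (h2 : ∀ y ∈ Q, τ • y - y ∈ Q ^ 2) i :
    ∀ y ∈ Q ^ i, τ • y - y ∈ Q ^ (i + 1) := by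
  induction i with
  | zero => intro y _; simpa using h1 y
  | succ i ih =>
    intro y hy
    induction hy using Submodule.mul_induction_on' with
    | mem_mul_mem a ha b hb =>
      have e : τ • (a * b) - a * b = (τ • a - a) * (τ • b) + a * (τ • b - b) := by
        rw [smul_mul']; ring
      rw [e]
      refine Ideal.add_mem _ ?_ ?_
      · rw [pow_succ]; exact Ideal.mul_mem_mul (ih a ha) (inertia_smul_mem h1 b hb)
      · rw [show i + 1 + 1 = i + 2 by ring, pow_add]; exact Ideal.mul_mem_mul ha (h2 b hb)
    | add a ha b hb iha ihb =>
      rw [smul_add, show τ • a + τ • b - (a + b) = (τ • a - a) + (τ • b - b) by ring]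
      exact Ideal.add_mem _ iha ihb

variable [IsDedekindDomain S] [Q.IsPrime]

lemma eq_one_of_trivial_on_sq [Finite G] [FaithfulSMul G S] (hQ : Q ≠ ⊥) (hG : (Nat.card G : S) ∉ Q) {τ : G}
    (h1 : τ ∈ Q.inertia G) (h2 : ∀ y ∈ Q, τ • y - y ∈ Q ^ 2) : τ = 1 := by
  have hmax := IsPrime.isMaximal ‹_› hQ
  have key : ∀ i : ℕ, ∀ x : S, τ • x - x ∈ Q ^ i := by
    intro i
    induction i with
    | zero => intro x; simp
    | succ i ih =>
      intro x
      rcases Nat.eq_zero_or_pos i with rfl | hi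
      · simpa using h1 x
      have hd := ih x
      set δ := τ • x - x
      have hk : ∀ k : ℕ, τ ^ k • x - x - k * δ ∈ Q ^ (i + 1) := by
        intro k
        induction k with
        | zero => simp
        | succ k ihk =>
          have e : τ ^ (k + 1) • x - x - ((k + 1 : ℕ) : S) * δ =
              τ • (τ ^ k • x - x - k * δ) + k * (τ • δ - δ) := by
            rw [pow_succ', mul_smul, smul_sub, smul_sub, smul_mul']
            have : τ • (k : S) = k := map_natCast (MulSemiringAction.toRingHom G S τ) k
            rw [this]; push_cast; simp only [δ]; ring
          rw [e]
          exact Ideal.add_mem _ (smul_mem_pow τ (inertia_smul_mem h1) _ _ ihk)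
            (mul_mem_left _ _ (smul_sub_mem_pow_succ h1 h2 i δ hd))
      have := hk (Nat.card G)
      rw [pow_card_eq_one', one_smul, sub_self, zero_sub, neg_mem_iff] at this
      exact (IsMaximal.mul_mem_pow Q this).resolve_left hG
  refine FaithfulSMul.eq_of_smul_eq_smul (α := S) fun x => ?_
  have : τ • x - x ∈ (⨅ i : ℕ, Q ^ i) := by
    simp; exact fun i => key i x
  rw [iInf_pow_eq_bot_of_isDomain Q hmax.ne_top, Ideal.mem_bot, sub_eq_zero] at this
  simpa using this

end Tame

section TameCard
variable {S : Type*} [CommRing S] [IsDedekindDomain S] {G : Type*} [CommGroup G] [Finite G] [MulSemiringAction G S]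
  [FaithfulSMul G S] [Algebra.IsInvariant ℤ S G]

/-- Tame inertia groups in abelian extensions of `ℚ` have order at most `ℓ - 1`. -/
theorem card_inertia_le {ℓ : ℕ} (hl : ℓ.Prime) (Q : Ideal S) [Q.IsPrime] (hQ : Q ≠ ⊥) [Finite (S ⧸ Q)]
    (hQl : Q.under ℤ = Ideal.span {(ℓ : ℤ)}) (hG : ¬ ℓ ∣ Nat.card G) : Nat.card (Q.inertia G) ≤ ℓ - 1 := by
  have hmax := Ideal.IsPrime.isMaximal ‹_› hQ
  have hG' : (Nat.card G : S) ∉ Q := by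
    intro h
    have : ((Nat.card G : ℕ) : ℤ) ∈ Q.under ℤ := by simpa using h
    rw [hQl, Ideal.mem_span_singleton] at this
    exact hG (mod_cast this)
  obtain ⟨π, hπ, hπ2⟩ : ∃ π ∈ Q, π ∉ Q ^ 2 := by
    have : Q ^ 2 < Q := by simpa using Ideal.pow_succ_lt_pow hQ 1
    exact Set.exists_of_ssubset this
  have ht : ∀ σ : Q.inertia G, ∃ t : S, ∀ y ∈ Q, σ.1 • y - t * y ∈ Q ^ 2 := by
    intro σ
    obtain ⟨t, e, he, hte⟩ := Ideal.exists_mul_add_mem_pow_succ hQ (i := 1) π (σ.1 • π) (by simpa using hπ)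
      (by simpa using hπ2) (by simpa using inertia_smul_mem σ.2 π hπ)
    refine ⟨t, fun y hy => ?_⟩
    obtain ⟨d, e', he', hde⟩ := Ideal.exists_mul_add_mem_pow_succ hQ (i := 1) π y (by simpa using hπ)
      (by simpa using hπ2) (by simpa using hy)
    have : σ.1 • y - t * y = π * t * (σ.1 • d - d) + e * σ.1 • d + σ.1 • e' - t * e' := by
      rw [← hde, smul_add, smul_mul', ← hte]; ring
    rw [this]
    refine Ideal.sub_mem _ (Ideal.add_mem _ (Ideal.add_mem _ ?_ (Ideal.mul_mem_right _ _ he)) ?_)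
      (Ideal.mul_mem_left _ _ he')
    · rw [pow_two]; exact Ideal.mul_mem_mul (Ideal.mul_mem_right _ _ hπ) (σ.2 d)
    · exact smul_mem_pow _ (inertia_smul_mem σ.2) _ _ he'
  choose t ht using ht
  have hcancel : ∀ a b : S, b ∈ Q → b ∉ Q ^ 2 → a * b ∈ Q ^ 2 → a ∈ Q := fun a b _ hb2 hab =>
    (Ideal.IsMaximal.mul_mem_pow Q hab).resolve_right hb2
  let f : Q.inertia G → S ⧸ Q := fun σ => Ideal.Quotient.mk Q (t σ)
  have hf : Function.Injective f := by
    intro σ σ' h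
    have h' := Ideal.Quotient.eq.1 h
    have : (σ'⁻¹ * σ).1 = 1 := by
      refine eq_one_of_trivial_on_sq hQ hG' (σ'⁻¹ * σ).2 fun y hy => ?_
      have e : σ.1 • y - σ'.1 • y ∈ Q ^ 2 := by
        have e1 : σ.1 • y - σ'.1 • y = (σ.1 • y - t σ * y) - (σ'.1 • y - t σ' * y) + (t σ - t σ') * y := by ring
        rw [e1]
        refine Ideal.add_mem _ (Ideal.sub_mem _ (ht σ y hy) (ht σ' y hy)) ?_
        rw [pow_two]; exact Ideal.mul_mem_mul h' hy
      have := smul_mem_pow _ (inertia_smul_mem σ'⁻¹.2) _ _ e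
      rw [smul_sub, smul_smul, smul_smul] at this
      simpa using this
    have : σ'⁻¹ * σ = 1 := Subtype.ext this
    exact (inv_mul_eq_one.1 this).symm
  obtain ⟨φ, hφ⟩ := IsArithFrobAt.exists_of_isInvariant ℤ G Q
  have hcard : Nat.card (ℤ ⧸ Q.under ℤ) = ℓ := by
    rw [hQl, Nat.card_congr (Int.quotientSpanNatEquivZMod ℓ).toEquiv, Nat.card_zmod]
  have hφ' : ∀ x, φ • x - x ^ ℓ ∈ Q := by
    intro x; have := hφ x; rwa [hcard] at this
  have hφQ : ∀ y ∈ Q, φ • y ∈ Q := by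
    intro y hy
    have := Ideal.add_mem _ (hφ' y) (Ideal.pow_mem_of_mem Q hy ℓ hl.pos); simpa using this
  have hφQ' : ∀ y ∈ Q, φ⁻¹ • y ∈ Q := by
    intro y hy
    have := hφ' (φ⁻¹ • y)
    rw [smul_inv_smul] at this
    have h2 := Ideal.sub_mem _ hy this
    rw [sub_sub_cancel] at h2
    exact Ideal.IsPrime.mem_of_pow_mem ‹_› _ h2
  have hφπ2 : φ • π ∉ Q ^ 2 := fun h => hπ2 (by simpa using smul_mem_pow φ⁻¹ hφQ' 2 _ h)
  have hf0 : ∀ σ, f σ ^ (ℓ - 1) = 1 := by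
    intro σ
    have h0 : f σ ≠ 0 := by
      intro h
      have htq := Ideal.Quotient.eq_zero_iff_mem.1 h
      have h1 := Ideal.add_mem _ (ht σ π hπ) (show t σ * π ∈ Q ^ 2 by rw [pow_two]; exact Ideal.mul_mem_mul htq hπ)
      have := smul_mem_pow _ (inertia_smul_mem σ⁻¹.2) 2 _ h1
      exact hπ2 (by simpa using this)
    have h1 := ht σ (φ • π) (hφQ π hπ)
    have h2 := smul_mem_pow φ hφQ 2 _ (ht σ π hπ)
    rw [smul_sub, smul_mul', smul_smul, mul_comm φ, ← smul_smul] at h2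
    have h3 : (φ • t σ - t σ) * φ • π ∈ Q ^ 2 := by
      have := Ideal.sub_mem _ h1 h2
      rwa [sub_sub_sub_cancel_left, ← sub_mul] at this
    have h4 := hcancel _ _ (hφQ π hπ) hφπ2 h3
    have h5 : (t σ) ^ ℓ - t σ ∈ Q := by
      have := Ideal.sub_mem _ h4 (hφ' (t σ)); simpa using this
    have h6 : f σ ^ ℓ = f σ := by
      have := Ideal.Quotient.eq.2 h5
      simpa [f] using this
    have h7 : f σ * f σ ^ (ℓ - 1) = f σ * 1 := by
      rw [← pow_succ', Nat.sub_add_cancel hl.one_le, h6, mul_one]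
    exact mul_left_cancel₀ h0 h7
  have hpos := Nat.sub_pos_of_lt hl.one_lt
  let g : Q.inertia G → (Polynomial.nthRoots (ℓ - 1) (1 : S ⧸ Q)).toFinset := fun σ =>
    ⟨f σ, by rw [Multiset.mem_toFinset, Polynomial.mem_nthRoots hpos]; exact hf0 σ⟩
  have hg : Function.Injective g := fun a b h => hf (congrArg Subtype.val h)
  calc Nat.card (Q.inertia G) ≤ Nat.card (Polynomial.nthRoots (ℓ - 1) (1 : S ⧸ Q)).toFinset :=
        Nat.card_le_card_of_injective g hg
    _ ≤ ℓ - 1 := by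
        rw [Nat.card_eq_fintype_card, Fintype.card_coe]
        exact (Multiset.toFinset_card_le _).trans (Polynomial.card_nthRoots _ _)

end TameCard

section Different
open AlgEquiv Ideal Module Nat Finset Set
open scoped Pointwise NumberField
open NumberField

variable (K : Type*) [Field K] [NumberField K]

lemma mem_differentIdeal_iff (x : 𝓞 K) : x ∈ differentIdeal ℤ (𝓞 K) ↔
    ∀ y : K, (∀ a : 𝓞 K, ∃ n : ℤ, n = Algebra.trace ℚ K (y * a)) → ∃ b : 𝓞 K, (b : K) = x * y := by
  have h := coeSubmodule_differentIdeal ℤ ℚ (L := K)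
  have h1 : x ∈ differentIdeal ℤ (𝓞 K) ↔ (algebraMap (𝓞 K) K x) ∈
      IsLocalization.coeSubmodule K (differentIdeal ℤ (𝓞 K)) := by
    constructor
    · intro h; exact ⟨x, h, rfl⟩
    · rintro ⟨y, hy, hxy⟩
      rwa [← (FaithfulSMul.algebraMap_injective (𝓞 K) K hxy)]
  rw [h1, h, Submodule.mem_div_iff_forall_mul_mem]
  refine forall_congr' fun y => ?_
  rw [Submodule.mem_one]
  refine imp_congr ?_ Iff.rfl
  constructor
  · intro H a
    obtain ⟨n, hn⟩ := H a (Submodule.mem_one.2 ⟨a, rfl⟩)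
    exact ⟨n, by simpa using hn⟩
  · intro H a ha
    obtain ⟨a, rfl⟩ := Submodule.mem_one.1 ha
    obtain ⟨n, hn⟩ := H a
    exact ⟨n, by simpa using hn⟩

variable {K}

lemma smul_coe (σ : K ≃ₐ[ℚ] K) (x : 𝓞 K) : ((σ • x : 𝓞 K) : K) = σ x := by
  rfl

lemma smul_mem_differentIdeal (σ : K ≃ₐ[ℚ] K) (x : 𝓞 K) (hx : x ∈ differentIdeal ℤ (𝓞 K)) :
    σ • x ∈ differentIdeal ℤ (𝓞 K) := by
  rw [mem_differentIdeal_iff] at hx ⊢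
  intro y hy
  obtain ⟨b, hb⟩ := hx (σ.symm y) (fun a => by
    obtain ⟨n, hn⟩ := hy (σ • a)
    refine ⟨n, hn.trans ?_⟩
    rw [smul_coe, ← Algebra.trace_eq_of_algEquiv σ (σ.symm y * a), map_mul σ, apply_symm_apply])
  refine ⟨σ • b, ?_⟩
  rw [smul_coe, hb, smul_coe, map_mul, apply_symm_apply]

lemma smul_differentIdeal (σ : K ≃ₐ[ℚ] K) : σ • differentIdeal ℤ (𝓞 K) = differentIdeal ℤ (𝓞 K) := by
  have h : ∀ τ : K ≃ₐ[ℚ] K, τ • differentIdeal ℤ (𝓞 K) ≤ differentIdeal ℤ (𝓞 K) := by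
    intro τ x hx
    obtain ⟨y, hy, rfl⟩ := mem_map_iff_of_surjective _ (MulSemiringAction.toRingEquiv _ (𝓞 K) τ).surjective |>.1 hx
    exact smul_mem_differentIdeal τ y hy
  refine le_antisymm (h σ) ?_
  have := pointwise_smul_subset_iff (a := σ⁻¹) |>.1 (h _)
  simpa using this

variable [IsGalois ℚ K]

/-- The `ℓ`-part of the discriminant of a Galois number field. -/
theorem factorization_discr {ℓ : ℕ} (hl : ℓ.Prime) :
    ∃ k, (discr K).natAbs.factorization ℓ * (span {(ℓ : ℤ)}).ramificationIdxIn (𝓞 K) = k * finrank ℚ K ∧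
      (span {(ℓ : ℤ)}).ramificationIdxIn (𝓞 K) - 1 ≤ k ∧
      k < (span {(ℓ : ℤ)}).ramificationIdxIn (𝓞 K) * ((finrank ℚ K).factorization ℓ + 1) := by
  set p := span {(ℓ : ℤ)} with hp
  have hlz : (ℓ : ℤ) ≠ 0 := mod_cast hl.ne_zero
  have hp0 : p ≠ ⊥ := by rw [hp, Ne, span_singleton_eq_bot]; exact hlz
  have hpP := (span_singleton_prime hlz).2 (prime_iff_prime_int.1 hl)
  have hpM := hpP.isMaximal hp0
  set e := p.ramificationIdxIn (𝓞 K) with he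
  set N := finrank ℚ K
  have hN0 : 0 < N := finrank_pos
  set D := differentIdeal ℤ (𝓞 K) with hD
  have hD0 : D ≠ 0 := differentIdeal_ne_bot
  set J := ∏ P ∈ IsDedekindDomain.primesOverFinset p (𝓞 K), P with hJ
  have hmem : ∀ {P : Ideal (𝓞 K)}, P ∈ IsDedekindDomain.primesOverFinset p (𝓞 K) ↔ P ∈ p.primesOver (𝓞 K) :=
    IsDedekindDomain.mem_primesOverFinset_iff hp0 _
  have hJe : J ^ e = p.map (algebraMap ℤ (𝓞 K)) := by
    rw [map_algebraMap_eq_finsetProd_pow hp0, hJ, ← Finset.prod_pow]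
    refine prod_congr ?_ fun P hP => ?_
    · ext P; rw [mem_toFinset]; exact hmem
    · rw [mem_toFinset] at hP
      have := hP.1; have := hP.2
      rw [he, ramificationIdxIn_eq_ramificationIdx p P (K ≃ₐ[ℚ] K)]
  have he0 : e ≠ 0 := ramificationIdxIn_ne_zero (K ≃ₐ[ℚ] K)
  have hmap0 : p.map (algebraMap ℤ (𝓞 K)) ≠ 0 := by
    rw [hp, map_span, Set.image_singleton]; simpa using hl.ne_zero
  have hJ0 : J ≠ 0 := by
    intro h; rw [h, zero_pow he0] at hJe; exact hmap0 hJe.symm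
  have hJN : J.absNorm ^ e = ℓ ^ N := by
    rw [← map_pow, hJe, absNorm_algebraMap, hp, absNorm_span_singleton]
    congr 1
    · simp
    · exact (IsFractionRing.finrank_eq ℤ ℚ (𝓞 K) K).symm
  have hJu : ¬ IsUnit J := by
    intro h
    have := isUnit_iff_eq_one.1 (h.map (absNorm))
    rw [this, one_pow] at hJN
    exact (one_lt_pow hN0.ne' hl.one_lt).ne hJN
  have hσJ : ∀ σ : K ≃ₐ[ℚ] K, σ • J = J := by
    intro σ
    have h1 : σ • J = ∏ P ∈ IsDedekindDomain.primesOverFinset p (𝓞 K), σ • P := by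
      rw [hJ]; exact map_prod (MulDistribMulAction.toMonoidHom (Ideal (𝓞 K)) σ) _ _
    rw [h1, hJ]
    refine prod_bijective (fun P => σ • P) (MulAction.bijective σ) (fun P => ?_) (fun _ _ => rfl)
    rw [hmem, hmem]
    constructor
    · rintro ⟨h1, h2⟩; exact ⟨inferInstance, inferInstance⟩
    · rintro ⟨h1, h2⟩
      have := inv_smul_smul σ P
      rw [← this]
      exact ⟨inferInstance, inferInstance⟩
  obtain ⟨D', hD', hDk⟩ := (FiniteMultiplicity.of_not_isUnit hJu hD0).exists_eq_pow_mul_and_not_dvd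
  generalize multiplicity J D = k at hD'
  have hσD' : ∀ σ : K ≃ₐ[ℚ] K, σ • D' = D' := by
    intro σ
    have h1 : J ^ k * (σ • D') = J ^ k * D' := by
      have h2 := smul_differentIdeal σ
      have h3 : σ • (J ^ k * D') = J ^ k * (σ • D') := by rw [smul_mul', smul_pow', hσJ]
      rw [← h3, ← hD', h2]
    exact mul_left_cancel₀ (pow_ne_zero _ hJ0) h1
  have hcop : ¬ ℓ ∣ D'.absNorm := by
    intro h
    obtain ⟨P, hPm, hPu, hPd⟩ := exists_isMaximal_dvd_of_dvd_absNorm' hl D' h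
    have hP : P.LiesOver p := ⟨hPu.symm⟩
    refine hDk ?_
    refine prod_dvd_of_coprime ?_ ?_
    · intro P1 h1 P2 h2 h12
      rw [mem_coe, hmem] at h1 h2
      have i1 := h1.1.isMaximal (by have := h1.2; exact ne_bot_of_liesOver_of_ne_bot hp0 P1)
      have i2 := h2.1.isMaximal (by have := h2.2; exact ne_bot_of_liesOver_of_ne_bot hp0 P2)
      exact (isCoprime_of_isMaximal h12)
    · intro P' h'
      rw [hmem] at h'
      have := h'.1; have := h'.2
      obtain ⟨σ, hσ⟩ := exists_smul_eq_of_isGaloisGroup p P P' (K ≃ₐ[ℚ] K)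
      rw [← hσ, ← hσD' σ]
      rw [dvd_iff_le] at hPd ⊢
      exact pointwise_smul_le_pointwise_smul_iff.2 hPd
  have hfac : (discr K).natAbs.factorization ℓ = k * J.absNorm.factorization ℓ := by
    rw [← absNorm_differentIdeal K (𝓞 K), ← hD, hD', map_mul, map_pow, Nat.factorization_mul, Nat.factorization_pow]
    · simp [factorization_eq_zero_of_not_dvd hcop]
    · exact pow_ne_zero _ (by rwa [Ne, absNorm_eq_zero_iff])
    · intro h0; exact hcop (h0 ▸ dvd_zero _)
  have hJf : e * J.absNorm.factorization ℓ = N := by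
    have := congrArg (fun n => n.factorization ℓ) hJN
    simpa [Nat.factorization_pow, hl.factorization_self] using this
  refine ⟨k, ?_, ?_, ?_⟩
  · rw [hfac, ← hJf]; ring
  · have h1 := pow_sub_one_dvd_differentIdeal ℤ J e hp0 (by rw [hJe])
    by_contra! hlt
    have h2 : J ^ (k + 1) ∣ D := (pow_dvd_pow _ hlt).trans h1
    rw [hD', pow_succ] at h2
    exact hDk ((mul_dvd_mul_iff_left (pow_ne_zero _ hJ0)).1 h2)
  · by_contra! hle
    set m := N.factorization ℓ + 1
    have h1 : J ^ (e * m) ∣ D := by rw [hD']; exact (pow_dvd_pow _ hle).mul_right _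
    refine not_dvd_differentIdeal_of_intTrace_not_mem ℤ (p := p ^ m) (J ^ (e * m)) ⊤ ?_ 1 trivial ?_ h1
    · rw [pow_mul, hJe, Ideal.map_pow, mul_top]
    · have : Algebra.intTrace ℤ (𝓞 K) 1 = N := by
        rw [Algebra.intTrace_eq_trace, ← map_one (algebraMap ℤ (𝓞 K)), Algebra.trace_algebraMap]
        have : finrank ℤ (𝓞 K) = N := (IsFractionRing.finrank_eq ℤ ℚ (𝓞 K) K).symm
        simp [this]
      rw [this, hp, span_singleton_pow, mem_span_singleton]
      norm_cast
      rw [hl.pow_dvd_iff_le_factorization hN0.ne']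
      simp [m]

/-- The discriminant exponent at a tamely ramified prime. -/
theorem factorization_discr_tame {ℓ : ℕ} (hl : ℓ.Prime) (hN : ¬ ℓ ∣ finrank ℚ K) :
    (discr K).natAbs.factorization ℓ * (span {(ℓ : ℤ)}).ramificationIdxIn (𝓞 K) =
      ((span {(ℓ : ℤ)}).ramificationIdxIn (𝓞 K) - 1) * finrank ℚ K := by
  obtain ⟨k, h1, h2, h3⟩ := factorization_discr (K := K) hl
  rw [factorization_eq_zero_of_not_dvd hN, zero_add, mul_one] at h3
  rw [h1, show k = (span {(ℓ : ℤ)}).ramificationIdxIn (𝓞 K) - 1 by omega]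

/-- The discriminant exponent only depends on the ramification index, up to the degree. -/
theorem factorization_discr_tower (L M : Type*) [Field L] [NumberField L] [Field M] [NumberField M]
    [Algebra L M] [IsGalois ℚ L] [IsGalois ℚ M] {ℓ : ℕ} (hl : ℓ.Prime)
    (he : (span {(ℓ : ℤ)}).ramificationIdxIn (𝓞 L) = (span {(ℓ : ℤ)}).ramificationIdxIn (𝓞 M)) :
    (discr M).natAbs.factorization ℓ = finrank L M * (discr L).natAbs.factorization ℓ := by
  set p := span {(ℓ : ℤ)} with hp
  have hlz : (ℓ : ℤ) ≠ 0 := mod_cast hl.ne_zero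
  have hp0 : p ≠ ⊥ := by rw [hp, Ne, span_singleton_eq_bot]; exact hlz
  have hpP := (span_singleton_prime hlz).2 (prime_iff_prime_int.1 hl)
  have hcop : ¬ ℓ ∣ absNorm (differentIdeal (𝓞 L) (𝓞 M)) := by
    intro h
    obtain ⟨P, hPm, hPu, hPd⟩ := exists_isMaximal_dvd_of_dvd_absNorm' hl _ h
    have hPl : P.LiesOver p := ⟨hPu.symm⟩
    rw [dvd_differentIdeal_iff] at hPd
    apply hPd
    set q := P.under (𝓞 L) with hq
    rw [← ramificationIdx_eq_one_iff]
    have h1 := ramificationIdx_tower (R := ℤ) q P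
    rw [← ramificationIdxIn_eq_ramificationIdx p P (M ≃ₐ[ℚ] M),
      ← ramificationIdxIn_eq_ramificationIdx p q (L ≃ₐ[ℚ] L), ← he] at h1
    exact Nat.eq_of_mul_eq_mul_left (Nat.pos_of_ne_zero (ramificationIdxIn_ne_zero (L ≃ₐ[ℚ] L)))
      (h1.symm.trans (mul_one _).symm)
  rw [natAbs_discr_eq_absNorm_differentIdeal_mul_natAbs_discr_pow L (𝓞 L) M (𝓞 M), Nat.factorization_mul,
    Nat.factorization_pow]
  · simp [factorization_eq_zero_of_not_dvd hcop]
  · intro h0; exact hcop (h0 ▸ dvd_zero _)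
  · exact pow_ne_zero _ (Int.natAbs_ne_zero.2 (discr_ne_zero L))

end Different

local notation "Ω" => AlgebraicClosure ℚ
local notation "Γ" => (AlgebraicClosure ℚ ≃ₐ[ℚ] AlgebraicClosure ℚ)

section InertiaGroups
open AlgEquiv Ideal
open scoped Pointwise NumberField
open NumberField

lemma coe_smul_ringOfIntegers {E : Type*} [Field E] {G : Type*} [Group G] [MulSemiringAction G E] (σ : G) (x : 𝓞 E) :
    ((σ • x : 𝓞 E) : E) = σ • (x : E) := rfl

instance isAlgClosure_rat : IsAlgClosure ℚ Ω := by
  convert (inferInstance : @IsAlgClosure ℚ Ω _ _ (AlgebraicClosure.instAlgebra ℚ) _)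
  exact Subsingleton.elim _ _

instance isGalois_rat : IsGalois ℚ Ω := IsAlgClosure.isGalois _ _

section
variable (K : IntermediateField ℚ Ω)

instance : SMulCommClass (Ω ≃ₐ[K] Ω) (𝓞 K) (𝓞 Ω) where
  smul_comm g a x := by
    have h : g • algebraMap (𝓞 K) (𝓞 Ω) a = algebraMap (𝓞 K) (𝓞 Ω) a := RingOfIntegers.ext (g.commutes a)
    rw [Algebra.smul_def, Algebra.smul_def, smul_mul', h]

instance : Algebra.IsInvariant (𝓞 K) (𝓞 Ω) (Ω ≃ₐ[K] Ω) where
  isInvariant x hx := by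
    have h1 := (InfiniteGalois.mem_range_algebraMap_iff_fixed (k := K) (x : Ω)).2 fun f => by
      exact congrArg (fun z : 𝓞 Ω => (z : Ω)) (hx f)
    obtain ⟨y, hy⟩ := h1
    have hy' : IsIntegral ℤ y := (isIntegral_algebraMap_iff (FaithfulSMul.algebraMap_injective K Ω)).1 (hy ▸ x.2)
    exact ⟨⟨y, hy'⟩, RingOfIntegers.ext hy⟩

/-- Inertia elements of a finite layer lift to inertia elements of the absolute Galois group. -/
theorem exists_mem_inertia_restrict [IsGalois ℚ K] (Q : Ideal (𝓞 Ω)) [Q.IsPrime]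
    (τ : K ≃ₐ[ℚ] K) (hτ : τ ∈ (Q.under (𝓞 K)).inertia (K ≃ₐ[ℚ] K)) :
    ∃ σ ∈ Q.inertia Γ, restrictNormalHom K σ = τ := by
  letI : TopologicalSpace (𝓞 Ω) := ⊥
  have : DiscreteTopology (𝓞 Ω) := ⟨rfl⟩
  have : ContinuousSMul (Ω ≃ₐ[K] Ω) (𝓞 Ω) := by
    rw [continuousSMul_iff_stabilizer_isOpen]
    intro x
    convert stabilizer_isOpen_of_isIntegral (K := K) (x : Ω) using 2
    ext g
    exact RingOfIntegers.ext_iff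
  obtain ⟨σ₀, hσ₀⟩ := restrictNormalHom_surjective Ω τ
  have hres : ∀ (σ : Γ), restrictNormalHom K σ = τ → ∀ a : 𝓞 K,
      σ • algebraMap (𝓞 K) (𝓞 Ω) a = algebraMap (𝓞 K) (𝓞 Ω) (τ • a) := by
    intro σ hσ a
    apply RingOfIntegers.ext
    rw [coe_smul_ringOfIntegers, ← hσ]
    exact (restrictNormal_commutes σ K a).symm
  have hlift : ∀ (g : Ω ≃ₐ[K] Ω) (σ : Γ), restrictNormalHom K (g.restrictScalars ℚ * σ) =
      restrictNormalHom K σ := by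
    intro g σ
    ext x
    have := restrictNormal_commutes (g.restrictScalars ℚ * σ) K x
    have h2 := restrictNormal_commutes σ K x
    exact this.trans ((congrArg g h2.symm).trans (g.commutes _))
  have hunder : Q.under (𝓞 K) = (σ₀ • Q).under (𝓞 K) := by
    ext a
    have h1 : a ∈ (σ₀ • Q).under (𝓞 K) ↔ σ₀⁻¹ • algebraMap (𝓞 K) (𝓞 Ω) a ∈ Q := by
      rw [Ideal.mem_comap, ← mem_inv_pointwise_smul_iff, inv_inv]
    have h2 : σ₀⁻¹ • algebraMap (𝓞 K) (𝓞 Ω) a = algebraMap (𝓞 K) (𝓞 Ω) (τ⁻¹ • a) := by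
      rw [inv_smul_eq_iff, hres _ hσ₀, smul_inv_smul]
    rw [h1, h2]
    have h3 := inv_mem hτ a
    constructor
    · intro h; exact Ideal.mem_comap.1 (by simpa using add_mem h3 h)
    · intro h
      simpa using sub_mem h h3
  obtain ⟨g, hg⟩ := Algebra.IsInvariant.exists_smul_of_under_eq_of_profinite (G := Ω ≃ₐ[K] Ω)
    (σ₀ • Q) Q hunder.symm
  set σ₁ := g.restrictScalars ℚ * σ₀ with hσ₁
  have hr1 : restrictNormalHom K σ₁ = τ := (hlift _ _).trans hσ₀
  have hst : σ₁ • Q = Q := by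
    rw [hσ₁, mul_smul]; exact hg.symm
  let f : (𝓞 Ω ⧸ Q) ≃+* (𝓞 Ω ⧸ Q) := quotientEquiv Q Q (MulSemiringAction.toRingEquiv Γ (𝓞 Ω) σ₁) hst.symm
  have hf : ∀ x : 𝓞 Ω, f (Ideal.Quotient.mk Q x) = Ideal.Quotient.mk Q (σ₁ • x) := fun x => rfl
  let F : (𝓞 Ω ⧸ Q) ≃ₐ[𝓞 K ⧸ Q.under (𝓞 K)] (𝓞 Ω ⧸ Q) := ofRingEquiv (by
    intro x
    obtain ⟨a, rfl⟩ := Ideal.Quotient.mk_surjective x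
    rw [Ideal.Quotient.algebraMap_mk_of_liesOver, hf, hres _ hr1, Ideal.Quotient.eq, ← map_sub]
    exact hτ a)
  obtain ⟨h, hh⟩ := Ideal.Quotient.stabilizerHom_surjective_of_profinite (Q.under (𝓞 K)) Q (G := Ω ≃ₐ[K] Ω) F
  refine ⟨(h⁻¹ : Ω ≃ₐ[K] Ω).restrictScalars ℚ * σ₁, ?_, (hlift _ _).trans hr1⟩
  intro x
  have h1 : Ideal.Quotient.mk Q (σ₁ • x) = Ideal.Quotient.mk Q ((h : Ω ≃ₐ[K] Ω) • x) := by
    exact (congrArg (fun z => z (Ideal.Quotient.mk Q x)) hh).symm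
  rw [Ideal.Quotient.eq] at h1
  have h2 : (h : Ω ≃ₐ[K] Ω)⁻¹ • (σ₁ • x - (h : Ω ≃ₐ[K] Ω) • x) ∈ (h : Ω ≃ₐ[K] Ω)⁻¹ • Q := smul_mem_pointwise_smul _ _ _ h1
  have h3 : (h : Ω ≃ₐ[K] Ω)⁻¹ • Q = Q := by rw [inv_smul_eq_iff]; exact h.2.symm
  rw [h3, smul_sub, inv_smul_smul] at h2
  exact h2

end
end InertiaGroups

section Layers
open Ideal Subgroup AlgEquiv MonoidHom Module
open scoped Pointwise NumberField
open NumberField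

lemma exists_prime_over (ℓ : ℕ) : ∃ Q : Ideal (𝓞 Ω), ℓ.Prime → Q.IsPrime ∧ Q.under ℤ = span {(ℓ : ℤ)} := by
  by_cases hl : ℓ.Prime
  · have hlz : (ℓ : ℤ) ≠ 0 := mod_cast hl.ne_zero
    have hpP := (span_singleton_prime hlz).2 (Nat.prime_iff_prime_int.1 hl)
    obtain ⟨Q, hQ⟩ := exists_ideal_over_prime_of_isIntegral_of_isDomain (span {(ℓ : ℤ)}) (by
      rw [(RingHom.injective_iff_ker_eq_bot _).1 (FaithfulSMul.algebraMap_injective ℤ (𝓞 Ω))]; exact bot_le)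
    exact ⟨Q, fun _ => hQ⟩
  · exact ⟨⊥, fun h => absurd h hl⟩

/-- A prime of `𝓞 Ω` above `ℓ`. -/
def primeOver (ℓ : ℕ) : Ideal (𝓞 Ω) := (exists_prime_over ℓ).choose

/-- An inertia group at `ℓ` in the absolute Galois group of `ℚ`. -/
def Iner (ℓ : ℕ) : Subgroup Γ := (primeOver ℓ).inertia Γ

variable {A B : Type*} [CommGroup A] [CommGroup B]

/-- The field cut out by a character. -/
def layer (φ : Γ →* A) : IntermediateField ℚ Ω := IntermediateField.fixedField φ.ker

section
variable {φ : Γ →* A} (hφ : IsOpen (φ.ker : Set Γ)) {ψ : Γ →* B} (hψ : IsOpen (ψ.ker : Set Γ))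
include hφ

lemma fixingSubgroup_layer : (layer φ).fixingSubgroup = φ.ker :=
  InfiniteGalois.fixingSubgroup_fixedField ⟨φ.ker, isClosed_of_isOpen _ hφ⟩

lemma layer_finite_isGalois : FiniteDimensional ℚ (layer φ) ∧ IsGalois ℚ (layer φ) := by
  have h := InfiniteGalois.isOpen_and_normal_iff_finite_and_isGalois (layer φ)
  rw [fixingSubgroup_layer hφ] at h
  exact h.1 ⟨hφ, inferInstance⟩

lemma restrictNormalHom_ker_layer [IsGalois ℚ (layer φ)] :
    (restrictNormalHom (layer φ)).ker = φ.ker := by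
  have h := IsGalois.to_normal (F := ℚ) (E := layer φ)
  exact (@IntermediateField.restrictNormalHom_ker _ _ _ _ _ (layer φ) h).trans (fixingSubgroup_layer hφ)

lemma card_map_layer [IsGalois ℚ (layer φ)] (H : Subgroup Γ) :
    Nat.card (H.map (restrictNormalHom (layer φ))) = Nat.card (H.map φ) := by
  rw [← relIndex_ker, ← relIndex_ker, restrictNormalHom_ker_layer hφ]

lemma card_aut_layer [IsGalois ℚ (layer φ)] : Nat.card (layer φ ≃ₐ[ℚ] layer φ) = Nat.card φ.range := by
  have h := card_map_layer hφ ⊤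
  rw [← range_eq_map, ← range_eq_map,
    range_eq_top.2 (restrictNormalHom_surjective Ω)] at h
  rw [← h, Nat.card_congr topEquiv.toEquiv]

lemma finrank_layer : finrank ℚ (layer φ) = Nat.card φ.range := by
  obtain ⟨h1, h2⟩ := layer_finite_isGalois hφ
  rw [← card_aut_layer hφ, IsGalois.card_aut_eq_finrank]

lemma absDisc_layer [NumberField (layer φ)] : absDisc (layer φ) = (discr (layer φ)).natAbs := by
  have h1 := (layer_finite_isGalois hφ).1
  rw [absDisc, dif_pos h1]

lemma map_restrict_Iner [IsGalois ℚ (layer φ)] {ℓ : ℕ} (hl : ℓ.Prime) :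
    (Iner ℓ).map (restrictNormalHom (layer φ)) =
      ((primeOver ℓ).under (𝓞 (layer φ))).inertia (layer φ ≃ₐ[ℚ] layer φ) := by
  have hQ : (primeOver ℓ).IsPrime := ((exists_prime_over ℓ).choose_spec hl).1
  apply le_antisymm
  · rintro _ ⟨σ, hσ, rfl⟩ a
    have h1 := hσ (algebraMap _ (𝓞 Ω) a)
    refine Ideal.mem_comap.2 ?_
    have h2 : algebraMap (𝓞 (layer φ)) (𝓞 Ω) (restrictNormalHom (layer φ) σ • a) =
        σ • algebraMap (𝓞 (layer φ)) (𝓞 Ω) a := by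
      apply RingOfIntegers.ext
      exact restrictNormal_commutes σ (layer φ) a
    rw [map_sub, h2]
    exact h1
  · intro τ hτ
    obtain ⟨σ, hσ, h⟩ := exists_mem_inertia_restrict (layer φ) (primeOver ℓ) τ hτ
    exact ⟨σ, hσ, h⟩

lemma ramificationIdxIn_layer [NumberField (layer φ)] {ℓ : ℕ} (hl : ℓ.Prime) :
    (span {(ℓ : ℤ)}).ramificationIdxIn (𝓞 (layer φ)) = Nat.card ((Iner ℓ).map φ) := by
  have h2 := (layer_finite_isGalois hφ).2
  have hQ := ((exists_prime_over ℓ).choose_spec hl)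
  have hQ1 : (primeOver ℓ).IsPrime := hQ.1
  have hpP : (span {(ℓ : ℤ)}).IsPrime := hQ.2 ▸ IsPrime.under ℤ (primeOver ℓ)
  have h3 : ((primeOver ℓ).under (𝓞 (layer φ))).LiesOver (span {(ℓ : ℤ)}) := ⟨by
    rw [under_under]; exact hQ.2.symm⟩
  rw [← card_inertia_eq_ramificationIdxIn (G := layer φ ≃ₐ[ℚ] layer φ) _ ((primeOver ℓ).under (𝓞 (layer φ))),
    ← map_restrict_Iner hφ hl, card_map_layer hφ]

lemma card_map_Iner_le [Finite A] {ℓ : ℕ} (hl : ℓ.Prime) (hA : ¬ ℓ ∣ Nat.card A) :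
    Nat.card ((Iner ℓ).map φ) ≤ ℓ - 1 := by
  obtain ⟨h1, h2⟩ := layer_finite_isGalois hφ
  have : NumberField (layer φ) := ⟨⟩
  have hQ := ((exists_prime_over ℓ).choose_spec hl)
  have hQ1 : (primeOver ℓ).IsPrime := hQ.1
  letI : CommGroup (layer φ ≃ₐ[ℚ] layer φ) := { (inferInstance : Group (layer φ ≃ₐ[ℚ] layer φ)) with
    mul_comm := fun a b => by
      obtain ⟨σ, rfl⟩ := restrictNormalHom_surjective Ω a
      obtain ⟨τ, rfl⟩ := restrictNormalHom_surjective Ω b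
      rw [← map_mul, ← map_mul]
      have : σ * τ / (τ * σ) ∈ φ.ker := by
        rw [MonoidHom.mem_ker, map_div, map_mul, map_mul, mul_comm, div_self']
      rw [← restrictNormalHom_ker_layer hφ, MonoidHom.mem_ker, map_div, div_eq_one] at this
      exact this }
  have hu : ((primeOver ℓ).under (𝓞 (layer φ))).under ℤ = span {(ℓ : ℤ)} := by
    rw [under_under]; exact hQ.2
  have hb : (primeOver ℓ).under (𝓞 (layer φ)) ≠ ⊥ := by
    intro h
    rw [h, under_bot] at hu
    exact hl.ne_zero (by exact_mod_cast span_singleton_eq_bot.1 hu.symm)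
  have := finiteQuotientOfFreeOfNeBot _ hb
  have hG : IsGaloisGroup (layer φ ≃ₐ[ℚ] layer φ) ℤ (𝓞 (layer φ)) := inferInstance
  have hfs := hG.faithful
  have key := card_inertia_le hl _ hb hu (by
    intro h
    rw [card_aut_layer hφ] at h
    exact hA (h.trans (card_subgroup_dvd_card _)))
  rwa [← map_restrict_Iner hφ hl, card_map_layer hφ] at key

lemma factorization_absDisc_tame {ℓ : ℕ} (hl : ℓ.Prime) (hA : ¬ ℓ ∣ Nat.card φ.range) :
    (absDisc (layer φ)).factorization ℓ * Nat.card ((Iner ℓ).map φ) =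
      (Nat.card ((Iner ℓ).map φ) - 1) * Nat.card φ.range := by
  obtain ⟨h1, h2⟩ := layer_finite_isGalois hφ
  have : NumberField (layer φ) := ⟨⟩
  rw [absDisc_layer hφ, ← ramificationIdxIn_layer hφ hl, ← finrank_layer hφ]
  exact factorization_discr_tame hl (by rwa [finrank_layer hφ])

lemma factorization_absDisc_le {ℓ : ℕ} (hl : ℓ.Prime) :
    (absDisc (layer φ)).factorization ℓ ≤ Nat.card φ.range * (Nat.card φ.range + 1) := by
  obtain ⟨h1, h2⟩ := layer_finite_isGalois hφ
  have : NumberField (layer φ) := ⟨⟩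
  obtain ⟨k, hk, -, hk2⟩ := factorization_discr (K := layer φ) hl
  rw [← absDisc_layer hφ, finrank_layer hφ] at hk
  rw [finrank_layer hφ] at hk2
  set e := (span {(ℓ : ℤ)}).ramificationIdxIn (𝓞 (layer φ))
  set N := Nat.card φ.range
  have he : 0 < e := by by_contra! h; simp [Nat.le_zero.1 h] at hk2
  have hN : N.factorization ℓ ≤ N := by
    rcases Nat.eq_zero_or_pos N with h | h
    · simp [h]
    · exact (Nat.factorization_lt ℓ h.ne').le
  refine Nat.le_of_mul_le_mul_right ?_ he
  nlinarith [Nat.mul_le_mul_left (e * N) hN]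

include hψ in
lemma factorization_absDisc_mul {ℓ : ℕ} (hl : ℓ.Prime) (hle : φ.ker ≤ ψ.ker)
    (hc : Nat.card ((Iner ℓ).map ψ) = Nat.card ((Iner ℓ).map φ)) :
    (absDisc (layer φ)).factorization ℓ * Nat.card ψ.range =
      Nat.card φ.range * (absDisc (layer ψ)).factorization ℓ := by
  obtain ⟨h1, h2⟩ := layer_finite_isGalois hφ
  obtain ⟨h1', h2'⟩ := layer_finite_isGalois hψ
  have : NumberField (layer φ) := ⟨⟩
  have : NumberField (layer ψ) := ⟨⟩
  have hL := IntermediateField.fixedField_antitone hle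
  letI : Algebra (layer ψ) (layer φ) := (IntermediateField.inclusion hL).toAlgebra
  rw [absDisc_layer hφ, absDisc_layer hψ, factorization_discr_tower (layer ψ) (layer φ) hl (by
    rw [ramificationIdxIn_layer hφ hl, ramificationIdxIn_layer hψ hl, hc]),
    ← finrank_layer hφ, ← finrank_layer hψ, ← finrank_mul_finrank ℚ (layer ψ) (layer φ)]
  ring

lemma absDisc_layer_ne_zero : absDisc (layer φ) ≠ 0 := by
  obtain ⟨h1, h2⟩ := layer_finite_isGalois hφ
  have : NumberField (layer φ) := ⟨⟩
  rw [absDisc_layer hφ, Int.natAbs_ne_zero]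
  exact discr_ne_zero _

end

lemma isOpen_ker_prod {φ : Γ →* A} (hφ : IsOpen (φ.ker : Set Γ)) {ψ : Γ →* B} (hψ : IsOpen (ψ.ker : Set Γ)) :
    IsOpen ((φ.prod ψ).ker : Set Γ) := by
  rw [MonoidHom.ker_prod]; exact hφ.inter hψ

/-- The discriminant exponent at `ℓ` of the field of a character only depends on the degree and the
restriction of the character to inertia. -/
theorem factorization_absDisc_congr {φ ψ : Γ →* A} (hφ : IsOpen (φ.ker : Set Γ)) (hψ : IsOpen (ψ.ker : Set Γ))
    {ℓ : ℕ} (hl : ℓ.Prime) (h : ∀ σ ∈ Iner ℓ, φ σ = ψ σ) (hr : Nat.card φ.range = Nat.card ψ.range)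
    (hr0 : Nat.card φ.range ≠ 0) :
    (absDisc (layer φ)).factorization ℓ = (absDisc (layer ψ)).factorization ℓ := by
  have hp := isOpen_ker_prod hφ hψ
  have hk := MonoidHom.ker_prod φ ψ
  have e1 : ∀ χ : Γ →* A, (∀ σ ∈ Iner ℓ, φ σ = χ σ) →
      (φ.prod ψ).ker ⊓ Iner ℓ = χ.ker ⊓ Iner ℓ := by
    intro χ hχ
    ext σ
    rw [hk]
    simp only [Subgroup.mem_inf, MonoidHom.mem_ker]
    constructor
    · rintro ⟨⟨h1, h2⟩, h3⟩; exact ⟨by rw [← hχ σ h3, h1], h3⟩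
    · rintro ⟨h1, h3⟩
      have : φ σ = 1 := by rw [hχ σ h3, h1]
      exact ⟨⟨this, by rw [← h σ h3, this]⟩, h3⟩
  have e2 : ∀ χ : Γ →* A, (∀ σ ∈ Iner ℓ, φ σ = χ σ) →
      Nat.card ((Iner ℓ).map χ) = Nat.card ((Iner ℓ).map (φ.prod ψ)) := by
    intro χ hχ
    rw [← relIndex_ker, ← relIndex_ker, ← inf_relIndex_right, ← e1 χ hχ,
      inf_relIndex_right]
  have a1 := factorization_absDisc_mul hp hφ hl (hk ▸ inf_le_left) (e2 φ fun _ _ => rfl)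
  have a2 := factorization_absDisc_mul hp hψ hl (hk ▸ inf_le_right) (e2 ψ h)
  have hpr : Nat.card (φ.prod ψ).range ≠ 0 := by
    rw [← finrank_layer hp]
    have := (layer_finite_isGalois hp).1
    exact finrank_pos.ne'
  rw [hr] at a1
  exact Nat.eq_of_mul_eq_mul_left (Nat.pos_of_ne_zero hpr) (a1.symm.trans a2)

lemma factorization_absDisc_eq_zero {φ : Γ →* A} (hφ : IsOpen (φ.ker : Set Γ)) {ℓ : ℕ} (hl : ℓ.Prime)
    (h : ∀ σ ∈ Iner ℓ, φ σ = 1) : (absDisc (layer φ)).factorization ℓ = 0 := by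
  have h1 : IsOpen ((1 : Γ →* A).ker : Set Γ) := by rw [ker_one]; exact isOpen_univ
  have hc1 : Nat.card (1 : Γ →* A).range = 1 := by rw [range_one]; simp
  have hm : ∀ χ : Γ →* A, (∀ σ ∈ Iner ℓ, χ σ = 1) → (Iner ℓ).map χ = ⊥ := fun χ h => by
    rw [Subgroup.map_eq_bot_iff]; exact h
  have c1 : Nat.card ((Iner ℓ).map (1 : Γ →* A)) = 1 := by rw [hm _ fun _ _ => rfl]; simp
  have a1 := factorization_absDisc_mul hφ h1 hl (by rw [ker_one]; exact le_top) (by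
    rw [hm φ h, c1]; simp)
  have a2 := factorization_absDisc_tame h1 hl (by rw [hc1]; exact hl.one_lt.ne' ∘ Nat.dvd_one.1)
  rw [c1, hc1] at a2
  simp only [mul_one, Nat.sub_self] at a2
  rw [hc1, a2] at a1
  simpa using a1

/-- Minkowski's theorem: a character unramified everywhere is trivial. -/
theorem eq_one_of_unramified {φ : Γ →* A} (hφ : IsOpen (φ.ker : Set Γ))
    (h : ∀ ℓ, ℓ.Prime → ∀ σ ∈ Iner ℓ, φ σ = 1) : φ = 1 := by
  obtain ⟨f1, f2⟩ := layer_finite_isGalois hφ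
  have : NumberField (layer φ) := ⟨⟩
  have hd : absDisc (layer φ) = 1 := by
    refine Nat.eq_of_factorization_eq (absDisc_layer_ne_zero hφ) one_ne_zero fun ℓ => ?_
    by_cases hl : ℓ.Prime
    · simpa using factorization_absDisc_eq_zero hφ hl (h ℓ hl)
    · simp [Nat.factorization_eq_zero_of_not_prime _ hl]
  by_contra hne
  rw [absDisc_layer hφ] at hd
  have h2 : ¬ 1 < finrank ℚ (layer φ) := fun h => by
    have := abs_discr_gt_two h
    rw [Int.abs_eq_natAbs, hd] at this
    norm_num at this
  have h3 := le_antisymm (not_lt.1 h2) finrank_pos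
  rw [finrank_layer hφ] at h3
  have h4 := card_eq_one.1 h3
  rw [range_eq_bot_iff] at h4
  exact hne h4

end Layers

section Fields
open Function AlgEquiv Set
open NumberField

lemma exists_mulEquiv_of_ker_eq {G C : Type*} [Group G] [Group C] {f g : G →* C} (hf : Surjective f)
    (hg : Surjective g) (h : f.ker = g.ker) : ∃ α : C ≃* C, ∀ x, α (f x) = g x := by
  refine ⟨(QuotientGroup.quotientKerEquivOfSurjective f hf).symm.trans ((QuotientGroup.quotientMulEquivOfEq h).trans
    (QuotientGroup.quotientKerEquivOfSurjective g hg)), fun x => ?_⟩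
  have : (QuotientGroup.quotientKerEquivOfSurjective f hf).symm (f x) = (x : G ⧸ f.ker) := by
    rw [MulEquiv.symm_apply_eq]; rfl
  rw [MulEquiv.trans_apply, this]
  rfl

/-- Counting fields with group `C` through surjective characters. -/
theorem card_mulAut_mul_galoisCount (C : Type) [CommGroup C] [Finite C] X :
    Nat.card (C ≃* C) * galoisCount C X =
      Nat.card {ρ : Γ →* C // IsOpen (ρ.ker : Set Γ) ∧ Surjective ρ ∧ (absDisc (layer ρ) : ℝ) ≤ X} := by
  rw [galoisCount, ← Nat.card_prod]
  set T := {L : IntermediateField ℚ Ω // FiniteDimensional ℚ L ∧ IsGalois ℚ L ∧ Nonempty ((L ≃ₐ[ℚ] L) ≃* C) ∧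
    (absDisc L : ℝ) ≤ X}
  have hN : ∀ L : T, @Normal ℚ L.1 _ _ L.1.algebra' := fun L => by
    have := L.2.2.1
    exact IsGalois.to_normal (F := ℚ) (E := L.1)
  have : ∀ L : T, IsGalois ℚ L.1 := fun L => L.2.2.1
  let e : ∀ L : T, (L.1 ≃ₐ[ℚ] L.1) ≃* C := fun L => L.2.2.2.1.some
  let f : T → Γ →* C := fun L => (e L).toMonoidHom.comp (restrictNormalHom L.1)
  have hfs := fun L =>
    (e L).surjective.comp (restrictNormalHom_surjective Ω)
  have hfk : ∀ L, (f L).ker = L.1.fixingSubgroup := by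
    intro L
    rw [← @IntermediateField.restrictNormalHom_ker _ _ _ _ _ L.1 (hN L)]
    ext σ
    exact (e L).map_eq_one_iff
  have hk : ∀ (L : T) (α : C ≃* C), (α.toMonoidHom.comp (f L)).ker = L.1.fixingSubgroup := by
    intro L α
    rw [← hfk]
    ext σ
    exact α.map_eq_one_iff
  have hl : ∀ (L : T) (α : C ≃* C), layer (α.toMonoidHom.comp (f L)) = L.1 := by
    intro L α
    rw [layer, hk, InfiniteGalois.fixedField_fixingSubgroup]
  refine Nat.card_congr (Equiv.ofBijective (fun q : (C ≃* C) × T => ⟨q.1.toMonoidHom.comp (f q.2), ?_, ?_, ?_⟩) ⟨?_, ?_⟩)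
  · rw [hk]
    exact (InfiniteGalois.isOpen_iff_finite q.2.1).2 q.2.2.1
  · exact q.1.surjective.comp (hfs _)
  · rw [hl]; exact q.2.2.2.2.2
  · rintro ⟨α, L⟩ ⟨α', L'⟩ h
    have h : α.toMonoidHom.comp (f L) = α'.toMonoidHom.comp (f L') := congrArg Subtype.val h
    have hL : L = L' := Subtype.ext (by rw [← hl L α, h, hl])
    subst hL
    refine Prod.ext (MulEquiv.ext fun c => ?_) rfl
    obtain ⟨σ, rfl⟩ := hfs L c
    exact DFunLike.congr_fun h σ
  · rintro ⟨ρ, h1, h2, h3⟩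
    obtain ⟨i1, i2⟩ := layer_finite_isGalois h1
    have hr := restrictNormalHom_ker_layer h1
    let L : T := ⟨layer ρ, i1, i2,
      ⟨(QuotientGroup.quotientKerEquivOfSurjective _ (restrictNormalHom_surjective Ω)).symm.trans
        ((QuotientGroup.quotientMulEquivOfEq hr).trans (QuotientGroup.quotientKerEquivOfSurjective ρ h2))⟩, h3⟩
    obtain ⟨α, hα⟩ := exists_mulEquiv_of_ker_eq (hfs L) h2 ((hfk L).trans (fixingSubgroup_layer h1))
    exact ⟨(α, L), Subtype.ext (MonoidHom.ext hα)⟩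

/-- There are finitely many characters to a finite group unramified outside `n`. -/
theorem finite_unramified_outside {A : Type*} [CommGroup A] [Finite A] {n : ℕ} (hn : n ≠ 0) :
    {φ : Γ →* A | IsOpen (φ.ker : Set Γ) ∧ ∀ ℓ, ℓ.Prime → ¬ ℓ ∣ n → ∀ σ ∈ Iner ℓ, φ σ = 1}.Finite := by
  set N := n ^ (Nat.card A * (Nat.card A + 1))
  have hfin := NumberField.finite_of_discr_bdd Ω N
  have hfib : ∀ K : IntermediateField ℚ Ω, FiniteDimensional ℚ K →
      {φ : Γ →* A | IsOpen (φ.ker : Set Γ) ∧ layer φ = K}.Finite := by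
    intro K hK
    by_cases hG : IsGalois ℚ K
    swap
    · refine Set.Finite.subset finite_empty ?_
      rintro φ ⟨h1, rfl⟩
      exact hG (layer_finite_isGalois h1).2
    have hs := restrictNormalHom_surjective (F := ℚ) (K₁ := K) Ω
    refine Set.Finite.of_injOn (f := fun φ : Γ →* A => fun τ : K ≃ₐ[ℚ] K => φ (hs τ).choose)
      (fun _ _ => mem_univ _) ?_ finite_univ
    rintro φ ⟨h1, h1'⟩ ψ ⟨h2, h2'⟩ h
    have key : ∀ χ : Γ →* A, IsOpen (χ.ker : Set Γ) → layer χ = K → ∀ σ,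
        χ σ = χ (hs (restrictNormalHom K σ)).choose := by
      rintro χ hχ rfl σ
      have hsp := (hs (restrictNormalHom (layer χ) σ)).choose_spec
      rw [← div_eq_one, ← map_div, ← MonoidHom.mem_ker, ← restrictNormalHom_ker_layer hχ, MonoidHom.mem_ker, map_div, hsp,
        div_self']
    ext σ
    rw [key φ h1 h1' σ, key ψ h2 h2' σ]
    exact congrFun h _
  refine Set.Finite.subset (hfin.biUnion fun K _ => hfib K.1 K.2) ?_
  rintro φ ⟨h1, h2⟩
  obtain ⟨i1, i2⟩ := layer_finite_isGalois h1
  have : NumberField (layer φ) := ⟨⟩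
  refine mem_biUnion (x := ⟨layer φ, i1⟩) ?_ ⟨h1, rfl⟩
  have hd : absDisc (layer φ) ∣ N := by
    rw [← Nat.factorization_le_iff_dvd (absDisc_layer_ne_zero h1) (pow_ne_zero _ hn)]
    intro ℓ
    by_cases hl : ℓ.Prime
    swap
    · simp [Nat.factorization_eq_zero_of_not_prime _ hl]
    by_cases hln : ℓ ∣ n
    · refine (factorization_absDisc_le h1 hl).trans ?_
      have hc : Nat.card φ.range ≤ Nat.card A := Nat.card_le_card_of_injective _ Subtype.val_injective
      rw [Nat.factorization_pow]
      have := hl.factorization_pos_of_dvd hn hln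
      calc _ ≤ Nat.card A * (Nat.card A + 1) * 1 := by rw [mul_one]; gcongr
        _ ≤ _ := Nat.mul_le_mul_left _ this
    · rw [factorization_absDisc_eq_zero h1 hl (h2 ℓ hl hln)]; exact Nat.zero_le _
  have := Nat.le_of_dvd (Nat.pos_of_ne_zero (pow_ne_zero _ hn)) hd
  rw [absDisc_layer h1] at this
  rw [mem_ofPred_eq, Int.abs_eq_natAbs]
  exact_mod_cast this

end Fields

section Characters
open Nat Subgroup Ideal MonoidHom
open scoped NumberField
open NumberField

/-- The cyclotomic character modulo `ℓ`. -/
lemma exists_cyclotomic_character {ℓ : ℕ} (hl : ℓ.Prime) : ∃ χ : Γ →* (ZMod ℓ)ˣ, IsOpen (χ.ker : Set Γ) ∧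
    Function.Surjective χ ∧ ∀ q, q.Prime → q ≠ ℓ → ∀ σ ∈ Iner q, χ σ = 1 := by
  have : Fact ℓ.Prime := ⟨hl⟩
  obtain ⟨ζ, hζ⟩ := HasEnoughRootsOfUnity.exists_primitiveRoot Ω ℓ
  set χ := hζ.autToPow ℚ
  have hs := hζ.autToPow_spec ℚ
  have h1 : ∀ σ : Γ, ∀ u : (ZMod ℓ)ˣ, σ ζ = ζ ^ (u : ZMod ℓ).val → χ σ = u := fun σ u h =>
    Units.ext (ZMod.val_injective _ (hζ.pow_inj (ZMod.val_lt _) (ZMod.val_lt _) ((hs σ).trans h)))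
  have h2 : ∀ σ : Γ, σ ζ = ζ → χ σ = 1 := fun σ h => h1 σ 1 (by
    rw [h, Units.val_one, ZMod.val_one_eq_one_mod, mod_eq_of_lt hl.one_lt, pow_one])
  refine ⟨χ, isOpen_mono (fun σ h => h2 σ h)
    (stabilizer_isOpen_of_isIntegral ζ), fun u => ?_, fun q hq hql σ hσ => h2 σ ?_⟩
  · have hu := hζ.pow_of_coprime _ (ZMod.val_coe_unit_coprime u)
    obtain ⟨σ, h⟩ := (isConjRoot_iff_exists_algEquiv (K := ℚ) (x := ζ ^ (u : ZMod ℓ).val)).1 (by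
      rw [IsConjRoot, ← Polynomial.cyclotomic_eq_minpoly_rat hζ hl.pos,
        ← Polynomial.cyclotomic_eq_minpoly_rat hu hl.pos])
    exact ⟨σ, h1 σ u h⟩
  · have hQ := (exists_prime_over q).choose_spec hq
    change (primeOver q).IsPrime ∧ (primeOver q).under ℤ = _ at hQ
    by_contra hne
    let z : 𝓞 Ω := ⟨ζ, hζ.isIntegral hl.pos⟩
    have hz : z ^ ℓ = 1 := RingOfIntegers.ext hζ.pow_eq_one
    have hzl : z ^ (ℓ - 1) * z = 1 := by rw [← pow_succ, Nat.sub_add_cancel hl.one_le, hz]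
    have hη : (σ • z * z ^ (ℓ - 1)) ^ ℓ = 1 := by
      rw [mul_pow, ← smul_pow', hz, smul_one, ← pow_mul, mul_comm, mul_comm (ℓ - 1), pow_mul, hz, one_pow, mul_one]
    have hη1 : σ • z * z ^ (ℓ - 1) - 1 ≠ 0 := fun h => hne (by
      have : σ • z = z := by
        rw [← mul_one (σ • z), ← hzl, ← mul_assoc, sub_eq_zero.1 h, one_mul]
      exact congrArg (fun x : 𝓞 Ω => (x : Ω)) this)
    have hηQ : σ • z * z ^ (ℓ - 1) - 1 ∈ primeOver q := by
      have := mul_mem_right (z ^ (ℓ - 1)) _ (hσ z)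
      rwa [sub_mul, mul_comm z, hzl] at this
    have hsum : ∑ i ∈ Finset.range ℓ, (σ • z * z ^ (ℓ - 1)) ^ i = 0 := by
      have := geom_sum_mul (σ • z * z ^ (ℓ - 1)) ℓ
      rw [hη, sub_self] at this
      exact (mul_eq_zero.1 this).resolve_right hη1
    have hlQ : ((ℓ : ℤ) : 𝓞 Ω) ∈ primeOver q := by
      rw [← Ideal.Quotient.eq_zero_iff_mem, Int.cast_natCast, map_natCast]
      have h := congrArg (Ideal.Quotient.mk (primeOver q)) hsum
      rw [← Ideal.Quotient.eq_zero_iff_mem, map_sub, map_one, sub_eq_zero] at hηQ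
      simpa [hηQ] using h
    have hlq : (ℓ : ℤ) ∈ (primeOver q).under ℤ := hlQ
    rw [hQ.2, mem_span_singleton, Int.natCast_dvd_natCast, Nat.prime_dvd_prime_iff_eq hq hl] at hlq
    exact hql hlq

/-- Tame inertia at `ℓ` is generated by one element as far as characters to `C` are concerned, and every value
permitted at this element is taken by a character unramified outside `ℓ`. -/
theorem exists_tame_generator {C : Type} [CommGroup C] [Finite C] {ℓ : ℕ} (hl : ℓ.Prime) (hn : ¬ ℓ ∣ Nat.card C) :
    ∃ γ ∈ Iner ℓ, (∀ ρ : Γ →* C, IsOpen (ρ.ker : Set Γ) → ρ γ ^ (ℓ - 1) = 1 ∧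
      ∀ σ ∈ Iner ℓ, ρ σ ∈ zpowers (ρ γ)) ∧
      ∀ c : C, c ^ (ℓ - 1) = 1 → ∃ θ : Γ →* C, IsOpen (θ.ker : Set Γ) ∧ θ γ = c ∧ (∀ r, c ^ r = 1 → θ ^ r = 1) ∧
        ∀ q, q.Prime → q ≠ ℓ → ∀ σ ∈ Iner q, θ σ = 1 := by
  have : Fact ℓ.Prime := ⟨hl⟩
  obtain ⟨χ, h1, h2, h3⟩ := exists_cyclotomic_character hl
  have hU : Nat.card (ZMod ℓ)ˣ = ℓ - 1 := by rw [card_eq_fintype_card, ZMod.card_units]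
  have hker : ∀ {D : Type} [CommGroup D] (f : (ZMod ℓ)ˣ →* D), IsOpen ((f.comp χ).ker : Set Γ) := fun f =>
    isOpen_mono (fun σ h => (congrArg f h).trans (map_one f)) h1
  have htop : (Iner ℓ).map χ = ⊤ := by
    obtain ⟨D, _, f, hf⟩ : ∃ (D : Type) (_ : CommGroup D) (f : (ZMod ℓ)ˣ →* D), ∀ u, f u = 1 ↔ u ∈ (Iner ℓ).map χ :=
      ⟨_ ⧸ (Iner ℓ).map χ, QuotientGroup.Quotient.commGroup _, QuotientGroup.mk' _, QuotientGroup.eq_one_iff⟩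
    have := eq_one_of_unramified (hker f) fun q hq σ hσ => by
      by_cases hql : q = ℓ
      · subst hql; exact (hf _).2 ⟨σ, hσ, rfl⟩
      · rw [comp_apply, h3 q hq hql σ hσ, map_one]
    refine (eq_top_iff' _).2 fun u => ?_
    obtain ⟨σ, rfl⟩ := h2 u
    exact (hf _).1 (DFunLike.congr_fun this σ)
  obtain ⟨g, hg⟩ := IsCyclic.exists_generator (α := (ZMod ℓ)ˣ)
  obtain ⟨γ, hγ, rfl⟩ : g ∈ (Iner ℓ).map χ := htop ▸ Subgroup.mem_top _
  have hog : orderOf (χ γ) = ℓ - 1 := by rw [← hU]; exact orderOf_eq_card_of_forall_mem_zpowers hg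
  refine ⟨γ, hγ, fun ρ hρ => ?_, fun c hc => ?_⟩
  · obtain ⟨ψ, hψ, hψo⟩ : ∃ ψ : Γ →* C × (ZMod ℓ)ˣ, (∀ σ, ψ σ = (ρ σ, χ σ)) ∧ IsOpen (ψ.ker : Set Γ) :=
      ⟨ρ.prod χ, fun _ => rfl, isOpen_ker_prod hρ h1⟩
    have hc := card_map_Iner_le hψo hl (by
      rw [card_prod, hU, hl.dvd_mul, not_or]
      exact ⟨hn, not_dvd_of_pos_of_lt (Nat.sub_pos_of_lt hl.one_lt) (sub_lt hl.pos one_pos)⟩)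
    have hle : zpowers (ψ γ) ≤ (Iner ℓ).map ψ := zpowers_le.2 (Subgroup.mem_map_of_mem _ hγ)
    have hd : ℓ - 1 ∣ orderOf (ψ γ) := by
      rw [← hog, hψ]; exact orderOf_map_dvd (snd C _) (ρ γ, χ γ)
    have hz := card_zpowers (ψ γ)
    have hge := Nat.le_of_dvd (orderOf_pos _) hd
    have heq := eq_of_le_of_card_ge hle (hc.trans (hge.trans hz.ge))
    have ho := le_antisymm (by rw [← hz, heq]; exact hc) hge
    refine ⟨?_, fun σ hσ => ?_⟩
    · have := pow_orderOf_eq_one (ψ γ)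
      rw [ho, hψ] at this
      exact congrArg Prod.fst this
    · obtain ⟨k, hk⟩ := mem_zpowers_iff.1 (heq ▸ Subgroup.mem_map_of_mem ψ hσ :
        ψ σ ∈ zpowers (ψ γ))
      rw [hψ, hψ] at hk
      exact mem_zpowers_iff.2 ⟨k, congrArg Prod.fst hk⟩
  · set f := monoidHomOfForallMemZpowers hg (hog ▸ orderOf_dvd_of_pow_eq_one hc)
    have hf : f (χ γ) = c := monoidHomOfForallMemZpowers_apply_gen hg _
    refine ⟨f.comp χ, hker f, hf, fun r hr => ?_, fun q hq hql σ hσ => ?_⟩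
    · ext σ
      obtain ⟨k, hk⟩ := mem_zpowers_iff.1 (hg (χ σ))
      change f (χ σ) ^ r = 1
      rw [← hk, map_zpow, hf, ← zpow_natCast, zpow_comm, zpow_natCast, hr, one_zpow]
    · rw [comp_apply, h3 q hq hql σ hσ, map_one]

end Characters

section Counting
open Nat Finset Set

/-- The exponent of the discriminant contributed by tame inertia generated by `c`. -/
def tameExp {C : Type} [CommGroup C] (c : C) : ℕ := Nat.card C - Nat.card C / orderOf c

lemma tameExp_eq_zero {C : Type} [CommGroup C] [Finite C] {c : C} : tameExp c = 0 ↔ c = 1 := by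
  rw [tameExp, Nat.sub_eq_zero_iff_le, ← orderOf_eq_one_iff]
  refine ⟨fun h => ?_, fun h => by rw [h, Nat.div_one]⟩
  by_contra h1
  have h2 := orderOf_pos c
  exact absurd h (not_le.2 (Nat.div_lt_self Nat.card_pos (by omega)))

lemma card_tame_values {C : Type} [CommGroup C] [Finite C] [IsCyclic C] {p : ℕ} (hp : p.Prime) (hp5 : 5 ≤ p)
    (hC : Nat.card C = 2 * p) r {ℓ e : ℕ} (hl : ℓ.Prime) (he : e ≠ 0) :
    Nat.card {c : C // c ^ (ℓ - 1) = 1 ∧ c ^ r = 1 ∧ tameExp c = e ∧ ¬ ℓ ∣ Nat.card C} =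
      gc p (if 2 ∣ r then 1 else 0) (if p ∣ r then 1 else 0) ℓ e := by
  have := Fintype.ofFinite C
  have hzero : ∀ P : C → Prop, (∀ c, ¬ P c) → Nat.card {c // P c} = 0 := fun P h => by
    have : IsEmpty {c // P c} := ⟨fun c => h c.1 c.2⟩
    exact card_of_isEmpty
  have hcop := (coprime_primes prime_two hp).2 (by omega)
  rw [gc, if_neg he]
  by_cases h1 : ℓ ∣ 2 * p
  · rw [if_pos h1]
    exact hzero _ fun c h => h.2.2.2 (hC ▸ h1)
  rw [if_neg h1]
  have hl2 : ℓ ≠ 2 := fun h => h1 (h ▸ Dvd.intro _ rfl)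
  have h2l : 2 ∣ ℓ - 1 := by
    have := hl.eq_one_or_self_of_dvd 2
    omega
  have hpl : p ∣ ℓ - 1 ↔ ℓ % p = 1 := by
    rw [← modEq_iff_dvd' hl.one_le, ModEq, mod_eq_of_lt hp.one_lt, eq_comm]
  have hmul : ∀ x, 2 * p ∣ x ↔ 2 ∣ x ∧ p ∣ x := fun x =>
    ⟨fun h => ⟨dvd_of_mul_right_dvd h, dvd_of_mul_left_dvd h⟩, fun h => hcop.mul_dvd_of_dvd_of_dvd h.1 h.2⟩
  have hexp : ∀ c : C, orderOf c = 1 ∧ tameExp c = 0 ∨ orderOf c = 2 ∧ tameExp c = p ∨ orderOf c = p ∧ tameExp c = 2 * p - 2 ∨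
      orderOf c = 2 * p ∧ tameExp c = 2 * p - 1 := by
    intro c
    have hd := hC ▸ orderOf_dvd_natCard c
    obtain ⟨a, b, ha, hb, hab⟩ := (Nat.dvd_mul).1 hd
    rw [tameExp, hC, ← hab]
    rcases (dvd_prime prime_two).1 ha with rfl | rfl <;> rcases (dvd_prime hp).1 hb with rfl | rfl
    · left; simp
    · right; right; left; simp [hp.pos]
    · right; left; omega
    · right; right; right; simp [hp.pos]
  have hcard : ∀ d, d ∣ 2 * p → (∀ c : C, tameExp c = e ↔ orderOf c = d) →
      Nat.card {c : C // c ^ (ℓ - 1) = 1 ∧ c ^ r = 1 ∧ tameExp c = e ∧ ¬ ℓ ∣ Nat.card C} =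
        if d ∣ ℓ - 1 ∧ d ∣ r then d.totient else 0 := by
    intro d hd h
    split_ifs with hdl
    · rw [← IsCyclic.card_orderOf_eq_totient (α := C) (by rwa [← card_eq_fintype_card, hC]), card_eq_fintype_card,
        Fintype.card_subtype]
      congr 1
      ext c
      simp only [mem_filter, Finset.mem_univ, true_and, ← orderOf_dvd_iff_pow_eq_one, h, hC]
      constructor
      · exact fun h => h.2.2.1
      · rintro rfl; exact ⟨hdl.1, hdl.2, rfl, h1⟩
    · refine hzero _ fun c hc => hdl ?_
      rw [← (h c).1 hc.2.2.1]
      exact ⟨orderOf_dvd_of_pow_eq_one hc.1, orderOf_dvd_of_pow_eq_one hc.2.1⟩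
  by_cases h2 : e = p
  · rw [if_pos h2, hcard 2 (Dvd.intro _ rfl) fun c => by rcases hexp c with h | h | h | h <;> omega]
    simp [h2l]
  by_cases h3 : e = 2 * p - 2
  · rw [if_neg h2, if_pos h3, hcard p (Dvd.intro_left _ rfl) fun c => by rcases hexp c with h | h | h | h <;> omega,
      totient_prime hp, tau]
    by_cases a : ℓ % p = 1 <;> by_cases b : p ∣ r <;> simp [b, hpl]
  by_cases h4 : e = 2 * p - 1
  · rw [if_neg h2, if_neg h3, if_pos h4, hcard (2 * p) dvd_rfl fun c => by rcases hexp c with h | h | h | h <;> omega,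
      totient_mul hcop, totient_prime hp, tau]
    by_cases a : ℓ % p = 1 <;> by_cases b : p ∣ r <;> by_cases c : 2 ∣ r <;> simp [b, c, h2l, hmul, hpl]
  · rw [if_neg h2, if_neg h3, if_neg h4]
    refine hzero _ fun c hc => ?_
    rcases hexp c with h | h | h | h <;> omega

/-- A group of characters together with its values on tame inertia, which are independent. -/
structure LocalData (C X : Type) [CommGroup C] [CommGroup X] where
  E : ℕ → X →* C
  θ : ℕ → C → X
  fin : ∀ ρ, {ℓ | E ℓ ρ ≠ 1}.Finite
  prime : ∀ ℓ ρ, E ℓ ρ ≠ 1 → ℓ.Prime ∧ ¬ ℓ ∣ Nat.card C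
  pow : ∀ ℓ ρ, E ℓ ρ ^ (ℓ - 1) = 1
  E_θ : ∀ ℓ c, ℓ.Prime → ¬ ℓ ∣ Nat.card C → c ^ (ℓ - 1) = 1 → ∀ q, E q (θ ℓ c) = if q = ℓ then c else 1
  θ_pow : ∀ ℓ c r, c ^ r = 1 → θ ℓ c ^ r = 1

namespace LocalData
variable {C X : Type} [CommGroup C] [CommGroup X] (D : LocalData C X)

lemma θ_one ℓ : D.θ ℓ 1 = 1 := by simpa using D.θ_pow ℓ 1 1 (one_pow _)

/-- The part of a character ramified at tame primes. -/
def twist (ρ : X) : X := ∏ᶠ ℓ, D.θ ℓ (D.E ℓ ρ)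

lemma twist_eq_prod (ρ : X) {t : Finset ℕ} (ht : ∀ ℓ, ℓ ∉ t → D.E ℓ ρ = 1) : D.twist ρ = ∏ ℓ ∈ t, D.θ ℓ (D.E ℓ ρ) := by
  refine finprod_eq_prod_of_mulSupport_subset _ fun ℓ h => ?_
  by_contra h1
  exact h (by dsimp only; rw [ht ℓ h1, D.θ_one])

lemma twist_eq_prod_fin (ρ : X) : D.twist ρ = ∏ ℓ ∈ (D.fin ρ).toFinset, D.θ ℓ (D.E ℓ ρ) :=
  D.twist_eq_prod ρ fun ℓ h => by simpa using h

lemma twist_pow {ρ : X} {r : ℕ} (h : ρ ^ r = 1) : D.twist ρ ^ r = 1 := by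
  rw [twist_eq_prod_fin, ← Finset.prod_pow]
  exact prod_eq_one fun ℓ _ => D.θ_pow _ _ _ (by rw [← map_pow, h, map_one])

lemma E_prod {t : Finset ℕ} {g : ℕ → C} (h : ∀ ℓ ∈ t, ℓ.Prime ∧ ¬ ℓ ∣ Nat.card C ∧ g ℓ ^ (ℓ - 1) = 1) q :
    D.E q (∏ ℓ ∈ t, D.θ ℓ (g ℓ)) = if q ∈ t then g q else 1 := by
  rw [map_prod, prod_congr rfl fun ℓ hl => D.E_θ ℓ _ (h ℓ hl).1 (h ℓ hl).2.1 (h ℓ hl).2.2 q, prod_ite_eq]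

lemma E_twist (ρ : X) q : D.E q (D.twist ρ) = D.E q ρ := by
  rw [twist_eq_prod_fin, E_prod _ fun ℓ hl => ?_]
  · split_ifs with h
    · rfl
    · simpa [eq_comm] using h
  · have := D.prime ℓ ρ (by simpa using hl)
    exact ⟨this.1, this.2, D.pow _ _⟩

/-- The exponents of the tame part of the discriminant. -/
def expo (ρ : X) : ℕ →₀ ℕ :=
  Finsupp.onFinset (D.fin ρ).toFinset (fun ℓ => tameExp (D.E ℓ ρ)) fun ℓ h => by
    simp only [Set.Finite.mem_toFinset, mem_ofPred_eq]
    intro h1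
    simp [h1, tameExp] at h

/-- The tame part of the discriminant. -/
def tame (ρ : X) : ℕ := (D.expo ρ).prod (· ^ ·)

lemma prime_of_mem_expo {ρ : X} {ℓ : ℕ} (h : ℓ ∈ (D.expo ρ).support) : ℓ.Prime :=
  (D.prime ℓ ρ fun h1 => by simp [expo, tameExp, h1] at h).1

lemma factorization_tame (ρ : X) ℓ : (D.tame ρ).factorization ℓ = tameExp (D.E ℓ ρ) := by
  rw [tame, prod_pow_factorization_eq_self fun ℓ h => D.prime_of_mem_expo h]
  rfl

lemma tame_ne_zero (ρ : X) : D.tame ρ ≠ 0 :=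
  prod_ne_zero_iff.2 fun ℓ h => pow_ne_zero _ (D.prime_of_mem_expo h).ne_zero

variable [Finite C] [IsCyclic C] {p : ℕ} (hp : p.Prime) (hp5 : 5 ≤ p) (hC : Nat.card C = 2 * p) {w : X}
  (hw : ∀ ℓ, D.E ℓ w = 1)
include hp hp5 hC hw

lemma card_tame_eq {r : ℕ} (hr : w ^ r = 1) {k : ℕ} (hk : k ≠ 0) :
    Finite {ρ : X // (ρ ^ r = 1 ∧ ρ = w * D.twist ρ) ∧ D.tame ρ = k} ∧
    Nat.card {ρ : X // (ρ ^ r = 1 ∧ ρ = w * D.twist ρ) ∧ D.tame ρ = k} =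
      fc p (if 2 ∣ r then 1 else 0) (if p ∣ r then 1 else 0) k := by
  let V : k.primeFactors → Type := fun ℓ =>
    {c : C // c ^ (ℓ.1 - 1) = 1 ∧ c ^ r = 1 ∧ tameExp c = k.factorization ℓ.1 ∧ ¬ ℓ.1 ∣ Nat.card C}
  have hne : ∀ ℓ ∈ k.primeFactors, k.factorization ℓ ≠ 0 := fun ℓ h => Finsupp.mem_support_iff.1 h
  have hfac : ∀ ρ, D.tame ρ = k → ∀ q, tameExp (D.E q ρ) = k.factorization q := fun ρ h q => by
    rw [← h, D.factorization_tame]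
  let F : {ρ : X // (ρ ^ r = 1 ∧ ρ = w * D.twist ρ) ∧ D.tame ρ = k} → ∀ ℓ, V ℓ := fun ρ ℓ =>
    ⟨D.E ℓ.1 ρ.1, D.pow _ _, by rw [← map_pow, ρ.2.1.1, map_one], hfac _ ρ.2.2 _, fun h =>
      (D.prime ℓ.1 ρ.1 fun h1 => hne _ ℓ.2 (by
        rw [← hfac _ ρ.2.2, h1, tameExp_eq_zero])).2 h⟩
  have hF : Function.Bijective F := by
    refine ⟨?_, fun d => ?_⟩
    · rintro ⟨ρ, ⟨h1, h2⟩, h3⟩ ⟨ρ', ⟨h1', h2'⟩, h3'⟩ h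
      have hE : ∀ q, D.E q ρ = D.E q ρ' := by
        intro q
        by_cases hq : q ∈ k.primeFactors
        · exact congrArg Subtype.val (congrFun h ⟨q, hq⟩)
        · have hq : k.factorization q = 0 := Finsupp.notMem_support_iff.1 hq
          rw [tameExp_eq_zero.1 ((hfac ρ h3 q).trans hq), tameExp_eq_zero.1 ((hfac ρ' h3' q).trans hq)]
      exact Subtype.ext (by dsimp only; rw [h2, h2', twist, twist]; simp_rw [hE])
    · let g : ℕ → C := fun q => if h : q ∈ k.primeFactors then (d ⟨q, h⟩).1 else 1
      have hg : ∀ ℓ (h : ℓ ∈ k.primeFactors), g ℓ = (d ⟨ℓ, h⟩).1 := fun ℓ h => dif_pos h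
      have hgn : ∀ ℓ, ℓ ∉ k.primeFactors → g ℓ = 1 := fun ℓ h => dif_neg h
      have hE : ∀ q, D.E q (w * ∏ ℓ ∈ k.primeFactors, D.θ ℓ (g ℓ)) = g q := by
        intro q
        rw [map_mul, hw, one_mul, D.E_prod fun ℓ h => ⟨prime_of_mem_primeFactors h, (d ⟨ℓ, h⟩).2.2.2.2, by
          rw [hg ℓ h]; exact (d ⟨ℓ, h⟩).2.1⟩]
        split_ifs with h
        · rfl
        · exact (hgn q h).symm
      refine ⟨⟨w * ∏ ℓ ∈ k.primeFactors, D.θ ℓ (g ℓ), ⟨?_, ?_⟩, ?_⟩, ?_⟩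
      · rw [mul_pow, hr, one_mul, ← Finset.prod_pow]
        exact prod_eq_one fun ℓ h => D.θ_pow _ _ _ (by rw [hg ℓ h]; exact (d ⟨ℓ, h⟩).2.2.1)
      · rw [D.twist_eq_prod _ fun ℓ h => (hE ℓ).trans (hgn ℓ h)]
        simp_rw [hE]
      · refine eq_of_factorization_eq (D.tame_ne_zero _) hk fun q => ?_
        rw [D.factorization_tame, hE]
        by_cases h : q ∈ k.primeFactors
        · rw [hg q h]; exact (d ⟨q, h⟩).2.2.2.1
        · rw [hgn q h, tameExp_eq_zero.2 rfl, Finsupp.notMem_support_iff.1 h]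
      · funext ℓ
        exact Subtype.ext ((hE ℓ.1).trans (hg ℓ.1 ℓ.2))
  refine ⟨Finite.of_injective F hF.1, ?_⟩
  rw [card_congr (Equiv.ofBijective F hF), Nat.card_pi, fc, if_neg hk, Finsupp.prod, Nat.support_factorization]
  exact (prod_congr rfl fun ℓ _ => card_tame_values hp hp5 hC r (prime_of_mem_primeFactors ℓ.2)
    (hne _ ℓ.2)).trans (prod_coe_sort k.primeFactors fun ℓ => gc p _ _ ℓ (k.factorization ℓ))

lemma exists_ncard_asymp r : ∃ b : Fin 3 → ℝ, ∃ K : ℝ, ∀ Y : ℝ, 1 ≤ Y →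
    {ρ : X | (ρ ^ r = 1 ∧ ρ = w * D.twist ρ) ∧ (D.tame ρ : ℝ) ≤ Y}.Finite ∧
    |({ρ : X | (ρ ^ r = 1 ∧ ρ = w * D.twist ρ) ∧ (D.tame ρ : ℝ) ≤ Y}.ncard : ℝ) - ∑ j, b j * Y ^ genPole p j| ≤
      K * Y ^ (1 / (2 * p : ℝ)) := by
  have : NeZero p := ⟨hp.ne_zero⟩
  by_cases hr : w ^ r = 1
  · obtain ⟨b, K, h⟩ := fc_count (e1 := if 2 ∣ r then 1 else 0) (e2 := if p ∣ r then 1 else 0) hp hp5 (by split_ifs <;> simp)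
      (by split_ifs <;> simp)
    refine ⟨b, K, fun Y hY => ?_⟩
    let e : {ρ : X | (ρ ^ r = 1 ∧ ρ = w * D.twist ρ) ∧ (D.tame ρ : ℝ) ≤ Y} ≃
        Σ k : Finset.Ioc 0 ⌊Y⌋₊, {ρ : X // (ρ ^ r = 1 ∧ ρ = w * D.twist ρ) ∧ D.tame ρ = k.1} :=
      { toFun := fun ρ => ⟨⟨D.tame ρ.1, Finset.mem_Ioc.2 ⟨Nat.pos_of_ne_zero (D.tame_ne_zero _),
          le_floor ρ.2.2⟩⟩, ρ.1, ρ.2.1, rfl⟩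
        invFun := fun x => ⟨x.2.1, x.2.2.1, by
          rw [x.2.2.2]; exact (le_floor_iff (by linarith)).1 (Finset.mem_Ioc.1 x.1.2).2⟩
        left_inv := fun _ => rfl
        right_inv := by
          rintro ⟨⟨k, hk⟩, ρ, hρ⟩
          have h := hρ.2
          subst h
          rfl }
    have hk : ∀ k : Finset.Ioc 0 ⌊Y⌋₊, k.1 ≠ 0 := fun k => (Finset.mem_Ioc.1 k.2).1.ne'
    have := fun k =>
      (D.card_tame_eq hp hp5 hC hw hr (hk k)).1
    refine ⟨finite_coe_iff.1 (Finite.of_equiv _ e.symm), ?_⟩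
    convert h Y hY using 4
    rw [← card_coe_set_eq, card_congr e, Nat.card_sigma, cast_sum]
    refine (sum_congr rfl fun k _ => ?_).trans (sum_coe_sort (Finset.Ioc 0 ⌊Y⌋₊) fun n => (fc p _ _ n : ℝ))
    rw [(D.card_tame_eq hp hp5 hC hw hr (hk k)).2]
  · have h0 : ∀ Y : ℝ, {ρ : X | (ρ ^ r = 1 ∧ ρ = w * D.twist ρ) ∧ (D.tame ρ : ℝ) ≤ Y} = ∅ := fun Y => by
      refine Set.eq_empty_iff_forall_notMem.2 fun ρ h => hr ?_
      rw [eq_mul_inv_of_mul_eq h.1.2.symm, mul_pow, h.1.1, inv_pow, D.twist_pow h.1.1, inv_one, mul_one]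
    exact ⟨0, 0, fun Y _ => by simp [h0]⟩

/-- The number of characters of exact order `2 p` with given base point. -/
theorem exists_ncard_generating (hX : ∀ ρ : X, ρ ^ (2 * p) = 1) : ∃ b : Fin 3 → ℝ, ∃ K : ℝ, ∀ Y : ℝ, 1 ≤ Y →
    {ρ : X | (¬ (ρ ^ 2 = 1 ∨ ρ ^ p = 1) ∧ ρ = w * D.twist ρ) ∧ (D.tame ρ : ℝ) ≤ Y}.Finite ∧
    |({ρ : X | (¬ (ρ ^ 2 = 1 ∨ ρ ^ p = 1) ∧ ρ = w * D.twist ρ) ∧ (D.tame ρ : ℝ) ≤ Y}.ncard : ℝ) -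
      ∑ j, b j * Y ^ genPole p j| ≤ K * Y ^ (1 / (2 * p : ℝ)) := by
  obtain ⟨b, K, h⟩ := D.exists_ncard_asymp hp hp5 hC hw (2 * p)
  obtain ⟨b2, K2, h2⟩ := D.exists_ncard_asymp hp hp5 hC hw 2
  obtain ⟨b3, K3, h3⟩ := D.exists_ncard_asymp hp hp5 hC hw p
  refine ⟨b - b2 - b3, K + K2 + K3 + 1, fun Y hY => ?_⟩
  obtain ⟨f1, g1⟩ := h Y hY
  obtain ⟨f2, g2⟩ := h2 Y hY
  obtain ⟨f3, g3⟩ := h3 Y hY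
  set S := fun r => {ρ : X | (ρ ^ r = 1 ∧ ρ = w * D.twist ρ) ∧ (D.tame ρ : ℝ) ≤ Y} with hS
  have hA : {ρ : X | (¬ (ρ ^ 2 = 1 ∨ ρ ^ p = 1) ∧ ρ = w * D.twist ρ) ∧ (D.tame ρ : ℝ) ≤ Y} = S (2 * p) \ (S 2 ∪ S p) := by
    ext ρ
    simp only [hS, mem_diff, Set.mem_union, mem_ofPred_eq, hX]
    tauto
  have hsub : S 2 ∪ S p ⊆ S (2 * p) := fun ρ h => by
    simp only [hS, Set.mem_union, mem_ofPred_eq, hX] at h ⊢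
    tauto
  have hig : (S 2 ∩ S p).ncard ≤ 1 := (ncard_le_one_iff_subset_singleton (f2.subset Set.inter_subset_left)).2 ⟨1, fun ρ h => by
    have := pow_gcd_eq_one.2 ⟨h.1.1.1, h.2.1.1⟩
    rwa [(coprime_primes prime_two hp).2 (by omega), pow_one] at this⟩
  have e1 := ncard_diff_add_ncard_of_subset hsub f1
  have e2 := ncard_union_add_ncard_inter (S 2) (S p) f2 f3
  rw [hA]
  refine ⟨f1.subset diff_subset, ?_⟩
  have hY1 : 1 ≤ Y ^ (1 / (2 * p : ℝ)) := Real.one_le_rpow hY (by positivity)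
  have e1' : ((S (2 * p) \ (S 2 ∪ S p)).ncard : ℝ) + (S 2 ∪ S p).ncard = (S (2 * p)).ncard := mod_cast e1
  have e2' : ((S 2 ∪ S p).ncard : ℝ) + (S 2 ∩ S p).ncard = (S 2).ncard + (S p).ncard := mod_cast e2
  have hig' : ((S 2 ∩ S p).ncard : ℝ) ≤ 1 := mod_cast hig
  simp only [Pi.sub_apply, sub_mul, sum_sub_distrib]
  rw [abs_le] at g1 g2 g3 ⊢
  constructor <;> linarith [g3.2]

end LocalData
end Counting

section Global
open Set MonoidHom Subgroup Nat Function

/-- The group of continuous characters. -/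
def charGroup (C : Type) [CommGroup C] : Subgroup (Γ →* C) where
  carrier := {ρ | IsOpen (ρ.ker : Set Γ)}
  one_mem' := by rw [mem_ofPred_eq, ker_one]; exact isOpen_univ
  mul_mem' {a b} ha hb := by
    rw [mem_ofPred_eq] at *
    refine isOpen_mono (H₁ := a.ker ⊓ b.ker) (fun σ h => ?_) (ha.inter hb)
    rw [MonoidHom.mem_ker, MonoidHom.mul_apply, MonoidHom.mem_ker.1 h.1, MonoidHom.mem_ker.1 h.2, one_mul]
  inv_mem' {a} ha := by
    rw [mem_ofPred_eq] at *
    refine isOpen_mono (fun σ h => ?_) ha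
    rw [MonoidHom.mem_ker, MonoidHom.inv_apply, MonoidHom.mem_ker.1 h, inv_one]

lemma mem_charGroup {C : Type} [CommGroup C] {ρ : Γ →* C} : ρ ∈ charGroup C ↔ IsOpen (ρ.ker : Set Γ) := by
  rw [← SetLike.mem_coe]; exact mem_ofPred_eq ▸ Iff.rfl

lemma isOpen_ker {C : Type} [CommGroup C] (ρ : charGroup C) : IsOpen (ρ.1.ker : Set Γ) := mem_charGroup.1 ρ.2

variable {C : Type} [CommGroup C] [Finite C]

theorem exists_localData (C : Type) [CommGroup C] [Finite C] : ∃ D : LocalData C (charGroup C),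
    (∀ ℓ, ℓ.Prime → ¬ ℓ ∣ Nat.card C → ∀ ρ, (Iner ℓ).map ρ.1 = zpowers (D.E ℓ ρ)) ∧
    ∀ ℓ c q, q.Prime → q ∣ Nat.card C → ∀ σ ∈ Iner q, (D.θ ℓ c).1 σ = 1 := by
  have := fun ℓ (h : ℓ.Prime ∧ ¬ ℓ ∣ Nat.card C) => exists_tame_generator h.1 h.2
  choose γ hγ h1 h2 using this
  choose θ θo θγ θp θu using h2
  let E : ℕ → charGroup C →* C := fun ℓ =>
    if h : ℓ.Prime ∧ ¬ ℓ ∣ Nat.card C then (MonoidHom.eval (γ ℓ h)).comp (charGroup C).subtype else 1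
  have hE : ∀ ℓ h ρ, E ℓ ρ = ρ.1 (γ ℓ h) := fun ℓ h ρ => by simp only [E, dif_pos h]; rfl
  have hE' : ∀ ℓ ρ, E ℓ ρ ≠ 1 → ℓ.Prime ∧ ¬ ℓ ∣ Nat.card C := fun ℓ ρ h => by
    by_contra h'
    exact h (by simp only [E, dif_neg h']; rfl)
  have hz : ∀ ℓ (h : ℓ.Prime ∧ ¬ ℓ ∣ Nat.card C) ρ, (Iner ℓ).map ρ.1 = zpowers (E ℓ ρ) := fun ℓ h ρ => by
    rw [hE ℓ h]
    refine le_antisymm ?_ (zpowers_le.2 (mem_map_of_mem _ (hγ ℓ h)))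
    rintro _ ⟨σ, hσ, rfl⟩
    exact (h1 ℓ h ρ.1 (isOpen_ker ρ)).2 σ hσ
  refine ⟨⟨E, fun ℓ c => if h : (ℓ.Prime ∧ ¬ ℓ ∣ Nat.card C) ∧ c ^ (ℓ - 1) = 1 then ⟨θ ℓ h.1 c h.2, mem_charGroup.2 (θo _ _ _ _)⟩ else 1,
    fun ρ => ?_, hE', fun ℓ ρ => ?_, fun ℓ c hl hn hc q => ?_, fun ℓ c r hr => ?_⟩, fun ℓ hl hn => hz ℓ ⟨hl, hn⟩,
    fun ℓ c q hq hqn σ hσ => ?_⟩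
  · refine (absDisc (layer ρ.1)).primeFactors.finite_toSet.subset fun ℓ h => ?_
    have hl := hE' ℓ ρ h
    by_contra hd
    have := factorization_absDisc_tame (isOpen_ker ρ) hl.1 fun h => hl.2 (h.trans (card_subgroup_dvd_card _))
    rw [hz ℓ hl, card_zpowers, Finsupp.notMem_support_iff.1 hd, zero_mul, zero_eq_mul] at this
    have h3 := orderOf_pos (E ℓ ρ)
    exact h (orderOf_eq_one_iff.1 (by have := this.resolve_right card_pos.ne'; omega))
  · by_cases h : E ℓ ρ = 1
    · rw [h, one_pow]
    · rw [hE ℓ (hE' ℓ ρ h)]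
      exact (h1 ℓ _ ρ.1 (isOpen_ker ρ)).1
  · rw [dif_pos ⟨⟨hl, hn⟩, hc⟩]
    split_ifs with hq
    · subst hq
      rw [hE q ⟨hl, hn⟩]
      exact θγ _ _ _ _
    · by_contra h
      have hq' := hE' q _ h
      rw [hE q hq'] at h
      exact h (θu _ _ _ _ q hq'.1 hq _ (hγ _ _))
  · split_ifs with h
    · exact Subtype.ext (θp _ _ _ _ r hr)
    · exact one_pow r
  · dsimp only
    split_ifs with h
    · exact θu ℓ h.1 c h.2 q hq (fun h' => h.1.2 (h' ▸ hqn)) σ hσ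
    · rfl

section
variable {D : LocalData C (charGroup C)} (hD : ∀ ℓ, ℓ.Prime → ¬ ℓ ∣ Nat.card C → ∀ ρ,
  (Iner ℓ).map ρ.1 = Subgroup.zpowers (D.E ℓ ρ))
include hD

lemma finite_base : {w : charGroup C | ∀ ℓ, D.E ℓ w = 1}.Finite := by
  refine Set.Finite.of_finite_image ((finite_unramified_outside (n := Nat.card C) card_pos.ne').subset ?_)
    (Subtype.val_injective.injOn)
  rintro _ ⟨w, hw, rfl⟩
  refine mem_ofPred_eq ▸ ⟨isOpen_ker w, fun ℓ hl hn σ hσ => ?_⟩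
  have := mem_map_of_mem w.1 hσ
  rwa [hD ℓ hl hn, hw, zpowers_one_eq_bot, Subgroup.mem_bot] at this

/-- The discriminant is, up to a factor depending only on the base point, the tame part. -/
lemma exists_absDisc_eq (hθ : ∀ ℓ c q, q.Prime → q ∣ Nat.card C → ∀ σ ∈ Iner q, (D.θ ℓ c).1 σ = 1) (w : charGroup C) :
    ∃ κ : ℝ, 0 < κ ∧ ∀ ρ : charGroup C, Surjective ρ.1 → ρ = w * D.twist ρ →
      (absDisc (layer ρ.1) : ℝ) = κ * D.tame ρ := by
  by_cases h0 : ∃ ρ : charGroup C, Surjective ρ.1 ∧ ρ = w * D.twist ρ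
  swap
  · exact ⟨1, one_pos, fun ρ h1 h2 => absurd ⟨ρ, h1, h2⟩ h0⟩
  obtain ⟨ρ₀, hs₀, hw₀⟩ := h0
  have ht : ∀ ρ, ((D.tame ρ : ℕ) : ℝ) ≠ 0 := fun ρ => cast_ne_zero.2 (D.tame_ne_zero ρ)
  have ha : ∀ ρ : charGroup C, absDisc (layer ρ.1) ≠ 0 := fun ρ => absDisc_layer_ne_zero (isOpen_ker ρ)
  refine ⟨absDisc (layer ρ₀.1) / D.tame ρ₀, div_pos (cast_pos.2 (Nat.pos_of_ne_zero (ha _)))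
    (cast_pos.2 (Nat.pos_of_ne_zero (D.tame_ne_zero _))), fun ρ hs hw => ?_⟩
  have hr : ∀ ρ : charGroup C, Surjective ρ.1 → Nat.card ρ.1.range = Nat.card C := fun ρ h => by
    rw [range_eq_top.2 h, card_congr topEquiv.toEquiv]
  have hI : ∀ ρ : charGroup C, ρ = w * D.twist ρ → ∀ q, q.Prime → q ∣ Nat.card C → ∀ σ ∈ Iner q, ρ.1 σ = w.1 σ := by
    intro ρ hw q hq hqn σ hσ
    have h1 : (D.twist ρ).1 σ = 1 := by
      have := map_prod ((MonoidHom.eval σ).comp (charGroup C).subtype) (fun ℓ => D.θ ℓ (D.E ℓ ρ)) (D.fin ρ).toFinset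
      rw [← D.twist_eq_prod_fin] at this
      exact this.trans (Finset.prod_eq_one fun ℓ _ => hθ ℓ _ q hq hqn σ hσ)
    rw [hw]
    exact (congrArg (w.1 σ * ·) h1).trans (mul_one _)
  have hgood : ∀ ρ : charGroup C, Surjective ρ.1 → ∀ ℓ, ℓ.Prime → ¬ ℓ ∣ Nat.card C →
      (absDisc (layer ρ.1)).factorization ℓ = (D.tame ρ).factorization ℓ := by
    intro ρ hs ℓ hl hn
    have := factorization_absDisc_tame (isOpen_ker ρ) hl ((hr ρ hs).symm ▸ hn)
    rw [hD ℓ hl hn, card_zpowers, hr ρ hs] at this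
    obtain ⟨k, hk⟩ := orderOf_dvd_natCard (D.E ℓ ρ)
    have ho := orderOf_pos (D.E ℓ ρ)
    rw [D.factorization_tame, tameExp, hk, Nat.mul_div_cancel_left _ ho]
    refine eq_of_mul_eq_mul_right ho (this.trans ?_)
    rw [hk, ← Nat.sub_one_mul]
    ring
  have key : absDisc (layer ρ.1) * D.tame ρ₀ = absDisc (layer ρ₀.1) * D.tame ρ := by
    refine eq_of_factorization_eq (mul_ne_zero (ha _) (D.tame_ne_zero _)) (mul_ne_zero (ha _) (D.tame_ne_zero _))
      fun ℓ => ?_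
    by_cases hl : ℓ.Prime
    swap
    · simp [factorization_eq_zero_of_not_prime _ hl]
    rw [Nat.factorization_mul (ha _) (D.tame_ne_zero _), Nat.factorization_mul (ha _) (D.tame_ne_zero _),
      Finsupp.add_apply, Finsupp.add_apply]
    by_cases hn : ℓ ∣ Nat.card C
    · have h1 : ∀ ρ, (D.tame ρ).factorization ℓ = 0 := fun ρ => by
        rw [D.factorization_tame, tameExp_eq_zero]
        by_contra h
        exact (D.prime ℓ ρ h).2 hn
      rw [h1, h1, factorization_absDisc_congr (isOpen_ker ρ) (isOpen_ker ρ₀) hl (fun σ hσ => (hI ρ hw ℓ hl hn σ hσ).trans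
        (hI ρ₀ hw₀ ℓ hl hn σ hσ).symm) ((hr ρ hs).trans (hr ρ₀ hs₀).symm) card_pos.ne']
    · rw [hgood ρ hs ℓ hl hn, hgood ρ₀ hs₀ ℓ hl hn, add_comm]
  rw [div_mul_eq_mul_div, eq_div_iff (ht _)]
  exact_mod_cast key

end

lemma surjective_iff [IsCyclic C] {p : ℕ} (hp : p.Prime) (hp5 : 5 ≤ p) (hC : Nat.card C = 2 * p) (ρ : Γ →* C) :
    Surjective ρ ↔ ¬ (ρ ^ 2 = 1 ∨ ρ ^ p = 1) := by
  constructor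
  · intro h h'
    obtain ⟨g, hg⟩ := IsCyclic.exists_generator (α := C)
    obtain ⟨σ, rfl⟩ := h g
    have ho := orderOf_eq_card_of_forall_mem_zpowers hg
    have : ∀ r, ρ ^ r = 1 → 2 * p ∣ r := fun r hr => by
      rw [← hC, ← ho]; exact orderOf_dvd_of_pow_eq_one (DFunLike.congr_fun hr σ)
    rcases h' with h | h
    · have := le_of_dvd two_pos (this _ h); omega
    · have := le_of_dvd hp.pos (this _ h); omega
  · intro h
    rw [← range_eq_top, ← card_eq_iff_eq_top, hC]
    have hr : ∀ r, Nat.card ρ.range ∣ r → ρ ^ r = 1 := fun r hr => MonoidHom.ext fun σ => by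
      have := pow_card_eq_one' (x := (⟨ρ σ, σ, rfl⟩ : ρ.range))
      exact orderOf_dvd_iff_pow_eq_one.1 ((orderOf_dvd_of_pow_eq_one (congrArg Subtype.val this)).trans hr)
    obtain ⟨a, b, ha, hb, hab⟩ := (Nat.dvd_mul).1 (hC ▸ card_subgroup_dvd_card ρ.range : Nat.card ρ.range ∣ 2 * p)
    rw [not_or] at h
    rcases (dvd_prime prime_two).1 ha with rfl | rfl <;> rcases (dvd_prime hp).1 hb with rfl | rfl
    · exact absurd (hr 2 (by rw [← hab]; simp)) h.1
    · exact absurd (hr b (by rw [← hab]; simp)) h.2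
    · exact absurd (hr 2 (by rw [← hab])) h.1
    · exact hab.symm

end Global

section Final
open Nat Function Set Finset Real

variable {C : Type} [CommGroup C] [Finite C] [IsCyclic C] {p : ℕ} (hp : p.Prime) (hp5 : 5 ≤ p)
  (hC : Nat.card C = 2 * p)
include hp hp5 hC

lemma exists_card_asymp : ∃ B : Fin 3 → ℝ, ∃ K : ℝ, ∀ᶠ X : ℝ in atTop,
    Finite {ρ : Γ →* C // IsOpen (ρ.ker : Set Γ) ∧ Surjective ρ ∧ (absDisc (layer ρ) : ℝ) ≤ X} ∧
    |(Nat.card {ρ : Γ →* C // IsOpen (ρ.ker : Set Γ) ∧ Surjective ρ ∧ (absDisc (layer ρ) : ℝ) ≤ X} : ℝ) -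
      ∑ j, B j * X ^ genPole p j| ≤ K * X ^ (1 / (2 * p : ℝ)) := by
  obtain ⟨D, hD, hθ⟩ := exists_localData C
  have hW := finite_base hD
  set W := {w : charGroup C | ∀ ℓ, D.E ℓ w = 1} with hWd
  have := hW.fintype
  have hmem : ∀ w, w ∈ W ↔ ∀ ℓ, D.E ℓ w = 1 := fun w => by rw [hWd, mem_ofPred_eq]
  have hX : ∀ ρ : charGroup C, ρ ^ (2 * p) = 1 := fun ρ => Subtype.ext (MonoidHom.ext fun σ => by
    rw [← hC]; exact pow_card_eq_one')
  choose b K hb using fun w : W => D.exists_ncard_generating hp hp5 hC ((hmem w.1).1 w.2) hX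
  choose κ hκ hdisc using fun w : W => exists_absDisc_eq hD hθ w.1
  have hgen : ∀ ρ : charGroup C, Surjective ρ.1 ↔ ¬ (ρ ^ 2 = 1 ∨ ρ ^ p = 1) := fun ρ => by
    rw [surjective_iff hp hp5 hC, Subtype.ext_iff, Subtype.ext_iff]; rfl
  refine ⟨fun j => ∑ w, b w j * (κ w)⁻¹ ^ genPole p j, ∑ w, K w * (κ w)⁻¹ ^ (1 / (2 * p : ℝ)), ?_⟩
  filter_upwards [eventually_ge_atTop 0, eventually_all.2 fun w => eventually_ge_atTop (κ w)] with X hX0 hXκ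
  have hY : ∀ w, 1 ≤ X * (κ w)⁻¹ := fun w => by
    rw [← div_eq_mul_inv, one_le_div (hκ w)]; exact hXκ w
  have hfin := fun w => (hb w _ (hY w)).1
  set S := fun w : W => {ρ : charGroup C | (¬ (ρ ^ 2 = 1 ∨ ρ ^ p = 1) ∧ ρ = w * D.twist ρ) ∧
    (D.tame ρ : ℝ) ≤ X * (κ w)⁻¹} with hS
  have hSm : ∀ w ρ, ρ ∈ S w ↔ (¬ (ρ ^ 2 = 1 ∨ ρ ^ p = 1) ∧ ρ = w * D.twist ρ) ∧ (D.tame ρ : ℝ) ≤ X * (κ w)⁻¹ :=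
    fun w ρ => by rw [hS]; exact mem_ofPred_eq ▸ Iff.rfl
  have := fun w => (hfin w).to_subtype
  have hle : ∀ (w : W) (ρ : charGroup C), Surjective ρ.1 → ρ = w * D.twist ρ →
      ((absDisc (layer ρ.1) : ℝ) ≤ X ↔ (D.tame ρ : ℝ) ≤ X * (κ w)⁻¹) := fun w ρ h h' => by
    rw [hdisc w ρ h h', ← div_eq_mul_inv, le_div_iff₀' (hκ w)]
  let g : (Σ w : W, S w) → {ρ : Γ →* C // IsOpen (ρ.ker : Set Γ) ∧ Surjective ρ ∧
      (absDisc (layer ρ) : ℝ) ≤ X} := fun x => ⟨x.2.1.1, isOpen_ker _, by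
    obtain ⟨⟨h1, h2⟩, h3⟩ := (hSm _ _).1 x.2.2
    have := (hgen _).2 h1
    exact ⟨this, (hle x.1 x.2.1 this h2).2 h3⟩⟩
  have hg : Bijective g := by
    constructor
    · rintro ⟨w, ρ, h⟩ ⟨w', ρ', h'⟩ he
      have he := congrArg Subtype.val he
      obtain rfl : ρ = ρ' := Subtype.ext he
      obtain rfl : w = w' := Subtype.ext (mul_right_cancel
        (((hSm _ _).1 h).1.2.symm.trans ((hSm _ _).1 h').1.2))
      rfl
    · rintro ⟨ρ, ho, hs, hX⟩
      set σ : charGroup C := ⟨ρ, mem_charGroup.2 ho⟩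
      have h1 : σ = σ * (D.twist σ)⁻¹ * D.twist σ := by rw [inv_mul_cancel_right]
      let w : W := ⟨σ * (D.twist σ)⁻¹, (hmem _).2 fun ℓ => by rw [map_mul, map_inv, D.E_twist, mul_inv_cancel]⟩
      exact ⟨⟨w, σ, (hSm _ _).2 ⟨⟨(hgen σ).1 hs, h1⟩, (hle w σ hs h1).1 hX⟩⟩, rfl⟩
  refine ⟨Finite.of_surjective g hg.2, ?_⟩
  rw [← Nat.card_eq_of_bijective g hg, Nat.card_sigma, cast_sum, sum_mul]
  have hr : ∀ w e, (X * (κ w)⁻¹) ^ e = X ^ (e : ℝ) * (κ w)⁻¹ ^ e := fun w e => mul_rpow hX0 (inv_pos.2 (hκ w)).le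
  have : ∑ j, (∑ w, b w j * (κ w)⁻¹ ^ genPole p j) * X ^ genPole p j =
      ∑ w, ∑ j, b w j * (X * (κ w)⁻¹) ^ genPole p j := by
    rw [sum_comm]
    refine sum_congr rfl fun j _ => ?_
    rw [sum_mul]
    exact sum_congr rfl fun w _ => by rw [hr]; ring
  rw [this, ← sum_sub_distrib]
  refine (abs_sum_le_sum_abs _ _).trans (sum_le_sum fun w _ => ?_)
  refine ((hb w _ (hY w)).2.trans_eq' ?_).trans_eq ?_
  · rw [card_coe_set_eq]
  · rw [hr]; ring

/-- There are at least as many extensions as primes, up to a bounded change. -/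
lemma exists_primeCounting_le : ∃ κ : ℝ, 0 < κ ∧ ∃ A : ℕ, ∀ (N : ℕ) X, κ * N ^ p ≤ X →
    Finite {ρ : Γ →* C // IsOpen (ρ.ker : Set Γ) ∧ Surjective ρ ∧ (absDisc (layer ρ) : ℝ) ≤ X} →
    N.primeCounting ≤ A +
      Nat.card {ρ : Γ →* C // IsOpen (ρ.ker : Set Γ) ∧ Surjective ρ ∧ (absDisc (layer ρ) : ℝ) ≤ X} := by
  obtain ⟨D, hD, hθ⟩ := exists_localData C
  obtain ⟨κ, hκ, hdisc⟩ := exists_absDisc_eq hD hθ 1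
  obtain ⟨q, hq, hqp, hq1⟩ := exists_prime_gt_modEq_one (2 * p) (k := 2 * p) (by omega)
  obtain ⟨c, hc⟩ := IsCyclic.exists_generator (α := C)
  have ho := (orderOf_eq_card_of_forall_mem_zpowers hc).trans hC
  have hcq := orderOf_dvd_iff_pow_eq_one.1 (ho ▸ (modEq_iff_dvd' hq.one_le).1 hq1.symm)
  have hos : orderOf (c ^ p) = 2 := by
    rw [orderOf_pow_of_dvd hp.ne_zero (ho ▸ Dvd.intro_left _ rfl), ho, Nat.mul_div_cancel _ hp.pos]
  have hs1 : c ^ p ≠ 1 := fun h => by rw [h, orderOf_one] at hos; omega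
  have hnd : ∀ l, 2 * p < l → ¬ l ∣ Nat.card C := fun l hl h =>
    absurd (le_of_dvd (by omega) (hC ▸ h)) (by omega)
  have hsl : ∀ l, l.Prime → q < l → (c ^ p) ^ (l - 1) = 1 := fun l hl h =>
    orderOf_dvd_iff_pow_eq_one.1 (hos ▸ (hl.even_sub_one (by omega)).two_dvd)
  let R : ℕ → charGroup C := fun l => D.θ q c * D.θ l (c ^ p)
  have hE : ∀ l, l.Prime → q < l → ∀ r, D.E r (R l) = (if r = q then c else 1) * if r = l then c ^ p else 1 :=
    fun l hl h r => by
      rw [map_mul, D.E_θ q c hq (hnd q hqp) hcq, D.E_θ l _ hl (hnd l (by omega)) (hsl l hl h)]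
  have hEq : ∀ l, l.Prime → q < l → D.E q (R l) = c := fun l hl h => by
    rw [hE l hl h, if_pos rfl, if_neg (by omega), mul_one]
  have hEl : ∀ l, l.Prime → q < l → D.E l (R l) = c ^ p := fun l hl h => by
    rw [hE l hl h, if_pos rfl, if_neg (by omega), one_mul]
  have hE1 : ∀ l, l.Prime → q < l → ∀ r, r ∉ ({q, l} : Finset ℕ) → D.E r (R l) = 1 := fun l hl h r hr => by
    rw [Finset.mem_insert, Finset.mem_singleton, not_or] at hr
    rw [hE l hl h, if_neg hr.1, if_neg hr.2, one_mul]
  have htw : ∀ l, l.Prime → q < l → R l = 1 * D.twist (R l) := fun l hl h => by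
    rw [D.twist_eq_prod _ (hE1 l hl h), prod_pair h.ne, hEq l hl h, hEl l hl h, one_mul]
  have hta : ∀ l, l.Prime → q < l → D.tame (R l) = q ^ tameExp c * l ^ p := fun l hl h => by
    have h1 : tameExp (c ^ p) = p := by rw [tameExp, hos, hC]; omega
    rw [LocalData.tame, Finsupp.prod_of_support_subset _ (s := {q, l}) (fun r hr => ?_) _ (fun _ _ => pow_zero _),
      prod_pair h.ne]
    · change q ^ tameExp (D.E q (R l)) * l ^ tameExp (D.E l (R l)) = _
      rw [hEq l hl h, hEl l hl h, h1]
    · by_contra h'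
      exact Finsupp.mem_support_iff.1 hr (tameExp_eq_zero.2 (hE1 l hl h r h'))
  have hsu : ∀ l, l.Prime → q < l → Surjective (R l).1 := fun l hl h => by
    rw [surjective_iff hp hp5 hC]
    have : ∀ r, 0 < r → r < 2 * p → (R l).1 ^ r ≠ 1 := fun r h0 hr h1 => by
      have h2 : R l ^ r = 1 := Subtype.ext h1
      have h3 := map_pow (D.E q) (R l) r
      rw [h2, map_one, hEq l hl h] at h3
      have := le_of_dvd h0 (orderOf_dvd_of_pow_eq_one h3.symm)
      omega
    exact not_or.2 ⟨this 2 two_pos (by omega), this p (by omega) (by omega)⟩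
  refine ⟨κ * q ^ tameExp c, by have := hq.pos; positivity, q + 1, fun N X hX hf => ?_⟩
  set S := (Finset.range (N + 1)).filter fun l => l.Prime ∧ q < l
  have hS : ∀ l : S, l.1.Prime ∧ q < l.1 ∧ l.1 ≤ N := fun l => by
    have := mem_filter.1 l.2
    exact ⟨this.2.1, this.2.2, by have := Finset.mem_range.1 this.1; omega⟩
  let f : S → {ρ : Γ →* C // IsOpen (ρ.ker : Set Γ) ∧ Surjective ρ ∧ (absDisc (layer ρ) : ℝ) ≤ X} :=
    fun l => ⟨(R l).1, isOpen_ker _, hsu l (hS l).1 (hS l).2.1, by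
      obtain ⟨h1, h2, h3⟩ := hS l
      rw [hdisc _ (hsu l h1 h2) (htw l h1 h2), hta l h1 h2]
      refine le_trans ?_ hX
      push_cast
      rw [← mul_assoc]
      gcongr⟩
  have hfi : Injective f := fun l m h => by
    have h := congrArg Subtype.val h
    have h1 : R l = R m := Subtype.ext h
    have h2 := hEl l (hS l).1 (hS l).2.1
    by_contra h3
    rw [h1, hE m (hS m).1 (hS m).2.1, if_neg (by have := hS l; omega), if_neg fun h => h3 (Subtype.ext h), one_mul] at h2
    exact hs1 h2.symm
  have h1 := Nat.card_le_card_of_injective f hfi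
  rw [card_eq_fintype_card, Fintype.card_coe] at h1
  have h2 : N.primeCounting ≤ (Finset.range (q + 1) ∪ S).card := by
    rw [primeCounting, primeCounting', count_eq_card_filter_range]
    refine Finset.card_le_card fun l hl => ?_
    rw [mem_filter] at hl
    rw [Finset.mem_union, mem_filter, Finset.mem_range]
    by_cases h : q < l
    · exact Or.inr ⟨hl.1, hl.2, h⟩
    · exact Or.inl (by omega)
  have h3 := Finset.card_union_le (Finset.range (q + 1)) S
  rw [card_range] at h3
  omega

omit hp hp5 hC in
lemma not_primeCounting_le K : ¬ ∀ᶠ m : ℕ in atTop, ((m ^ 8).primeCounting : ℝ) ≤ K * m ^ 5 := fun h => by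
  obtain ⟨m, h, hm2, hmK⟩ := (h.and ((eventually_ge_atTop 2).and
    (tendsto_natCast_atTop_atTop.eventually_gt_atTop (2 * (9 + 8 * |K|))))).exists
  have hm : (2 : ℝ) ≤ m := mod_cast hm2
  have h1 := (Chebyshev.pi_ge (m ^ 8)).trans h
  have hl0 := Real.log_pos (show (1 : ℝ) < m by linarith)
  have hl := log_le_sub_one_of_pos (show (0 : ℝ) < m by linarith)
  have h8 : Real.log ((m ^ 8 : ℕ) : ℝ) = 8 * Real.log m := by rw [cast_pow, Real.log_pow]; norm_num
  have hm8 : (1 : ℝ) ≤ m ^ 8 := one_le_pow₀ (by linarith)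
  have h2 : Real.log ((m ^ 8 : ℕ) + 1 : ℝ) ≤ 1 + 8 * m := by
    have : Real.log ((m ^ 8 : ℕ) + 1 : ℝ) ≤ Real.log (2 * (m ^ 8 : ℕ)) :=
      log_le_log (by positivity) (by push_cast; linarith)
    rw [log_mul two_ne_zero (by positivity), h8] at this
    linarith [log_two_lt_d9]
  rw [h8, div_le_iff₀ (by linarith), cast_pow] at h1
  have h3 : K * m ^ 5 * (8 * Real.log m) ≤ |K| * m ^ 5 * (8 * m) := by
    gcongr
    · exact le_abs_self K
    · linarith
  have h4 : (m : ℝ) ^ 8 * (1 / 2) ≤ m ^ 8 * Real.log 2 := by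
    gcongr; linarith [log_two_gt_d9]
  have h5 : (m : ℝ) ≤ m ^ 6 := le_self_pow₀ (by linarith) (by norm_num)
  have h7 : (m : ℝ) ^ 6 * (2 * (9 + 8 * |K|)) < m ^ 6 * m := by gcongr
  push_cast at h2
  nlinarith

lemma leading_coeff_pos {B : Fin 3 → ℝ} {K : ℝ} (h : ∀ᶠ X : ℝ in atTop,
    Finite {ρ : Γ →* C // IsOpen (ρ.ker : Set Γ) ∧ Surjective ρ ∧ (absDisc (layer ρ) : ℝ) ≤ X} ∧
    |(Nat.card {ρ : Γ →* C // IsOpen (ρ.ker : Set Γ) ∧ Surjective ρ ∧ (absDisc (layer ρ) : ℝ) ≤ X} : ℝ) -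
      ∑ j, B j * X ^ genPole p j| ≤ K * X ^ (1 / (2 * p : ℝ))) : 0 < B 0 := by
  by_contra! hB
  obtain ⟨κ, hκ, A, hA⟩ := exists_primeCounting_le hp hp5 hC
  have hp5' : (5 : ℝ) ≤ p := mod_cast hp5
  set κ' := max κ 1
  have hκ1 : 1 ≤ κ' := le_max_right _ _
  set e : ℝ := 1 / (2 * p - 2 : ℕ) with he
  have hec : ((2 * p - 2 : ℕ) : ℝ) = 2 * p - 2 := by
    rw [cast_sub (by omega)]; push_cast; ring
  have hfc : ((2 * p - 1 : ℕ) : ℝ) = 2 * p - 1 := by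
    rw [cast_sub (by omega)]; push_cast; ring
  have ht : Tendsto (fun m : ℕ => κ' * ((m ^ 8 : ℕ) : ℝ) ^ p) atTop atTop :=
    Tendsto.const_mul_atTop (by linarith) ((tendsto_pow_atTop hp.ne_zero).comp
      (tendsto_natCast_atTop_atTop.comp (tendsto_pow_atTop (by norm_num))))
  refine not_primeCounting_le (A + (|B 1| + |B 2| + |K|) * κ' ^ e) ?_
  filter_upwards [ht.eventually h, eventually_ge_atTop 1] with m hm hm1
  obtain ⟨hf, hm⟩ := hm
  have hm1' : (1 : ℝ) ≤ m := mod_cast hm1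
  have h1 := hA (m ^ 8) _ (mul_le_mul_of_nonneg_right (le_max_left κ 1) (by positivity)) hf
  rw [← cast_le (α := ℝ)] at h1
  set X := κ' * ((m ^ 8 : ℕ) : ℝ) ^ p with hX
  have hX1 : 1 ≤ X := one_le_mul_of_one_le_of_one_le hκ1 (one_le_pow₀ (mod_cast one_le_pow _ _ hm1))
  have h2 := (abs_le.1 hm).2
  rw [Fin.sum_univ_three] at h2
  have hb0 : B 0 * X ^ genPole p 0 ≤ 0 := mul_nonpos_of_nonpos_of_nonneg hB (by positivity)
  have hb1 : B 1 * X ^ genPole p 1 ≤ |B 1| * X ^ e := by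
    exact mul_le_mul_of_nonneg_right (le_abs_self _) (by positivity)
  have hb2 : B 2 * X ^ genPole p 2 ≤ |B 2| * X ^ e := by
    gcongr
    · exact le_abs_self _
    · change 1 / (2 * p - 1 : ℕ) ≤ e
      exact one_div_le_one_div_of_le (by linarith) (by linarith)
  have hb3 : K * X ^ (1 / (2 * p : ℝ)) ≤ |K| * X ^ e := by
    gcongr
    · exact le_abs_self _
    · rw [he, hec]
      exact one_div_le_one_div_of_le (by linarith) (by linarith)
  have hXe : X ^ e ≤ κ' ^ e * m ^ 5 := by
    rw [hX, mul_rpow (by linarith) (by positivity)]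
    gcongr
    rw [cast_pow, ← pow_mul, ← rpow_natCast, ← rpow_mul (by positivity), ← rpow_natCast]
    refine rpow_le_rpow_of_exponent_le hm1' ?_
    rw [he, hec, mul_one_div, div_le_iff₀ (by linarith)]
    push_cast
    linarith
  have hs : 0 ≤ |B 1| + |B 2| + |K| := by positivity
  have hm5 : (A : ℝ) ≤ A * m ^ 5 := le_mul_of_one_le_right (by positivity) (one_le_pow₀ hm1')
  have := mul_le_mul_of_nonneg_left hXe hs
  push_cast at h1
  linarith

end Final

end CountC2p

end

/-- asymptotic count of C₂ₚ-extensions of ℚ, for a prime p ≥ 5, with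
square-root saving error (implied constant may depend on p). -/
theorem count_C2p_fields p (hp : p.Prime) (hp5 : 5 ≤ p) :
    ∃ c₁ c₂ c₃ : ℝ, 0 < c₁ ∧
      (fun X : ℝ => (galoisCount (Multiplicative (ZMod (2*p))) X : ℝ)
          - c₁ * X ^ ((1:ℝ)/p) - c₂ * X ^ ((1:ℝ)/(2*p-2)) - c₃ * X ^ ((1:ℝ)/(2*p-1)))
        =O[Filter.atTop] fun X : ℝ => X ^ ((1:ℝ)/(2*p)) * Real.log X ^ 3 := by
  have : NeZero (2 * p) := ⟨by omega⟩
  have hC : Nat.card (Multiplicative (ZMod (2 * p))) = 2 * p := Nat.card_zmod _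
  obtain ⟨B, K, h⟩ := CountC2p.exists_card_asymp hp hp5 hC
  have hB := CountC2p.leading_coeff_pos hp hp5 hC h
  set M := Nat.card (Multiplicative (ZMod (2 * p)) ≃* Multiplicative (ZMod (2 * p))) with hM
  have hM0 : (0 : ℝ) < M := Nat.cast_pos.2 Nat.card_pos
  refine ⟨B 0 / M, B 1 / M, B 2 / M, div_pos hB hM0, Asymptotics.IsBigO.of_bound (K / M) ?_⟩
  filter_upwards [h, Filter.eventually_ge_atTop (Real.exp 1)] with X hX hX1
  have hX0 := (Real.exp_pos 1).trans_le hX1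
  have hl : 1 ≤ Real.log X ^ 3 := one_le_pow₀ ((Real.le_log_iff_exp_le hX0).2 hX1)
  replace hX := hX.2
  have hc1 : ((2 * p - 2 : ℕ) : ℝ) = 2 * p - 2 := by
    rw [Nat.cast_sub (by omega)]; push_cast; ring
  have hc2 : ((2 * p - 1 : ℕ) : ℝ) = 2 * p - 1 := by
    rw [Nat.cast_sub (by omega)]; push_cast; ring
  have h1 : ∑ j, B j * X ^ CountC2p.genPole p j = B 0 * X ^ ((1:ℝ)/p) + B 1 * X ^ ((1:ℝ)/(2*p-2)) +
      B 2 * X ^ ((1:ℝ)/(2*p-1)) := by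
    rw [← hc1, ← hc2]; exact Fin.sum_univ_three _
  rw [← CountC2p.card_mulAut_mul_galoisCount, h1, Nat.cast_mul, ← hM] at hX
  rw [Real.norm_eq_abs, Real.norm_of_nonneg (by positivity), div_mul_eq_mul_div K, le_div_iff₀ hM0,
    ← abs_of_pos hM0, ← abs_mul, abs_of_pos hM0]
  refine le_trans (le_of_eq_of_le ?_ hX) ?_
  · congr 1
    field_simp
    ring
  · have h2 := (abs_nonneg _).trans hX
    rw [← mul_assoc]
    exact le_mul_of_one_le_right h2 hl
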